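/- Let r ≥ 0 be an integer. Let N_r(X) denote the number of squarefree integers d with d ≡ 3 (mod 4), 1 < 2d ≤ X, every prime p dividing d satisfying (2/p) = 1, and rk₄ Cl⁺(8d) = r; and let A(X; 3, 4) denote the number of such d without the 4-rank condition. Then N_r(X) ~ 2^{−r²}·η_∞(2)·η_r(2)^{−2}·A(X; 3, 4) as X → ∞, where η_r(2) = ∏_{j=1}^{r} (1 − 2^{−j}) and η_∞(2) = ∏_{j=1}^{∞} (1 − 2^{−j}). -/

import Mathlib

open NumberField IntermediateField
open scoped nonZeroDivisors

/-- The subgroup of invertible fractional ideals generated by principal fractional ideals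
with a totally positive generator. -/
def narrowPrincipals (F : Type*) [Field F] :
    Subgroup (FractionalIdeal (𝓞 F)⁰ F)ˣ :=
  Subgroup.closure {I | ∃ x : F, (∀ φ : F →+* ℝ, 0 < φ x) ∧
    ((I : FractionalIdeal (𝓞 F)⁰ F) : Submodule (𝓞 F) F) = Submodule.span (𝓞 F) {x}}

/-- The narrow class group: nonzero fractional ideals modulo principal fractional ideals
generated by totally positive elements. -/
abbrev NarrowClassGroup (F : Type*) [Field F] :=
  (FractionalIdeal (𝓞 F)⁰ F)ˣ ⧸ narrowPrincipals F

/-- `ℚ(√n)` as a subfield of `ℂ`. -/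
noncomputable def quadField (n : ℕ) : IntermediateField ℚ ℂ := ℚ⟮(Real.sqrt n : ℂ)⟯

open scoped Classical

/-- `|G²/G⁴|`, i.e. `2^{rk₄ G}` where `rk₄` is the 4-rank of `G`. -/
noncomputable def fourRankPow (G : Type*) [CommGroup G] : ℕ :=
  Nat.card ((powMonoidHom 2 : G →* G).range ⧸
    ((powMonoidHom 4 : G →* G).range.subgroupOf (powMonoidHom 2 : G →* G).range))

/-- The condition on `d`: squarefree, `d ≡ 3 (mod 4)`, `1 < 2d ≤ X`, and every prime
`p ∣ d` satisfies `(2/p) = 1`. -/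
def dCond (X : ℝ) (d : ℕ) : Prop :=
  Squarefree d ∧ d % 4 = 3 ∧ 1 < 2 * d ∧ (2 * d : ℝ) ≤ X ∧
    ∀ p : ℕ, p.Prime → p ∣ d → jacobiSym 2 p = 1

/-- `N_r(X)`: the number of squarefree `d ≡ 3 (mod 4)` with `1 < 2d ≤ X`, `(2/p) = 1`
for all primes `p ∣ d`, and `rk₄ Cl⁺(8d) = r` (i.e. `|G²/G⁴| = 2^r`). -/
noncomputable def Ncount (r : ℕ) (X : ℝ) : ℝ :=
  ∑ d ∈ Finset.range (⌊X⌋₊ + 1),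
    if dCond X d ∧ fourRankPow (NarrowClassGroup (quadField (2 * d))) = 2 ^ r then 1 else 0

/-- `A(X; 3, 4)`: the number of `d` satisfying `dCond X`. -/
noncomputable def Acount34 (X : ℝ) : ℝ :=
  ∑ d ∈ Finset.range (⌊X⌋₊ + 1), if dCond X d then 1 else 0


set_option linter.all false

namespace FR
open Finset Filter Topology

noncomputable def phi (k R : ℕ) : ℝ := ∏ i ∈ range k, ((2:ℝ)^R - 2^i)

noncomputable def aa (i : ℕ) : ℝ := (∏ j ∈ range i, ((2:ℝ)^(j+1) - 1))⁻¹

lemma two_pow_sub_pos (j : ℕ) : (0:ℝ) < 2^(j+1) - 1 := by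
  have : (1:ℝ) < 2^(j+1) := one_lt_pow₀ (by norm_num) (by omega)
  linarith

lemma aa_pos (i : ℕ) : 0 < aa i := by
  unfold aa
  exact inv_pos.mpr (prod_pos fun j _ => two_pow_sub_pos j)

lemma aa_succ (i : ℕ) : aa (i+1) * ((2:ℝ)^(i+1) - 1) = aa i := by
  unfold aa
  rw [prod_range_succ, mul_inv, mul_assoc, inv_mul_cancel₀ (two_pow_sub_pos i).ne', mul_one]

lemma aa_le (i : ℕ) : aa i ≤ 2 * (1/2)^i := by
  induction i with
  | zero => simp [aa]
  | succ n ih =>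
    rcases Nat.eq_zero_or_pos n with rfl | hn
    · simp [aa]; norm_num
    · have h1 := aa_succ n
      have h2 : (2:ℝ) ≤ 2^(n+1) - 1 := by
        have : (2:ℝ)^2 ≤ 2^(n+1) := pow_le_pow_right₀ (by norm_num) (by omega)
        linarith
      have h3 := aa_pos (n+1)
      rw [pow_succ]
      nlinarith

/-- Euler series. -/
noncomputable def FF (x : ℝ) : ℝ := ∑' i : ℕ, (-1)^i * x^i * aa i

lemma FF_summable {x : ℝ} (hx0 : 0 ≤ x) (hx : x ≤ 1) :
    Summable (fun i : ℕ => (-1)^i * x^i * aa i) := by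
  refine Summable.of_norm_bounded (g := fun i : ℕ => 2 * (1/2:ℝ)^i)
    ((summable_geometric_of_lt_one (by norm_num) (by norm_num)).mul_left 2) ?_
  intro i
  rw [norm_mul, norm_mul, norm_pow, norm_neg, norm_one, one_pow, one_mul, norm_pow,
    Real.norm_of_nonneg hx0, Real.norm_of_nonneg (aa_pos i).le]
  calc x^i * aa i ≤ 1 * aa i := by
        gcongr
        · exact (aa_pos i).le
        · exact pow_le_one₀ hx0 hx
    _ ≤ _ := by rw [one_mul]; exact aa_le i

lemma FF_func {x : ℝ} (hx0 : 0 ≤ x) (hx : x ≤ 1) : FF x = (1 - x/2) * FF (x/2) := by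
  have s1 := FF_summable hx0 hx
  have s2 := FF_summable (x := x/2) (by linarith) (by linarith)
  have h : FF x - FF (x/2) = - (x/2) * FF (x/2) := by
    unfold FF
    rw [← s1.tsum_sub s2, ← tsum_mul_left, (s1.sub s2).tsum_eq_zero_add]
    simp only [pow_zero, sub_self, zero_add]
    congr 1
    ext i
    rw [← aa_succ i, div_pow, div_pow]
    have : (2:ℝ)^(i+1) ≠ 0 := by positivity
    field_simp
    ring
  linarith

lemma FF_lim : Tendsto (fun N : ℕ => FF ((1/2)^N)) atTop (𝓝 1) := by
  have hb : ∀ N : ℕ, |FF ((1/2)^N) - 1| ≤ (1/2)^N * 2 := by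
    intro N
    have hx0 : (0:ℝ) ≤ (1/2)^N := by positivity
    have hx1 : ((1:ℝ)/2)^N ≤ 1 := pow_le_one₀ (by norm_num) (by norm_num)
    have s := FF_summable hx0 hx1
    have e : FF ((1/2)^N) - 1 = ∑' i : ℕ, (-1)^(i+1) * ((1/2)^N)^(i+1) * aa (i+1) := by
      unfold FF
      rw [s.tsum_eq_zero_add]
      simp [aa]
    rw [e]
    have hg : HasSum (fun i : ℕ => ((1:ℝ)/2)^N * (1/2)^i) ((1/2)^N * 2) := by
      apply HasSum.mul_left
      exact hasSum_geometric_two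
    rw [← Real.norm_eq_abs]
    refine tsum_of_norm_bounded hg ?_
    intro i
    rw [norm_mul, norm_mul, norm_pow, norm_neg, norm_one, one_pow, one_mul, norm_pow,
      Real.norm_of_nonneg hx0, Real.norm_of_nonneg (aa_pos _).le]
    have h1 := aa_le (i+1)
    have h2 : (((1:ℝ)/2)^N)^(i+1) ≤ (1/2)^N := by
      rw [pow_succ]
      exact mul_le_of_le_one_left hx0 (pow_le_one₀ hx0 hx1)
    have h3 : (2:ℝ) * (1/2)^(i+1) = (1/2)^i := by rw [pow_succ]; ring
    rw [h3] at h1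
    exact mul_le_mul h2 h1 (aa_pos _).le hx0
  rw [tendsto_iff_norm_sub_tendsto_zero]
  refine squeeze_zero (fun _ => norm_nonneg _) (fun N => by simpa [Real.norm_eq_abs] using hb N) ?_
  have := (tendsto_pow_atTop_nhds_zero_of_lt_one (r := (1/2:ℝ)) (by norm_num) (by norm_num)).mul_const 2
  simpa using this

noncomputable def eta (r : ℕ) : ℝ := ∏ j ∈ range r, (1 - (2 : ℝ) ^ (-((j : ℤ) + 1)))
noncomputable def etaInf : ℝ := ∏' j : ℕ, (1 - (2 : ℝ) ^ (-((j : ℤ) + 1)))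
noncomputable def piR (r : ℕ) : ℝ := (2 : ℝ) ^ (-(r ^ 2 : ℤ)) * etaInf * (eta r)⁻¹ ^ 2

lemma zpow_aux (j : ℕ) : (2 : ℝ) ^ (-((j : ℤ) + 1)) = (1/2)^(j+1) := by
  rw [zpow_neg, ← Nat.cast_succ, zpow_natCast]
  simp

lemma eta_pos (r : ℕ) : 0 < eta r := by
  unfold eta
  apply prod_pos
  intro j _
  rw [zpow_aux]
  have : ((1:ℝ)/2)^(j+1) < 1 := pow_lt_one₀ (by norm_num) (by norm_num) (by omega)
  linarith

lemma eta_lim : Tendsto eta atTop (𝓝 etaInf) := by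
  have hm : Multipliable (fun j : ℕ => (1 - (2 : ℝ) ^ (-((j : ℤ) + 1)))) := by
    have := Real.multipliable_one_add_of_summable (f := fun j : ℕ => - (2 : ℝ) ^ (-((j : ℤ) + 1))) ?_
    · simpa [sub_eq_add_neg] using this
    · apply Summable.neg
      simp only [zpow_aux]
      exact (summable_nat_add_iff 1).mpr (summable_geometric_of_lt_one (by norm_num) (by norm_num))
  exact hm.hasProd.tendsto_prod_nat

lemma eta_mul_FF (r N : ℕ) : eta r * FF ((1/2)^r) = eta (r+N) * FF ((1/2)^(r+N)) := by
  induction N with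
  | zero => rfl
  | succ n ih =>
    rw [ih, FF_func (by positivity) (pow_le_one₀ (by norm_num) (by norm_num))]
    have : eta (r + (n+1)) = eta (r+n) * (1 - (1/2)^(r+n)/2) := by
      unfold eta
      rw [← add_assoc, prod_range_succ, zpow_aux, pow_succ]
      ring
    rw [this, ← add_assoc, pow_succ]
    ring_nf

lemma eta_FF (r : ℕ) : eta r * FF ((1/2)^r) = etaInf := by
  have h1 : Tendsto (fun N => eta (r+N) * FF ((1/2)^(r+N))) atTop (𝓝 (etaInf * 1)) := by
    have e : Tendsto (fun N => r + N) atTop atTop := tendsto_atTop_mono (fun n => Nat.le_add_left n r) tendsto_id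
    exact (eta_lim.comp e).mul (FF_lim.comp e)
  have h2 : (fun N => eta (r+N) * FF ((1/2)^(r+N))) = fun _ => eta r * FF ((1/2)^r) := by
    ext N; exact (eta_mul_FF r N).symm
  rw [h2, mul_one] at h1
  exact tendsto_nhds_unique tendsto_const_nhds h1

lemma phi_self (r : ℕ) : phi r r = 2^(r^2) * eta r := by
  unfold phi eta
  rw [← Finset.prod_range_reflect]
  have : (2:ℝ)^(r^2) = ∏ j ∈ range r, (2:ℝ)^r := by simp [← pow_mul, sq]
  rw [this, ← prod_mul_distrib]
  apply prod_congr rfl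
  intro j hj
  have hj := mem_range.mp hj
  rw [zpow_aux, mul_sub, mul_one]
  congr 1
  have : r = (r - 1 - j) + (j+1) := by omega
  conv_rhs => rw [this]
  rw [pow_add, mul_assoc, ← mul_pow]
  norm_num

lemma phi_self_pos (r : ℕ) : 0 < phi r r := by
  rw [phi_self]; have := eta_pos r; positivity

noncomputable def cc (r i : ℕ) : ℝ := (phi r r)⁻¹ * ((-1)^i * ((1/2)^r)^i * aa i)

lemma cc_hasSum (r : ℕ) : HasSum (cc r) (piR r) := by
  have h := (FF_summable (x := (1/2)^r) (by positivity) (pow_le_one₀ (by norm_num) (by norm_num))).hasSum.mul_left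
    (phi r r)⁻¹
  suffices h4 : piR r = (phi r r)⁻¹ * FF ((1/2)^r) by
    rw [h4]; exact h
  have h2 := eta_FF r
  have h3 := (eta_pos r).ne'
  unfold piR
  rw [phi_self, ← h2]
  have : (2:ℝ) ^ (-(r ^ 2 : ℤ)) = (2^(r^2))⁻¹ := by
    rw [zpow_neg]; norm_cast
  rw [this]
  field_simp

noncomputable def ff (r K R : ℕ) : ℝ :=
  phi r R / phi r r * ∏ j ∈ range K, (1 - ((2:ℝ)^R/2^r - 1)/(2^(j+1)-1))

lemma ff_aux (y : ℝ) (K : ℕ) : (∏ j ∈ range K, (1 - (y - 1)/((2:ℝ)^(j+1)-1))) * (y - 1) =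
    (-1)^K * (∏ j ∈ range (K+1), (y - 2^j)) * aa K := by
  induction K with
  | zero => simp [aa]
  | succ n ih =>
    rw [prod_range_succ, mul_right_comm, ih, prod_range_succ _ (n+1), ← aa_succ n]
    have := (two_pow_sub_pos n).ne'
    field_simp
    ring

lemma phi_add (r i R : ℕ) : phi (r+i) R = phi r R * ((2^r)^i * ∏ j ∈ range i, ((2:ℝ)^R/2^r - 2^j)) := by
  unfold phi
  rw [prod_range_add]
  congr 1
  have : ((2:ℝ)^r)^i = ∏ j ∈ range i, (2:ℝ)^r := by simp
  rw [this, ← prod_mul_distrib]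
  apply prod_congr rfl
  intro j _
  rw [pow_add]
  field_simp

lemma cc_phi (r i R : ℕ) : cc r i * phi (r+i) R =
    phi r R / phi r r * ((-1)^i * aa i * ∏ j ∈ range i, ((2:ℝ)^R/2^r - 2^j)) := by
  rw [phi_add, cc]
  have : (((1:ℝ)/2)^r)^i * (2^r)^i = 1 := by
    rw [← mul_pow, ← mul_pow]; norm_num
  calc _ = phi r R / phi r r * ((-1)^i * aa i * ∏ j ∈ range i, ((2:ℝ)^R/2^r - 2^j)) * ((((1:ℝ)/2)^r)^i * (2^r)^i) := by
        ring
    _ = _ := by rw [this, mul_one]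

lemma ff_eq (r K R : ℕ) : ff r K R = ∑ i ∈ range (K+1), cc r i * phi (r+i) R := by
  induction K with
  | zero => rw [sum_range_one, cc_phi]; simp [ff, aa]
  | succ n ih =>
    rw [sum_range_succ, ← ih, cc_phi, ff, ff, prod_range_succ, mul_sub, mul_one, mul_sub, sub_eq_add_neg]
    congr 1
    rw [mul_div_assoc', ff_aux, ← mul_neg, ← aa_succ n]
    have := (two_pow_sub_pos n).ne'
    field_simp
    ring

lemma phi_zero {k R : ℕ} (h : R < k) : phi k R = 0 :=
  prod_eq_zero (mem_range.mpr h) (by simp)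

lemma phi_nonneg (k R : ℕ) : 0 ≤ phi k R := by
  rcases lt_or_ge R k with h | h
  · rw [phi_zero h]
  · apply prod_nonneg
    intro i hi
    have := mem_range.mp hi
    have : (2:ℝ)^i ≤ 2^R := pow_le_pow_right₀ (by norm_num) (by omega)
    linarith

lemma ff_bound (r K R : ℕ) : |ff r K R - (if R = r then 1 else 0)| ≤ |cc r (K+1)| * phi (r+(K+1)) R := by
  have hpos := mul_nonneg (abs_nonneg (cc r (K+1))) (phi_nonneg (r+(K+1)) R)
  rcases lt_trichotomy R r with h | rfl | h
  · rw [if_neg h.ne, ff, phi_zero h]; simpa using hpos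
  · have : ff R K R = 1 := by
      unfold ff
      rw [div_self (phi_self_pos R).ne', div_self (by positivity)]
      simp
    rw [this]; simpa using hpos
  · rw [if_neg h.ne', sub_zero]
    obtain ⟨n, rfl⟩ : ∃ n, R = r + (n+1) := ⟨R - r - 1, by omega⟩
    have hy : (2:ℝ)^(r+(n+1))/2^r = 2^(n+1) := by rw [pow_add]; field_simp
    rcases lt_or_ge n K with hn | hn
    · have : ff r K (r+(n+1)) = 0 := by
        unfold ff
        rw [hy, prod_eq_zero (mem_range.mpr hn), mul_zero]
        rw [div_self (two_pow_sub_pos n).ne', sub_self]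
      rw [this]; simpa using hpos
    · have key : ff r K (r+(n+1)) * ((2:ℝ)^(n+1) - 1) = - cc r (K+1) * phi (r+(K+1)) (r+(n+1)) * (2^(K+1) - 1) := by
        rw [neg_mul, cc_phi, ff, mul_assoc, hy, ff_aux, ← aa_succ K]
        ring
      have h1 := two_pow_sub_pos n
      have h2 := two_pow_sub_pos K
      have h3 : (2:ℝ)^(K+1) - 1 ≤ 2^(n+1) - 1 := by
        have : (2:ℝ)^(K+1) ≤ 2^(n+1) := pow_le_pow_right₀ (by norm_num) (by omega)
        linarith
      have key2 : |ff r K (r+(n+1))| * ((2:ℝ)^(n+1) - 1) = |cc r (K+1)| * phi (r+(K+1)) (r+(n+1)) * (2^(K+1) - 1) := by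
        have := congrArg abs key
        rwa [abs_mul, abs_mul, abs_mul, abs_neg, abs_of_pos h1, abs_of_pos h2,
          abs_of_nonneg (phi_nonneg _ _)] at this
      have h4 : |ff r K (r+(n+1))| * ((2:ℝ)^(n+1) - 1) ≤ (|cc r (K+1)| * phi (r+(K+1)) (r+(n+1))) * ((2:ℝ)^(n+1) - 1) := by
        rw [key2]; gcongr
      exact le_of_mul_le_mul_right h4 h1

theorem moment_lemma (r : ℕ) {ε : ℝ} (hε : 0 < ε) : ∃ K : ℕ, ∃ δ : ℝ, 0 < δ ∧
    ∀ (Ω : Type) [Fintype Ω] [Nonempty Ω] (R : Ω → ℕ),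
      (∀ k ≤ K, |(∑ w, phi k (R w)) / Fintype.card Ω - 1| ≤ δ) →
      |(∑ w, if R w = r then (1:ℝ) else 0) / Fintype.card Ω - piR r| ≤ ε := by
  have hs := cc_hasSum r
  have h0 : Tendsto (fun i => |cc r (i+1)|) atTop (𝓝 0) := by
    have := (hs.summable.tendsto_atTop_zero).abs
    rw [abs_zero] at this
    exact this.comp (tendsto_add_atTop_nat 1)
  have h1 : Tendsto (fun K => |(∑ i ∈ range (K+1), cc r i) - piR r|) atTop (𝓝 0) := by
    have := ((hs.tendsto_sum_nat.comp (tendsto_add_atTop_nat 1)).sub_const (piR r)).abs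
    simpa using this
  obtain ⟨K, hK1, hK2⟩ := ((h0.eventually (gt_mem_nhds (show (0:ℝ) < ε/6 by linarith))).and
    (h1.eventually (gt_mem_nhds (show (0:ℝ) < ε/3 by linarith)))).exists
  set B := ∑ i ∈ range (K+1), |cc r i| with hB
  have hB0 : 0 ≤ B := sum_nonneg fun _ _ => abs_nonneg _
  refine ⟨r + (K+1), min 1 (ε/(3*(B+1))), by positivity, ?_⟩
  intro Ω _ _ R hM
  set N : ℝ := ((Fintype.card Ω : ℕ) : ℝ) with hN
  have hNpos : 0 < N := by rw [hN]; exact_mod_cast Fintype.card_pos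
  set M : ℕ → ℝ := fun k => (∑ w, phi k (R w)) / N with hMdef
  have hM' : ∀ k ≤ r+(K+1), |M k - 1| ≤ min 1 (ε/(3*(B+1))) := hM
  have e1 : (∑ w, ff r K (R w)) / N = ∑ i ∈ range (K+1), cc r i * M (r+i) := by
    simp only [ff_eq, hMdef]
    rw [sum_comm, sum_div]
    apply sum_congr rfl
    intro i _
    rw [← mul_sum, mul_div_assoc]
  have e2 : |(∑ w, ff r K (R w)) / N - (∑ w, if R w = r then (1:ℝ) else 0) / N| ≤ |cc r (K+1)| * M (r+(K+1)) := by
    rw [← sub_div, ← sum_sub_distrib, abs_div, abs_of_pos hNpos, hMdef]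
    simp only
    rw [← mul_div_assoc, mul_sum]
    gcongr
    exact (abs_sum_le_sum_abs _ _).trans (sum_le_sum fun w _ => ff_bound r K (R w))
  have e3 : M (r+(K+1)) ≤ 2 := by
    have := (abs_le.mp ((hM' _ le_rfl).trans (min_le_left _ _))).2
    linarith
  have e4 : |(∑ i ∈ range (K+1), cc r i * M (r+i)) - ∑ i ∈ range (K+1), cc r i| ≤ ε/3 := by
    rw [← sum_sub_distrib]
    calc _ ≤ ∑ i ∈ range (K+1), |cc r i| * (ε/(3*(B+1))) := by
          refine (abs_sum_le_sum_abs _ _).trans (sum_le_sum fun i hi => ?_)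
          rw [← mul_sub_one, abs_mul]
          have := mem_range.mp hi
          gcongr
          exact (hM' _ (by omega)).trans (min_le_right _ _)
      _ = B * (ε/(3*(B+1))) := by rw [← sum_mul]
      _ ≤ (B+1) * (ε/(3*(B+1))) := by gcongr; linarith
      _ = ε/3 := by field_simp
  have e5 : |cc r (K+1)| * M (r+(K+1)) ≤ ε/3 := by
    calc _ ≤ |cc r (K+1)| * 2 := by gcongr
      _ ≤ ε/3 := by linarith
  rw [e1] at e2
  have hK2' := hK2.le
  rw [abs_le] at *
  constructor <;> linarith [e2.1, e2.2, e4.1, e4.2, hK2'.1, hK2'.2]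

end FR

namespace FR
open Finset BigOperators

/-- sign character on `ZMod 2` -/
noncomputable def chi (z : ZMod 2) : ℝ := if z = 0 then 1 else -1

lemma zcases (z : ZMod 2) : z = 0 ∨ z = 1 := by revert z; decide

lemma zadd_self (z : ZMod 2) : z + z = 0 := by revert z; decide

lemma zsq (z : ZMod 2) : z * z = z := by revert z; decide

lemma chi_zero : chi 0 = 1 := by simp [chi]
lemma chi_one : chi 1 = -1 := by simp [chi]

lemma chi_add (a b : ZMod 2) : chi (a + b) = chi a * chi b := by
  rcases zcases a with rfl | rfl <;> rcases zcases b with rfl | rfl <;>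
    simp [chi_zero, chi_one, zadd_self]

lemma chi_abs (a : ZMod 2) : |chi a| = 1 := by
  rcases zcases a with rfl | rfl <;> simp [chi_zero, chi_one]

lemma chi_sum {κ : Type*} (s : Finset κ) (f : κ → ZMod 2) : chi (∑ i ∈ s, f i) = ∏ i ∈ s, chi (f i) := by
  induction s using Finset.induction_on with
  | empty => simp [chi_zero]
  | insert a s ha ih => rw [sum_insert ha, prod_insert ha, chi_add, ih]

lemma sum_z2 (f : ZMod 2 → ℝ) : ∑ z, f z = f 0 + f 1 := by
  exact Fin.sum_univ_two f

lemma chi_orth {κ : Type*} [Fintype κ] [DecidableEq κ] (t : κ → ZMod 2) :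
    ∑ s : κ → ZMod 2, chi (∑ k, s k * t k) = if t = 0 then (2:ℝ) ^ Fintype.card κ else 0 := by
  simp_rw [chi_sum]
  have := Fintype.prod_sum (fun (k : κ) (z : ZMod 2) => chi (z * t k))
  rw [← this]
  simp_rw [sum_z2]
  split_ifs with h
  · subst h; simp [chi_zero]; norm_num
  · obtain ⟨k, hk⟩ := Function.ne_iff.mp h
    apply prod_eq_zero (mem_univ k)
    have : t k = 1 := (zcases _).resolve_left hk
    rw [this]; simp [chi_zero, chi_one]

section row
variable {ι : Type} [Fintype ι]

/-- the rows of the Rédei-type system -/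
def row (v : ι → ZMod 2) (a : ι → ι → ZMod 2) (x : ι → ZMod 2) (i : ι) : ZMod 2 :=
  ∑ j, a i j * (x i + x j) + v i * x i

def om (v x y : ι → ZMod 2) : ZMod 2 := ∑ i, v i * x i * y i

lemma row_add (v : ι → ZMod 2) (a : ι → ι → ZMod 2) (x y : ι → ZMod 2) (i : ι) :
    row v a (x + y) i = row v a x i + row v a y i := by
  simp only [row, Pi.add_apply]
  rw [show ∑ j, a i j * (x i + x j) + v i * x i + (∑ j, a i j * (y i + y j) + v i * y i)
    = (∑ j, a i j * (x i + x j) + ∑ j, a i j * (y i + y j)) + (v i * x i + v i * y i) by ring,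
    ← sum_add_distrib]
  congr 1
  · apply sum_congr rfl; intros; ring
  · ring

lemma row_smul (v : ι → ZMod 2) (a : ι → ι → ZMod 2) (c : ZMod 2) (x : ι → ZMod 2) (i : ι) :
    row v a (c • x) i = c * row v a x i := by
  simp only [row, Pi.smul_apply, smul_eq_mul, mul_add, mul_sum]
  congr 1
  · apply sum_congr rfl; intros; ring
  · ring

variable {v : ι → ZMod 2} {a : ι → ι → ZMod 2}

lemma skew_sum [DecidableEq ι] (hs : ∀ i j, i ≠ j → a i j + a j i = v i * v j) (x y : ι → ZMod 2) :
    ∑ i, ∑ j, (a i j + a j i) * (x i * y j) = (∑ i, v i * x i) * (∑ i, v i * y i) + om v x y := by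
  rw [sum_mul_sum, om, ← sum_add_distrib]
  apply sum_congr rfl
  intro i _
  rw [← add_sum_erase _ _ (mem_univ i), ← add_sum_erase univ (fun j => v i * x i * (v j * y j)) (mem_univ i)]
  rw [zadd_self, zero_mul, zero_add]
  have : v i * x i * (v i * y i) = v i * x i * y i := by
    rw [show v i * x i * (v i * y i) = (v i * v i) * x i * y i by ring, zsq]
  rw [this, add_right_comm, zadd_self, zero_add]
  apply sum_congr rfl
  intro j hj
  rw [hs i j (ne_of_mem_erase hj).symm]; ring

lemma sum_row [DecidableEq ι] (hs : ∀ i j, i ≠ j → a i j + a j i = v i * v j) (hv : ∑ i, v i = 1)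
    (x : ι → ZMod 2) : ∑ i, row v a x i = ∑ i, v i * x i := by
  have h := skew_sum hs x 1
  simp only [om, Pi.one_apply, mul_one, hv, zadd_self] at h
  simp only [row, sum_add_distrib, mul_add]
  simp only [add_mul, sum_add_distrib] at h
  rw [sum_comm (f := fun i j => a j i * x i)] at h
  rw [h, zero_add]

lemma row_pair [DecidableEq ι] (hs : ∀ i j, i ≠ j → a i j + a j i = v i * v j)
    (x y : ι → ZMod 2) (hx : ∑ i, v i * x i = 0) :
    ∑ i, y i * row v a x i + ∑ i, x i * row v a y i = om v x y := by
  have h := skew_sum hs x y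
  rw [hx, zero_mul, zero_add] at h
  rw [← h, ← sum_add_distrib]
  have e : ∀ i, y i * row v a x i + x i * row v a y i =
      ∑ j, a i j * (x i * y j) + ∑ j, a i j * (x j * y i) := by
    intro i
    simp only [row, mul_add, mul_sum, sum_add_distrib]
    have h1 : ∑ j, y i * (a i j * x i) = ∑ j, x i * (a i j * y i) := by
      apply sum_congr rfl; intros; ring
    have h2 : y i * (v i * x i) = x i * (v i * y i) := by ring
    have h3 : ∑ j, a i j * (x i * y j) = ∑ j, x i * (a i j * y j) := by
      apply sum_congr rfl; intros; ring
    have h4 : ∑ j, a i j * (x j * y i) = ∑ j, y i * (a i j * x j) := by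
      apply sum_congr rfl; intros; ring
    rw [h1, h2, h3, h4]
    have A := zadd_self (∑ j, x i * (a i j * y i))
    have B := zadd_self (x i * (v i * y i))
    linear_combination A + B
  simp_rw [e, sum_add_distrib]
  rw [sum_comm (f := fun i j => a i j * (x j * y i))]
  simp only [add_mul, sum_add_distrib]

end row

end FR

namespace FR
open Finset BigOperators

def gen {β : Type} {k : ℕ} (X : β → Fin k → ZMod 2) : Prop :=
  ∀ u : Fin k → ZMod 2, (∀ i j, ∑ l, u l * (X i l + X j l) = 0) → u = 0

def altM (k : ℕ) : Finset (Fin k → Fin k → ZMod 2) :=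
  univ.filter fun A => (∀ l l', A l l' = A l' l) ∧ ∀ l, A l l = 0

lemma sum_symm_zero {β : Type} [Fintype β] (S : β → β → ZMod 2) (hs : ∀ i j, S i j = S j i)
    (hd : ∀ i, S i i = 0) : ∑ i, ∑ j, S i j = 0 := by
  rw [← sum_product']
  apply sum_involution (fun p _ => (p.2, p.1))
  · intro p _; simp only; rw [hs p.2 p.1, zadd_self]
  · intro p _ h h2
    apply h
    have : p.2 = p.1 := congrArg Prod.fst h2
    rw [this, hd]
  · intros; simp
  · intros; rfl

lemma span_of_gen {k : ℕ} {β : Type} (Z : β → Fin k → ZMod 2)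
    (h : ∀ u : Fin k → ZMod 2, (∀ i, ∑ l, u l * Z i l = 0) → u = 0) :
    Submodule.span (ZMod 2) (Set.range Z) = ⊤ := by
  by_contra hne
  obtain ⟨f, hf, hle⟩ := Submodule.exists_le_ker_of_lt_top _ (lt_top_iff_ne_top.mpr hne)
  have key : ∀ w, f w = ∑ l, f (Pi.single l 1) * w l := by
    intro w
    conv_lhs => rw [pi_eq_sum_univ' w, map_sum]
    apply sum_congr rfl
    intro l _
    rw [map_smul, smul_eq_mul, mul_comm]
  apply hf
  have h0 := h (fun l => f (Pi.single l 1)) (by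
    intro i
    rw [← key]
    exact hle (Submodule.subset_span ⟨i, rfl⟩))
  ext l
  simpa using congrFun h0 l

lemma alt_exists {k : ℕ} {β : Type} [Fintype β] (X Y : β → Fin k → ZMod 2) (hX : gen X)
    (hXY : ∀ i j, ∑ l, (Y i l + Y j l) * (X i l + X j l) = 0) :
    ∃ A ∈ altM k, ∃ c : Fin k → ZMod 2, ∀ i l, Y i l = ∑ l', A l l' * X i l' + c l := by
  rcases isEmpty_or_nonempty β with hβ | ⟨⟨i0⟩⟩
  · exact ⟨0, by simp [altM], 0, fun i => (hβ.false i).elim⟩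
  set X' : β → Fin k → ZMod 2 := fun i => X i + X i0 with hX'
  set Y' : β → Fin k → ZMod 2 := fun i => Y i + Y i0 with hY'
  have zz : ∀ z : ZMod 2, z + z = 0 := zadd_self
  have hXX : ∀ i j l, X i l + X j l = X' i l + X' j l := by
    intro i j l; simp only [hX', Pi.add_apply]; linear_combination - zz (X i0 l)
  have hYY : ∀ i j l, Y i l + Y j l = Y' i l + Y' j l := by
    intro i j l; simp only [hY', Pi.add_apply]; linear_combination - zz (Y i0 l)
  have hSd : ∀ i, ∑ l, X' i l * Y' i l = 0 := by
    intro i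
    rw [← hXY i i0]
    apply sum_congr rfl; intros; simp only [hX', hY', Pi.add_apply]; ring
  have hS : ∀ i j, ∑ l, X' i l * Y' j l = ∑ l, X' j l * Y' i l := by
    intro i j
    have h := hXY i j
    simp_rw [hXX, hYY] at h
    have e : ∑ l, (Y' i l + Y' j l) * (X' i l + X' j l) =
        ∑ l, X' i l * Y' i l + ∑ l, X' j l * Y' j l + (∑ l, X' i l * Y' j l + ∑ l, X' j l * Y' i l) := by
      simp only [← sum_add_distrib]
      apply sum_congr rfl; intros; ring
    rw [e, hSd, hSd, zero_add, zero_add] at h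
    linear_combination h - zz (∑ l, X' j l * Y' i l)
  have hg : ∀ u : Fin k → ZMod 2, (∀ i, ∑ l, u l * X' i l = 0) → u = 0 := by
    intro u hu
    apply hX
    intro i j
    simp_rw [hXX, mul_add, sum_add_distrib, hu, add_zero]
  set f := Fintype.linearCombination (ZMod 2) X' with hf
  set g := Fintype.linearCombination (ZMod 2) Y' with hgdef
  have hfs : LinearMap.range f = ⊤ := by
    rw [hf, Fintype.range_linearCombination]
    exact span_of_gen X' hg
  have hfa : ∀ t l, f t l = ∑ i, t i * X' i l := by
    intro t l; simp [hf, Fintype.linearCombination_apply, Finset.sum_apply]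
  have hga : ∀ t l, g t l = ∑ i, t i * Y' i l := by
    intro t l; simp [hgdef, Fintype.linearCombination_apply, Finset.sum_apply]
  -- pairing
  have hpair : ∀ t s, ∑ l, f t l * g s l = ∑ i, ∑ j, t i * s j * ∑ l, X' i l * Y' j l := by
    intro t s
    simp_rw [hfa, hga, sum_mul_sum, mul_sum]
    rw [sum_comm]
    apply sum_congr rfl; intro i _
    rw [sum_comm]
    apply sum_congr rfl; intro j _
    apply sum_congr rfl; intro l _
    ring
  have hpair_symm : ∀ t s, ∑ l, f t l * g s l = ∑ l, f s l * g t l := by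
    intro t s
    rw [hpair, hpair, sum_comm]
    apply sum_congr rfl; intro i _
    apply sum_congr rfl; intro j _
    rw [hS]; ring
  have hpair_zero : ∀ t, ∑ l, f t l * g t l = 0 := by
    intro t
    rw [hpair]
    apply sum_symm_zero
    · intro i j; rw [hS]; ring
    · intro i; rw [hSd, mul_zero]
  have hker : ∀ t, f t = 0 → g t = 0 := by
    intro t ht
    apply hg
    intro i
    have := hpair_symm (Pi.single i 1) t
    rw [ht] at this
    have e : f (Pi.single i 1) = X' i := by simp [hf]
    rw [e] at this
    simp only [Pi.zero_apply, zero_mul, sum_const_zero] at this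
    rw [← this]
    apply sum_congr rfl; intros; ring
  obtain ⟨h, hh⟩ := LinearMap.exists_rightInverse_of_surjective f hfs
  have hfh : ∀ w, f (h w) = w := fun w => LinearMap.congr_fun hh w
  have hgh : ∀ t, g (h (f t)) = g t := by
    intro t
    have := hker (h (f t) - t) (by rw [map_sub, hfh, sub_self])
    rw [map_sub, sub_eq_zero] at this
    exact this
  set M : Fin k → Fin k → ZMod 2 := fun l l' => g (h (Pi.single l' 1)) l with hM
  have hMw : ∀ w l, g (h w) l = ∑ l', M l l' * w l' := by
    intro w l
    conv_lhs => rw [pi_eq_sum_univ' w, map_sum, map_sum, Finset.sum_apply]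
    apply sum_congr rfl
    intro l' _
    rw [map_smul, map_smul, Pi.smul_apply, smul_eq_mul, mul_comm]
  have hent : ∀ l l', M l l' = ∑ m, f (h (Pi.single l 1)) m * g (h (Pi.single l' 1)) m := by
    intro l l'
    rw [hfh, sum_eq_single l]
    · simp [hM]
    · intro b _ hb; simp [hb]
    · simp
  refine ⟨M, ?_, fun l => ∑ l', M l l' * X i0 l' + Y i0 l, ?_⟩
  · simp only [altM, mem_filter, mem_univ, true_and]
    constructor
    · intro l l'; rw [hent, hent, hpair_symm]
    · intro l; rw [hent, hpair_zero]
  · intro i l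
    have e : f (Pi.single i 1) = X' i := by simp [hf]
    have e2 : g (Pi.single i 1) = Y' i := by simp [hgdef]
    have h3 := hMw (X' i) l
    rw [← e, hgh, e2, e] at h3
    have h4 : ∑ l', M l l' * X' i l' = ∑ l', M l l' * X i l' + ∑ l', M l l' * X i0 l' := by
      rw [← sum_add_distrib]; apply sum_congr rfl; intros; simp only [hX', Pi.add_apply]; ring
    rw [h4] at h3
    simp only [hY', Pi.add_apply] at h3
    linear_combination h3 - zz (Y i0 l)

lemma alt_cond {k : ℕ} {β : Type} (X : β → Fin k → ZMod 2) (A : Fin k → Fin k → ZMod 2) (hA : A ∈ altM k)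
    (c : Fin k → ZMod 2) (i j : β) :
    ∑ l, ((∑ l', A l l' * X i l' + c l) + (∑ l', A l l' * X j l' + c l)) * (X i l + X j l) = 0 := by
  simp only [altM, mem_filter, mem_univ, true_and] at hA
  have : ∀ l, ((∑ l', A l l' * X i l' + c l) + (∑ l', A l l' * X j l' + c l)) * (X i l + X j l) =
      ∑ l', A l l' * ((X i l' + X j l') * (X i l + X j l)) := by
    intro l
    rw [show (∑ l', A l l' * X i l' + c l) + (∑ l', A l l' * X j l' + c l) =
      (∑ l', A l l' * X i l' + ∑ l', A l l' * X j l') + (c l + c l) by ring, zadd_self, add_zero,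
      ← sum_add_distrib, sum_mul]
    apply sum_congr rfl; intros; ring
  simp_rw [this]
  apply sum_symm_zero
  · intro l l'; rw [hA.1 l l']; ring
  · intro l; rw [hA.2, zero_mul]

lemma alt_inj {k : ℕ} {β : Type} [Nonempty β] (X : β → Fin k → ZMod 2) (hX : gen X)
    (A B : Fin k → Fin k → ZMod 2) (c c' : Fin k → ZMod 2)
    (h : ∀ i l, ∑ l', A l l' * X i l' + c l = ∑ l', B l l' * X i l' + c' l) : A = B ∧ c = c' := by
  have hAB : A = B := by
    ext1 l
    rw [← sub_eq_zero]
    apply hX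
    intro i j
    have h1 := h i l
    have h2 := h j l
    simp only [Pi.sub_apply, sub_mul, mul_add, sum_sub_distrib, sum_add_distrib]
    have e := zadd_self (∑ l', A l l' * X j l')
    have e2 := zadd_self (∑ l', B l l' * X j l')
    linear_combination h1 - h2 + e - e2
  subst hAB
  refine ⟨rfl, ?_⟩
  ext1 l
  obtain ⟨i⟩ := ‹Nonempty β›
  exact add_left_cancel (h i l)

lemma sum_alt {k : ℕ} {β : Type} [Fintype β] [DecidableEq β] [Nonempty β] (X : β → Fin k → ZMod 2) (hX : gen X)
    (G : (β → Fin k → ZMod 2) → ℝ) :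
    (∑ Y : β → Fin k → ZMod 2, if (∀ i j, ∑ l, (Y i l + Y j l) * (X i l + X j l) = 0) then G Y else 0)
    = ∑ A ∈ altM k, ∑ c : Fin k → ZMod 2, G (fun i l => ∑ l', A l l' * X i l' + c l) := by
  rw [← sum_filter, ← sum_product']
  symm
  apply sum_bij (fun p _ => (fun i l => ∑ l', p.1 l l' * X i l' + p.2 l))
  · intro p hp
    simp only [mem_product, mem_univ, and_true] at hp
    simp only [mem_filter, mem_univ, true_and]
    exact fun i j => alt_cond X p.1 hp p.2 i j
  · intro p _ q _ h
    obtain ⟨h1, h2⟩ := alt_inj X hX p.1 q.1 p.2 q.2 (fun i l => congrFun (congrFun h i) l)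
    exact Prod.ext h1 h2
  · intro Y hY
    simp only [mem_filter, mem_univ, true_and] at hY
    obtain ⟨A, hA, c, hc⟩ := alt_exists X Y hX hY
    refine ⟨(A, c), by simp [hA], ?_⟩
    funext i l
    exact (hc i l).symm
  · intros; rfl

end FR

namespace FR
open Finset BigOperators

abbrev EE (β : Type) [LinearOrder β] := {p : β × β // p.1 < p.2}

section
variable {α β : Type} [Fintype α] [Fintype β] [DecidableEq α] [LinearOrder β]

def upS (σ : EE β → ZMod 2) (i j : β) : ZMod 2 := if h : i < j then σ ⟨(i, j), h⟩ else 0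

def symS (σ : EE β → ZMod 2) : α ⊕ β → α ⊕ β → ZMod 2
  | Sum.inr i, Sum.inr j => upS σ i j + upS σ j i
  | _, _ => 0

lemma sum_EE (σ : EE β → ZMod 2) (f : β × β → ZMod 2) :
    ∑ e : EE β, σ e * f e.1 = ∑ i, ∑ j, upS σ i j * f (i, j) := by
  rw [← Fintype.sum_prod_type']
  rw [← sum_subset (subset_univ (univ.filter (fun p : β × β => p.1 < p.2)))]
  · rw [sum_subtype (univ.filter (fun p : β × β => p.1 < p.2)) (p := fun p => p.1 < p.2) (by simp)]
    apply sum_congr rfl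
    rintro ⟨⟨i, j⟩, h⟩ _
    simp only at h
    simp [upS, h]
  · intro p _ hp
    simp only [mem_filter, mem_univ, true_and] at hp
    simp [upS, hp]

lemma row_symS (v : α ⊕ β → ZMod 2) (a : α ⊕ β → α ⊕ β → ZMod 2) (σ : EE β → ZMod 2) (x : α ⊕ β → ZMod 2)
    (i : β) : row v (a + symS σ) x (Sum.inr i) = row v a x (Sum.inr i) +
      ∑ j, (upS σ i j + upS σ j i) * (x (Sum.inr i) + x (Sum.inr j)) := by
  have h : ∑ j, (upS σ i j + upS σ j i) * (x (Sum.inr i) + x (Sum.inr j)) =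
      ∑ j : α ⊕ β, symS σ (Sum.inr i) j * (x (Sum.inr i) + x j) := by
    rw [Fintype.sum_sum_type]; simp [symS]
  rw [h]
  simp only [row, Pi.add_apply, add_mul _ _ (_ + _), sum_add_distrib]
  ring

lemma row_symS_small (v : α ⊕ β → ZMod 2) (a : α ⊕ β → α ⊕ β → ZMod 2) (σ : EE β → ZMod 2) (x : α ⊕ β → ZMod 2)
    (q : α) : row v (a + symS σ) x (Sum.inl q) = row v a x (Sum.inl q) := by
  simp only [row, Pi.add_apply, Fintype.sum_sum_type, symS, add_zero]

variable {k : ℕ}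

lemma phase_lin (v : α ⊕ β → ZMod 2) (a : α ⊕ β → α ⊕ β → ZMod 2) (σ : EE β → ZMod 2)
    (x : Fin k → α ⊕ β → ZMod 2) (Y : β → Fin k → ZMod 2) :
    ∑ i, ∑ l, Y i l * row v (a + symS σ) (x l) (Sum.inr i) =
    ∑ i, ∑ l, Y i l * row v a (x l) (Sum.inr i) +
    ∑ e : EE β, σ e * ∑ l, (Y e.1.1 l + Y e.1.2 l) * (x l (Sum.inr e.1.1) + x l (Sum.inr e.1.2)) := by
  rw [sum_EE σ (fun p => ∑ l, (Y p.1 l + Y p.2 l) * (x l (Sum.inr p.1) + x l (Sum.inr p.2)))]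
  have split : ∀ i l, Y i l * row v (a + symS σ) (x l) (Sum.inr i) = Y i l * row v a (x l) (Sum.inr i) +
      Y i l * ∑ j, (upS σ i j + upS σ j i) * (x l (Sum.inr i) + x l (Sum.inr j)) := by
    intro i l; rw [row_symS, mul_add]
  simp_rw [split, sum_add_distrib]
  congr 1
  set T : β → β → ZMod 2 := fun i j => ∑ l, Y i l * (x l (Sum.inr i) + x l (Sum.inr j)) with hT
  have e1 : ∀ i, ∑ l, Y i l * ∑ j, (upS σ i j + upS σ j i) * (x l (Sum.inr i) + x l (Sum.inr j)) =
      ∑ j, (upS σ i j + upS σ j i) * T i j := by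
    intro i
    simp_rw [hT, mul_sum]
    rw [sum_comm]
    apply sum_congr rfl; intro j _
    apply sum_congr rfl; intro l _
    ring
  have e2 : ∑ i, ∑ l, Y i l * ∑ j, (upS σ i j + upS σ j i) * (x l (Sum.inr i) + x l (Sum.inr j)) =
    ∑ i, ∑ j, upS σ i j * (T i j + T j i) := by
    simp_rw [e1, add_mul, mul_add, sum_add_distrib]
    congr 1
    rw [sum_comm]
  rw [e2]
  apply sum_congr rfl; intro i _
  apply sum_congr rfl; intro j _
  congr 1
  simp_rw [hT, ← sum_add_distrib]
  apply sum_congr rfl; intro l _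
  ring

/-- number of `σ` for which all big rows vanish -/
noncomputable def cnt (v : α ⊕ β → ZMod 2) (a : α ⊕ β → α ⊕ β → ZMod 2) (x : Fin k → α ⊕ β → ZMod 2) : ℝ :=
  ∑ σ : EE β → ZMod 2, if (∀ i l, row v (a + symS σ) (x l) (Sum.inr i) = 0) then 1 else 0

lemma cnt_fourier (v : α ⊕ β → ZMod 2) (a : α ⊕ β → α ⊕ β → ZMod 2) (x : Fin k → α ⊕ β → ZMod 2) :
    cnt v a x * 2 ^ (Fintype.card β * k) = 2 ^ (Fintype.card (EE β)) * ∑ Y : β → Fin k → ZMod 2,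
      if (∀ i j, ∑ l, (Y i l + Y j l) * (x l (Sum.inr i) + x l (Sum.inr j)) = 0) then
        chi (∑ i, ∑ l, Y i l * row v a (x l) (Sum.inr i)) else 0 := by
  have h1 : ∀ σ : EE β → ZMod 2, (if (∀ i l, row v (a + symS σ) (x l) (Sum.inr i) = 0) then (1:ℝ) else 0)
      * 2 ^ (Fintype.card β * k) = ∑ Y : β → Fin k → ZMod 2, chi (∑ i, ∑ l, Y i l * row v (a + symS σ) (x l) (Sum.inr i)) := by
    intro σ
    have := chi_orth (κ := β × Fin k) (fun p => row v (a + symS σ) (x p.2) (Sum.inr p.1))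
    rw [← (Equiv.curry β (Fin k) (ZMod 2)).sum_comp]
    simp_rw [Fintype.sum_prod_type] at this
    simp only [Equiv.curry_apply, Function.curry]
    rw [this]
    have e : ((fun p : β × Fin k => row v (a + symS σ) (x p.2) (Sum.inr p.1)) = 0) ↔
      (∀ i l, row v (a + symS σ) (x l) (Sum.inr i) = 0) := by
      constructor
      · intro h i l; exact congrFun h (i, l)
      · intro h; funext ⟨i, l⟩; exact h i l
    simp only [e]
    split_ifs <;> simp
  rw [cnt, sum_mul]
  simp_rw [h1]
  rw [sum_comm, mul_sum]
  apply sum_congr rfl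
  intro Y _
  simp_rw [phase_lin, chi_add]
  rw [← mul_sum]
  have := chi_orth (κ := EE β) (fun e => ∑ l, (Y e.1.1 l + Y e.1.2 l) * (x l (Sum.inr e.1.1) + x l (Sum.inr e.1.2)))
  rw [this]
  have e : ((fun e : EE β => ∑ l, (Y e.1.1 l + Y e.1.2 l) * (x l (Sum.inr e.1.1) + x l (Sum.inr e.1.2))) = 0) ↔
      (∀ i j, ∑ l, (Y i l + Y j l) * (x l (Sum.inr i) + x l (Sum.inr j)) = 0) := by
    constructor
    · intro h i j
      rcases lt_trichotomy i j with hij | rfl | hij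
      · exact congrFun h ⟨(i, j), hij⟩
      · simp [zadd_self]
      · have := congrFun h ⟨(j, i), hij⟩
        simp only [Pi.zero_apply] at this
        rw [← this]
        apply sum_congr rfl; intros; ring
    · intro h; funext ⟨⟨i, j⟩, hij⟩; exact h i j
  simp only [e]
  split_ifs <;> ring

/-- the quadratic phase -/
noncomputable def Phi (v : α ⊕ β → ZMod 2) (a : α ⊕ β → α ⊕ β → ZMod 2) (A : Fin k → Fin k → ZMod 2)
    (x : Fin k → α ⊕ β → ZMod 2) : ZMod 2 :=
  ∑ l, ∑ l', A l l' * ∑ i, x l' i * row v a (x l) i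

def HH (v : α ⊕ β → ZMod 2) (a : α ⊕ β → α ⊕ β → ZMod 2) : Submodule (ZMod 2) (α ⊕ β → ZMod 2) where
  carrier := {x | (∀ q, row v a x (Sum.inl q) = 0) ∧ ∑ i, v i * x i = 0}
  zero_mem' := by
    refine ⟨fun q => ?_, by simp⟩
    have := row_smul v a 0 0 (Sum.inl q)
    simpa using this
  add_mem' := by
    intro x y hx hy
    refine ⟨fun q => by rw [row_add, hx.1, hy.1, add_zero], ?_⟩
    simp only [Pi.add_apply, mul_add, sum_add_distrib, hx.2, hy.2, add_zero]
  smul_mem' := by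
    intro c x hx
    refine ⟨fun q => by rw [row_smul, hx.1, mul_zero], ?_⟩
    have : ∑ i, v i * (c • x) i = c * ∑ i, v i * x i := by
      rw [mul_sum]; apply sum_congr rfl; intros; simp; ring
    rw [this, hx.2, mul_zero]

lemma cnt_generic [Nonempty β] {v : α ⊕ β → ZMod 2} {a : α ⊕ β → α ⊕ β → ZMod 2}
    (hs : ∀ i j, i ≠ j → a i j + a j i = v i * v j) (hv : ∑ i, v i = 1)
    (x : Fin k → α ⊕ β → ZMod 2) (hx : ∀ l, x l ∈ HH v a) (hg : gen (fun (i : β) l => x l (Sum.inr i))) :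
    cnt v a x * 2 ^ (Fintype.card β * k) = 2 ^ (Fintype.card (EE β)) * (2 ^ k * ∑ A ∈ altM k, chi (Phi v a A x)) := by
  rw [cnt_fourier, sum_alt (fun (i : β) l => x l (Sum.inr i)) hg
    (fun Y => chi (∑ i, ∑ l, Y i l * row v a (x l) (Sum.inr i)))]
  congr 1
  rw [mul_sum]
  apply sum_congr rfl
  intro A _
  have : ∀ c : Fin k → ZMod 2, ∑ i : β, ∑ l, (∑ l', A l l' * x l' (Sum.inr i) + c l) * row v a (x l) (Sum.inr i)
      = Phi v a A x := by
    intro c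
    have h1 : ∑ i : β, ∑ l, (∑ l', A l l' * x l' (Sum.inr i) + c l) * row v a (x l) (Sum.inr i) =
      ∑ i : α ⊕ β, ∑ l, (∑ l', A l l' * x l' i + c l) * row v a (x l) i := by
      rw [Fintype.sum_sum_type]
      simp only [(hx _).1, mul_zero, sum_const_zero, zero_add]
    rw [h1, sum_comm, Phi]
    apply sum_congr rfl
    intro l _
    simp_rw [add_mul, sum_add_distrib, ← mul_sum]
    rw [sum_row hs hv, (hx l).2, mul_zero, add_zero]
    simp_rw [mul_sum, sum_mul]
    rw [sum_comm]
    apply sum_congr rfl; intro l' _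
    apply sum_congr rfl; intro i _
    ring
  simp only [this, sum_const, card_univ, Fintype.card_fun, ZMod.card, Fintype.card_fin]
  simp

end
end FR

namespace FR
open Finset BigOperators

section
variable {α β : Type} [Fintype α] [Fintype β] [DecidableEq α] [LinearOrder β]
variable {v : α ⊕ β → ZMod 2} {a : α ⊕ β → α ⊕ β → ZMod 2}

/-- the functional attached to `(t, c)` -/
def lamF (v : α ⊕ β → ZMod 2) (a : α ⊕ β → α ⊕ β → ZMod 2) (t : α → ZMod 2) (c : ZMod 2) :
    (α ⊕ β → ZMod 2) →ₗ[ZMod 2] ZMod 2 where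
  toFun x := ∑ q, t q * row v a x (Sum.inl q) + c * ∑ i, v i * x i
  map_add' x y := by
    simp only [row_add, Pi.add_apply, mul_add, sum_add_distrib]; ring
  map_smul' c' x := by
    simp only [row_smul, Pi.smul_apply, smul_eq_mul, RingHom.id_apply, mul_add, mul_sum]
    congr 1 <;> (apply sum_congr rfl; intros; ring)

def wF (v : α ⊕ β → ZMod 2) (a : α ⊕ β → α ⊕ β → ZMod 2) (t : α → ZMod 2) (c : ZMod 2) (i : α ⊕ β) : ZMod 2 :=
  lamF v a t c (Pi.single i 1)

lemma lamF_eq (t : α → ZMod 2) (c : ZMod 2) (x : α ⊕ β → ZMod 2) :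
    lamF v a t c x = ∑ i, x i * wF v a t c i := by
  conv_lhs => rw [pi_eq_sum_univ' x, map_sum]
  apply sum_congr rfl
  intro i _
  rw [map_smul, smul_eq_mul]; rfl

lemma wF_inr (t : α → ZMod 2) (c : ZMod 2) (i : β) :
    wF v a t c (Sum.inr i) = ∑ q, t q * a (Sum.inl q) (Sum.inr i) + c * v (Sum.inr i) := by
  simp [wF, lamF, row, Pi.single_apply]

lemma HH_ind (x : α ⊕ β → ZMod 2) :
    (if x ∈ HH v a then (2:ℝ) ^ (Fintype.card α + 1) else 0) =
      ∑ t : α → ZMod 2, ∑ c : ZMod 2, chi (lamF v a t c x) := by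
  have h0 : ∀ t c, lamF v a t c x = ∑ q, t q * row v a x (Sum.inl q) + c * ∑ i, v i * x i := fun _ _ => rfl
  simp_rw [h0, chi_add, ← mul_sum, ← sum_mul]
  rw [chi_orth (fun q => row v a x (Sum.inl q)), sum_z2]
  have hm : x ∈ HH v a ↔ ((fun q => row v a x (Sum.inl q)) = 0) ∧ ∑ i, v i * x i = 0 := by
    constructor
    · intro h; exact ⟨funext h.1, h.2⟩
    · intro h; exact ⟨fun q => congrFun h.1 q, h.2⟩
  rw [hm]
  rcases zcases (∑ i, v i * x i) with h | h
  · simp only [h, mul_zero, chi_zero, and_true, pow_succ]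
    split_ifs <;> norm_num
  · simp [h, chi_zero, chi_one]

lemma sum_HH_om (y : α ⊕ β → ZMod 2) :
    (∑ x : α ⊕ β → ZMod 2, if x ∈ HH v a then chi (om v x y) else 0) * 2 ^ (Fintype.card α + 1) =
      ∑ t : α → ZMod 2, ∑ c : ZMod 2,
        if (∀ i, wF v a t c i + v i * y i = 0) then (2:ℝ) ^ (Fintype.card α + Fintype.card β) else 0 := by
  rw [sum_mul]
  have : ∀ x : α ⊕ β → ZMod 2, (if x ∈ HH v a then chi (om v x y) else 0) * (2:ℝ) ^ (Fintype.card α + 1) =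
      ∑ t : α → ZMod 2, ∑ c : ZMod 2, chi (∑ i, x i * (wF v a t c i + v i * y i)) := by
    intro x
    have h1 : (if x ∈ HH v a then chi (om v x y) else 0) * (2:ℝ) ^ (Fintype.card α + 1) =
      (if x ∈ HH v a then (2:ℝ) ^ (Fintype.card α + 1) else 0) * chi (om v x y) := by
      split_ifs <;> ring
    rw [h1, HH_ind, sum_mul]
    apply sum_congr rfl; intro t _
    rw [sum_mul]
    apply sum_congr rfl; intro c _
    rw [← chi_add, lamF_eq, om, ← sum_add_distrib]
    congr 1
    apply sum_congr rfl; intros; ring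
  simp_rw [this]
  rw [sum_comm]
  apply sum_congr rfl; intro t _
  rw [sum_comm]
  apply sum_congr rfl; intro c _
  rw [chi_orth]
  simp only [funext_iff, Pi.zero_apply, Fintype.card_sum]

/-- nontriviality hypothesis -/
def NT (v : α ⊕ β → ZMod 2) (a : α ⊕ β → α ⊕ β → ZMod 2) : Prop :=
  ∀ e : α → ZMod 2, e ≠ 0 → ∀ c : ZMod 2, ∃ i : β,
    ∑ q, a (Sum.inr i) (Sum.inl q) * e q + c * v (Sum.inr i) ≠ 0

lemma wF_ne (hs : ∀ i j, i ≠ j → a i j + a j i = v i * v j) (hv : ∑ i, v i = 1) (hNT : NT v a)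
    (t : α → ZMod 2) (c : ZMod 2) (h : ∀ i, wF v a t c i = 0) : t = 0 ∧ c = 0 := by
  have ht : t = 0 := by
    by_contra hne
    obtain ⟨i, hi⟩ := hNT t hne (∑ q, t q * v (Sum.inl q) + c)
    apply hi
    rw [← h (Sum.inr i), wF_inr, add_mul, ← add_assoc, sum_mul, ← sum_add_distrib]
    congr 1
    apply sum_congr rfl
    intro q _
    have h1 := hs (Sum.inl q) (Sum.inr i) (by simp)
    have h2 := zadd_self (a (Sum.inr i) (Sum.inl q))
    linear_combination t q * h2 - t q * h1
  refine ⟨ht, ?_⟩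
  subst ht
  by_contra hc
  have hc1 : c = 1 := (zcases c).resolve_left hc
  have : ∀ i, v i = 0 := by
    intro i
    have := h i
    rcases i with i | i <;> simpa [wF, lamF, hc1, Pi.single_apply] using this
  simp [this] at hv

lemma card_HH (hs : ∀ i j, i ≠ j → a i j + a j i = v i * v j) (hv : ∑ i, v i = 1) (hNT : NT v a) :
    (Fintype.card (HH v a) : ℝ) * 2 = 2 ^ Fintype.card β := by
  have h := sum_HH_om (v := v) (a := a) 0
  have e1 : (∑ x : α ⊕ β → ZMod 2, if x ∈ HH v a then chi (om v x 0) else 0) = (Fintype.card (HH v a) : ℝ) := by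
    simp only [om, Pi.zero_apply, mul_zero, sum_const_zero, chi_zero]
    rw [Fintype.card_subtype]
    simp
  have e2 : (∑ t : α → ZMod 2, ∑ c : ZMod 2,
        if (∀ i, wF v a t c i + v i * (0 : α ⊕ β → ZMod 2) i = 0) then (2:ℝ) ^ (Fintype.card α + Fintype.card β) else 0)
      = 2 ^ (Fintype.card α + Fintype.card β) := by
    rw [sum_eq_single 0, sum_eq_single 0]
    · rw [if_pos]; intro i; simp [wF, lamF]
    · intro c _ hc
      rw [if_neg]; intro h
      exact hc (wF_ne hs hv hNT 0 c (fun i => by simpa using h i)).2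
    · simp
    · intro t _ ht
      apply sum_eq_zero
      intro c _
      rw [if_neg]; intro h
      exact ht (wF_ne hs hv hNT t c (fun i => by simpa using h i)).1
    · simp
  rw [e1, e2, pow_add, pow_add, pow_one] at h
  have : (2:ℝ) ^ Fintype.card α ≠ 0 := by positivity
  apply mul_left_cancel₀ this
  linarith

lemma sum_om_bound : (∑ y : HH v a, |∑ x : HH v a, chi (om v x y)|) ≤
    2 ^ (Fintype.card α + Fintype.card β) * 2 ^ Fintype.card {i // v i = 0} := by
  have hsub : ∀ f : (α ⊕ β → ZMod 2) → ℝ, ∑ x : HH v a, f x = ∑ x : α ⊕ β → ZMod 2, if x ∈ HH v a then f x else 0 := by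
    intro f
    rw [← sum_filter, sum_subtype (univ.filter (fun x => x ∈ HH v a)) (p := fun x => x ∈ HH v a) (by simp)]
  have h1 : ∀ y : α ⊕ β → ZMod 2, |∑ x : HH v a, chi (om v x y)| * 2 ^ (Fintype.card α + 1) =
      ∑ t : α → ZMod 2, ∑ c : ZMod 2,
        if (∀ i, wF v a t c i + v i * y i = 0) then (2:ℝ) ^ (Fintype.card α + Fintype.card β) else 0 := by
    intro y
    rw [hsub (fun x => chi (om v x y)), ← sum_HH_om, abs_eq_self.mpr]
    have := sum_HH_om (v := v) (a := a) y
    have h2 : 0 ≤ ∑ t : α → ZMod 2, ∑ c : ZMod 2,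
        if (∀ i, wF v a t c i + v i * y i = 0) then (2:ℝ) ^ (Fintype.card α + Fintype.card β) else 0 := by
      apply sum_nonneg; intro _ _; apply sum_nonneg; intro _ _; split_ifs <;> positivity
    rw [← this] at h2
    exact nonneg_of_mul_nonneg_left h2 (by positivity)
  have h2 : (∑ y : HH v a, |∑ x : HH v a, chi (om v x y)|) * 2 ^ (Fintype.card α + 1) ≤
      ∑ y : α ⊕ β → ZMod 2, ∑ t : α → ZMod 2, ∑ c : ZMod 2,
        if (∀ i, wF v a t c i + v i * y i = 0) then (2:ℝ) ^ (Fintype.card α + Fintype.card β) else 0 := by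
    rw [hsub (fun y => |∑ x : HH v a, chi (om v x y)|), sum_mul]
    apply sum_le_sum
    intro y _
    rw [← h1]
    split_ifs
    · exact le_rfl
    · rw [zero_mul]; positivity
  have h3 : ∀ w : α ⊕ β → ZMod 2, (∑ y : α ⊕ β → ZMod 2,
      if (∀ i, w i + v i * y i = 0) then (2:ℝ) ^ (Fintype.card α + Fintype.card β) else 0) ≤
      2 ^ (Fintype.card α + Fintype.card β) * 2 ^ Fintype.card {i // v i = 0} := by
    intro w
    rw [← sum_filter, sum_const, nsmul_eq_mul, mul_comm]
    gcongr
    have : (univ.filter (fun y : α ⊕ β → ZMod 2 => ∀ i, w i + v i * y i = 0)).card ≤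
        Fintype.card ({i // v i = 0} → ZMod 2) := by
      rw [← Finset.card_univ]
      apply card_le_card_of_injOn (fun y i => y i.1) (by simp)
      intro y hy z hz hyz
      simp only [coe_filter, mem_univ, true_and, Set.mem_ofPred_eq] at hy hz
      ext1 i
      rcases zcases (v i) with h | h
      · exact congrFun hyz ⟨i, h⟩
      · have a1 := hy i; have a2 := hz i
        rw [h, one_mul] at a1 a2
        exact add_left_cancel (a1.trans a2.symm)
    rw [Fintype.card_fun, ZMod.card] at this
    exact_mod_cast this
  have h4 : ∑ y : α ⊕ β → ZMod 2, ∑ t : α → ZMod 2, ∑ c : ZMod 2,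
        (if (∀ i, wF v a t c i + v i * y i = 0) then (2:ℝ) ^ (Fintype.card α + Fintype.card β) else 0) ≤
      2 ^ (Fintype.card α + 1) * (2 ^ (Fintype.card α + Fintype.card β) * 2 ^ Fintype.card {i // v i = 0}) := by
    rw [sum_comm]
    calc _ ≤ ∑ t : α → ZMod 2, ∑ c : ZMod 2, ((2:ℝ) ^ (Fintype.card α + Fintype.card β) * 2 ^ Fintype.card {i // v i = 0}) := by
          apply sum_le_sum; intro t _
          rw [sum_comm]
          apply sum_le_sum; intro c _
          exact h3 _
      _ = _ := by
          simp only [sum_const, card_univ, Fintype.card_fun, ZMod.card, nsmul_eq_mul]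
          push_cast; ring
  have := h2.trans h4
  rw [mul_comm] at this
  exact le_of_mul_le_mul_left this (by positivity)

end
end FR

namespace FR
open Finset BigOperators

section
variable {α β : Type} [Fintype α] [Fintype β] [DecidableEq α] [LinearOrder β]
variable {v : α ⊕ β → ZMod 2} {a : α ⊕ β → α ⊕ β → ZMod 2} {k : ℕ}

def kerM {ι : Type} [Fintype ι] (v : ι → ZMod 2) (a : ι → ι → ZMod 2) : Submodule (ZMod 2) (ι → ZMod 2) where
  carrier := {x | ∀ i, row v a x i = 0}
  zero_mem' := by
    intro i
    have := row_smul v a 0 0 i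
    simpa using this
  add_mem' := by
    intro x y hx hy i
    rw [row_add, hx, hy, add_zero]
  smul_mem' := by
    intro c x hx i
    rw [row_smul, hx, mul_zero]

lemma symS_symm (σ : EE β → ZMod 2) (i j : α ⊕ β) : symS σ i j = symS σ j i := by
  rcases i with i | i <;> rcases j with j | j <;> simp [symS, add_comm]

lemma skew_symS (hs : ∀ i j, i ≠ j → a i j + a j i = v i * v j) (σ : EE β → ZMod 2) :
    ∀ i j, i ≠ j → (a + symS σ : α ⊕ β → α ⊕ β → ZMod 2) i j + (a + symS σ : α ⊕ β → α ⊕ β → ZMod 2) j i = v i * v j := by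
  intro i j hij
  rw [← hs i j hij]
  simp only [Pi.add_apply]
  rw [symS_symm σ j i]
  linear_combination zadd_self (symS σ i j)

lemma ker_le_HH (hs : ∀ i j, i ≠ j → a i j + a j i = v i * v j) (hv : ∑ i, v i = 1)
    (σ : EE β → ZMod 2) {x : α ⊕ β → ZMod 2} (hx : x ∈ kerM v (a + symS σ)) : x ∈ HH v a := by
  refine ⟨fun q => by rw [← row_symS_small v a σ]; exact hx _, ?_⟩
  rw [← sum_row (skew_symS hs σ) hv]
  exact sum_eq_zero fun i _ => hx i

lemma gen_of_indep (hs : ∀ i j, i ≠ j → a i j + a j i = v i * v j) (hv : ∑ i, v i = 1) (hNT : NT v a)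
    (σ : EE β → ZMod 2) [Nonempty β] (x : Fin k → α ⊕ β → ZMod 2) (hx : ∀ l, x l ∈ kerM v (a + symS σ))
    (hli : LinearIndependent (ZMod 2) x) : gen (fun (i : β) l => x l (Sum.inr i)) := by
  intro u hu
  set y : α ⊕ β → ZMod 2 := ∑ l, u l • x l with hy
  have hyk : y ∈ kerM v (a + symS σ) := Submodule.sum_mem _ fun l _ => Submodule.smul_mem _ _ (hx l)
  have hya : ∀ i, y i = ∑ l, u l * x l i := by intro i; simp [hy, Finset.sum_apply]
  obtain ⟨i0⟩ := ‹Nonempty β›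
  set c := y (Sum.inr i0) with hc
  have hconst : ∀ i : β, y (Sum.inr i) = c := by
    intro i
    have := hu i i0
    simp only [mul_add, sum_add_distrib] at this
    rw [← hya, ← hya] at this
    linear_combination this - zadd_self c
  have hrow : ∀ i : β, ∑ q, a (Sum.inr i) (Sum.inl q) * (c + y (Sum.inl q)) + c * v (Sum.inr i) = 0 := by
    intro i
    have h := hyk (Sum.inr i)
    rw [row_symS] at h
    simp only [row, Fintype.sum_sum_type, hconst, zadd_self, mul_zero, sum_const_zero, add_zero] at h
    rw [mul_comm c]; exact h
  have he : (fun q => c + y (Sum.inl q)) = 0 := by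
    by_contra hne
    obtain ⟨i, hi⟩ := hNT _ hne c
    exact hi (hrow i)
  have hyc : ∀ i, y i = c := by
    intro i
    rcases i with q | i
    · have := congrFun he q
      simp only [Pi.zero_apply] at this
      linear_combination this - zadd_self c
    · exact hconst i
  have hc0 : c = 0 := by
    have := (ker_le_HH hs hv σ hyk).2
    simp only [hyc, ← sum_mul, hv, one_mul] at this
    exact this
  have hy0 : ∑ l, u l • x l = 0 := by
    rw [← hy]; ext i; rw [hyc, hc0]; rfl
  ext l
  exact Fintype.linearIndependent_iff.mp hli u hy0 l

lemma indep_of_gen (x : Fin k → α ⊕ β → ZMod 2) (hg : gen (fun (i : β) l => x l (Sum.inr i))) :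
    LinearIndependent (ZMod 2) x := by
  rw [Fintype.linearIndependent_iff]
  intro u hu l
  have hya : ∀ i, ∑ l, u l * x l i = 0 := by
    intro i; have := congrFun hu i; simpa [Finset.sum_apply] using this
  have := hg u (by intro i j; simp only [mul_add, sum_add_distrib, hya, add_zero])
  rw [this]; rfl

lemma card_indep (W : Submodule (ZMod 2) (α ⊕ β → ZMod 2)) :
    (Nat.card {s : Fin k → W // LinearIndependent (ZMod 2) s} : ℝ) = phi k (Module.finrank (ZMod 2) W) := by
  rcases le_or_gt k (Module.finrank (ZMod 2) W) with h | h
  · rw [card_linearIndependent h, phi, ← Fin.prod_univ_eq_prod_range (fun i => (2:ℝ) ^ Module.finrank (ZMod 2) W - 2 ^ i)]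
    push_cast
    apply prod_congr rfl
    intro i _
    rw [Nat.cast_sub]
    · simp [ZMod.card]
    · apply Nat.pow_le_pow_right
      · rw [ZMod.card]; norm_num
      · have := i.2; omega
  · have : IsEmpty {s : Fin k → W // LinearIndependent (ZMod 2) s} := by
      constructor
      rintro ⟨s, hs⟩
      have := hs.fintype_card_le_finrank
      simp at this; omega
    rw [Nat.card_eq_zero.mpr (Or.inl this), phi]
    symm
    push_cast
    apply prod_eq_zero (mem_range.mpr h)
    simp

lemma phi_sum (hs : ∀ i j, i ≠ j → a i j + a j i = v i * v j) (hv : ∑ i, v i = 1) (hNT : NT v a) [Nonempty β]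
    (σ : EE β → ZMod 2) : phi k (Module.finrank (ZMod 2) (kerM v (a + symS σ))) =
      ∑ x : Fin k → HH v a, if gen (fun (i : β) l => (x l).1 (Sum.inr i)) then
        (if (∀ i l, row v (a + symS σ) (x l).1 (Sum.inr i) = 0) then (1:ℝ) else 0) else 0 := by
  rw [← card_indep]
  have e : {s : Fin k → kerM v (a + symS σ) // LinearIndependent (ZMod 2) s} ≃
      {x : Fin k → HH v a // gen (fun (i : β) l => (x l).1 (Sum.inr i)) ∧
        ∀ i l, row v (a + symS σ) (x l).1 (Sum.inr i) = 0} :=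
    { toFun := fun s => ⟨fun l => ⟨(s.1 l).1, ker_le_HH hs hv σ (s.1 l).2⟩,
        gen_of_indep hs hv hNT σ (fun l => (s.1 l).1) (fun l => (s.1 l).2)
          (s.2.map' (Submodule.subtype _) (Submodule.ker_subtype _)),
        fun i l => (s.1 l).2 _⟩
      invFun := fun x => ⟨fun l => ⟨(x.1 l).1, by
          intro i
          rcases i with q | i
          · rw [row_symS_small]; exact (x.1 l).2.1 q
          · exact x.2.2 i l⟩, by
          apply LinearIndependent.of_comp (Submodule.subtype _)
          exact indep_of_gen (fun l => (x.1 l).1) x.2.1⟩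
      left_inv := fun s => rfl
      right_inv := fun x => rfl }
  rw [Nat.card_congr e, Nat.card_eq_fintype_card, Fintype.card_subtype]
  simp only [← ite_and]
  simp

lemma phi_avg (hs : ∀ i j, i ≠ j → a i j + a j i = v i * v j) (hv : ∑ i, v i = 1) (hNT : NT v a) [Nonempty β] :
    (∑ σ : EE β → ZMod 2, phi k (Module.finrank (ZMod 2) (kerM v (a + symS σ)))) / 2 ^ Fintype.card (EE β)
      = (∑ A ∈ altM k, ∑ x : Fin k → HH v a, if gen (fun (i : β) l => (x l).1 (Sum.inr i)) then
        chi (Phi v a A (fun l => (x l).1)) else 0) / (Fintype.card (HH v a) : ℝ) ^ k := by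
  have hH := card_HH hs hv hNT
  have hHpos : (0:ℝ) < Fintype.card (HH v a) := by
    have : (0:ℝ) < 2 ^ Fintype.card β := by positivity
    linarith
  simp_rw [phi_sum hs hv hNT]
  rw [sum_comm, div_eq_div_iff (by positivity) (by positivity), sum_mul, sum_comm, sum_mul]
  apply sum_congr rfl
  intro x _
  by_cases hg : gen (fun (i : β) l => (x l).1 (Sum.inr i))
  · have h := cnt_generic hs hv (fun l => (x l).1) (fun l => (x l).2) hg
    simp only [hg, if_true]
    rw [cnt] at h
    have h2 : (2:ℝ) ^ (Fintype.card β * k) = (Fintype.card (HH v a) : ℝ) ^ k * 2 ^ k := by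
      rw [pow_mul, ← hH, mul_pow]
    rw [h2] at h
    have h3 : (2:ℝ)^k ≠ 0 := by positivity
    apply mul_right_cancel₀ h3
    linear_combination h
  · simp [hg]

/-- bilinear pairing lemma for the phase -/
lemma Phi_shift (hs : ∀ i j, i ≠ j → a i j + a j i = v i * v j) (A : Fin k → Fin k → ZMod 2) (hA : A ∈ altM k)
    (x : Fin k → α ⊕ β → ZMod 2) (hx : ∀ l, ∑ i, v i * x l i = 0) (b : α ⊕ β → ZMod 2) (hb : ∑ i, v i * b i = 0)
    (l0 : Fin k) : Phi v a A (x + Pi.single l0 b) = Phi v a A x + om v b (∑ l, A l0 l • x l) := by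
  set g : (α ⊕ β → ZMod 2) → (α ⊕ β → ZMod 2) → ZMod 2 := fun y z => ∑ i, y i * row v a z i with hg
  have gl : ∀ y y' z, g (y + y') z = g y z + g y' z := by
    intro y y' z; simp only [hg, Pi.add_apply, add_mul, sum_add_distrib]
  have gr : ∀ y z z', g y (z + z') = g y z + g y z' := by
    intro y z z'; simp only [hg, row_add, mul_add, sum_add_distrib]
  have g0l : ∀ z, g 0 z = 0 := by intro z; simp [hg]
  have g0r : ∀ y, g y 0 = 0 := by intro y; have := gr y 0 0; simpa using this
  simp only [altM, mem_filter, mem_univ, true_and] at hA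
  have hP : ∀ x, Phi v a A x = ∑ l, ∑ l', A l l' * g (x l') (x l) := fun x => rfl
  set δ : Fin k → (α ⊕ β → ZMod 2) := Pi.single l0 b with hδ
  have hδ0 : δ l0 = b := by simp [hδ]
  have hδn : ∀ l, l ≠ l0 → δ l = 0 := by intro l hl; simp [hδ, hl]
  rw [hP, hP]
  have e1 : ∀ l l', A l l' * g ((x + δ) l') ((x + δ) l) = A l l' * g (x l') (x l) + A l l' * g (x l') (δ l)
      + A l l' * g (δ l') (x l) + A l l' * g (δ l') (δ l) := by
    intro l l'; simp only [Pi.add_apply, gl, gr]; ring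
  simp_rw [e1, sum_add_distrib]
  have e2 : ∑ l, ∑ l', A l l' * g (x l') (δ l) = ∑ l', A l0 l' * g (x l') b := by
    rw [sum_eq_single l0]
    · rw [hδ0]
    · intro l _ hl; simp [hδn l hl, g0r]
    · simp
  have e3 : ∑ l, ∑ l', A l l' * g (δ l') (x l) = ∑ l', A l0 l' * g b (x l') := by
    apply sum_congr rfl
    intro l _
    rw [sum_eq_single l0]
    · rw [hδ0, hA.1]
    · intro l _ hl; simp [hδn l hl, g0l]
    · simp
  have e4 : ∑ l, ∑ l', A l l' * g (δ l') (δ l) = 0 := by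
    apply sum_eq_zero; intro l _; apply sum_eq_zero; intro l' _
    by_cases h1 : l = l0
    · by_cases h2 : l' = l0
      · rw [h1, h2, hA.2, zero_mul]
      · rw [hδn l' h2, g0l, mul_zero]
    · rw [hδn l h1, g0r, mul_zero]
  rw [e2, e3, e4, add_zero, add_assoc, ← sum_add_distrib]
  congr 1
  have e5 : om v b (∑ l, A l0 l • x l) = ∑ l, A l0 l * om v b (x l) := by
    simp only [om, Finset.sum_apply, Pi.smul_apply, smul_eq_mul, mul_sum]
    rw [sum_comm]
    apply sum_congr rfl; intro i _
    apply sum_congr rfl; intro i _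
    ring
  rw [e5]
  apply sum_congr rfl
  intro l _
  rw [← mul_add, ← row_pair hs b (x l) hb]

lemma shift_sum {W : Type} [AddCommGroup W] [Fintype W] (f : (Fin k → W) → ℝ) (l : Fin k) :
    ∑ x : Fin k → W, ∑ b : W, f (x + Pi.single l b) = Fintype.card W * ∑ x, f x := by
  rw [sum_comm]
  have : ∀ b : W, ∑ x : Fin k → W, f (x + Pi.single l b) = ∑ x, f x := by
    intro b
    exact Fintype.sum_equiv (Equiv.addRight (Pi.single l b : Fin k → W)) _ _ (fun _ => rfl)
  simp [this]

lemma chi_Phi_bound (hs : ∀ i j, i ≠ j → a i j + a j i = v i * v j) (A : Fin k → Fin k → ZMod 2) (hA : A ∈ altM k)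
    (hA0 : A ≠ 0) :
    |∑ x : Fin k → HH v a, chi (Phi v a A (fun l => (x l).1))| * (Fintype.card (HH v a) : ℝ) ^ 2 ≤
      (Fintype.card (HH v a) : ℝ) ^ k * ∑ y : HH v a, |∑ x : HH v a, chi (om v x y)| := by
  obtain ⟨l0, h0⟩ := Function.ne_iff.mp hA0
  obtain ⟨l1, h1⟩ := Function.ne_iff.mp h0
  have hA' := hA
  simp only [altM, mem_filter, mem_univ, true_and] at hA'
  have h1' : A l0 l1 = 1 := (zcases _).resolve_left h1
  set f : (Fin k → HH v a) → ℝ := fun x => chi (Phi v a A (fun l => (x l).1)) with hf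
  set z : (Fin k → HH v a) → HH v a := fun x => ∑ l, A l0 l • x l with hz
  have hfs : ∀ x (b : HH v a), f (x + Pi.single l0 b) = f x * chi (om v b (z x)) := by
    intro x b
    have := Phi_shift hs A hA (fun l => (x l).1) (fun l => (x l).2.2) b.1 b.2.2 l0
    simp only [hf]
    rw [← chi_add]
    have e1 : (fun l => ((x + Pi.single l0 b : Fin k → HH v a) l).1) = (fun l => (x l).1) + Pi.single l0 b.1 := by
      ext1 l
      by_cases h : l = l0
      · subst h; simp
      · simp [h]
    rw [e1, this]
    congr 3
    simp [hz]
  have hzs : ∀ x (b : HH v a), z (x + Pi.single l1 b) = z x + b := by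
    intro x b
    simp only [hz, Pi.add_apply, smul_add, sum_add_distrib]
    congr 1
    rw [sum_eq_single l1]
    · simp [h1']
    · intro l _ hl; simp [hl]
    · simp
  have key : (Fintype.card (HH v a) : ℝ) * ((Fintype.card (HH v a) : ℝ) * ∑ x, f x) =
      ∑ x : Fin k → HH v a, ∑ b : HH v a, f (x + Pi.single l1 b) * ∑ c : HH v a, chi (om v c (z x + b).1) := by
    have q2 := shift_sum (W := HH v a) (fun x => ∑ b, f (x + Pi.single l0 b)) l1
    rw [← shift_sum f l0]
    refine q2.symm.trans ?_
    apply sum_congr rfl; intro x _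
    apply sum_congr rfl; intro b _
    simp_rw [hfs, hzs, mul_sum]
  have h3 : |∑ x, f x| * (Fintype.card (HH v a) : ℝ) ^ 2 = |(Fintype.card (HH v a) : ℝ) * ((Fintype.card (HH v a) : ℝ) * ∑ x, f x)| := by
    rw [abs_mul, abs_mul, Nat.abs_cast]; ring
  rw [h3, key]
  calc _ ≤ ∑ x : Fin k → HH v a, |∑ b : HH v a, f (x + Pi.single l1 b) * ∑ c : HH v a, chi (om v c (z x + b).1)| :=
        abs_sum_le_sum_abs _ _
    _ ≤ ∑ x : Fin k → HH v a, ∑ y : HH v a, |∑ c : HH v a, chi (om v c y)| := by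
        apply sum_le_sum; intro x _
        refine (abs_sum_le_sum_abs _ _).trans ?_
        have e : ∀ b : HH v a, |f (x + Pi.single l1 b) * ∑ c : HH v a, chi (om v c (z x + b).1)| =
            |∑ c : HH v a, chi (om v c (z x + b).1)| := by
          intro b; rw [abs_mul, hf]; simp only [chi_abs, one_mul]
        simp_rw [e]
        exact le_of_eq (Fintype.sum_equiv (Equiv.addLeft (z x)) _ (fun y : HH v a => |∑ c : HH v a, chi (om v c y.1)|) (fun _ => rfl))
    _ = _ := by simp

lemma nongen_bound : (∑ x : Fin k → HH v a, if gen (fun (i : β) l => (x l).1 (Sum.inr i)) then (0:ℝ) else 1)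
      * Fintype.card (HH v a) ≤ 2 ^ k * (2 ^ (Fintype.card α + 1) * (Fintype.card (HH v a) : ℝ) ^ k) := by
  -- constants on β
  set Cst : HH v a → Prop := fun h => ∀ i j : β, h.1 (Sum.inr i) + h.1 (Sum.inr j) = 0 with hC
  have hcard : ((univ.filter Cst).card : ℝ) ≤ 2 ^ (Fintype.card α + 1) := by
    have : (univ.filter Cst).card ≤ Fintype.card ((α → ZMod 2) × ZMod 2) := by
      rw [← Finset.card_univ]
      rcases isEmpty_or_nonempty β with hβ | ⟨⟨i0⟩⟩
      · apply card_le_card_of_injOn (fun h => (fun q => h.1 (Sum.inl q), 0)) (by simp)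
        intro h _ h' _ e
        simp only [Prod.mk.injEq, and_true] at e
        ext1; ext1 i
        rcases i with q | i
        · exact congrFun e q
        · exact (hβ.false i).elim
      · apply card_le_card_of_injOn (fun h => (fun q => h.1 (Sum.inl q), h.1 (Sum.inr i0))) (by simp)
        intro h h1 h' h2 e
        simp only [coe_filter, mem_univ, true_and, Set.mem_ofPred_eq, hC] at h1 h2
        simp only [Prod.mk.injEq] at e
        ext1; ext1 i
        rcases i with q | i
        · exact congrFun e.1 q
        · have a1 := h1 i i0
          have a2 := h2 i i0
          rw [← e.2] at a2
          exact add_right_cancel (a1.trans a2.symm)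
    rw [Fintype.card_prod, Fintype.card_fun, ZMod.card] at this
    rw [pow_succ]; exact_mod_cast this
  have hu : ∀ u : Fin k → ZMod 2, u ≠ 0 → (∑ x : Fin k → HH v a, if Cst (∑ l, u l • x l) then (1:ℝ) else 0)
      * Fintype.card (HH v a) ≤ 2 ^ (Fintype.card α + 1) * (Fintype.card (HH v a) : ℝ) ^ k := by
    intro u hu0
    obtain ⟨l0, h0⟩ := Function.ne_iff.mp hu0
    have h1' : u l0 = 1 := (zcases _).resolve_left h0
    rw [mul_comm, ← shift_sum _ l0]
    have hzs : ∀ (x : Fin k → HH v a) (b : HH v a), ∑ l, u l • (x + Pi.single l0 b : Fin k → HH v a) l = ∑ l, u l • x l + b := by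
      intro x b
      simp only [Pi.add_apply, smul_add, sum_add_distrib]
      congr 1
      rw [sum_eq_single l0]
      · simp [h1']
      · intro l _ hl; simp [hl]
      · simp
    simp_rw [hzs]
    have : ∀ x : Fin k → HH v a, (∑ b : HH v a, if Cst (∑ l, u l • x l + b) then (1:ℝ) else 0) = (univ.filter Cst).card := by
      intro x
      have hh : (∑ b : HH v a, if Cst b then (1:ℝ) else 0) = ((univ.filter Cst).card : ℝ) := by
        rw [Finset.sum_boole]
      rw [← hh]
      exact Fintype.sum_equiv (Equiv.addLeft (∑ l, u l • x l)) _ _ (fun _ => rfl)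
    simp_rw [this]
    simp only [sum_const, card_univ, Fintype.card_fun, Fintype.card_fin, nsmul_eq_mul]
    push_cast
    rw [mul_comm]
    gcongr
  have hle : (∑ x : Fin k → HH v a, if gen (fun (i : β) l => (x l).1 (Sum.inr i)) then (0:ℝ) else 1) ≤
      ∑ u ∈ univ.filter (fun u : Fin k → ZMod 2 => u ≠ 0), ∑ x : Fin k → HH v a, if Cst (∑ l, u l • x l) then (1:ℝ) else 0 := by
    rw [sum_comm]
    apply sum_le_sum
    intro x _
    split_ifs with hg
    · apply sum_nonneg; intros; split_ifs <;> norm_num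
    · unfold gen at hg
      push Not at hg
      obtain ⟨u, hu1, hu2⟩ := hg
      have hcu : Cst (∑ l, u l • x l) := by
        intro i j
        rw [← hu1 i j]
        simp [Finset.sum_apply, mul_add, sum_add_distrib]
      have hnn : ∀ u' ∈ univ.filter (fun u : Fin k → ZMod 2 => u ≠ 0),
          (0:ℝ) ≤ (if Cst (∑ l, u' l • x l) then (1:ℝ) else 0) := by
        intro u' _; split_ifs <;> norm_num
      have := single_le_sum hnn (mem_filter.mpr ⟨mem_univ u, hu2⟩)
      rw [if_pos hcu] at this
      exact this
  calc _ ≤ (∑ u ∈ univ.filter (fun u : Fin k → ZMod 2 => u ≠ 0), ∑ x : Fin k → HH v a, if Cst (∑ l, u l • x l) then (1:ℝ) else 0) * Fintype.card (HH v a) := by gcongr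
    _ ≤ ∑ u ∈ univ.filter (fun u : Fin k → ZMod 2 => u ≠ 0), 2 ^ (Fintype.card α + 1) * (Fintype.card (HH v a) : ℝ) ^ k := by
        rw [sum_mul]
        apply sum_le_sum
        intro u hu'
        exact hu u (mem_filter.mp hu').2
    _ ≤ _ := by
        rw [sum_const, nsmul_eq_mul]
        gcongr
        have : (univ.filter (fun u : Fin k → ZMod 2 => u ≠ 0)).card ≤ Fintype.card (Fin k → ZMod 2) := card_le_univ _
        simp only [Fintype.card_fun, ZMod.card, Fintype.card_fin] at this
        exact_mod_cast this

end
end FR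

namespace FR
open Finset BigOperators

section
variable {α β : Type} [Fintype α] [Fintype β] [DecidableEq α] [LinearOrder β]
variable {v : α ⊕ β → ZMod 2} {a : α ⊕ β → α ⊕ β → ZMod 2} {k : ℕ}

lemma moment_bound (hs : ∀ i j, i ≠ j → a i j + a j i = v i * v j) (hv : ∑ i, v i = 1) (hNT : NT v a) [Nonempty β]
    {δ : ℝ} (h1 : (2:ℝ) ^ (k + Fintype.card α + 2) ≤ δ * 2 ^ Fintype.card β)
    (h2 : (2:ℝ) ^ (Fintype.card α + 2 + Fintype.card {i // v i = 0}) ≤ δ * 2 ^ Fintype.card β) :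
    |(∑ σ : EE β → ZMod 2, phi k (Module.finrank (ZMod 2) (kerM v (a + symS σ)))) / 2 ^ Fintype.card (EE β) - 1|
      ≤ 2 ^ (k * k) * (2 * δ) := by
  rw [phi_avg hs hv hNT]
  have hH := card_HH hs hv hNT
  have hb : (0:ℝ) < 2 ^ Fintype.card β := by positivity
  set h : ℝ := ((Fintype.card (HH v a) : ℕ) : ℝ) with hh
  have hpos : 0 < h := by linarith
  have hδ : 0 ≤ δ := by
    have : (0:ℝ) < 2 ^ (k + Fintype.card α + 2) := by positivity
    by_contra hneg
    push Not at hneg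
    have := mul_neg_of_neg_of_pos hneg hb
    linarith
  -- nongeneric
  set ng : ℝ := ∑ x : Fin k → HH v a, if gen (fun (i : β) l => (x l).1 (Sum.inr i)) then (0:ℝ) else 1 with hng
  have hngb : ng ≤ δ * h ^ k := by
    have := nongen_bound (v := v) (a := a) (k := k)
    rw [← hng, ← hh] at this
    have e : (2:ℝ) ^ k * (2 ^ (Fintype.card α + 1) * h ^ k) = 2 ^ (k + Fintype.card α + 2) / 2 * h ^ k := by
      rw [pow_add, pow_add, pow_add]; ring
    rw [e] at this
    have h3 : 2 ^ (k + Fintype.card α + 2) / 2 * h ^ k ≤ δ * h * h ^ k := by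
      gcongr; rw [← hH] at h1; linarith
    have h4 : ng * h ≤ (δ * h ^ k) * h := by linarith
    exact le_of_mul_le_mul_right h4 hpos
  have hng0 : 0 ≤ ng := sum_nonneg fun _ _ => by split_ifs <;> norm_num
  have hdiff : ∀ A, |(∑ x : Fin k → HH v a, if gen (fun (i : β) l => (x l).1 (Sum.inr i)) then
        chi (Phi v a A (fun l => (x l).1)) else 0) - ∑ x : Fin k → HH v a, chi (Phi v a A (fun l => (x l).1))| ≤ ng := by
    intro A
    rw [← sum_sub_distrib, hng]
    refine (abs_sum_le_sum_abs _ _).trans (sum_le_sum fun x _ => ?_)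
    split_ifs
    · simp
    · simp [chi_abs]
  have hA : ∀ A ∈ altM k, A ≠ 0 → |∑ x : Fin k → HH v a, chi (Phi v a A (fun l => (x l).1))| ≤ δ * h ^ k := by
    intro A hA hA0
    have b1 := chi_Phi_bound hs A hA hA0
    have b2 := sum_om_bound (v := v) (a := a)
    rw [← hh] at b1
    have b3 := b1.trans (mul_le_mul_of_nonneg_left b2 (by positivity))
    have b4 : (2:ℝ) ^ (Fintype.card α + Fintype.card β) * 2 ^ Fintype.card {i // v i = 0} ≤ δ * h ^ 2 := by
      have : (2:ℝ) ^ (Fintype.card α + Fintype.card β) * 2 ^ Fintype.card {i // v i = 0} * 4 =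
        2 ^ (Fintype.card α + 2 + Fintype.card {i // v i = 0}) * 2 ^ Fintype.card β := by
        rw [pow_add, pow_add, pow_add]; ring
      have h5 := mul_le_mul_of_nonneg_right h2 hb.le
      rw [← this, ← hH] at h5
      linarith
    have b5 := b3.trans (mul_le_mul_of_nonneg_left b4 (by positivity))
    have : |∑ x : Fin k → HH v a, chi (Phi v a A (fun l => (x l).1))| * h ^ 2 ≤ (δ * h ^ k) * h ^ 2 := by
      linarith
    exact le_of_mul_le_mul_right this (by positivity)
  have h0 : (0 : Fin k → Fin k → ZMod 2) ∈ altM k := by simp [altM]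
  have hz : ∑ x : Fin k → HH v a, chi (Phi v a 0 (fun l => (x l).1)) = h ^ k := by
    simp [Phi, chi_zero, hh]
  have hcard : ((altM k).card : ℝ) ≤ 2 ^ (k * k) := by
    have : (altM k).card ≤ Fintype.card (Fin k → Fin k → ZMod 2) := card_le_univ _
    simp only [Fintype.card_fun, ZMod.card, Fintype.card_fin, ← pow_mul] at this
    exact_mod_cast this
  set G : (Fin k → Fin k → ZMod 2) → ℝ := fun A => (∑ x : Fin k → HH v a, if gen (fun (i : β) l => (x l).1 (Sum.inr i)) then
        chi (Phi v a A (fun l => (x l).1)) else 0) with hG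
  have hGA : ∀ A ∈ altM k, |G A - if A = 0 then h ^ k else 0| ≤ 2 * δ * h ^ k := by
    intro A hAm
    have d := hdiff A
    split_ifs with hA0
    · subst hA0
      rw [hz] at d
      have : 0 ≤ δ * h ^ k := by positivity
      exact d.trans (by linarith)
    · have := hA A hAm hA0
      rw [sub_zero]
      have t := abs_sub_abs_le_abs_sub (G A) (∑ x : Fin k → HH v a, chi (Phi v a A (fun l => (x l).1)))
      simp only [hG] at t ⊢
      linarith
  have hsum : |∑ A ∈ altM k, G A - h ^ k| ≤ 2 ^ (k * k) * (2 * δ * h ^ k) := by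
    have e : h ^ k = ∑ A ∈ altM k, if A = 0 then h ^ k else 0 := by
      rw [sum_ite_eq']; simp [h0]
    rw [e, ← sum_sub_distrib, ← e]
    refine (abs_sum_le_sum_abs _ _).trans ((sum_le_sum hGA).trans ?_)
    rw [sum_const, nsmul_eq_mul]
    gcongr
  have hk : 0 < h ^ k := by positivity
  rw [div_sub_one hk.ne', abs_div, abs_of_pos hk, div_le_iff₀ hk]
  linarith

lemma card_kerM (W : Submodule (ZMod 2) (α ⊕ β → ZMod 2)) : Nat.card W = 2 ^ Module.finrank (ZMod 2) W := by
  rw [Nat.card_eq_fintype_card, Module.card_eq_pow_finrank (K := ZMod 2), ZMod.card]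

end

theorem LA_main (r : ℕ) {ε : ℝ} (hε : 0 < ε) : ∃ C : ℕ, ∀ (α β : Type) [Fintype α] [Fintype β] [DecidableEq α]
    [LinearOrder β] (v : α ⊕ β → ZMod 2) (a : α ⊕ β → α ⊕ β → ZMod 2),
    (∀ i j, i ≠ j → a i j + a j i = v i * v j) → ∑ i, v i = 1 → NT v a →
    Fintype.card α + C ≤ Fintype.card β →
    Fintype.card α + Fintype.card {i // v i = 0} + C ≤ Fintype.card β →
    |(∑ σ : EE β → ZMod 2, if Nat.card (kerM v (a + symS σ)) = 2 ^ r then (1:ℝ) else 0) / 2 ^ Fintype.card (EE β)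
      - piR r| ≤ ε := by
  obtain ⟨K, δ, hδ, hM⟩ := moment_lemma r hε
  obtain ⟨C0, hC0⟩ := pow_unbounded_of_one_lt ((2:ℝ) ^ (K * K) * 2 * 2 ^ (K + 2) / δ) (one_lt_two)
  refine ⟨C0 + 1, ?_⟩
  intro α β _ _ _ _ v a hs hv hNT h1 h2
  have hne : Nonempty β := by
    rw [← Fintype.card_pos_iff]; omega
  have := hM (EE β → ZMod 2) (fun σ => Module.finrank (ZMod 2) (kerM v (a + symS σ))) ?_
  · simp only [Fintype.card_fun, ZMod.card] at this
    push_cast at this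
    convert this using 6
    rw [card_kerM]
    exact (Nat.pow_right_injective (le_refl 2)).eq_iff
  · intro k hk
    simp only [Fintype.card_fun, ZMod.card]
    push_cast
    have hC1 : (2:ℝ) ^ (K * K) * 2 * 2 ^ (K + 2) < 2 ^ C0 * δ := by
      rwa [div_lt_iff₀ hδ] at hC0
    set δ' : ℝ := δ / (2 ^ (K * K) * 2) with hδ'
    have hδ'0 : 0 < δ' := by positivity
    have hC2 : (2:ℝ) ^ (K + 2) ≤ 2 ^ C0 * δ' := by
      rw [hδ', ← mul_div_assoc, le_div_iff₀ (by positivity)]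
      linarith
    have hb := moment_bound (k := k) hs hv hNT (δ := δ') ?_ ?_
    · refine hb.trans ?_
      have : (2:ℝ) ^ (k * k) ≤ 2 ^ (K * K) := pow_le_pow_right₀ (by norm_num) (Nat.mul_le_mul hk hk)
      calc (2:ℝ) ^ (k * k) * (2 * δ') ≤ 2 ^ (K * K) * (2 * δ') := by gcongr
        _ = δ := by rw [hδ']; field_simp
    · calc (2:ℝ) ^ (k + Fintype.card α + 2) ≤ 2 ^ ((K + 2) + Fintype.card α) := pow_le_pow_right₀ (by norm_num) (by omega)
        _ ≤ (2 ^ C0 * δ') * 2 ^ Fintype.card α := by rw [pow_add]; gcongr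
        _ = δ' * 2 ^ (C0 + Fintype.card α) := by rw [pow_add]; ring
        _ ≤ _ := by gcongr; norm_num; omega
    · calc (2:ℝ) ^ (Fintype.card α + 2 + Fintype.card {i // v i = 0}) ≤ 2 ^ ((K + 2) + (Fintype.card α + Fintype.card {i // v i = 0})) :=
            pow_le_pow_right₀ (by norm_num) (by omega)
        _ ≤ (2 ^ C0 * δ') * 2 ^ (Fintype.card α + Fintype.card {i // v i = 0}) := by rw [pow_add _ (K+2)]; gcongr
        _ = δ' * 2 ^ (C0 + (Fintype.card α + Fintype.card {i // v i = 0})) := by rw [pow_add _ C0]; ring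
        _ ≤ _ := by gcongr; norm_num; omega

end FR

namespace FR
open Finset

/-- A nontrivial completely multiplicative periodic function has partial sums bounded by its period. -/
lemma per_bound (g : ℕ → ℝ) (q : ℕ) (hq : 0 < q) (hper : ∀ n, g (n + q) = g n)
    (hmul : ∀ a b, g (a * b) = g a * g b) (hb : ∀ n, |g n| ≤ 1) (u : ℕ) (hu : u.Coprime q) (hgu : g u ≠ 1) (N : ℕ) :
    |∑ n ∈ range N, g n| ≤ q := by
  haveI : NeZero q := ⟨hq.ne'⟩
  have hP : Function.Periodic g q := hper
  have h0 : ∑ n ∈ range q, g n = 0 := by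
    have e1 : ∑ n ∈ range q, g n = ∑ x : ZMod q, g x.val := by
      refine (Finset.sum_bij (fun (x : ZMod q) _ => x.val) ?_ ?_ ?_ ?_).symm
      · intro x _; simpa using ZMod.val_lt x
      · intro x _ y _ h; exact ZMod.val_injective q h
      · intro n hn; exact ⟨(n : ZMod q), mem_univ _, ZMod.val_cast_of_lt (by simpa using hn)⟩
      · intro x _; rfl
    have e2 : ∑ x : ZMod q, g x.val = ∑ x : ZMod q, g u * g x.val := by
      refine (Fintype.sum_equiv (Units.mulLeft (ZMod.unitOfCoprime u hu)) _ _ ?_).symm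
      intro x
      rw [← hmul, ← hP.map_mod_nat (u * x.val)]
      congr 1
      simp only [Units.mulLeft_apply, ZMod.coe_unitOfCoprime]
      rw [ZMod.val_mul, ZMod.val_natCast, Nat.mod_mul_mod]
    rw [← mul_sum, ← e1] at e2
    have : (g u - 1) * ∑ n ∈ range q, g n = 0 := by linarith [e1, e2]
    rcases mul_eq_zero.mp this with h | h
    · exact absurd (by linarith) hgu
    · exact h
  induction N using Nat.strong_induction_on with
  | _ N ih =>
    by_cases hN : N < q
    · calc |∑ n ∈ range N, g n| ≤ ∑ n ∈ range N, |g n| := abs_sum_le_sum_abs _ _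
        _ ≤ ∑ n ∈ range N, 1 := sum_le_sum fun n _ => hb n
        _ = N := by simp
        _ ≤ q := by exact_mod_cast hN.le
    · push Not at hN
      obtain ⟨M, rfl⟩ := Nat.exists_eq_add_of_le hN
      rw [sum_range_add, h0, zero_add]
      have : ∀ i, g (q + i) = g i := fun i => by rw [add_comm]; exact hper i
      simp_rw [this]
      exact ih M (by omega)

lemma jac_abs (a : ℤ) (b : ℕ) : |(jacobiSym a b : ℝ)| ≤ 1 := by
  rcases jacobiSym.trichotomy a b with h | h | h <;> rw [h] <;> norm_num

/-- existence of a nonresidue -/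
lemma exists_nonres (p : ℕ) (hp : p.Prime) (hp2 : p ≠ 2) (r : ℕ) (hr : p.Coprime r) :
    ∃ u : ℕ, jacobiSym u p = -1 ∧ u ≡ 1 [MOD r] := by
  haveI := Fact.mk hp
  have hne : ringChar (ZMod p) ≠ 2 := by rw [ZMod.ringChar_zmod_n]; exact hp2
  obtain ⟨a, ha⟩ := FiniteField.exists_nonsquare hne
  obtain ⟨u, hu1, hu2⟩ := Nat.chineseRemainder hr a.val 1
  refine ⟨u, ?_, hu2⟩
  rw [← jacobiSym.legendreSym.to_jacobiSym, legendreSym.eq_neg_one_iff]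
  have : ((u : ℤ) : ZMod p) = a := by
    push_cast
    rw [(ZMod.natCast_eq_natCast_iff _ _ _).mpr hu1]
    simp
  rwa [this]

lemma jac_pp_bound (p p' : ℕ) (hp : p.Prime) (hp' : p'.Prime) (h2 : p ≠ 2) (hne : p ≠ p') (N : ℕ) :
    |∑ n ∈ range N, (jacobiSym n p : ℝ) * jacobiSym n p'| ≤ p * p' := by
  have hc : p.Coprime p' := (Nat.coprime_primes hp hp').mpr hne
  obtain ⟨u, hu1, hu2⟩ := exists_nonres p hp h2 p' hc
  have hup' : (jacobiSym u p') = 1 := by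
    rw [jacobiSym.mod_left' (a₂ := 1)]
    · simp
    · exact_mod_cast hu2
  have hcu : u.Coprime (p * p') := by
    apply Nat.Coprime.mul_right
    · haveI : NeZero p := ⟨hp.ne_zero⟩
      have := jacobiSym.eq_zero_iff_not_coprime (a := u) (b := p)
      by_contra hh
      have : jacobiSym u p = 0 := this.mpr (by simpa [Int.gcd_natCast_natCast] using hh)
      rw [this] at hu1; norm_num at hu1
    · have h1 := hu2.gcd_eq
      simpa [Nat.Coprime] using h1
  have := per_bound (fun n => (jacobiSym n p : ℝ) * jacobiSym n p') (p * p') (Nat.mul_pos hp.pos hp'.pos) ?_ ?_ ?_ u hcu ?_ N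
  · simpa using this
  · intro n
    congr 2
    · apply jacobiSym.mod_left'; push_cast; simp [Int.add_mul_emod_self_left]
    · apply jacobiSym.mod_left'; push_cast; simp [Int.add_mul_emod_self_right]
  · intro a b; push_cast; rw [jacobiSym.mul_left, jacobiSym.mul_left]; push_cast; ring
  · intro n; rw [abs_mul]; exact mul_le_one₀ (jac_abs _ _) (abs_nonneg _) (jac_abs _ _)
  · simp [hu1, hup']; norm_num

/-- number of triples with a given product -/
lemma triple_sum (S : Finset ℕ) (Q : ℕ) (hS : ∀ q ∈ S, q.Prime ∧ q ≤ Q) (g : ℕ → ℝ) (hg : ∀ n, 0 ≤ g n) :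
    ∑ x ∈ S ×ˢ S ×ˢ S, g (x.1 * x.2.1 * x.2.2) ≤ 27 * ∑ n ∈ range (Q ^ 3 + 1), g n := by
  have hm : ∀ x ∈ S ×ˢ S ×ˢ S, x.1 * x.2.1 * x.2.2 ∈ range (Q ^ 3 + 1) := by
    rintro ⟨a, b, c⟩ hx
    simp only [mem_product] at hx
    rw [mem_range, Nat.lt_succ_iff, pow_three']
    exact Nat.mul_le_mul (Nat.mul_le_mul (hS a hx.1).2 (hS b hx.2.1).2) (hS c hx.2.2).2
  rw [← sum_fiberwise_of_maps_to hm, mul_sum]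
  apply sum_le_sum
  intro n _
  have h1 : ∑ x ∈ (S ×ˢ S ×ˢ S) with x.1 * x.2.1 * x.2.2 = n, g (x.1 * x.2.1 * x.2.2) =
      (((S ×ˢ S ×ˢ S).filter (fun x => x.1 * x.2.1 * x.2.2 = n)).card : ℝ) * g n := by
    rw [← nsmul_eq_mul, ← sum_const]
    apply sum_congr rfl
    intro x hx; rw [(mem_filter.mp hx).2]
  rw [h1]
  apply mul_le_mul_of_nonneg_right _ (hg n)
  rcases ((S ×ˢ S ×ˢ S).filter (fun x => x.1 * x.2.1 * x.2.2 = n)).eq_empty_or_nonempty with h | ⟨⟨a, b, c⟩, hx⟩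
  · rw [h]; norm_num
  · simp only [mem_filter, mem_product] at hx
    obtain ⟨⟨ha, hb, hc⟩, rfl⟩ := hx
    have hsub : (S ×ˢ S ×ˢ S).filter (fun x => x.1 * x.2.1 * x.2.2 = a * b * c) ⊆
        ({a, b, c} : Finset ℕ) ×ˢ ({a, b, c} : Finset ℕ) ×ˢ ({a, b, c} : Finset ℕ) := by
      rintro ⟨x, y, z⟩ hxyz
      simp only [mem_filter, mem_product] at hxyz
      obtain ⟨⟨hx, hy, hz⟩, he⟩ := hxyz
      have key : ∀ w ∈ S, w ∣ a * b * c → w ∈ ({a, b, c} : Finset ℕ) := by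
        intro w hw hd
        have hwp := (hS w hw).1
        simp only [mem_insert, mem_singleton]
        rcases hwp.dvd_mul.mp hd with h | h
        · rcases hwp.dvd_mul.mp h with h | h
          · left; exact (Nat.prime_dvd_prime_iff_eq hwp (hS a ha).1).mp h
          · right; left; exact (Nat.prime_dvd_prime_iff_eq hwp (hS b hb).1).mp h
        · right; right; exact (Nat.prime_dvd_prime_iff_eq hwp (hS c hc).1).mp h
      simp only [mem_product]
      refine ⟨key x hx ?_, key y hy ?_, key z hz ?_⟩
      · rw [← he, mul_assoc]; exact dvd_mul_right _ _
      · rw [← he, mul_comm x y, mul_assoc]; exact dvd_mul_right _ _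
      · rw [← he]; exact dvd_mul_left _ _
    have h3 : ({a, b, c} : Finset ℕ).card ≤ 3 := card_le_three
    have := card_le_card hsub
    rw [card_product, card_product] at this
    have : ((S ×ˢ S ×ˢ S).filter (fun x => x.1 * x.2.1 * x.2.2 = a * b * c)).card ≤ 27 :=
      this.trans (by calc _ ≤ 3 * (3 * 3) := Nat.mul_le_mul h3 (Nat.mul_le_mul h3 h3)
                       _ = 27 := by norm_num)
    exact_mod_cast this

/-- The mean square of the character sums. -/
lemma U_sq (A : Finset ℕ) (P Q : ℕ) (hA : ∀ p ∈ A, p.Prime ∧ p ≠ 2 ∧ p ≤ P) (hPQ : P ≤ Q) (hP : 1 ≤ P) (s : ℕ → ℝ)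
    (hs : ∀ p, |s p| ≤ 1) :
    ∑ n ∈ range (Q ^ 3 + 1), (∑ p ∈ A, s p * jacobiSym n p) ^ 2 ≤ 3 * (P * Q ^ 3) := by
  have hcard : (A.card : ℝ) ≤ P := by
    have : A ⊆ Icc 1 P := by
      intro p hp; rw [mem_Icc]; exact ⟨(hA p hp).1.one_le, (hA p hp).2.2⟩
    have := card_le_card this
    rw [Nat.card_Icc] at this
    exact_mod_cast (by omega : A.card ≤ P)
  have hP' : (1:ℝ) ≤ P := by exact_mod_cast hP
  have hQ' : (P:ℝ) ≤ Q := by exact_mod_cast hPQ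
  have e1 : ∑ n ∈ range (Q ^ 3 + 1), (∑ p ∈ A, s p * jacobiSym n p) ^ 2 =
      ∑ p ∈ A, ∑ p' ∈ A, s p * s p' * ∑ n ∈ range (Q ^ 3 + 1), (jacobiSym n p : ℝ) * jacobiSym n p' := by
    simp_rw [sq, sum_mul_sum, mul_sum]
    rw [sum_comm]
    apply sum_congr rfl; intro p _
    rw [sum_comm]
    apply sum_congr rfl; intro p' _
    apply sum_congr rfl; intro n _
    ring
  rw [e1]
  have hss : ∀ p p', |s p * s p'| ≤ 1 := fun p p' => by
    rw [abs_mul]; exact mul_le_one₀ (hs _) (abs_nonneg _) (hs _)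
  have e2 : ∀ p ∈ A, ∀ p' ∈ A, s p * s p' * ∑ n ∈ range (Q ^ 3 + 1), (jacobiSym n p : ℝ) * jacobiSym n p' ≤
      (if p = p' then ((Q:ℝ) ^ 3 + 1) else 0) + (P:ℝ) * P := by
    intro p hp p' hp'
    refine (le_abs_self _).trans ?_
    rw [abs_mul]
    refine (mul_le_mul_of_nonneg_right (hss p p') (abs_nonneg _)).trans ?_
    rw [one_mul]
    split_ifs with h
    · subst h
      refine (abs_sum_le_sum_abs _ _).trans ?_
      have : ∑ n ∈ range (Q ^ 3 + 1), |(jacobiSym n p : ℝ) * jacobiSym n p| ≤ ∑ n ∈ range (Q ^ 3 + 1), 1 := by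
        apply sum_le_sum; intro n _; rw [abs_mul]; exact mul_le_one₀ (jac_abs _ _) (abs_nonneg _) (jac_abs _ _)
      refine this.trans ?_
      simp; positivity
    · refine (jac_pp_bound p p' (hA p hp).1 (hA p' hp').1 (hA p hp).2.1 h _).trans ?_
      rw [zero_add]
      have a1 : (p:ℝ) ≤ P := by exact_mod_cast (hA p hp).2.2
      have a2 : (p':ℝ) ≤ P := by exact_mod_cast (hA p' hp').2.2
      gcongr
  refine (sum_le_sum fun p hp => sum_le_sum fun p' hp' => e2 p hp p' hp').trans ?_
  simp only [sum_add_distrib, sum_ite_eq, sum_const, nsmul_eq_mul, sum_ite_mem, inter_self]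
  have q3 : (P:ℝ) ^ 3 ≤ Q ^ 3 := by gcongr
  have q1 : (1:ℝ) ≤ Q ^ 3 := one_le_pow₀ (hP'.trans hQ')
  have hc0 : (0:ℝ) ≤ A.card := by positivity
  calc (A.card:ℝ) * (Q:ℝ) ^ 3 + (A.card:ℝ) * 1 + A.card * (A.card * ((P:ℝ) * P))
      ≤ (P:ℝ) * (Q:ℝ) ^ 3 + (P:ℝ) * (Q:ℝ) ^ 3 + (P:ℝ) * (P * (P * P)) := by gcongr
    _ ≤ 3 * ((P:ℝ) * (Q:ℝ) ^ 3) := by nlinarith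

/-- Box bound for the bilinear form. -/
lemma box (A B : Finset ℕ) (P Q : ℕ) (hA : ∀ p ∈ A, p.Prime ∧ p ≠ 2 ∧ p ≤ P) (hB : ∀ q ∈ B, q.Prime ∧ q ≤ Q)
    (hPQ : P ≤ Q) (hP : 1 ≤ P) (α β : ℕ → ℝ) (hα : ∀ p, |α p| ≤ 1) (hβ : ∀ p, |β p| ≤ 1) :
    |∑ p ∈ A, ∑ q ∈ B, α p * β q * jacobiSym q p| ^ 6 ≤ 81 * P ^ 5 * Q ^ 6 := by
  have hcard : (A.card : ℝ) ≤ P := by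
    have : A ⊆ Icc 1 P := by
      intro p hp; rw [mem_Icc]; exact ⟨(hA p hp).1.one_le, (hA p hp).2.2⟩
    have := card_le_card this
    rw [Nat.card_Icc] at this
    exact_mod_cast (by omega : A.card ≤ P)
  have hcardB : (B.card : ℝ) ≤ Q := by
    have : B ⊆ Icc 1 Q := by
      intro p hp; rw [mem_Icc]; exact ⟨(hB p hp).1.one_le, (hB p hp).2⟩
    have := card_le_card this
    rw [Nat.card_Icc] at this
    exact_mod_cast (by omega : B.card ≤ Q)
  set T : ℕ → ℝ := fun p => ∑ q ∈ B, β q * jacobiSym q p with hT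
  set s : ℕ → ℝ := fun p => (SignType.sign (T p) : ℝ) with hs
  have hs1 : ∀ p, |s p| ≤ 1 := by
    intro p; simp only [hs]
    rcases lt_trichotomy (T p) 0 with h | h | h <;> simp [h]
  have hsT : ∀ p, |T p| ^ 3 = s p * T p ^ 3 := by
    intro p; simp only [hs]
    rcases lt_trichotomy (T p) 0 with h | h | h
    · simp [h, abs_of_neg]; ring
    · simp [h]
    · simp [h, abs_of_pos]
  have b1 : |∑ p ∈ A, ∑ q ∈ B, α p * β q * jacobiSym q p| ≤ ∑ p ∈ A, |T p| := by
    refine (abs_sum_le_sum_abs _ _).trans (sum_le_sum fun p _ => ?_)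
    simp_rw [mul_assoc, ← mul_sum]
    rw [abs_mul]
    exact mul_le_of_le_one_left (abs_nonneg _) (hα p)
  have b2 : (∑ p ∈ A, |T p|) ^ 3 ≤ P ^ 2 * ∑ p ∈ A, |T p| ^ 3 := by
    have := pow_sum_div_card_le_sum_pow (s := A) (f := fun p => |T p|) (fun p _ => abs_nonneg _) 2
    by_cases hA0 : A.card = 0
    · rw [card_eq_zero.mp hA0]; simp
    · have hpos : (0:ℝ) < (A.card : ℝ) ^ 2 := by positivity
      rw [div_le_iff₀ hpos] at this
      refine this.trans ?_
      rw [mul_comm]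
      gcongr
  have b3 : ∑ p ∈ A, |T p| ^ 3 = ∑ x ∈ B ×ˢ B ×ˢ B, β x.1 * β x.2.1 * β x.2.2 * ∑ p ∈ A, s p * jacobiSym ((x.1 * x.2.1 * x.2.2 : ℕ) : ℤ) p := by
    simp_rw [hsT, mul_sum]
    rw [sum_comm]
    apply sum_congr rfl
    intro p _
    simp only [hT, pow_three', sum_mul_sum, mul_sum, sum_product, sum_mul]
    apply sum_congr rfl; intro a _
    apply sum_congr rfl; intro b _
    apply sum_congr rfl; intro c _
    push_cast
    rw [jacobiSym.mul_left, jacobiSym.mul_left]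
    push_cast; ring
  set U : ℕ → ℝ := fun n => ∑ p ∈ A, s p * jacobiSym n p with hU
  have b4 : (∑ p ∈ A, |T p| ^ 3) ^ 2 ≤ 81 * (P * Q ^ 6) := by
    rw [b3]
    refine (sum_mul_sq_le_sq_mul_sq _ _ _).trans ?_
    have c1 : ∑ x ∈ B ×ˢ B ×ˢ B, (β x.1 * β x.2.1 * β x.2.2) ^ 2 ≤ (Q:ℝ) ^ 3 := by
      have : ∑ x ∈ B ×ˢ B ×ˢ B, (β x.1 * β x.2.1 * β x.2.2) ^ 2 ≤ ∑ x ∈ B ×ˢ B ×ˢ B, 1 := by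
        apply sum_le_sum; intro x _
        rw [sq_le_one_iff_abs_le_one, abs_mul, abs_mul]
        exact mul_le_one₀ (mul_le_one₀ (hβ _) (abs_nonneg _) (hβ _)) (abs_nonneg _) (hβ _)
      refine this.trans ?_
      simp only [sum_const, card_product, nsmul_eq_mul, mul_one]
      push_cast
      calc (B.card:ℝ) * (B.card * B.card) ≤ Q * (Q * Q) := by gcongr
        _ = Q ^ 3 := by ring
    have c2 : ∑ x ∈ B ×ˢ B ×ˢ B, (U (x.1 * x.2.1 * x.2.2)) ^ 2 ≤ 27 * (3 * (P * Q ^ 3)) :=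
      (triple_sum B Q hB (fun n => U n ^ 2) (fun n => sq_nonneg _)).trans
        (by have := U_sq A P Q hA hPQ hP s hs1; linarith)
    calc _ ≤ (Q:ℝ) ^ 3 * (27 * (3 * (P * Q ^ 3))) :=
          mul_le_mul c1 c2 (sum_nonneg fun _ _ => sq_nonneg _) (by positivity)
      _ = _ := by ring
  have hn : 0 ≤ ∑ p ∈ A, |T p| := sum_nonneg fun _ _ => abs_nonneg _
  have hn3 : 0 ≤ ∑ p ∈ A, |T p| ^ 3 := sum_nonneg fun _ _ => by positivity
  calc |∑ p ∈ A, ∑ q ∈ B, α p * β q * jacobiSym q p| ^ 6 ≤ (∑ p ∈ A, |T p|) ^ 6 := by gcongr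
    _ = ((∑ p ∈ A, |T p|) ^ 3) ^ 2 := by ring
    _ ≤ (P ^ 2 * ∑ p ∈ A, |T p| ^ 3) ^ 2 := by gcongr
    _ = P ^ 4 * (∑ p ∈ A, |T p| ^ 3) ^ 2 := by ring
    _ ≤ P ^ 4 * (81 * (P * Q ^ 6)) := by gcongr
    _ = _ := by ring

end FR

namespace FR
open Finset

lemma box_lin (A B : Finset ℕ) (P Q : ℕ) (κ : ℝ) (hκ : 0 < κ) (hA : ∀ p ∈ A, p.Prime ∧ p ≠ 2 ∧ p ≤ P) (hB : ∀ q ∈ B, q.Prime ∧ q ≤ Q)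
    (hPQ : P ≤ Q) (hP : 1 ≤ P) (hκP : κ ^ 12 ≤ P) (α β : ℕ → ℝ) (hα : ∀ p, |α p| ≤ 1) (hβ : ∀ p, |β p| ≤ 1) :
    |∑ p ∈ A, ∑ q ∈ B, α p * β q * jacobiSym q p| ≤ (7 / 3) * (P * Q / κ ^ 2) := by
  have h := box A B P Q hA hB hPQ hP α β hα hβ
  have hP' : (0:ℝ) < P := by exact_mod_cast hP
  refine le_of_pow_le_pow_left₀ (n := 6) (by norm_num) (by positivity) (h.trans ?_)
  have e : ((7:ℝ) / 3 * (P * Q / κ ^ 2)) ^ 6 = (7 / 3) ^ 6 * (P ^ 6 * Q ^ 6 / κ ^ 12) := by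
    field_simp
  rw [e]
  have : (P:ℝ) ^ 5 * Q ^ 6 ≤ P ^ 6 * Q ^ 6 / κ ^ 12 := by
    rw [le_div_iff₀ (by positivity)]
    calc (P:ℝ) ^ 5 * Q ^ 6 * κ ^ 12 ≤ (P:ℝ) ^ 5 * Q ^ 6 * P := by gcongr
      _ = _ := by ring
  calc 81 * (P:ℝ) ^ 5 * Q ^ 6 = 81 * ((P:ℝ) ^ 5 * Q ^ 6) := by ring
    _ ≤ (7 / 3) ^ 6 * (P ^ 6 * Q ^ 6 / κ ^ 12) := by
      apply mul_le_mul _ this (by positivity) (by positivity)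
      norm_num

lemma box_sym (A B : Finset ℕ) (P Q : ℕ) (κ : ℝ) (hκ : 0 < κ) (hA : ∀ p ∈ A, p.Prime ∧ p ≠ 2 ∧ p ≤ P)
    (hB : ∀ q ∈ B, q.Prime ∧ q ≠ 2 ∧ q ≤ Q)
    (hP : 1 ≤ P) (hκP : κ ^ 12 ≤ P) (hQ : 1 ≤ Q) (hκQ : κ ^ 12 ≤ Q) (α β : ℕ → ℝ) (hα : ∀ p, |α p| ≤ 1) (hβ : ∀ p, |β p| ≤ 1) :
    |∑ p ∈ A, ∑ q ∈ B, α p * β q * jacobiSym q p| ≤ 7 * (P * Q / κ ^ 2) := by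
  have h0 : (0:ℝ) ≤ P * Q / κ ^ 2 := by positivity
  by_cases hPQ : P ≤ Q
  · have := box_lin A B P Q κ hκ hA (fun q hq => ⟨(hB q hq).1, (hB q hq).2.2⟩) hPQ hP hκP α β hα hβ
    linarith
  · push Not at hPQ
    set i3 : ℕ → ℝ := fun n => if n % 4 = 3 then 1 else 0 with hi3
    have hi : ∀ n, |i3 n| ≤ 1 := by intro n; simp only [hi3]; split_ifs <;> norm_num
    have e : ∑ p ∈ A, ∑ q ∈ B, α p * β q * jacobiSym q p =
        (∑ q ∈ B, ∑ p ∈ A, β q * α p * jacobiSym p q) - 2 * ∑ q ∈ B, ∑ p ∈ A, (β q * i3 q) * (α p * i3 p) * jacobiSym p q := by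
      rw [mul_sum, ← sum_sub_distrib, sum_comm]
      apply sum_congr rfl; intro q hq
      rw [mul_sum, ← sum_sub_distrib]
      apply sum_congr rfl; intro p hp
      have hp2 : p % 2 = 1 := (hA p hp).1.eq_two_or_odd.resolve_left (hA p hp).2.1
      have hq2 : q % 2 = 1 := (hB q hq).1.eq_two_or_odd.resolve_left (hB q hq).2.1
      have := jacobiSym.quadratic_reciprocity_if hq2 hp2
      rw [← this]
      simp only [hi3]
      by_cases h1 : q % 4 = 3 <;> by_cases h2 : p % 4 = 3 <;> simp only [h1, h2, and_self, and_true, and_false, true_and, if_true, if_false] <;> push_cast <;> ring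
    have r1 := box_lin B A Q P κ hκ hB (fun q hq => ⟨(hA q hq).1, (hA q hq).2.2⟩) hPQ.le hQ hκQ β α hβ hα
    have r2 := box_lin B A Q P κ hκ hB (fun q hq => ⟨(hA q hq).1, (hA q hq).2.2⟩) hPQ.le hQ hκQ (fun q => β q * i3 q) (fun p => α p * i3 p)
      (fun p => by rw [abs_mul]; exact mul_le_one₀ (hβ _) (abs_nonneg _) (hi _))
      (fun p => by rw [abs_mul]; exact mul_le_one₀ (hα _) (abs_nonneg _) (hi _))
    rw [e]
    refine (abs_sub _ _).trans ?_
    rw [abs_mul, abs_two]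
    have : (Q:ℝ) * P / κ ^ 2 = P * Q / κ ^ 2 := by ring
    rw [this] at r1 r2
    linarith

lemma card_Ico_real (S : Finset ℕ) (a b : ℝ) (hab : a ≤ b) (hb : 0 ≤ b) (h : ∀ n ∈ S, a ≤ n ∧ (n:ℝ) < b) : (S.card : ℝ) ≤ b - a + 1 := by
  have hs : S ⊆ Ico ⌈a⌉₊ ⌈b⌉₊ := by
    intro n hn
    rw [mem_Ico]
    exact ⟨Nat.ceil_le.mpr (h n hn).1, Nat.lt_ceil.mpr (h n hn).2⟩
  have h1 := card_le_card hs
  rw [Nat.card_Ico] at h1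
  have h2 : ⌈a⌉₊ ≤ ⌈b⌉₊ := Nat.ceil_mono hab
  have h3 : (S.card : ℝ) + ⌈a⌉₊ ≤ ⌈b⌉₊ := by exact_mod_cast (by omega : S.card + ⌈a⌉₊ ≤ ⌈b⌉₊)
  have := Nat.le_ceil a
  have := Nat.ceil_lt_add_one hb
  linarith

lemma card_Ioc_real (S : Finset ℕ) (a b : ℝ) (hab : a ≤ b) (ha : 0 ≤ a) (h : ∀ n ∈ S, a < n ∧ (n:ℝ) ≤ b) : (S.card : ℝ) ≤ b - a + 1 := by
  have hs : S ⊆ Ioc ⌊a⌋₊ ⌊b⌋₊ := by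
    intro n hn
    rw [mem_Ioc]
    exact ⟨(Nat.floor_lt ha).mpr (h n hn).1, Nat.le_floor (h n hn).2⟩
  have h1 := card_le_card hs
  rw [Nat.card_Ioc] at h1
  have h2 : ⌊a⌋₊ ≤ ⌊b⌋₊ := Nat.floor_mono hab
  have h3 : (S.card : ℝ) + ⌊a⌋₊ ≤ ⌊b⌋₊ := by exact_mod_cast (by omega : S.card + ⌊a⌋₊ ≤ ⌊b⌋₊)
  have := Nat.lt_floor_add_one a
  have := Nat.floor_le (ha.trans hab)
  linarith

lemma cell_bound (A B : Finset ℕ) (κ x : ℝ) (hκ : 2 ≤ κ) (hA : ∀ p ∈ A, p.Prime ∧ κ ^ 12 ≤ p ∧ Real.exp x ≤ p ∧ (p:ℝ) < Real.exp (x + 1 / κ))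
    (hB : ∀ q ∈ B, q.Prime ∧ κ ^ 12 ≤ q) (α β : ℕ → ℝ) (hα : ∀ p, |α p| ≤ 1) (hβ : ∀ p, |β p| ≤ 1) (Y : ℕ) :
    |∑ p ∈ A, ∑ q ∈ B, if p * q ≤ Y then α p * β q * jacobiSym q p else 0| ≤ 13 * (Y / κ ^ 2) := by
  have hκ0 : 0 < κ := by linarith
  have k12 : (2:ℝ) ^ 12 ≤ κ ^ 12 := by gcongr
  have hne2 : ∀ p : ℕ, κ ^ 12 ≤ p → p ≠ 2 := by
    intro p hp h; rw [h] at hp; norm_num at hp k12; linarith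
  set R := Real.exp (x + 1 / κ) with hR
  have hRpos : 0 < R := Real.exp_pos _
  set z : ℝ := Y / R with hz
  have hz0 : 0 ≤ z := by positivity
  rcases A.eq_empty_or_nonempty with hA0 | ⟨p0, hp0⟩
  · rw [hA0]; simp; positivity
  have hRk : κ ^ 12 ≤ R := (hA p0 hp0).2.1.trans (hA p0 hp0).2.2.2.le
  set B1 := B.filter (fun q : ℕ => (q:ℝ) ≤ z) with hB1
  have split : ∑ p ∈ A, ∑ q ∈ B, (if p * q ≤ Y then α p * β q * (jacobiSym q p : ℝ) else 0) =
      (∑ p ∈ A, ∑ q ∈ B1, α p * β q * jacobiSym q p) +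
      ∑ p ∈ A, ∑ q ∈ B, if p * q ≤ Y ∧ z < q then α p * β q * (jacobiSym q p : ℝ) else 0 := by
    rw [← sum_add_distrib]
    apply sum_congr rfl; intro p hp
    rw [hB1, sum_filter, ← sum_add_distrib]
    apply sum_congr rfl; intro q hq
    by_cases h1 : (q:ℝ) ≤ z
    · have : p * q ≤ Y := by
        have : (p:ℝ) * q ≤ Y := by
          rw [hz, le_div_iff₀ hRpos] at h1
          have := (hA p hp).2.2.2
          have hq0 : (0:ℝ) ≤ q := by positivity
          nlinarith
        exact_mod_cast this
      simp [h1, this, not_lt.mpr h1]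
    · push Not at h1
      simp [h1, not_le.mpr h1]
  rw [split]
  have m1 : |∑ p ∈ A, ∑ q ∈ B1, α p * β q * jacobiSym q p| ≤ 7 * (Y / κ ^ 2) := by
    rcases B1.eq_empty_or_nonempty with h0 | ⟨q0, hq0⟩
    · rw [h0]; simp; positivity
    have hq0' := mem_filter.mp hq0
    have hzk : κ ^ 12 ≤ z := (hB q0 hq0'.1).2.trans hq0'.2
    have f1 : p0 ≤ ⌊R⌋₊ := Nat.le_floor (hA p0 hp0).2.2.2.le
    have f2 : q0 ≤ ⌊z⌋₊ := Nat.le_floor hq0'.2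
    have := box_sym A B1 ⌊R⌋₊ ⌊z⌋₊ κ hκ0
      (fun p hp => ⟨(hA p hp).1, hne2 p (hA p hp).2.1, Nat.le_floor (hA p hp).2.2.2.le⟩)
      (fun q hq => by
        have hq' := mem_filter.mp hq
        exact ⟨(hB q hq'.1).1, hne2 q (hB q hq'.1).2, Nat.le_floor hq'.2⟩)
      ((hA p0 hp0).1.one_le.trans f1) ((hA p0 hp0).2.1.trans (by exact_mod_cast f1))
      ((hB q0 hq0'.1).1.one_le.trans f2) ((hB q0 hq0'.1).2.trans (by exact_mod_cast f2)) α β hα hβ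
    refine this.trans ?_
    have g1 := Nat.floor_le hRpos.le
    have g2 := Nat.floor_le hz0
    have : (⌊R⌋₊:ℝ) * ⌊z⌋₊ ≤ Y := by
      calc (⌊R⌋₊:ℝ) * ⌊z⌋₊ ≤ R * z := by gcongr
        _ = Y := by rw [hz]; field_simp
    gcongr
  have m2 : |∑ p ∈ A, ∑ q ∈ B, if p * q ≤ Y ∧ z < q then α p * β q * (jacobiSym q p : ℝ) else 0| ≤ 6 * (Y / κ ^ 2) := by
    set E := Real.exp x with hE
    have hEpos : 0 < E := Real.exp_pos _
    have hRE : R = E * Real.exp (1 / κ) := by rw [hR, Real.exp_add]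
    have hinv : 1 / κ ≤ 1 := by rw [div_le_one hκ0]; linarith
    have hinv0 : 0 < 1 / κ := by positivity
    have hexp1 : Real.exp (1 / κ) - 1 ≤ 2 * (1 / κ) := by
      have := Real.abs_exp_sub_one_le (x := 1 / κ) (by rw [abs_of_pos hinv0]; exact hinv)
      rw [abs_of_pos hinv0] at this
      exact (le_abs_self _).trans this
    have hexp3 : Real.exp (1 / κ) ≤ 3 := by linarith
    have hEk : κ ≤ E := by
      have h1 : κ ^ 12 ≤ 3 * E := by nlinarith
      have h2 : κ * 2 ^ 11 ≤ κ ^ 12 := by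
        rw [show κ ^ 12 = κ * κ ^ 11 by ring]; gcongr
      linarith
    set B2 := B.filter (fun q : ℕ => z < q ∧ (q:ℝ) ≤ Y / E) with hB2
    have hstep : |∑ p ∈ A, ∑ q ∈ B, if p * q ≤ Y ∧ z < q then α p * β q * (jacobiSym q p : ℝ) else 0| ≤ A.card * B2.card := by
      calc _ ≤ ∑ p ∈ A, ∑ q ∈ B, |if p * q ≤ Y ∧ z < q then α p * β q * (jacobiSym q p : ℝ) else 0| :=
            (abs_sum_le_sum_abs _ _).trans (sum_le_sum fun p _ => abs_sum_le_sum_abs _ _)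
        _ ≤ ∑ p ∈ A, ∑ q ∈ B, if z < q ∧ (q:ℝ) ≤ Y / E then (1:ℝ) else 0 := by
            apply sum_le_sum; intro p hp; apply sum_le_sum; intro q hq
            by_cases h : p * q ≤ Y ∧ z < q
            · have : (q:ℝ) ≤ Y / E := by
                rw [le_div_iff₀ hEpos]
                have h1 : (p:ℝ) * q ≤ Y := by exact_mod_cast h.1
                have := (hA p hp).2.2.1
                have hq0 : (0:ℝ) ≤ q := by positivity
                nlinarith
              rw [if_pos h, if_pos ⟨h.2, this⟩, abs_mul, abs_mul]
              exact mul_le_one₀ (mul_le_one₀ (hα _) (abs_nonneg _) (hβ _)) (abs_nonneg _) (jac_abs _ _)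
            · rw [if_neg h]; simp; split_ifs <;> norm_num
        _ = A.card * B2.card := by
            simp [hB2, sum_const]
    refine hstep.trans ?_
    rcases B2.eq_empty_or_nonempty with h0 | ⟨q0, hq0⟩
    · rw [h0]; simp; positivity
    have hq0' := mem_filter.mp hq0
    have hYE : κ ≤ Y / E := by
      have h1 := (hB q0 hq0'.1).2.trans hq0'.2.2
      have h2 : κ * 1 ^ 11 ≤ κ ^ 12 := by
        rw [show κ ^ 12 = κ * κ ^ 11 by ring]; gcongr; linarith
      linarith
    have hER : E ≤ R := by rw [hRE]; nlinarith [Real.one_le_exp hinv0.le]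
    have cA := card_Ico_real A E R hER hRpos.le (fun p hp => (hA p hp).2.2)
    have cB := card_Ioc_real B2 z (Y / E) (by rw [hz]; gcongr) hz0 (fun q hq => (mem_filter.mp hq).2)
    have cA' : (A.card:ℝ) ≤ 3 * (E / κ) := by
      have h1 : 1 ≤ E / κ := by rw [le_div_iff₀ hκ0]; linarith
      have h2 : R - E ≤ 2 * (E / κ) := by
        rw [hRE]
        calc E * Real.exp (1 / κ) - E = E * (Real.exp (1 / κ) - 1) := by ring
          _ ≤ E * (2 * (1 / κ)) := by gcongr
          _ = _ := by ring
      linarith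
    have cB' : (B2.card:ℝ) ≤ 2 * (Y / E / κ) := by
      have h1 : 1 ≤ Y / E / κ := by rw [le_div_iff₀ hκ0]; linarith
      have h2 : Y / E - z ≤ Y / E / κ := by
        have e1 : z = Y / E * Real.exp (-(1 / κ)) := by
          rw [hz, hRE, Real.exp_neg]; field_simp
        have e2 : 1 - Real.exp (-(1 / κ)) ≤ 1 / κ := by
          have := Real.add_one_le_exp (-(1 / κ)); linarith
        rw [e1]
        calc (Y:ℝ) / E - Y / E * Real.exp (-(1 / κ)) = Y / E * (1 - Real.exp (-(1 / κ))) := by ring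
          _ ≤ Y / E * (1 / κ) := by gcongr
          _ = _ := by ring
      linarith
    calc (A.card:ℝ) * B2.card ≤ (3 * (E / κ)) * (2 * (Y / E / κ)) := by gcongr
      _ = 6 * (Y / κ ^ 2) := by field_simp; ring
  calc _ ≤ 7 * (Y / κ ^ 2) + 6 * (Y / κ ^ 2) := (abs_add_le _ _).trans (add_le_add m1 m2)
    _ = _ := by ring

lemma hyper (A B : Finset ℕ) (κ : ℝ) (hκ : 2 ≤ κ) (hA : ∀ p ∈ A, p.Prime ∧ κ ^ 12 ≤ p)
    (hB : ∀ q ∈ B, q.Prime ∧ κ ^ 12 ≤ q) (α β : ℕ → ℝ) (hα : ∀ p, |α p| ≤ 1) (hβ : ∀ p, |β p| ≤ 1) (Y : ℕ) :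
    |∑ p ∈ A, ∑ q ∈ B, if p * q ≤ Y then α p * β q * jacobiSym q p else 0| ≤ 13 * (Y * (Real.log Y + 1) / κ) := by
  have hκ0 : 0 < κ := by linarith
  set A' := A.filter (fun p => p ≤ Y) with hA'
  have e0 : ∑ p ∈ A, ∑ q ∈ B, (if p * q ≤ Y then α p * β q * (jacobiSym q p:ℝ) else 0) =
      ∑ p ∈ A', ∑ q ∈ B, if p * q ≤ Y then α p * β q * (jacobiSym q p : ℝ) else 0 := by
    rw [hA', sum_filter]
    apply sum_congr rfl; intro p hp
    split_ifs with h
    · rfl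
    · apply sum_eq_zero; intro q hq
      rw [if_neg]
      intro h'
      have := (hB q hq).1.one_le
      exact h ((Nat.le_mul_of_pos_right p this).trans h')
  rw [e0]
  set c : ℕ → ℕ := fun p => ⌊κ * Real.log p⌋₊ with hc
  set K := ⌊κ * Real.log Y⌋₊ + 1 with hK
  have hm : ∀ p ∈ A', c p ∈ range K := by
    intro p hp
    have hp' := mem_filter.mp hp
    rw [mem_range, hK, Nat.lt_succ_iff]
    apply Nat.floor_mono
    have : (0:ℝ) < p := by exact_mod_cast (hA p hp'.1).1.pos
    have h2 : (p:ℝ) ≤ Y := by exact_mod_cast hp'.2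
    gcongr
  rw [← sum_fiberwise_of_maps_to hm]
  refine (abs_sum_le_sum_abs _ _).trans ?_
  have hb : ∀ k ∈ range K, |∑ p ∈ A' with c p = k, ∑ q ∈ B, if p * q ≤ Y then α p * β q * (jacobiSym q p : ℝ) else 0| ≤ 13 * (Y / κ ^ 2) := by
    intro k _
    apply cell_bound _ B κ (k / κ) hκ _ hB α β hα hβ Y
    intro p hp
    simp only [hA', mem_filter] at hp
    obtain ⟨⟨hp1, hp2⟩, hp3⟩ := hp
    have hpp := hA p hp1
    have hppos : (0:ℝ) < p := by exact_mod_cast hpp.1.pos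
    have hlog : 0 ≤ κ * Real.log p := mul_nonneg hκ0.le (Real.log_natCast_nonneg p)
    refine ⟨hpp.1, hpp.2, ?_, ?_⟩
    · rw [← Real.le_log_iff_exp_le hppos, div_le_iff₀ hκ0, mul_comm, ← hp3]
      exact Nat.floor_le hlog
    · rw [← Real.log_lt_iff_lt_exp hppos, ← add_div, lt_div_iff₀ hκ0, mul_comm, ← hp3]
      exact Nat.lt_floor_add_one _
  refine (sum_le_sum hb).trans ?_
  rw [sum_const, card_range, nsmul_eq_mul]
  have hl : 0 ≤ Real.log Y := Real.log_natCast_nonneg Y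
  have hK' : (K:ℝ) ≤ κ * (Real.log Y + 1) := by
    rw [hK]; push_cast
    have := Nat.floor_le (mul_nonneg hκ0.le hl)
    nlinarith
  calc (K:ℝ) * (13 * (Y / κ ^ 2)) ≤ κ * (Real.log Y + 1) * (13 * (Y / κ ^ 2)) := by gcongr
    _ = _ := by field_simp

lemma hyper_cl {K : Type*} [Fintype K] (cl : ℕ → K) (γ : K → K → ℝ) (hγ : ∀ k k', |γ k k'| ≤ 1)
    (A B : Finset ℕ) (κ : ℝ) (hκ : 2 ≤ κ) (hA : ∀ p ∈ A, p.Prime ∧ κ ^ 12 ≤ p)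
    (hB : ∀ q ∈ B, q.Prime ∧ κ ^ 12 ≤ q) (α β : ℕ → ℝ) (hα : ∀ p, |α p| ≤ 1) (hβ : ∀ p, |β p| ≤ 1) (Y : ℕ) :
    |∑ p ∈ A, ∑ q ∈ B, if p * q ≤ Y then γ (cl p) (cl q) * (α p * β q * jacobiSym q p) else 0| ≤
      (Fintype.card K : ℝ) ^ 2 * (13 * (Y * (Real.log Y + 1) / κ)) := by
  have e : ∑ p ∈ A, ∑ q ∈ B, (if p * q ≤ Y then γ (cl p) (cl q) * (α p * β q * (jacobiSym q p : ℝ)) else 0) =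
      ∑ k, ∑ k', γ k k' * ∑ p ∈ A, ∑ q ∈ B, if p * q ≤ Y then (if cl p = k then α p else 0) * (if cl q = k' then β q else 0) * (jacobiSym q p : ℝ) else 0 := by
    simp_rw [mul_sum]
    have : ∀ k, ∑ k', ∑ p ∈ A, ∑ q ∈ B, γ k k' * (if p * q ≤ Y then (if cl p = k then α p else 0) * (if cl q = k' then β q else 0) * (jacobiSym q p : ℝ) else 0)
       = ∑ p ∈ A, ∑ q ∈ B, ∑ k', γ k k' * (if p * q ≤ Y then (if cl p = k then α p else 0) * (if cl q = k' then β q else 0) * (jacobiSym q p : ℝ) else 0) := by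
      intro k
      rw [sum_comm]; apply sum_congr rfl; intro p _; rw [sum_comm]
    simp_rw [this]
    symm
    rw [sum_comm]; apply sum_congr rfl; intro p _
    rw [sum_comm]; apply sum_congr rfl; intro q _
    split_ifs with h
    · rw [sum_eq_single (cl p), sum_eq_single (cl q)]
      · simp
      · intro k' _ hk'; simp [hk'.symm]
      · simp
      · intro k _ hk; simp [hk.symm]
      · simp
    · simp
  rw [e]
  have hb : ∀ k k', |γ k k' * ∑ p ∈ A, ∑ q ∈ B, if p * q ≤ Y then (if cl p = k then α p else 0) * (if cl q = k' then β q else 0) * (jacobiSym q p : ℝ) else 0|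
      ≤ 13 * (Y * (Real.log Y + 1) / κ) := by
    intro k k'
    rw [abs_mul]
    refine (mul_le_of_le_one_left (abs_nonneg _) (hγ k k')).trans ?_
    apply hyper A B κ hκ hA hB (fun p => if cl p = k then α p else 0) (fun q => if cl q = k' then β q else 0)
    · intro p; split_ifs; exact hα p; simp
    · intro p; split_ifs; exact hβ p; simp
  refine (abs_sum_le_sum_abs _ _).trans ((sum_le_sum fun k _ => (abs_sum_le_sum_abs _ _).trans (sum_le_sum fun k' _ => hb k k')).trans ?_)
  simp only [sum_const, card_univ, nsmul_eq_mul]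
  apply le_of_eq; ring

end FR

namespace FR
open Finset

lemma split1 {n : ℕ} (S : Fin n → Finset ℕ) (i : Fin n) (F : (Fin n → ℕ) → ℝ) :
    ∑ t ∈ Fintype.piFinset S, F t =
      ∑ t ∈ Fintype.piFinset (Function.update S i {1}), ∑ p ∈ S i, F (Function.update t i p) := by
  rw [← sum_product']
  refine sum_bij' (fun t _ => (Function.update t i 1, t i)) (fun x _ => Function.update x.1 i x.2) ?_ ?_ ?_ ?_ ?_
  · intro t ht
    rw [Fintype.mem_piFinset] at ht
    rw [mem_product, Fintype.mem_piFinset]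
    refine ⟨fun a => ?_, ht i⟩
    by_cases h : a = i
    · subst h; simp
    · simp [h, ht a]
  · intro x hx
    rw [mem_product, Fintype.mem_piFinset] at hx
    rw [Fintype.mem_piFinset]
    intro a
    by_cases h : a = i
    · subst h; simpa using hx.2
    · have := hx.1 a; simpa [h] using this
  · intro t ht; simp
  · intro x hx
    rw [mem_product, Fintype.mem_piFinset] at hx
    have h1 : x.1 i = 1 := by simpa using hx.1 i
    ext a
    · by_cases h : a = i
      · subst h; simp [h1]
      · simp [h]
    · simp
  · intro t ht; simp

lemma split2 {n : ℕ} (S : Finset ℕ) (i j : Fin n) (hij : i ≠ j) (F : (Fin n → ℕ) → ℝ) :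
    ∑ t ∈ Fintype.piFinset (fun _ : Fin n => S), F t =
      ∑ t ∈ Fintype.piFinset (Function.update (Function.update (fun _ : Fin n => S) i {1}) j {1}), ∑ p ∈ S, ∑ q ∈ S,
        F (Function.update (Function.update t i p) j q) := by
  rw [split1 _ i, split1 _ j]
  apply sum_congr rfl
  intro t _
  simp only [Function.update_of_ne hij.symm]
  rw [sum_comm]
  apply sum_congr rfl; intro p _
  apply sum_congr rfl; intro q _
  rw [Function.update_comm hij]

lemma abs_prod_le_one {ι : Type*} (s : Finset ι) (f : ι → ℝ) (h : ∀ i ∈ s, |f i| ≤ 1) : |∏ i ∈ s, f i| ≤ 1 := by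
  rw [abs_prod]; exact prod_le_one (fun _ _ => abs_nonneg _) h

lemma tuple_bound {L : ℕ} (S : Finset ℕ) (κ : ℝ) (hκ : 2 ≤ κ) (hS : ∀ p ∈ S, p.Prime ∧ κ ^ 12 ≤ p) (M Y : ℕ) (hM : 1 ≤ M)
    {K : Type*} [Fintype K] (cl : ℕ → K) (c : (Fin L → K) → ℝ) (hc : ∀ k, |c k| ≤ 1)
    (g : EE (Fin L) → ℕ → ℕ → ℝ) (hg : ∀ e a b, |g e a b| ≤ 1) (e0 : EE (Fin L))
    (hg0 : ∀ p ∈ S, ∀ q ∈ S, g e0 p q = jacobiSym q p) (H : ℝ) (hH1 : 1 ≤ H) (hH : ∑ p ∈ S, (1:ℝ) / p ≤ H) :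
    |∑ t ∈ Fintype.piFinset (fun _ : Fin L => S), if M * ∏ k, t k ≤ Y then c (cl ∘ t) * ∏ e, g e (t e.1.1) (t e.1.2) else 0|
      ≤ (Fintype.card K : ℝ) ^ 2 * (13 * (Y / M * (Real.log Y + 1) / κ)) * H ^ L := by
  obtain ⟨⟨i, j⟩, hij⟩ := e0
  have hij' : i ≠ j := ne_of_lt hij
  rw [split2 S i j hij']
  set S' := Function.update (Function.update (fun _ : Fin L => S) i {1}) j {1} with hS'
  have hκ0 : 0 < κ := by linarith
  have hl : 0 ≤ Real.log Y := Real.log_natCast_nonneg Y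
  have hM0 : (0:ℝ) < M := by exact_mod_cast hM
  have inner : ∀ t ∈ Fintype.piFinset S', |∑ p ∈ S, ∑ q ∈ S,
      if M * ∏ k, (Function.update (Function.update t i p) j q) k ≤ Y then
        c (cl ∘ (Function.update (Function.update t i p) j q)) * ∏ e : EE (Fin L), g e ((Function.update (Function.update t i p) j q) e.1.1) ((Function.update (Function.update t i p) j q) e.1.2) else 0|
      ≤ (Fintype.card K : ℝ) ^ 2 * (13 * (Y / M * (Real.log Y + 1) / κ)) * ∏ k, (1:ℝ) / t k := by
    intro t ht
    rw [Fintype.mem_piFinset] at ht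
    have hti : t i = 1 := by have := ht i; simpa [hS', hij'] using this
    have htj : t j = 1 := by have := ht j; simpa [hS'] using this
    have htpos : ∀ k, 0 < t k := by
      intro k
      by_cases h1 : k = j
      · rw [h1, htj]; norm_num
      by_cases h2 : k = i
      · rw [h2, hti]; norm_num
      have := ht k
      simp [hS', h1, h2] at this
      exact (hS _ this).1.pos
    set R := ∏ k, t k with hR
    have hRpos : 0 < R := prod_pos fun k _ => htpos k
    have hprod : ∀ p q, ∏ k, (Function.update (Function.update t i p) j q) k = R * (p * q) := by
      intro p q
      have h1 : ∀ (t : Fin L → ℕ) (a : Fin L) (x : ℕ), t a = 1 → ∏ k, (Function.update t a x) k = (∏ k, t k) * x := by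
        intro t a x hta
        rw [← mul_prod_erase univ _ (mem_univ a), ← mul_prod_erase univ t (mem_univ a)]
        rw [hta, one_mul, Function.update_self, mul_comm]
        congr 1
        apply prod_congr rfl
        intro k hk
        rw [Function.update_of_ne (ne_of_mem_erase hk)]
      rw [h1 _ j q, h1 _ i p hti, mul_assoc]
      rw [Function.update_of_ne hij'.symm, htj]
    set Z := Y / (M * R) with hZ
    have hcond : ∀ p q, M * (R * (p * q)) ≤ Y ↔ p * q ≤ Z := by
      intro p q
      rw [hZ, Nat.le_div_iff_mul_le (Nat.mul_pos hM hRpos)]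
      rw [show M * (R * (p * q)) = p * q * (M * R) by ring]
    set E1 := univ.filter (fun e : EE (Fin L) => e ≠ ⟨(i, j), hij⟩ ∧ (e.1.1 = i ∨ e.1.2 = i)) with hE1
    set E2 := univ.filter (fun e : EE (Fin L) => e ≠ ⟨(i, j), hij⟩ ∧ ¬ (e.1.1 = i ∨ e.1.2 = i)) with hE2
    set α : ℕ → ℝ := fun p => ∏ e ∈ E1, g e ((Function.update t i p) e.1.1) ((Function.update t i p) e.1.2) with hα
    set β : ℕ → ℝ := fun q => ∏ e ∈ E2, g e ((Function.update t j q) e.1.1) ((Function.update t j q) e.1.2) with hβ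
    have hfac : ∀ p ∈ S, ∀ q ∈ S, ∏ e : EE (Fin L), g e ((Function.update (Function.update t i p) j q) e.1.1) ((Function.update (Function.update t i p) j q) e.1.2)
        = α p * β q * jacobiSym q p := by
      intro p hp q hq
      rw [← mul_prod_erase univ _ (mem_univ (⟨(i, j), hij⟩ : EE (Fin L)))]
      have h0 : g ⟨(i, j), hij⟩ ((Function.update (Function.update t i p) j q) i) ((Function.update (Function.update t i p) j q) j) = jacobiSym q p := by
        rw [Function.update_of_ne hij', Function.update_self, Function.update_self]; exact hg0 p hp q hq
      have h1 : ∏ e ∈ univ.erase (⟨(i, j), hij⟩ : EE (Fin L)), g e ((Function.update (Function.update t i p) j q) e.1.1) ((Function.update (Function.update t i p) j q) e.1.2)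
          = α p * β q := by
        rw [← prod_filter_mul_prod_filter_not _ (fun e : EE (Fin L) => e.1.1 = i ∨ e.1.2 = i)]
        have f1 : (univ.erase (⟨(i, j), hij⟩ : EE (Fin L))).filter (fun e : EE (Fin L) => e.1.1 = i ∨ e.1.2 = i) = E1 := by
          ext e; simp [hE1]
        have f2 : (univ.erase (⟨(i, j), hij⟩ : EE (Fin L))).filter (fun e : EE (Fin L) => ¬ (e.1.1 = i ∨ e.1.2 = i)) = E2 := by
          ext e; simp [hE2]
        rw [f1, f2]
        congr 1
        · apply prod_congr rfl
          intro e he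
          rw [hE1, mem_filter] at he
          obtain ⟨_, hne, hor⟩ := he
          obtain ⟨⟨a, b⟩, hab⟩ := e
          have hab' : a < b := hab
          have hij2 : i < j := hij
          simp only at hor
          have ha : a ≠ j := by
            rintro rfl
            rcases hor with h | h
            · exact hij' h.symm
            · subst h; exact absurd hij2 (not_lt.mpr hab'.le)
          have hb : b ≠ j := by
            rintro rfl
            rcases hor with h | h
            · subst h; exact hne rfl
            · exact hij' h.symm
          simp only [Function.update_of_ne ha, Function.update_of_ne hb]
        · apply prod_congr rfl
          intro e he
          rw [hE2, mem_filter] at he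
          obtain ⟨_, hne, hor⟩ := he
          push Not at hor
          rw [Function.update_comm hij', Function.update_of_ne hor.1, Function.update_of_ne hor.2]
      rw [h1]
      show g ⟨(i, j), hij⟩ ((Function.update (Function.update t i p) j q) i) ((Function.update (Function.update t i p) j q) j) * (α p * β q) = _
      rw [h0]; ring
    have hsum : (∑ p ∈ S, ∑ q ∈ S,
      if M * ∏ k, (Function.update (Function.update t i p) j q) k ≤ Y then
        c (cl ∘ (Function.update (Function.update t i p) j q)) * ∏ e : EE (Fin L), g e ((Function.update (Function.update t i p) j q) e.1.1) ((Function.update (Function.update t i p) j q) e.1.2) else 0)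
      = ∑ p ∈ S, ∑ q ∈ S, if p * q ≤ Z then (fun k k' => c (Function.update (Function.update (cl ∘ t) i k) j k')) (cl p) (cl q) * (α p * β q * jacobiSym q p) else 0 := by
      apply sum_congr rfl; intro p hp
      apply sum_congr rfl; intro q hq
      rw [hprod, hfac p hp q hq, Function.comp_update, Function.comp_update]
      by_cases h : p * q ≤ Z
      · rw [if_pos h, if_pos ((hcond p q).mpr h)]
      · rw [if_neg h, if_neg (fun h' => h ((hcond p q).mp h'))]
    rw [hsum]
    refine (hyper_cl cl (fun k k' => c (Function.update (Function.update (cl ∘ t) i k) j k')) (fun _ _ => hc _) S S κ hκ hS hS α β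
      (fun p => abs_prod_le_one _ _ fun _ _ => hg _ _ _) (fun p => abs_prod_le_one _ _ fun _ _ => hg _ _ _) Z).trans ?_
    have hRpos' : (0:ℝ) < R := by exact_mod_cast hRpos
    have z1 : (Z:ℝ) ≤ Y / M * (1 / R) := by
      have := @Nat.cast_div_le ℝ _ _ _ Y (M * R)
      refine this.trans (le_of_eq ?_)
      push_cast; field_simp
    have z2 : Real.log Z ≤ Real.log Y := by
      rcases Nat.eq_zero_or_pos Z with h | h
      · rw [h]; simpa using hl
      · apply Real.log_le_log (by exact_mod_cast h)
        exact_mod_cast Nat.div_le_self _ _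
    have z3 : 0 ≤ Real.log Z := Real.log_natCast_nonneg Z
    have z4 : ∏ k, (1:ℝ) / t k = 1 / R := by rw [hR]; push_cast; rw [prod_div_distrib]; simp
    rw [z4]
    have z5 : (Z:ℝ) * (Real.log Z + 1) / κ ≤ (Y / M * (Real.log Y + 1) / κ) * (1 / R) := by
      calc (Z:ℝ) * (Real.log Z + 1) / κ ≤ (Y / M * (1 / R)) * (Real.log Y + 1) / κ := by gcongr
        _ = _ := by ring
    calc (Fintype.card K:ℝ) ^ 2 * (13 * ((Z:ℝ) * (Real.log Z + 1) / κ))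
        ≤ (Fintype.card K:ℝ) ^ 2 * (13 * ((Y / M * (Real.log Y + 1) / κ) * (1 / R))) := by gcongr
      _ = _ := by ring
  refine (abs_sum_le_sum_abs _ _).trans ((sum_le_sum inner).trans ?_)
  rw [← mul_sum]
  apply mul_le_mul_of_nonneg_left _ (by positivity)
  have := (Finset.prod_univ_sum S' (fun _ p => (1:ℝ) / p)).symm
  rw [this]
  calc ∏ k, ∑ p ∈ S' k, (1:ℝ) / p ≤ ∏ k : Fin L, H := by
        apply prod_le_prod
        · intro k _; apply sum_nonneg; intro p _; positivity
        · intro k _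
          by_cases h1 : k = j
          · subst h1; simp [hS', hH1]
          by_cases h2 : k = i
          · subst h2; simp [hS', hij', hH1]
          · simp only [hS', Function.update_of_ne h1, Function.update_of_ne h2]; exact hH
    _ = H ^ L := by simp

end FR

namespace FR
open Finset

/-- additive symbol of `(q/p)` -/
noncomputable def ls (p q : ℕ) : ZMod 2 := if jacobiSym q p = -1 then 1 else 0

lemma jac_ne {p q : ℕ} (hp : p.Prime) (hq : q.Prime) (h : p ≠ q) : jacobiSym q p ≠ 0 := by
  apply jacobiSym.ne_zero
  rw [Int.gcd_natCast_natCast]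
  exact (Nat.coprime_primes hq hp).mpr h.symm

lemma chi_ls {p q : ℕ} (hp : p.Prime) (hq : q.Prime) (h : p ≠ q) : chi (ls p q) = jacobiSym q p := by
  have := jac_ne hp hq h
  rcases jacobiSym.trichotomy q p with h1 | h1 | h1
  · exact absurd h1 this
  · simp [ls, h1, chi]
  · simp [ls, h1, chi]

lemma jac_self {p : ℕ} (hp : p.Prime) : jacobiSym p p = 0 := by
  rw [jacobiSym.eq_zero_iff]
  exact ⟨hp.ne_zero, by simp [hp.ne_one]⟩

lemma chi_mul_prod {E : Type} [Fintype E] (w s : E → ZMod 2) :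
    chi (∑ e, w e * s e) = ∏ e, if w e = 0 then 1 else chi (s e) := by
  rw [chi_sum]
  apply prod_congr rfl
  intro e _
  rcases zcases (w e) with h | h <;> simp [h, chi_zero]

noncomputable def fhat {E : Type} [Fintype E] [DecidableEq E] (F : (E → ZMod 2) → ℝ) (w : E → ZMod 2) : ℝ :=
  (∑ s, F s * chi (∑ e, w e * s e)) / 2 ^ Fintype.card E

lemma card_fun {E : Type} [Fintype E] [DecidableEq E] : ((univ : Finset (E → ZMod 2)).card : ℝ) = 2 ^ Fintype.card E := by
  rw [card_univ, Fintype.card_fun, ZMod.card]; push_cast; rfl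

lemma fhat_abs {E : Type} [Fintype E] [DecidableEq E] (F : (E → ZMod 2) → ℝ) (hF : ∀ s, |F s| ≤ 1) (w : E → ZMod 2) :
    |fhat F w| ≤ 1 := by
  unfold fhat
  rw [abs_div, abs_of_pos (show (0:ℝ) < 2 ^ Fintype.card E by positivity), div_le_one (by positivity)]
  refine (abs_sum_le_sum_abs _ _).trans ?_
  calc ∑ s, |F s * chi (∑ e, w e * s e)| ≤ ∑ s : E → ZMod 2, (1:ℝ) := by
        apply sum_le_sum; intro s _; rw [abs_mul, chi_abs, mul_one]; exact hF s
    _ = _ := by rw [sum_const, nsmul_eq_mul, mul_one, card_fun]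

lemma fhat_inv {E : Type} [Fintype E] [DecidableEq E] (F : (E → ZMod 2) → ℝ) (s : E → ZMod 2) :
    F s = ∑ w, fhat F w * chi (∑ e, w e * s e) := by
  have h : ∀ s' : E → ZMod 2, ∑ w : E → ZMod 2, chi (∑ e, w e * s' e) * chi (∑ e, w e * s e)
      = if s' = s then 2 ^ Fintype.card E else 0 := by
    intro s'
    have := chi_orth (fun e => s' e + s e)
    have e1 : ∀ w : E → ZMod 2, chi (∑ e, w e * s' e) * chi (∑ e, w e * s e) = chi (∑ e, w e * (s' e + s e)) := by
      intro w; rw [← chi_add, ← sum_add_distrib]; simp only [mul_add]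
    simp only [e1]
    rw [this]
    congr 1
    rw [funext_iff, funext_iff, eq_iff_iff]
    refine forall_congr' fun e => ?_
    simp only [Pi.zero_apply]
    generalize s' e = a; generalize s e = b
    revert a b; decide
  unfold fhat
  simp only [div_mul_eq_mul_div, ← sum_div, sum_mul]
  rw [sum_comm]
  simp only [mul_assoc, ← mul_sum, h]
  simp

lemma equid {L : ℕ} (S : Finset ℕ) (κ : ℝ) (hκ : 2 ≤ κ) (hS : ∀ p ∈ S, p.Prime ∧ κ ^ 12 ≤ p) (M Y : ℕ) (hM : 1 ≤ M)
    {K : Type*} [Fintype K] (cl : ℕ → K) (F : (Fin L → K) → (EE (Fin L) → ZMod 2) → ℝ) (hF : ∀ k s, |F k s| ≤ 1)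
    (H : ℝ) (hH1 : 1 ≤ H) (hH : ∑ p ∈ S, (1:ℝ) / p ≤ H) :
    |∑ t ∈ Fintype.piFinset (fun _ : Fin L => S), if M * ∏ k, t k ≤ Y ∧ Function.Injective t then
        F (cl ∘ t) (fun e => ls (t e.1.1) (t e.1.2)) - (∑ s, F (cl ∘ t) s) / 2 ^ Fintype.card (EE (Fin L)) else 0|
      ≤ 2 ^ Fintype.card (EE (Fin L)) * ((Fintype.card K : ℝ) ^ 2 * (13 * (Y / M * (Real.log Y + 1) / κ)) * H ^ L) := by
  set B := (Fintype.card K : ℝ) ^ 2 * (13 * (Y / M * (Real.log Y + 1) / κ)) * H ^ L with hB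
  set g : (EE (Fin L) → ZMod 2) → EE (Fin L) → ℕ → ℕ → ℝ := fun w e a b =>
    if a = b then 0 else if w e = 0 then 1 else jacobiSym b a with hg
  have key : ∀ t ∈ Fintype.piFinset (fun _ : Fin L => S),
      (if M * ∏ k, t k ≤ Y ∧ Function.Injective t then
        F (cl ∘ t) (fun e => ls (t e.1.1) (t e.1.2)) - (∑ s, F (cl ∘ t) s) / 2 ^ Fintype.card (EE (Fin L)) else 0)
      = ∑ w ∈ univ.erase (0 : EE (Fin L) → ZMod 2), if M * ∏ k, t k ≤ Y then
          fhat (F (cl ∘ t)) w * ∏ e, g w e (t e.1.1) (t e.1.2) else 0 := by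
    intro t ht
    rw [Fintype.mem_piFinset] at ht
    by_cases h1 : M * ∏ k, t k ≤ Y
    swap
    · simp [h1]
    simp only [h1, true_and, if_true]
    by_cases h2 : Function.Injective t
    · rw [if_pos h2]
      have hne : ∀ e : EE (Fin L), t e.1.1 ≠ t e.1.2 := fun e h => (ne_of_lt e.2) (h2 h)
      have hprod : ∀ w : EE (Fin L) → ZMod 2, ∏ e, g w e (t e.1.1) (t e.1.2) = chi (∑ e, w e * ls (t e.1.1) (t e.1.2)) := by
        intro w
        rw [chi_mul_prod]
        apply prod_congr rfl
        intro e _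
        simp only [hg, if_neg (hne e)]
        rw [chi_ls (hS _ (ht _)).1 (hS _ (ht _)).1 (hne e)]
      simp only [hprod]
      rw [fhat_inv (F (cl ∘ t)) (fun e => ls (t e.1.1) (t e.1.2)), ← add_sum_erase univ _ (mem_univ (0 : EE (Fin L) → ZMod 2))]
      have : fhat (F (cl ∘ t)) 0 = (∑ s, F (cl ∘ t) s) / 2 ^ Fintype.card (EE (Fin L)) := by
        simp [fhat, chi_zero]
      rw [this]; simp [chi_zero]
    · rw [if_neg h2]
      symm
      apply sum_eq_zero
      intro w _
      simp only [Function.Injective] at h2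
      push Not at h2
      obtain ⟨i, j, hij, hne⟩ := h2
      have : ∃ e : EE (Fin L), t e.1.1 = t e.1.2 := by
        rcases lt_or_gt_of_ne hne with h | h
        · exact ⟨⟨(i, j), h⟩, hij⟩
        · exact ⟨⟨(j, i), h⟩, hij.symm⟩
      obtain ⟨e, he⟩ := this
      rw [prod_eq_zero (mem_univ e), mul_zero]
      simp only [hg, if_pos he]
  rw [sum_congr rfl key, sum_comm]
  refine (abs_sum_le_sum_abs _ _).trans ?_
  calc _ ≤ ∑ w ∈ univ.erase (0 : EE (Fin L) → ZMod 2), B := by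
        apply sum_le_sum
        intro w hw
        have hw0 : w ≠ 0 := ne_of_mem_erase hw
        obtain ⟨e0, he0⟩ := Function.ne_iff.mp hw0
        refine tuple_bound S κ hκ hS M Y hM cl (fun k => fhat (F k) w) (fun k => fhat_abs _ (hF k) _) (g w) ?_ e0 ?_ H hH1 hH
        · intro e a b
          simp only [hg]
          split_ifs
          · simp
          · simp
          · exact jac_abs _ _
        · intro p hp q hq
          simp only [hg]
          by_cases hpq : p = q
          · subst hpq; rw [if_pos rfl, jac_self (hS p hp).1]; simp
          · rw [if_neg hpq, if_neg (show ¬ w e0 = 0 from he0)]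
    _ ≤ _ := by
        rw [sum_const, nsmul_eq_mul]
        have hB0 : 0 ≤ B := by
          have := Real.log_natCast_nonneg Y
          positivity
        apply mul_le_mul_of_nonneg_right _ hB0
        rw [← card_fun]
        exact_mod_cast card_le_card (subset_univ _)

end FR

namespace FR
open Finset

noncomputable def vv (p : ℕ) : ZMod 2 := if p % 4 = 3 then 1 else 0

def Bcond (d B : ℕ) : Prop := ∀ p : ℕ, p.Prime → p ∣ d →
  (p ∣ d / B → jacobiSym B p = 1) ∧ (p ∣ B → jacobiSym (-((d / B : ℕ) : ℤ)) p = 1)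

noncomputable def RR (d : ℕ) : ℕ := (d.divisors.filter (fun B => Bcond d B)).card

lemma chi_inj {a b : ZMod 2} : chi a = chi b ↔ a = b := by
  rcases zcases a with h | h <;> rcases zcases b with h' | h' <;> simp [h, h', chi_zero, chi_one] <;> norm_num

lemma chi_vv {p : ℕ} (hp : p % 2 = 1) : chi (vv p) = jacobiSym (-1) p := by
  rw [jacobiSym.at_neg_one (Nat.odd_iff.mpr hp)]
  have : p % 4 = 1 ∨ p % 4 = 3 := by omega
  rcases this with h | h
  · rw [ZMod.χ₄_nat_one_mod_four h]; simp [vv, h, chi_zero]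
  · rw [ZMod.χ₄_nat_three_mod_four h]; simp [vv, h, chi_one]

lemma jac_prod {ι : Type} (s : Finset ι) (P : ι → ℕ) (n : ℕ) :
    jacobiSym ((∏ j ∈ s, P j : ℕ) : ℤ) n = ∏ j ∈ s, jacobiSym (P j) n := by
  induction s using Finset.induction_on with
  | empty => simp
  | insert a s ha ih => rw [prod_insert ha, prod_insert ha, ← ih, Nat.cast_mul, jacobiSym.mul_left]

lemma chi_sum_ls {ι : Type} (s : Finset ι) (P : ι → ℕ) (p : ℕ) (hp : p.Prime) (hP : ∀ j ∈ s, (P j).Prime ∧ p ≠ P j) :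
    chi (∑ j ∈ s, ls p (P j)) = jacobiSym ((∏ j ∈ s, P j : ℕ) : ℤ) p := by
  rw [jac_prod, chi_sum]
  push_cast
  apply prod_congr rfl
  intro j hj
  exact chi_ls hp (hP j hj).1 (hP j hj).2

lemma ker_eq_RR {ι : Type} [Fintype ι] (P : ι → ℕ) (hP : Function.Injective P) (hp : ∀ i, (P i).Prime ∧ P i ≠ 2)
    (a : ι → ι → ZMod 2) (ha : ∀ i j, i ≠ j → a i j = ls (P i) (P j)) :
    Nat.card (kerM (fun i => vv (P i)) a) = RR (∏ i, P i) := by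
  set d := ∏ i, P i with hd
  have hd0 : 0 < d := prod_pos fun i _ => (hp i).1.pos
  have hdvd : ∀ (s : Finset ι) (p : ℕ), p.Prime → (p ∣ ∏ i ∈ s, P i ↔ ∃ i ∈ s, p = P i) := by
    intro s p hpp
    rw [hpp.prime.dvd_finset_prod_iff]
    constructor
    · rintro ⟨i, hi, h⟩; exact ⟨i, hi, (Nat.prime_dvd_prime_iff_eq hpp (hp i).1).mp h⟩
    · rintro ⟨i, hi, h⟩; exact ⟨i, hi, h ▸ dvd_rfl⟩
  have hsplit : ∀ s : Finset ι, (∏ i ∈ s, P i) * ∏ i ∈ sᶜ, P i = d := fun s => prod_mul_prod_compl s P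
  have hspos : ∀ s : Finset ι, 0 < ∏ i ∈ s, P i := fun s => prod_pos fun i _ => (hp i).1.pos
  have hdiv : ∀ s : Finset ι, d / (∏ i ∈ s, P i) = ∏ i ∈ sᶜ, P i := fun s => by
    rw [← hsplit s, Nat.mul_div_cancel_left _ (hspos s)]
  have hrow : ∀ x : ι → ZMod 2, ∀ i, row (fun i => vv (P i)) a x i = 0 ↔
      if x i = 0 then jacobiSym ((∏ j ∈ univ.filter (fun j => x j = 1), P j : ℕ) : ℤ) (P i) = 1
      else jacobiSym (-((∏ j ∈ univ.filter (fun j => x j = 0), P j : ℕ) : ℤ)) (P i) = 1 := by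
    intro x i
    have e1 : ∀ s : Finset ι, i ∉ s → (∑ j ∈ s, a i j) = ∑ j ∈ s, ls (P i) (P j) := fun s hs =>
      sum_congr rfl fun j hj => ha i j (fun h => hs (h ▸ hj))
    have e2 : ∀ s : Finset ι, i ∉ s → chi (∑ j ∈ s, a i j) = jacobiSym ((∏ j ∈ s, P j : ℕ) : ℤ) (P i) := fun s hs => by
      rw [e1 s hs]
      exact chi_sum_ls s P (P i) (hp i).1 fun j hj => ⟨(hp j).1, fun h => hs (hP h ▸ hj)⟩
    rcases zcases (x i) with h | h
    · rw [if_pos h]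
      have : row (fun i => vv (P i)) a x i = ∑ j ∈ univ.filter (fun j => x j = 1), a i j := by
        rw [row, h, sum_filter]
        simp only [zero_add, mul_zero, add_zero]
        apply sum_congr rfl; intro j _
        rcases zcases (x j) with h' | h' <;> simp [h']
      rw [this, ← chi_inj, e2 _ (by simp [h]), chi_zero]; norm_cast
    · rw [if_neg (by simp [h])]
      have : row (fun i => vv (P i)) a x i = (∑ j ∈ univ.filter (fun j => x j = 0), a i j) + vv (P i) := by
        rw [row, h, sum_filter]
        simp only [mul_one]
        congr 1
        apply sum_congr rfl; intro j _
        rcases zcases (x j) with h' | h' <;> simp [h', zadd_self]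
      have hneg : (-((∏ j ∈ univ.filter (fun j => x j = 0), P j : ℕ) : ℤ)) = (-1) * ((∏ j ∈ univ.filter (fun j => x j = 0), P j : ℕ) : ℤ) := by ring
      rw [hneg, jacobiSym.mul_left, this, ← chi_inj, chi_add, e2 _ (by simp [h]), chi_vv ((hp i).1.eq_two_or_odd.resolve_left (hp i).2), chi_zero,
        mul_comm]
      exact_mod_cast Iff.rfl
  unfold RR
  have hc : Nat.card (kerM (fun i => vv (P i)) a) = (univ.filter (fun x => x ∈ kerM (fun i => vv (P i)) a)).card := by
    rw [← Fintype.card_subtype, Nat.card_eq_fintype_card]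
  have hcompl : ∀ x : ι → ZMod 2, (univ.filter (fun j => x j = 1))ᶜ = univ.filter (fun j => x j = 0) := by
    intro x; ext j
    rcases zcases (x j) with h' | h' <;> simp [h']
  have hB : ∀ x : ι → ZMod 2, Bcond d (∏ j ∈ univ.filter (fun j => x j = 1), P j) ↔ x ∈ kerM (fun i => vv (P i)) a := by
    intro x
    have hm : x ∈ kerM (fun i => vv (P i)) a ↔ ∀ i, row (fun i => vv (P i)) a x i = 0 := Iff.rfl
    rw [hm]
    simp only [hrow]
    unfold Bcond
    simp only [hdiv, hcompl]
    constructor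
    · intro h i
      have := h (P i) (hp i).1 ((hdvd univ _ (hp i).1).mpr ⟨i, mem_univ _, rfl⟩)
      rcases zcases (x i) with h' | h'
      · rw [if_pos h']
        exact this.1 ((hdvd _ _ (hp i).1).mpr ⟨i, by simp [h'], rfl⟩)
      · rw [if_neg (by simp [h'])]
        exact this.2 ((hdvd _ _ (hp i).1).mpr ⟨i, by simp [h'], rfl⟩)
    · intro h p hpp _
      constructor
      · intro h1
        obtain ⟨i, hi, rfl⟩ := (hdvd _ _ hpp).mp h1
        have := h i
        rw [if_pos (by simpa using hi)] at this
        exact this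
      · intro h1
        obtain ⟨i, hi, rfl⟩ := (hdvd _ _ hpp).mp h1
        have := h i
        have hi' : x i = 1 := by simpa using hi
        rw [if_neg (by simp [hi'])] at this
        exact this
  rw [hc]
  refine card_bij (fun x _ => ∏ j ∈ univ.filter (fun j => x j = 1), P j) ?_ ?_ ?_
  · intro x hx
    rw [mem_filter, Nat.mem_divisors]
    refine ⟨⟨⟨_, (hsplit _).symm⟩, hd0.ne'⟩, (hB x).mpr (by simpa using hx)⟩
  · intro x _ y _ hxy
    have hxy' : ∏ j ∈ univ.filter (fun j => x j = 1), P j = ∏ j ∈ univ.filter (fun j => y j = 1), P j := hxy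
    ext i
    have hi : x i = 1 ↔ y i = 1 := by
      have h1 := hdvd (univ.filter (fun j => x j = 1)) (P i) (hp i).1
      have h2 := hdvd (univ.filter (fun j => y j = 1)) (P i) (hp i).1
      rw [hxy', h2] at h1
      have f : ∀ z : ι → ZMod 2, (∃ k ∈ univ.filter (fun j => z j = 1), P i = P k) ↔ z i = 1 := by
        intro z
        constructor
        · rintro ⟨k, hk, h⟩; rw [hP h]; simpa using hk
        · intro h; exact ⟨i, by simpa using h, rfl⟩
      rw [f, f] at h1; exact h1.symm
    have : x i = y i := by
      rcases zcases (x i) with h | h <;> rcases zcases (y i) with h' | h' <;> simp_all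
    rw [this]
  · intro B hBm
    rw [mem_filter, Nat.mem_divisors] at hBm
    obtain ⟨⟨hBd, _⟩, hBc⟩ := hBm
    have hprodB : ∏ j ∈ univ.filter (fun j => P j ∣ B), P j = B := by
      apply Nat.dvd_antisymm
      · apply Finset.prod_dvd_of_isRelPrime
        · intro i _ j _ hij
          rw [Function.onFun, ← Nat.coprime_iff_isRelPrime, Nat.coprime_primes (hp i).1 (hp j).1]
          exact fun h => hij (hP h)
        · intro i hi; simpa using hi
      · have : B ∣ (∏ j ∈ univ.filter (fun j => P j ∣ B), P j) * ∏ j ∈ (univ.filter (fun j => P j ∣ B))ᶜ, P j := by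
          rw [hsplit]; exact hBd
        refine Nat.Coprime.dvd_of_dvd_mul_right ?_ this
        apply Nat.Coprime.prod_right
        intro j hj
        rw [Nat.coprime_comm, (hp j).1.coprime_iff_not_dvd]
        simpa using hj
    have hf : univ.filter (fun j => (if P j ∣ B then (1 : ZMod 2) else 0) = 1) = univ.filter (fun j => P j ∣ B) := by
      ext j; by_cases h : P j ∣ B <;> simp [h]
    refine ⟨fun i => if P i ∣ B then 1 else 0, ?_, ?_⟩
    · rw [mem_filter]
      refine ⟨mem_univ _, (hB _).mp ?_⟩
      rw [hf, hprodB]; exact hBc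
    · simp only [hf, hprodB]

end FR

namespace FR
open Finset

lemma recip {p q : ℕ} (hp : p.Prime) (hq : q.Prime) (hp2 : p ≠ 2) (hq2 : q ≠ 2) (h : p ≠ q) :
    ls p q + ls q p = vv p * vv q := by
  have hpo := hp.eq_two_or_odd.resolve_left hp2
  have hqo := hq.eq_two_or_odd.resolve_left hq2
  have hr := jacobiSym.quadratic_reciprocity_if hpo hqo
  have h1 := jac_ne hp hq h
  have h2 := jac_ne hq hp h.symm
  rcases (jacobiSym.trichotomy q p).resolve_left h1 with e1 | e1 <;>
  rcases (jacobiSym.trichotomy p q).resolve_left h2 with e2 | e2 <;>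
  by_cases c1 : p % 4 = 3 <;> by_cases c2 : q % 4 = 3 <;>
  simp [e1, e2, c1, c2, ls, vv] at hr ⊢ <;> decide

lemma vv_prod {ι : Type} (s : Finset ι) (P : ι → ℕ) (hP : ∀ i ∈ s, P i % 2 = 1) :
    (∏ i ∈ s, P i) % 2 = 1 ∧ vv (∏ i ∈ s, P i) = ∑ i ∈ s, vv (P i) := by
  induction s using Finset.induction_on with
  | empty => simp [vv]
  | insert a s ha ih =>
    obtain ⟨h1, h2⟩ := ih (fun i hi => hP i (mem_insert_of_mem hi))
    have h3 := hP a (mem_insert_self _ _)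
    rw [prod_insert ha, sum_insert ha, ← h2]
    generalize P a = x at *
    generalize (∏ i ∈ s, P i) = y at *
    refine ⟨by rw [Nat.mul_mod, h3, h1], ?_⟩
    have hx : x % 4 = 1 ∨ x % 4 = 3 := by omega
    have hy : y % 4 = 1 ∨ y % 4 = 3 := by omega
    unfold vv
    rw [Nat.mul_mod]
    rcases hx with hx | hx <;> rcases hy with hy | hy <;> simp [hx, hy]; decide

def Adm (d : ℕ) : Prop := Squarefree d ∧ d % 4 = 3 ∧ ∀ p : ℕ, p.Prime → p ∣ d → jacobiSym 2 p = 1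

def good (C T d : ℕ) : Prop :=
  2 * (d.primeFactors.filter (fun p => p ≤ T)).card + C ≤ (d.primeFactors.filter (fun p => T < p ∧ vv p = 1)).card ∧
  ∀ E ⊆ d.primeFactors.filter (fun p => p ≤ T), E.Nonempty → ∀ c : ZMod 2, ∃ p ∈ d.primeFactors, T < p ∧
    ∑ q ∈ E, ls p q + c * vv p ≠ 0

section fiber
variable {m L : ℕ}

abbrev PF (m : ℕ) : Type := {q // q ∈ m.primeFactors}
abbrev KK (m : ℕ) : Type := ZMod 2 × (PF m → ZMod 2 × ZMod 2)

noncomputable def clK (m p : ℕ) : KK m := (vv p, fun q => (ls q p, ls p q))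

noncomputable def vK (k : Fin L → KK m) : PF m ⊕ Fin L → ZMod 2 := Sum.elim (fun q => vv q) (fun i => (k i).1)

noncomputable def aK (k : Fin L → KK m) : PF m ⊕ Fin L → PF m ⊕ Fin L → ZMod 2
  | Sum.inl q, Sum.inl q' => ls q q'
  | Sum.inl q, Sum.inr i => ((k i).2 q).1
  | Sum.inr i, Sum.inl q => ((k i).2 q).2
  | Sum.inr i, Sum.inr j => if j < i then (k i).1 * (k j).1 else 0

def GK (C : ℕ) (k : Fin L → KK m) : Prop :=
  (∀ i j, i ≠ j → aK k i j + aK k j i = vK k i * vK k j) ∧ ∑ i, vK k i = 1 ∧ NT (vK k) (aK k) ∧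
  Fintype.card (PF m) + C ≤ Fintype.card (Fin L) ∧
  Fintype.card (PF m) + Fintype.card {i // vK k i = 0} + C ≤ Fintype.card (Fin L)

noncomputable def FK (r C : ℕ) (k : Fin L → KK m) (s : EE (Fin L) → ZMod 2) : ℝ :=
  if GK C k then (if Nat.card (kerM (vK k) (aK k + symS s)) = 2 ^ r then 1 else 0) else 0

variable {T : ℕ} {t : Fin L → ℕ}

def PP (m : ℕ) (t : Fin L → ℕ) : PF m ⊕ Fin L → ℕ := Sum.elim (fun q => q.1) t

lemma PP_prime (hmT : ∀ q ∈ m.primeFactors, q ≤ T ∧ q ≠ 2) (ht : ∀ i, (t i).Prime ∧ T < t i ∧ t i ≠ 2) (i : PF m ⊕ Fin L) : (PP m t i).Prime ∧ PP m t i ≠ 2 := by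
  rcases i with q | i
  · exact ⟨Nat.prime_of_mem_primeFactors q.2, (hmT q.1 q.2).2⟩
  · exact ⟨(ht i).1, (ht i).2.2⟩

lemma PP_inj (hmT : ∀ q ∈ m.primeFactors, q ≤ T ∧ q ≠ 2) (ht : ∀ i, (t i).Prime ∧ T < t i ∧ t i ≠ 2) (htI : Function.Injective t) : Function.Injective (PP m t) := by
  apply Function.Injective.sumElim
  · exact Subtype.val_injective
  · exact htI
  · intro q i h
    have h1 := (hmT q.1 q.2).1
    have h2 := (ht i).2.1
    have : q.1 = t i := h
    omega

lemma PP_prod (hm : Squarefree m) : ∏ i, PP m t i = m * ∏ i, t i := by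
  rw [Fintype.prod_sum_type]
  congr 1
  exact (Finset.prod_coe_sort m.primeFactors (fun q => q)).trans (Nat.prod_primeFactors_of_squarefree hm)

lemma vK_cl (i : PF m ⊕ Fin L) : vK (clK m ∘ t) i = vv (PP m t i) := by
  rcases i with q | i <;> rfl

lemma aK_cl (hmT : ∀ q ∈ m.primeFactors, q ≤ T ∧ q ≠ 2) (ht : ∀ i, (t i).Prime ∧ T < t i ∧ t i ≠ 2) (htI : Function.Injective t) (i j : PF m ⊕ Fin L) (hij : i ≠ j) :
    (aK (clK m ∘ t) + symS (α := PF m) (fun e : EE (Fin L) => ls (t e.1.1) (t e.1.2))) i j = ls (PP m t i) (PP m t j) := by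
  rw [Pi.add_apply, Pi.add_apply]
  rcases i with q | i <;> rcases j with q' | j
  · simp [aK, symS, PP]
  · simp [aK, symS, PP, clK]
  · simp [aK, symS, PP, clK]
  · have hne : i ≠ j := fun h => hij (by rw [h])
    simp only [aK, symS, PP, Sum.elim_inr, upS, Function.comp, clK]
    rcases lt_or_gt_of_ne hne with h | h
    · simp [h, not_lt.mpr h.le]
    · simp only [h, not_lt.mpr h.le, if_true, dif_pos, dif_neg, not_false_eq_true, zero_add]
      rw [← recip (ht i).1 (ht j).1 (ht i).2.2 (ht j).2.2 (fun e => hne (htI e)), add_assoc, zadd_self, add_zero]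

lemma aK_skew (hmT : ∀ q ∈ m.primeFactors, q ≤ T ∧ q ≠ 2) (ht : ∀ i, (t i).Prime ∧ T < t i ∧ t i ≠ 2) (htI : Function.Injective t) (i j : PF m ⊕ Fin L) (hij : i ≠ j) :
    aK (clK m ∘ t) i j + aK (clK m ∘ t) j i = vK (clK m ∘ t) i * vK (clK m ∘ t) j := by
  have h1 := aK_cl hmT ht htI i j hij
  have h2 := aK_cl hmT ht htI j i hij.symm
  have hP := PP_prime hmT ht
  have h3 := recip (hP i).1 (hP j).1 (hP i).2 (hP j).2 (fun h => hij (PP_inj hmT ht htI h))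
  rw [vK_cl, vK_cl, ← h3, ← h1, ← h2]
  simp only [Pi.add_apply]
  rw [symS_symm _ j i]
  generalize symS (α := PF m) (fun e : EE (Fin L) => ls (t e.1.1) (t e.1.2)) i j = z
  have := zadd_self z
  linear_combination -this

lemma sum_vK (hm : Squarefree m) (hmT : ∀ q ∈ m.primeFactors, q ≤ T ∧ q ≠ 2) (ht : ∀ i, (t i).Prime ∧ T < t i ∧ t i ≠ 2) (htI : Function.Injective t) : (∑ i, vK (clK m ∘ t) i = 1) ↔ (m * ∏ i, t i) % 4 = 3 := by
  have hP := PP_prime hmT ht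
  have := vv_prod univ (PP m t) (fun i _ => (hP i).1.eq_two_or_odd.resolve_left (hP i).2)
  simp only [vK_cl]
  rw [← this.2, PP_prod hm]
  unfold vv
  split_ifs with h <;> simp [h]

lemma pf_prod (hm : Squarefree m) (hmT : ∀ q ∈ m.primeFactors, q ≤ T ∧ q ≠ 2) (ht : ∀ i, (t i).Prime ∧ T < t i ∧ t i ≠ 2) (htI : Function.Injective t) (p : ℕ) : p ∈ (m * ∏ i, t i).primeFactors ↔ p ∈ m.primeFactors ∨ ∃ i, p = t i := by
  have hm0 : m ≠ 0 := hm.ne_zero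
  have ht0 : ∏ i, t i ≠ 0 := prod_ne_zero_iff.mpr fun i _ => (ht i).1.ne_zero
  rw [Nat.primeFactors_mul hm0 ht0, mem_union]
  apply or_congr Iff.rfl
  rw [Nat.mem_primeFactors]
  constructor
  · rintro ⟨hp, hd, _⟩
    obtain ⟨i, _, h⟩ := (hp.prime.dvd_finset_prod_iff t).mp hd
    exact ⟨i, (Nat.prime_dvd_prime_iff_eq hp (ht i).1).mp h⟩
  · rintro ⟨i, rfl⟩
    exact ⟨(ht i).1, dvd_prod_of_mem t (mem_univ i), ht0⟩

lemma GK_of_good (hm : Squarefree m) (hmT : ∀ q ∈ m.primeFactors, q ≤ T ∧ q ≠ 2) (ht : ∀ i, (t i).Prime ∧ T < t i ∧ t i ≠ 2) (htI : Function.Injective t) {C : ℕ} (h4 : (m * ∏ i, t i) % 4 = 3) (hg : good C T (m * ∏ i, t i)) : GK C (clK m ∘ t) := by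
  have hpf := pf_prod hm hmT ht htI
  obtain ⟨hg1, hg2⟩ := hg
  have hsm : (m * ∏ i, t i).primeFactors.filter (fun p => p ≤ T) = m.primeFactors := by
    ext p
    rw [mem_filter, hpf]
    constructor
    · rintro ⟨h | ⟨i, rfl⟩, h2⟩
      · exact h
      · have := (ht i).2.1; omega
    · intro h; exact ⟨Or.inl h, (hmT p h).1⟩
  rw [hsm] at hg1 hg2
  set I1 := univ.filter (fun i : Fin L => vv (t i) = 1) with hI1
  have hlg : (m * ∏ i, t i).primeFactors.filter (fun p => T < p ∧ vv p = 1) = I1.image t := by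
    ext p
    rw [mem_filter, hpf, mem_image]
    constructor
    · rintro ⟨h | ⟨i, rfl⟩, h2⟩
      · have := (hmT p h).1; omega
      · exact ⟨i, by simp [hI1, h2.2], rfl⟩
    · rintro ⟨i, hi, rfl⟩
      exact ⟨Or.inr ⟨i, rfl⟩, (ht i).2.1, by simpa [hI1] using hi⟩
  rw [hlg, card_image_of_injective _ htI] at hg1
  have hL : I1.card ≤ L := by simpa using card_le_univ I1
  have hPF : Fintype.card (PF m) = m.primeFactors.card := Fintype.card_coe _
  refine ⟨fun i j hij => aK_skew hmT ht htI i j hij, (sum_vK hm hmT ht htI).mpr h4, ?_, ?_, ?_⟩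
  · intro e he c
    obtain ⟨q0, hq0⟩ := Function.ne_iff.mp he
    set E := (univ.filter (fun q : PF m => e q = 1)).image (fun q => q.1) with hE
    have hEs : E ⊆ m.primeFactors := by
      intro q hq
      rw [hE, mem_image] at hq
      obtain ⟨q', _, rfl⟩ := hq
      exact q'.2
    have hEn : E.Nonempty := ⟨q0.1, by
      rw [hE]; exact mem_image_of_mem _ (by simpa using (zcases _).resolve_left hq0)⟩
    obtain ⟨p, hp, hpT, hs⟩ := hg2 E hEs hEn c
    rcases (hpf p).mp hp with h | ⟨i, rfl⟩
    · have := (hmT p h).1; omega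
    refine ⟨i, ?_⟩
    have hrfl : vK (clK m ∘ t) (Sum.inr i) = vv (t i) := rfl
    rw [hrfl]
    convert hs using 2
    rw [hE, sum_image (fun a _ b _ h => Subtype.ext h), sum_filter]
    apply sum_congr rfl
    intro q _
    show ls (t i) q.1 * e q = _
    rcases zcases (e q) with h | h <;> simp [h]
  · rw [hPF, Fintype.card_fin]; omega
  · have hz : Fintype.card {i // vK (clK m ∘ t) i = 0} ≤ m.primeFactors.card + (L - I1.card) := by
      rw [Fintype.card_subtype]
      have hsub : (univ.filter (fun i => vK (clK m ∘ t) i = 0)) ⊆ (univ : Finset (PF m)).disjSum (I1ᶜ) := by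
        intro i hi
        rcases i with q | i
        · simp
        · rw [inr_mem_disjSum, mem_compl, hI1]
          simp only [mem_filter, mem_univ, true_and] at hi ⊢
          have : vv (t i) = 0 := hi
          simp [this]
      refine (card_le_card hsub).trans ?_
      rw [card_disjSum, card_univ, hPF, card_compl, Fintype.card_fin]
    rw [hPF, Fintype.card_fin]; omega

lemma FK_cl (hm : Squarefree m) (hmT : ∀ q ∈ m.primeFactors, q ≤ T ∧ q ≠ 2) (ht : ∀ i, (t i).Prime ∧ T < t i ∧ t i ≠ 2) (htI : Function.Injective t) {r C : ℕ} (hG : GK C (clK m ∘ t)) :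
    FK r C (clK m ∘ t) (fun e : EE (Fin L) => ls (t e.1.1) (t e.1.2)) = if RR (m * ∏ i, t i) = 2 ^ r then 1 else 0 := by
  rw [FK, if_pos hG, ← PP_prod hm (t := t), ← ker_eq_RR (PP m t) (PP_inj hmT ht htI) (PP_prime hmT ht) _ (aK_cl hmT ht htI)]
  have : vK (clK m ∘ t) = fun i => vv (PP m t i) := funext vK_cl
  rw [this]

end fiber

end FR

namespace FR
open Finset

lemma sqf_prod {ι : Type} [Fintype ι] (P : ι → ℕ) (hP : Function.Injective P) (hp : ∀ i, (P i).Prime) :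
    Squarefree (∏ i, P i) := by
  apply Finset.squarefree_prod_of_pairwise_isCoprime
  · intro i _ j _ hij
    rw [Function.onFun, ← Nat.coprime_iff_isRelPrime, Nat.coprime_primes (hp i) (hp j)]
    exact fun h => hij (hP h)
  · intro i _; exact (hp i).squarefree

lemma fiber_bound (r C : ℕ) (ε : ℝ) (hε : 0 ≤ ε) (hC : ∀ (α β : Type) [Fintype α] [Fintype β] [DecidableEq α]
    [LinearOrder β] (v : α ⊕ β → ZMod 2) (a : α ⊕ β → α ⊕ β → ZMod 2),
    (∀ i j, i ≠ j → a i j + a j i = v i * v j) → ∑ i, v i = 1 → NT v a →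
    Fintype.card α + C ≤ Fintype.card β →
    Fintype.card α + Fintype.card {i // v i = 0} + C ≤ Fintype.card β →
    |(∑ σ : EE β → ZMod 2, if Nat.card (kerM v (a + symS σ)) = 2 ^ r then (1:ℝ) else 0) / 2 ^ Fintype.card (EE β)
      - piR r| ≤ ε) {L m T : ℕ} (S : Finset ℕ) (κ : ℝ) (hκ : 2 ≤ κ) (hS : ∀ p ∈ S, p.Prime ∧ κ ^ 12 ≤ p)
    (hS' : ∀ p ∈ S, T < p ∧ p ≠ 2 ∧ jacobiSym 2 p = 1) (Y : ℕ)
    (hm : Squarefree m) (hmT : ∀ q ∈ m.primeFactors, q ≤ T ∧ q ≠ 2) (hmJ : ∀ q ∈ m.primeFactors, jacobiSym 2 q = 1)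
    (H : ℝ) (hH1 : 1 ≤ H) (hH : ∑ p ∈ S, (1:ℝ) / p ≤ H) :
    |∑ t ∈ Fintype.piFinset (fun _ : Fin L => S), if m * ∏ k, t k ≤ Y ∧ Function.Injective t ∧ Adm (m * ∏ k, t k) then
        (if RR (m * ∏ k, t k) = 2 ^ r then 1 else 0) - piR r else 0|
      ≤ 2 ^ Fintype.card (EE (Fin L)) * ((Fintype.card (KK m) : ℝ) ^ 2 * (13 * (Y / m * (Real.log Y + 1) / κ)) * H ^ L)
       + ∑ t ∈ Fintype.piFinset (fun _ : Fin L => S), if m * ∏ k, t k ≤ Y ∧ Function.Injective t ∧ Adm (m * ∏ k, t k) then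
        ε + (if good C T (m * ∏ k, t k) then 0 else 1 + |piR r|) else 0 := by
  have hm1 : 1 ≤ m := Nat.pos_of_ne_zero hm.ne_zero
  have hE := equid S κ hκ hS m Y hm1 (clK m) (FK (L := L) (m := m) r C) (by
    intro k s; unfold FK; split_ifs <;> simp) H hH1 hH
  set X : (Fin L → ℕ) → ℝ := fun t => if m * ∏ k, t k ≤ Y ∧ Function.Injective t ∧ Adm (m * ∏ k, t k) then
        (if RR (m * ∏ k, t k) = 2 ^ r then 1 else 0) - piR r else 0 with hX
  set Z : (Fin L → ℕ) → ℝ := fun t => if m * ∏ k, t k ≤ Y ∧ Function.Injective t then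
        FK r C (clK m ∘ t) (fun e => ls (t e.1.1) (t e.1.2)) - (∑ s, FK r C (clK m ∘ t) s) / 2 ^ Fintype.card (EE (Fin L)) else 0 with hZ
  set W : (Fin L → ℕ) → ℝ := fun t => if m * ∏ k, t k ≤ Y ∧ Function.Injective t ∧ Adm (m * ∏ k, t k) then
        ε + (if good C T (m * ∏ k, t k) then 0 else 1 + |piR r|) else 0 with hW
  have key : ∀ t ∈ Fintype.piFinset (fun _ : Fin L => S), |X t - Z t| ≤ W t := by
    intro t htm
    rw [Fintype.mem_piFinset] at htm
    have ht : ∀ i, (t i).Prime ∧ T < t i ∧ t i ≠ 2 := fun i =>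
      ⟨(hS _ (htm i)).1, (hS' _ (htm i)).1, (hS' _ (htm i)).2.1⟩
    simp only [hX, hZ, hW]
    by_cases h1 : m * ∏ k, t k ≤ Y
    swap
    · simp [h1]
    by_cases h2 : Function.Injective t
    swap
    · simp [h2]
    simp only [h1, h2, true_and, if_true]
    have hpf := pf_prod hm hmT ht h2
    have hAdm : (m * ∏ k, t k) % 4 = 3 → Adm (m * ∏ k, t k) := by
      intro h4
      have hsq : Squarefree (m * ∏ k, t k) := by
        rw [← PP_prod hm (t := t)]
        exact sqf_prod _ (PP_inj hmT ht h2) (fun i => (PP_prime hmT ht i).1)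
      refine ⟨hsq, h4, ?_⟩
      intro p hp hpd
      rcases (hpf p).mp (Nat.mem_primeFactors.mpr ⟨hp, hpd, hsq.ne_zero⟩) with h | ⟨i, rfl⟩
      · exact hmJ p h
      · exact (hS' _ (htm i)).2.2
    have hb : ∀ P : Prop, 0 ≤ if P then (0:ℝ) else 1 + |piR r| := by
      intro P; split_ifs <;> positivity
    by_cases hG : GK C (clK m ∘ t)
    · have hA := hAdm ((sum_vK hm hmT ht h2).mp hG.2.1)
      rw [FK_cl hm hmT ht h2 hG, if_pos hA, if_pos hA]
      have := hC (PF m) (Fin L) (vK (clK m ∘ t)) (aK (clK m ∘ t)) hG.1 hG.2.1 hG.2.2.1 hG.2.2.2.1 hG.2.2.2.2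
      simp only [FK, if_pos hG]
      have e : ∀ x y z : ℝ, x - y - (x - z) = z - y := by intros; ring
      rw [e]
      exact this.trans (le_add_of_nonneg_right (hb _))
    · have h0 : ∀ s, FK r C (clK m ∘ t) s = 0 := fun s => by rw [FK, if_neg hG]
      simp only [h0, sum_const_zero, zero_div, sub_zero]
      by_cases hA : Adm (m * ∏ k, t k)
      · rw [if_pos hA, if_pos hA, if_neg (fun hg => hG (GK_of_good hm hmT ht h2 hA.2.1 hg))]
        refine (abs_sub _ _).trans ?_
        have : |(if RR (m * ∏ k, t k) = 2 ^ r then (1:ℝ) else 0)| ≤ 1 := by split_ifs <;> simp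
        linarith
      · rw [if_neg hA, if_neg hA]; simp
  have e1 : ∑ t ∈ Fintype.piFinset (fun _ : Fin L => S), X t = ∑ t ∈ Fintype.piFinset (fun _ : Fin L => S), Z t +
    ∑ t ∈ Fintype.piFinset (fun _ : Fin L => S), (X t - Z t) := by rw [← sum_add_distrib]; simp
  rw [e1]
  refine (abs_add_le _ _).trans (add_le_add hE ?_)
  exact (abs_sum_le_sum_abs _ _).trans (sum_le_sum key)

lemma tuples_sum {L : ℕ} (S : Finset ℕ) (f : Finset ℕ → ℝ) :
    ∑ t ∈ Fintype.piFinset (fun _ : Fin L => S), (if Function.Injective t then f (univ.image t) else 0)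
      = (L.factorial : ℝ) * ∑ s ∈ S.powersetCard L, f s := by
  rw [← sum_filter]
  rw [← sum_fiberwise_of_maps_to (t := S.powersetCard L) (g := fun t : Fin L → ℕ => univ.image t)]
  · rw [mul_sum]
    apply sum_congr rfl
    intro s hs
    rw [mem_powersetCard] at hs
    rw [sum_congr rfl (g := fun _ => f s), sum_const, nsmul_eq_mul]
    · congr 2
      have hcard : Fintype.card (Fin L ≃ s) = L.factorial := by
        rw [Fintype.card_equiv (Fintype.equivOfCardEq (by simp [hs.2]))]; simp
      rw [← hcard, ← card_univ]
      symm
      refine card_bij (fun e _ i => (e i).1) ?_ ?_ ?_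
      · intro e _
        rw [mem_filter, mem_filter, Fintype.mem_piFinset]
        refine ⟨⟨fun i => hs.1 (e i).2, fun i j h => e.injective (Subtype.ext h)⟩, ?_⟩
        ext x
        rw [mem_image]
        constructor
        · rintro ⟨i, _, rfl⟩; exact (e i).2
        · intro hx; exact ⟨e.symm ⟨x, hx⟩, mem_univ _, by simp⟩
      · intro e _ e' _ h
        ext i; exact congrFun h i
      · intro t ht
        rw [mem_filter, mem_filter] at ht
        obtain ⟨⟨_, hI⟩, him⟩ := ht
        have hb : Function.Bijective (fun i => (⟨t i, by rw [← him]; exact mem_image_of_mem _ (mem_univ i)⟩ : s)) := by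
          rw [Fintype.bijective_iff_injective_and_card]
          exact ⟨fun i j h => hI (Subtype.ext_iff.mp h), by simp [hs.2]⟩
        exact ⟨Equiv.ofBijective _ hb, mem_univ _, rfl⟩
    · intro t ht
      rw [(mem_filter.mp ht).2]
  · intro t ht
    rw [mem_filter, Fintype.mem_piFinset] at ht
    rw [mem_powersetCard]
    refine ⟨?_, ?_⟩
    · intro x hx
      obtain ⟨i, _, rfl⟩ := mem_image.mp hx
      exact ht.1 i
    · rw [card_image_of_injective _ ht.2]; simp

end FR

namespace FR
open Finset

noncomputable def DD (Y Z : ℕ) : Finset ℕ := (range (Y + 1)).filter (fun d => Adm d ∧ d.primeFactors.card ≤ Z)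
noncomputable def SS (T Y : ℕ) : Finset ℕ := (range (Y + 1)).filter (fun p => p.Prime ∧ T < p ∧ jacobiSym 2 p = 1)
noncomputable def MM (T Y : ℕ) : Finset ℕ := (Icc 1 Y).filter (fun m => Squarefree m ∧ ∀ q ∈ m.primeFactors, q ≤ T ∧ jacobiSym 2 q = 1)
noncomputable def II (T Y Z : ℕ) : Finset (ℕ × ℕ) := (MM T Y ×ˢ range (Z + 1)).filter (fun x => x.1.primeFactors.card + x.2 ≤ Z)

lemma jac22 : jacobiSym 2 2 ≠ 1 := by
  norm_num

lemma ne_two {p : ℕ} (h : jacobiSym 2 p = 1) : p ≠ 2 := by rintro rfl; exact jac22 h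

lemma pf_prod_set (s : Finset ℕ) (hs : ∀ p ∈ s, p.Prime) : (∏ p ∈ s, p).primeFactors = s :=
  Nat.primeFactors_prod hs

lemma decomp (T Y Z : ℕ) (f : ℕ → ℝ) :
    ∑ d ∈ DD Y Z, f d = ∑ x ∈ II T Y Z, ∑ s ∈ (SS T Y).powersetCard x.2,
      if x.1 * ∏ p ∈ s, p ≤ Y ∧ Adm (x.1 * ∏ p ∈ s, p) then f (x.1 * ∏ p ∈ s, p) else 0 := by
  simp only [← sum_filter]
  rw [sum_sigma']
  have hpfs : ∀ m ∈ MM T Y, ∀ s ⊆ SS T Y, (m * ∏ p ∈ s, p).primeFactors = m.primeFactors ∪ s := by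
    intro m hm s hs
    rw [MM, mem_filter, mem_Icc] at hm
    have hsp : ∀ p ∈ s, p.Prime := fun p hp => by have := hs hp; rw [SS, mem_filter] at this; exact this.2.1
    rw [Nat.primeFactors_mul (by omega) (prod_ne_zero_iff.mpr fun p hp => (hsp p hp).ne_zero), pf_prod_set s hsp]
  have hsplit : ∀ d : ℕ, Squarefree d → (∏ p ∈ d.primeFactors.filter (fun p => p ≤ T), p) * ∏ p ∈ d.primeFactors.filter (fun p => ¬ p ≤ T), p = d := by
    intro d hd
    rw [prod_filter_mul_prod_filter_not]; exact Nat.prod_primeFactors_of_squarefree hd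
  refine sum_bij' (fun d _ => ⟨(∏ p ∈ d.primeFactors.filter (fun p => p ≤ T), p, (d.primeFactors.filter (fun p => ¬ p ≤ T)).card),
     d.primeFactors.filter (fun p => ¬ p ≤ T)⟩) (fun x _ => x.1.1 * ∏ p ∈ x.2, p) ?_ ?_ ?_ ?_ ?_
  · intro d hd
    rw [DD, mem_filter, mem_range] at hd
    obtain ⟨hdY, ⟨hsq, h4, hJ⟩, hω⟩ := hd
    have hsp := hsplit d hsq
    have hd0 : 0 < d := Nat.pos_of_ne_zero hsq.ne_zero
    have hpr : ∀ p ∈ d.primeFactors.filter (fun p => p ≤ T), p.Prime := fun p hp => Nat.prime_of_mem_primeFactors (mem_filter.mp hp).1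
    rw [mem_sigma]
    simp only
    refine ⟨?_, ?_⟩
    · rw [II, mem_filter, mem_product, MM, mem_filter, mem_Icc, mem_range]
      simp only
      rw [pf_prod_set _ hpr]
      have hcc := card_filter_add_card_filter_not (s := d.primeFactors) (fun p => p ≤ T)
      refine ⟨⟨⟨⟨?_, ?_⟩, ?_, ?_⟩, ?_⟩, ?_⟩
      · exact prod_pos fun p hp => (hpr p hp).pos
      · have : (∏ p ∈ d.primeFactors.filter (fun p => p ≤ T), p) ∣ d := ⟨_, hsp.symm⟩
        have := Nat.le_of_dvd hd0 this
        omega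
      · exact hsq.squarefree_of_dvd ⟨_, hsp.symm⟩
      · intro q hq
        rw [mem_filter] at hq
        exact ⟨hq.2, hJ q (Nat.prime_of_mem_primeFactors hq.1) (Nat.dvd_of_mem_primeFactors hq.1)⟩
      · omega
      · omega
    · rw [mem_filter, hsp, mem_powersetCard]
      refine ⟨⟨?_, rfl⟩, by omega, hsq, h4, hJ⟩
      intro p hp
      rw [mem_filter] at hp
      rw [SS, mem_filter, mem_range]
      have hpp := Nat.prime_of_mem_primeFactors hp.1
      have hpd := Nat.dvd_of_mem_primeFactors hp.1
      have := Nat.le_of_dvd hd0 hpd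
      exact ⟨by omega, hpp, by omega, hJ p hpp hpd⟩
  · rintro ⟨⟨m, L⟩, s⟩ hx
    rw [mem_sigma, II, mem_filter, mem_product, mem_filter, mem_powersetCard] at hx
    simp only at hx
    obtain ⟨⟨⟨hm, _⟩, hω⟩, ⟨hs, hL⟩, hY, hA⟩ := hx
    rw [DD, mem_filter, mem_range]
    simp only
    refine ⟨by omega, hA, ?_⟩
    rw [hpfs m hm s hs]
    have := card_union_le m.primeFactors s
    omega
  · intro d hd
    rw [DD, mem_filter] at hd
    exact hsplit d hd.2.1.1
  · rintro ⟨⟨m, L⟩, s⟩ hx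
    rw [mem_sigma, II, mem_filter, mem_product, mem_filter, mem_powersetCard] at hx
    simp only at hx
    obtain ⟨⟨⟨hm, _⟩, hω⟩, ⟨hs, hL⟩, hY, hA⟩ := hx
    have hpf := hpfs m hm s hs
    have hm' := hm
    rw [MM, mem_filter] at hm'
    have f1 : (m.primeFactors ∪ s).filter (fun p => p ≤ T) = m.primeFactors := by
      rw [filter_union, filter_true_of_mem (fun p hp => (hm'.2.2 p hp).1), filter_false_of_mem, union_empty]
      intro p hp; have := hs hp; rw [SS, mem_filter] at this; omega
    have f2 : (m.primeFactors ∪ s).filter (fun p => ¬ p ≤ T) = s := by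
      rw [filter_union, filter_true_of_mem (s := s), filter_false_of_mem, empty_union]
      · intro p hp h; exact h (hm'.2.2 p hp).1
      · intro p hp; have := hs hp; rw [SS, mem_filter] at this; omega
    simp only [hpf, f1, f2, hL, Nat.prod_primeFactors_of_squarefree hm'.2.1]
  · intro d hd
    rw [DD, mem_filter] at hd
    rw [hsplit d hd.2.1.1]

lemma fiber_tuples {m L T Y : ℕ} (h : ℕ → ℝ) :
    ∑ t ∈ Fintype.piFinset (fun _ : Fin L => SS T Y), (if m * ∏ k, t k ≤ Y ∧ Function.Injective t ∧ Adm (m * ∏ k, t k) then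
        h (m * ∏ k, t k) else 0) = (L.factorial : ℝ) * ∑ s ∈ (SS T Y).powersetCard L,
          if m * ∏ p ∈ s, p ≤ Y ∧ Adm (m * ∏ p ∈ s, p) then h (m * ∏ p ∈ s, p) else 0 := by
  rw [← tuples_sum]
  apply sum_congr rfl
  intro t _
  by_cases hI : Function.Injective t
  · rw [if_pos hI, prod_image (fun a _ b _ e => hI e)]
    simp only [hI, true_and]
  · rw [if_neg hI, if_neg (fun hh => hI hh.2.1)]

lemma card_EE (L : ℕ) : Fintype.card (EE (Fin L)) ≤ L ^ 2 := by
  refine (Fintype.card_subtype_le _).trans ?_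
  simp [sq]

lemma card_KK (m : ℕ) : Fintype.card (KK m) = 2 * 4 ^ m.primeFactors.card := by
  simp [KK, Fintype.card_prod]

lemma inv_sum_le (Y : ℕ) : ∑ n ∈ Icc 1 Y, (1:ℝ) / n ≤ 1 + Real.log Y := by
  have := harmonic_le_one_add_log Y
  rw [harmonic_eq_sum_Icc] at this
  push_cast at this
  simpa using this

theorem main_sum (r : ℕ) (ε : ℝ) (hε : 0 < ε) : ∃ C : ℕ, ∀ (T Y Z : ℕ) (κ : ℝ), 2 ≤ κ → κ ^ 12 ≤ T →
    |∑ d ∈ DD Y Z, ((if RR d = 2 ^ r then 1 else 0) - piR r)| ≤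
      (Z + 1) * (2 ^ (Z ^ 2) * ((2 * 4 ^ Z) ^ 2 * (13 * (Y * (Real.log Y + 1) ^ 2 / κ)) * (1 + Real.log Y) ^ Z))
      + ∑ d ∈ DD Y Z, (ε + if good C T d then 0 else 1 + |piR r|) := by
  obtain ⟨C, hC⟩ := LA_main r hε
  refine ⟨C, ?_⟩
  intro T Y Z κ hκ hκT
  rw [decomp T, decomp T Y Z (fun d => ε + if good C T d then 0 else 1 + |piR r|)]
  have hlog := Real.log_natCast_nonneg Y
  set H := 1 + Real.log Y with hH
  have hκ0 : 0 < κ := by linarith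
  have hSH : ∑ p ∈ SS T Y, (1:ℝ) / p ≤ H := by
    refine le_trans ?_ (inv_sum_le Y)
    apply sum_le_sum_of_subset_of_nonneg
    · intro p hp
      rw [SS, mem_filter, mem_range] at hp
      rw [mem_Icc]
      exact ⟨hp.2.1.pos, by omega⟩
    · intros; positivity
  have hfib : ∀ x ∈ II T Y Z, |∑ s ∈ (SS T Y).powersetCard x.2,
      if x.1 * ∏ p ∈ s, p ≤ Y ∧ Adm (x.1 * ∏ p ∈ s, p) then ((if RR (x.1 * ∏ p ∈ s, p) = 2 ^ r then (1:ℝ) else 0) - piR r) else 0| ≤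
      (2 ^ (Z ^ 2) * ((2 * 4 ^ Z) ^ 2 * (13 * (Y * (Real.log Y + 1) / κ)) * H ^ Z)) * (1 / x.1)
      + ∑ s ∈ (SS T Y).powersetCard x.2, if x.1 * ∏ p ∈ s, p ≤ Y ∧ Adm (x.1 * ∏ p ∈ s, p) then
        (ε + if good C T (x.1 * ∏ p ∈ s, p) then 0 else 1 + |piR r|) else 0 := by
    rintro ⟨m, L⟩ hx
    rw [II, mem_filter, mem_product, MM, mem_filter, mem_Icc, mem_range] at hx
    simp only at hx ⊢
    obtain ⟨⟨⟨⟨hm1, hmY⟩, hmsq, hmq⟩, hL⟩, hω⟩ := hx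
    have hfb := fiber_bound r C ε hε.le hC (L := L) (m := m) (T := T) (SS T Y) κ hκ (by
      intro p hp
      rw [SS, mem_filter] at hp
      refine ⟨hp.2.1, hκT.trans ?_⟩
      exact_mod_cast hp.2.2.1.le) (by
      intro p hp
      rw [SS, mem_filter] at hp
      exact ⟨hp.2.2.1, ne_two hp.2.2.2, hp.2.2.2⟩) Y hmsq (fun q hq => ⟨(hmq q hq).1, ne_two (hmq q hq).2⟩)
      (fun q hq => (hmq q hq).2) H (by linarith) hSH
    rw [fiber_tuples (fun d => (if RR d = 2 ^ r then (1:ℝ) else 0) - piR r),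
      fiber_tuples (fun d => ε + if good C T d then 0 else 1 + |piR r|), abs_mul, abs_of_pos (by positivity)] at hfb
    have hfac : (1:ℝ) ≤ L.factorial := by exact_mod_cast Nat.succ_le_of_lt (Nat.factorial_pos L)
    have hEb : (2:ℝ) ^ Fintype.card (EE (Fin L)) * ((Fintype.card (KK m) : ℝ) ^ 2 * (13 * (Y / m * (Real.log Y + 1) / κ)) * H ^ L)
      ≤ (2 ^ (Z ^ 2) * ((2 * 4 ^ Z) ^ 2 * (13 * (Y * (Real.log Y + 1) / κ)) * H ^ Z)) * (1 / m) := by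
      have hm0 : (0:ℝ) < m := by exact_mod_cast hm1
      have g1 : (2:ℝ) ^ Fintype.card (EE (Fin L)) ≤ 2 ^ (Z ^ 2) := by
        apply pow_le_pow_right₀ (by norm_num)
        refine (card_EE L).trans ?_
        exact Nat.pow_le_pow_left (by omega) 2
      have g2 : (Fintype.card (KK m) : ℝ) ≤ 2 * 4 ^ Z := by
        rw [card_KK]; push_cast
        have : (4:ℝ) ^ m.primeFactors.card ≤ 4 ^ Z := pow_le_pow_right₀ (by norm_num) (by omega)
        linarith
      have g3 : H ^ L ≤ H ^ Z := pow_le_pow_right₀ (by linarith) (by omega)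
      calc _ ≤ (2:ℝ) ^ (Z ^ 2) * ((2 * 4 ^ Z) ^ 2 * (13 * (Y / m * (Real.log Y + 1) / κ)) * H ^ Z) := by
            gcongr
        _ = _ := by field_simp
    have := hfb.trans (add_le_add_left hEb _)
    set E := (2 ^ (Z ^ 2) * ((2 * 4 ^ Z) ^ 2 * (13 * ((Y:ℝ) * (Real.log Y + 1) / κ)) * H ^ Z)) * (1 / (m:ℝ)) with hE
    have hE0 : 0 ≤ E := by
      have : 0 ≤ H := by linarith
      positivity
    have h2 : E ≤ L.factorial * E := by nlinarith
    have h3 := this.trans (add_le_add_left h2 _)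
    rw [← mul_add] at h3
    exact le_of_mul_le_mul_left h3 (by linarith)
  refine (abs_sum_le_sum_abs _ _).trans ((sum_le_sum hfib).trans ?_)
  rw [sum_add_distrib]
  refine add_le_add ?_ le_rfl
  rw [← mul_sum]
  have hI : ∑ x ∈ II T Y Z, (1:ℝ) / x.1 ≤ (Z + 1) * (Real.log Y + 1) := by
    calc ∑ x ∈ II T Y Z, (1:ℝ) / x.1 ≤ ∑ x ∈ Icc 1 Y ×ˢ range (Z + 1), (1:ℝ) / x.1 := by
          apply sum_le_sum_of_subset_of_nonneg
          · intro x hx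
            rw [II, mem_filter, mem_product, MM, mem_filter] at hx
            rw [mem_product]; exact ⟨hx.1.1.1, hx.1.2⟩
          · intros; positivity
      _ = (Z + 1) * ∑ n ∈ Icc 1 Y, (1:ℝ) / n := by
          rw [sum_product]; simp [mul_sum]
      _ ≤ _ := by
          have := inv_sum_le Y
          gcongr
          linarith
  have hH0 : 0 ≤ H := by linarith
  calc _ ≤ (2 ^ (Z ^ 2) * ((2 * 4 ^ Z) ^ 2 * (13 * ((Y:ℝ) * (Real.log Y + 1) / κ)) * H ^ Z)) * ((Z + 1) * (Real.log Y + 1)) := by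
        gcongr
    _ = _ := by ring

end FR

namespace FR
open Finset

lemma abel_bound (g a : ℕ → ℝ) (B : ℝ) (M : ℕ) (hg : ∀ N, M ≤ N → |∑ n ∈ Ico M N, g n| ≤ B)
    (ha : ∀ n, M ≤ n → a (n+1) ≤ a n) (ha0 : ∀ n, M ≤ n → 0 ≤ a n) (N : ℕ) (hN : M ≤ N) :
    |∑ n ∈ Ico M N, g n * a n| ≤ B * a M := by
  have key : |∑ n ∈ Ico M N, g n * a n - (∑ n ∈ Ico M N, g n) * a N| ≤ B * (a M - a N) := by
    induction N, hN using Nat.le_induction with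
    | base => simp
    | succ N hN ih =>
      rw [sum_Ico_succ_top hN]
      have e : ∑ k ∈ Ico M N, g k * a k + g N * a N - (∑ k ∈ Ico M (N+1), g k) * a (N + 1) =
        (∑ k ∈ Ico M N, g k * a k - (∑ k ∈ Ico M N, g k) * a N) + (∑ k ∈ Ico M (N+1), g k) * (a N - a (N+1)) := by
        rw [sum_Ico_succ_top hN]; ring
      rw [e]
      refine (abs_add_le _ _).trans ?_
      rw [abs_mul, abs_of_nonneg (sub_nonneg.2 (ha N hN))]
      have := mul_le_mul_of_nonneg_right (hg (N+1) (by omega)) (sub_nonneg.2 (ha N hN))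
      linarith
  have h1 := mul_le_mul_of_nonneg_right (hg N hN) (ha0 N hN)
  have h2 : |(∑ n ∈ Ico M N, g n) * a N| ≤ B * a N := by
    rw [abs_mul, abs_of_nonneg (ha0 N hN)]; exact h1
  have h3 := abs_add_le (∑ n ∈ Ico M N, g n * a n - (∑ n ∈ Ico M N, g n) * a N) ((∑ n ∈ Ico M N, g n) * a N)
  rw [sub_add_cancel] at h3
  linarith

noncomputable def PS (w : ℕ → ℝ) (s : ℝ) : ℝ := ∑' p : Nat.Primes, w p * (p:ℝ)^(-s)

noncomputable def LS (g : ℕ → ℝ) (s : ℝ) : ℝ := ∑' n : ℕ, g n * (n:ℝ)^(-s)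

lemma summable_P (w : ℕ → ℝ) (W : ℝ) (hw : ∀ p : Nat.Primes, |w p| ≤ W) (s : ℝ) (hs : 1 < s) :
    Summable (fun p : Nat.Primes => w p * (p:ℝ)^(-s)) := by
  have h : Summable (fun p : Nat.Primes => W * (p:ℝ)^(-s)) := (Nat.Primes.summable_rpow.2 (by linarith)).mul_left _
  refine Summable.of_norm_bounded h fun p => ?_
  rw [Real.norm_eq_abs, abs_mul, abs_of_nonneg (by positivity : (0:ℝ) ≤ (p:ℝ)^(-s))]
  have := hw p
  gcongr

lemma summable_L (g : ℕ → ℝ) (hg : ∀ n, |g n| ≤ 1) (s : ℝ) (hs : 1 < s) :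
    Summable (fun n : ℕ => ‖g n * (n:ℝ)^(-s)‖) := by
  have h : Summable (fun n : ℕ => (n:ℝ)^(-s)) := Real.summable_nat_rpow.2 (by linarith)
  refine Summable.of_nonneg_of_le (fun _ => norm_nonneg _) (fun n => ?_) h
  rw [Real.norm_eq_abs, abs_mul, abs_of_nonneg (by positivity : (0:ℝ) ≤ (n:ℝ)^(-s))]
  have := hg n
  have h0 : (0:ℝ) ≤ (n:ℝ)^(-s) := by positivity
  nlinarith

noncomputable def twist (g : ℕ →*₀ ℝ) (s : ℝ) (hs : 1 < s) : ℕ →*₀ ℝ where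
  toFun n := g n * (n:ℝ)^(-s)
  map_zero' := by simp
  map_one' := by simp
  map_mul' a b := by
    rw [map_mul, Nat.cast_mul, Real.mul_rpow (by positivity) (by positivity)]; ring

lemma prime_rpow_le (p : Nat.Primes) (s : ℝ) (hs : 1 < s) : ((p:ℕ):ℝ)^(-s) ≤ 1/2 := by
  have h2 : (2:ℝ) ≤ (p:ℕ) := by exact_mod_cast p.2.two_le
  calc ((p:ℕ):ℝ)^(-s) ≤ ((p:ℕ):ℝ)^(-1:ℝ) := Real.rpow_le_rpow_of_exponent_le (by linarith) (by linarith)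
    _ = ((p:ℕ):ℝ)⁻¹ := Real.rpow_neg_one _
    _ ≤ 1/2 := by rw [inv_le_comm₀ (by linarith) (by norm_num)]; linarith

lemma tw_abs (g : ℕ →*₀ ℝ) (hg : ∀ n, |g n| ≤ 1) (s : ℝ) (hs : 1 < s) (p : Nat.Primes) :
    |g p * ((p:ℕ):ℝ)^(-s)| ≤ 1/2 := by
  rw [abs_mul, abs_of_nonneg (by positivity : (0:ℝ) ≤ ((p:ℕ):ℝ)^(-s))]
  have := hg p
  have h0 : (0:ℝ) ≤ ((p:ℕ):ℝ)^(-s) := by positivity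
  have := prime_rpow_le p s hs
  nlinarith

lemma euler_le (g : ℕ →*₀ ℝ) (hg : ∀ n, |g n| ≤ 1) (s : ℝ) (hs : 1 < s) :
    Real.exp (PS g s) ≤ LS g s := by
  have h1 := EulerProduct.eulerProduct_completely_multiplicative_hasProd (f := twist g s hs) (summable_L g hg s hs)
  have h2 := (summable_P g 1 (fun p => hg p) s hs).hasSum.rexp
  refine le_of_tendsto_of_tendsto' h2 h1 fun S => ?_
  refine prod_le_prod (fun _ _ => (Real.exp_pos _).le) fun p _ => ?_
  have hy := abs_le.1 (tw_abs g hg s hs p)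
  show Real.exp (g p * ((p:ℕ):ℝ)^(-s)) ≤ (1 - g p * ((p:ℕ):ℝ)^(-s))⁻¹
  set y := g p * ((p:ℕ):ℝ)^(-s)
  rw [le_inv_comm₀ (Real.exp_pos _) (by linarith), ← Real.exp_neg]
  have := Real.add_one_le_exp (-y); linarith

lemma euler_ge (g : ℕ →*₀ ℝ) (hg : ∀ n, |g n| ≤ 1) (s : ℝ) (hs : 1 < s) :
    LS g s ≤ Real.exp (PS g s + ∑' p : Nat.Primes, ((p:ℕ):ℝ)^(-2:ℝ)) := by
  have h1 := EulerProduct.eulerProduct_completely_multiplicative_hasProd (f := twist g s hs) (summable_L g hg s hs)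
  have h2 := ((summable_P g 1 (fun p => hg p) s hs).hasSum.add (Nat.Primes.summable_rpow.2 (by norm_num : (-2:ℝ) < -1)).hasSum).rexp
  refine le_of_tendsto_of_tendsto' h1 h2 fun S => ?_
  have hy := fun p => abs_le.1 (tw_abs g hg s hs p)
  refine prod_le_prod (fun p _ => ?_) fun p _ => ?_
  · have := hy p
    show 0 ≤ (1 - g p * ((p:ℕ):ℝ)^(-s))⁻¹
    rw [inv_nonneg]; linarith
  have hy := hy p
  have hp0 : (0:ℝ) < (p:ℕ) := by exact_mod_cast p.2.pos
  have hsq : (g p * ((p:ℕ):ℝ)^(-s))^2 ≤ ((p:ℕ):ℝ)^(-2:ℝ) := by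
    rw [← sq_abs, abs_mul, mul_pow, abs_of_nonneg (by positivity : (0:ℝ) ≤ ((p:ℕ):ℝ)^(-s))]
    have e : (((p:ℕ):ℝ)^(-s))^2 ≤ ((p:ℕ):ℝ)^(-2:ℝ) := by
      rw [← Real.rpow_natCast, ← Real.rpow_mul hp0.le]
      apply Real.rpow_le_rpow_of_exponent_le
      · exact_mod_cast p.2.one_le
      · push_cast; linarith
    have := hg p
    have h5 : |g p|^2 ≤ 1 := by
      have := abs_nonneg (g p); nlinarith
    have : 0 ≤ (((p:ℕ):ℝ)^(-s))^2 := by positivity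
    nlinarith
  show (1 - g p * ((p:ℕ):ℝ)^(-s))⁻¹ ≤ Real.exp (g p * ((p:ℕ):ℝ)^(-s) + ((p:ℕ):ℝ)^(-2:ℝ))
  set y := g p * ((p:ℕ):ℝ)^(-s)
  refine le_trans ?_ (Real.exp_le_exp.2 (add_le_add_right hsq y))
  have h3 : (1 - y)⁻¹ ≤ 1 + y + y^2 + (if 0 ≤ y then 2 * y^3 else 0) := by
    rw [inv_le_iff_one_le_mul₀ (by linarith)]
    split_ifs with h
    · nlinarith [pow_nonneg h 3, mul_nonneg (pow_nonneg h 3) (by linarith : (0:ℝ) ≤ 1/2 - y)]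
    · have : 0 ≤ -y^3 := by
        have : y^3 ≤ 0 := by
          have := mul_nonneg (by push Not at h; linarith : (0:ℝ) ≤ -y) (sq_nonneg y); nlinarith
        linarith
      nlinarith
  refine h3.trans ?_
  have hle := Real.add_one_le_exp (y + y^2)
  split_ifs with h
  · have := Real.quadratic_le_exp_of_nonneg (x := y + y^2) (by positivity)
    have h6 : (0:ℝ) ≤ y^2 := by positivity
    -- 1 + (y+y^2) + (y+y^2)^2/2 ; need y^2/2 + y^3 + y^4/2 ≥ 2 y^3
    nlinarith [mul_nonneg h6 (sq_nonneg (y-1)), mul_nonneg h6 (by linarith : (0:ℝ) ≤ 1/2 - y)]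
  · linarith

/-- upper bound for periodic nontrivial L -/
lemma LS_per (g : ℕ → ℝ) (q : ℕ) (hq : 0 < q) (hper : ∀ n, g (n+q) = g n) (hmul : ∀ a b, g (a*b) = g a * g b)
    (hb : ∀ n, |g n| ≤ 1) (u : ℕ) (hu : u.Coprime q) (hgu : g u ≠ 1) (s : ℝ) (hs : 1 < s) :
    LS g s ≤ Real.log q + 3 := by
  have hsum := (summable_L g hb s hs).of_norm.hasSum.tendsto_sum_nat
  refine le_of_tendsto hsum ?_
  filter_upwards [Filter.eventually_ge_atTop (q+1)] with N hN
  rw [range_eq_Ico, ← sum_Ico_consecutive _ (Nat.zero_le (q+1)) hN]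
  have hpb := per_bound g q hq hper hmul hb u hu hgu
  have h1 : |∑ n ∈ Ico (q+1) N, g n * (n:ℝ)^(-s)| ≤ (2*q) * ((q+1:ℕ):ℝ)^(-s) := by
    apply abel_bound g (fun n => (n:ℝ)^(-s))
    · intro N hN
      have e := sum_Ico_consecutive g (Nat.zero_le (q+1)) hN
      rw [← range_eq_Ico, ← range_eq_Ico] at e
      have := hpb N; have := hpb (q+1)
      rw [show ∑ n ∈ Ico (q+1) N, g n = ∑ n ∈ range N, g n - ∑ n ∈ range (q+1), g n by linarith]
      refine (abs_sub _ _).trans (by linarith)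
    · intro n hn
      apply Real.rpow_le_rpow_of_nonpos
      · have : 0 < n := by omega
        exact_mod_cast this
      · push_cast; linarith
      · linarith
    · intros; positivity
    · exact hN
  have h2 : (2*q) * ((q+1:ℕ):ℝ)^(-s) ≤ (2:ℝ) := by
    have : ((q+1:ℕ):ℝ)^(-s) ≤ ((q+1:ℕ):ℝ)^(-1:ℝ) := by
      apply Real.rpow_le_rpow_of_exponent_le
      · push_cast; linarith [(Nat.cast_nonneg q : (0:ℝ) ≤ q)]
      · linarith
    rw [Real.rpow_neg_one] at this
    have hq0 : (0:ℝ) < q := by exact_mod_cast hq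
    calc (2*q) * ((q+1:ℕ):ℝ)^(-s) ≤ (2*q) * ((q+1:ℕ):ℝ)⁻¹ := by gcongr
      _ ≤ 2 := by
        rw [← div_eq_mul_inv, div_le_iff₀ (by positivity)]; push_cast; linarith
  have h3 : ∑ n ∈ Ico 0 (q+1), g n * (n:ℝ)^(-s) ≤ 1 + Real.log q := by
    refine le_trans ?_ (inv_sum_le q)
    rw [← range_eq_Ico, range_eq_Ico, sum_eq_sum_Ico_succ_bot (by omega)]
    have : g 0 * ((0:ℕ):ℝ)^(-s) = 0 := by
      rw [Nat.cast_zero, Real.zero_rpow (by linarith), mul_zero]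
    rw [this, zero_add]
    apply sum_le_sum
    intro n hn
    rw [mem_Ico] at hn
    have hn1 : (1:ℝ) ≤ n := by exact_mod_cast hn.1
    have h5 : (n:ℝ)^(-s) ≤ 1/n := by
      rw [one_div, ← Real.rpow_neg_one]
      exact Real.rpow_le_rpow_of_exponent_le hn1 (by linarith)
    have := (abs_le.1 (hb n)).2
    have h0 : (0:ℝ) ≤ (n:ℝ)^(-s) := by positivity
    nlinarith
  have := (abs_le.1 h1).2
  linarith

lemma LS_one : ∃ δ : ℝ, 0 < δ ∧ ∀ s, 1 < s → s ≤ 1 + δ → LS (fun _ => 1) s ≤ 2/(s-1) := by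
  have h := tendsto_sub_mul_tsum_nat_rpow
  have h2 := h.eventually (gt_mem_nhds (show (1:ℝ) < 2 by norm_num))
  rw [eventually_nhdsWithin_iff, Metric.eventually_nhds_iff] at h2
  obtain ⟨ε, hε, h⟩ := h2
  refine ⟨ε/2, by linarith, fun s h1 h2 => ?_⟩
  have := h (y := s) (by rw [Real.dist_eq, abs_of_pos (by linarith)]; linarith) h1
  have e : LS (fun _ => 1) s = ∑' n : ℕ, 1/(n:ℝ)^s := by
    unfold LS; congr 1; ext n; rw [Real.rpow_neg (by positivity)]; simp
  rw [e, le_div_iff₀ (by linarith)]; linarith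

end FR

namespace FR
open Finset

noncomputable def FW (w : ℕ → ℝ) (n : ℕ) : ℝ := if Squarefree n then ∏ p ∈ n.primeFactors, w p else 0

lemma FW_nonneg {w : ℕ → ℝ} (hw : ∀ p, 0 ≤ w p) (n : ℕ) : 0 ≤ FW w n := by
  unfold FW; split_ifs
  · exact prod_nonneg fun p _ => hw p
  · exact le_rfl

lemma FW_euler (w : ℕ → ℝ) (hw : ∀ p, 0 ≤ w p) (s : ℝ) (hs : 1 < s) (W : ℝ) (hW : ∀ p, w p ≤ W) (N : ℕ) :
    ∑ m ∈ Icc 1 N, FW w m * (m:ℝ)^(-s) ≤ Real.exp (PS w s) := by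
  set P := (range (N+1)).filter Nat.Prime with hP
  calc ∑ m ∈ Icc 1 N, FW w m * (m:ℝ)^(-s)
      = ∑ m ∈ (Icc 1 N).filter Squarefree, ∏ p ∈ m.primeFactors, (w p * (p:ℝ)^(-s)) := by
        rw [sum_filter]; apply sum_congr rfl; intro m hm
        unfold FW
        split_ifs with h
        · rw [prod_mul_distrib]; congr 1
          rw [Real.finset_prod_rpow _ _ (fun _ _ => by positivity), ← Nat.cast_prod, Nat.prod_primeFactors_of_squarefree h]
        · simp
    _ ≤ ∑ E ∈ P.powerset, ∏ p ∈ E, (w p * (p:ℝ)^(-s)) := by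
        rw [← sum_image (f := fun E : Finset ℕ => ∏ p ∈ E, (w p * (p:ℝ)^(-s))) (g := Nat.primeFactors)]
        · apply sum_le_sum_of_subset_of_nonneg
          · intro E hE
            rw [mem_image] at hE
            obtain ⟨m, hm, rfl⟩ := hE
            rw [mem_filter, mem_Icc] at hm
            rw [mem_powerset]; intro p hp
            rw [hP, mem_filter, mem_range]
            exact ⟨by have := Nat.le_of_mem_primeFactors hp; omega, Nat.prime_of_mem_primeFactors hp⟩
          · intro E _ _
            exact prod_nonneg fun p _ => mul_nonneg (hw p) (by positivity)
        · intro a ha b hb hab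
          rw [mem_coe, mem_filter] at ha hb
          have hab : a.primeFactors = b.primeFactors := hab
          rw [← Nat.prod_primeFactors_of_squarefree ha.2, ← Nat.prod_primeFactors_of_squarefree hb.2, hab]
    _ = ∏ p ∈ P, (1 + w p * (p:ℝ)^(-s)) := (prod_one_add _).symm
    _ ≤ ∏ p ∈ P, Real.exp (w p * (p:ℝ)^(-s)) := by
        apply prod_le_prod
        · intro p _; have := mul_nonneg (hw p) (by positivity : (0:ℝ) ≤ (p:ℝ)^(-s)); linarith
        · intro p _; rw [add_comm]; exact Real.add_one_le_exp _
    _ = Real.exp (∑ p ∈ P, w p * (p:ℝ)^(-s)) := (Real.exp_sum _ _).symm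
    _ ≤ _ := by
        apply Real.exp_le_exp.2
        have hsm := summable_P w W (fun p => by rw [abs_of_nonneg (hw p)]; exact hW p) s hs
        have h3 := sum_le_hasSum (f := fun p : Nat.Primes => w p * (p:ℝ)^(-s)) (P.subtype Nat.Prime) (fun p _ => mul_nonneg (hw p) (by positivity)) hsm.hasSum
        refine le_trans (le_of_eq ?_) h3
        symm
        exact Finset.sum_subtype_of_mem (p := Nat.Prime) (fun p : ℕ => w p * (p:ℝ)^(-s)) fun p hp => (mem_filter.1 hp).2

lemma FW_log (w : ℕ → ℝ) (hw : ∀ p, 0 ≤ w p) (W : ℝ) (hW : ∀ p, w p ≤ W) (N : ℕ) :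
    ∑ n ∈ Icc 1 N, FW w n * Real.log n ≤ W * ∑ m ∈ Icc 1 N, FW w m * Chebyshev.theta ((N:ℝ)/m) := by
  have hW0 : 0 ≤ W := (hw 0).trans (hW 0)
  have h1 : ∀ n ∈ Icc 1 N, FW w n * Real.log n = ∑ p ∈ (Icc 1 N).filter (fun p => p.Prime ∧ p ∣ n), FW w n * Real.log p := by
    intro n hn
    rw [mem_Icc] at hn
    by_cases h : Squarefree n
    · rw [← mul_sum]; congr 1
      conv_lhs => rw [← Nat.prod_primeFactors_of_squarefree h]
      rw [Nat.cast_prod, Real.log_prod]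
      · apply sum_congr _ (fun _ _ => rfl)
        ext p; rw [Nat.mem_primeFactors, mem_filter, mem_Icc]
        constructor
        · rintro ⟨a, b, c⟩; exact ⟨⟨a.one_le, (Nat.le_of_dvd (by omega) b).trans hn.2⟩, a, b⟩
        · rintro ⟨a, b, c⟩; exact ⟨b, c, by omega⟩
      · intro p hp; have := (Nat.prime_of_mem_primeFactors hp).pos; positivity
    · simp [FW, h]
  rw [sum_congr rfl h1, mul_sum]
  -- double sums
  have h2 : ∀ m ∈ Icc 1 N, W * (FW w m * Chebyshev.theta ((N:ℝ)/m)) = ∑ p ∈ (Icc 1 N).filter (fun p => p.Prime ∧ p * m ≤ N), W * (FW w m * Real.log p) := by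
    intro m hm
    rw [mem_Icc] at hm
    rw [← mul_sum, ← mul_sum, Chebyshev.theta]
    congr 2
    apply sum_congr _ (fun _ _ => rfl)
    ext p
    rw [mem_filter, mem_filter, mem_Ioc, mem_Icc, Nat.floor_div_natCast, Nat.floor_natCast, Nat.le_div_iff_mul_le (by omega)]
    constructor
    · rintro ⟨⟨a, b⟩, c⟩
      exact ⟨⟨a, by nlinarith⟩, c, b⟩
    · rintro ⟨⟨a, b⟩, c, e⟩
      exact ⟨⟨a, e⟩, c⟩
  rw [sum_congr rfl h2, sum_sigma', sum_sigma']
  -- compare via map (n,p) -> (n/p, p)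
  have hlog : ∀ p : ℕ, p.Prime → 0 ≤ Real.log p := fun p hp => Real.log_nonneg (by exact_mod_cast hp.one_le)
  calc _ ≤ ∑ x ∈ ((Icc 1 N).sigma fun n => (Icc 1 N).filter (fun p => p.Prime ∧ p ∣ n)), W * (FW w (x.1/x.2) * Real.log x.2) := by
        apply sum_le_sum
        rintro ⟨n, p⟩ hx
        rw [mem_sigma, mem_filter, mem_Icc] at hx
        obtain ⟨hn, hp1, hp, hpn⟩ := hx
        dsimp only at *
        rw [← mul_assoc]
        apply mul_le_mul_of_nonneg_right _ (hlog p hp)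
        unfold FW
        split_ifs with h h' h'
        · obtain ⟨m, rfl⟩ := hpn
          rw [Nat.mul_div_cancel_left _ hp.pos] at h' ⊢
          have hc := Nat.coprime_of_squarefree_mul h
          have hpm : p ∉ m.primeFactors := fun hm => by
            have := Nat.dvd_of_mem_primeFactors hm
            exact hp.one_lt.ne' (Nat.eq_one_of_dvd_coprimes hc (dvd_refl p) this)
          rw [Nat.primeFactors_mul hp.ne_zero (by rintro rfl; simp at hn), hp.primeFactors, ← insert_eq, prod_insert hpm]
          exact mul_le_mul_of_nonneg_right (hW p) (prod_nonneg fun q _ => hw q)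
        · exact absurd (h.squarefree_of_dvd (Nat.div_dvd_of_dvd hpn)) h'
        · exact mul_nonneg hW0 (prod_nonneg fun q _ => hw q)
        · simp
    _ ≤ _ := by
        rw [← sum_image (s := (Icc 1 N).sigma fun n => (Icc 1 N).filter (fun p => p.Prime ∧ p ∣ n)) (f := fun x : (_ : ℕ) × ℕ => W * (FW w x.1 * Real.log x.2)) (g := fun x => ⟨x.1/x.2, x.2⟩)]
        · apply sum_le_sum_of_subset_of_nonneg
          · rintro ⟨m, p⟩ hx
            rw [mem_image] at hx
            obtain ⟨⟨n, q⟩, hx, hx2⟩ := hx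
            rw [mem_sigma, mem_filter, mem_Icc] at hx
            obtain ⟨hn, hp1, hp, hpn⟩ := hx
            dsimp only at *
            obtain ⟨k, rfl⟩ := hpn
            rw [Nat.mul_div_cancel_left _ hp.pos] at hx2
            cases hx2
            rw [mem_sigma, mem_filter, mem_Icc]
            have : 0 < m := by
              rcases Nat.eq_zero_or_pos m with h | h
              · subst h; simp at hn
              · exact h
            exact ⟨⟨this, by nlinarith [hn.2, hp.pos]⟩, hp1, hp, hn.2⟩
          · rintro ⟨m, p⟩ hx _
            rw [mem_sigma, mem_filter] at hx
            exact mul_nonneg hW0 (mul_nonneg (FW_nonneg hw _) (hlog p hx.2.2.1))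
        · rintro ⟨n, p⟩ hx ⟨n', p'⟩ hx' h
          rw [mem_coe, mem_sigma, mem_filter] at hx hx'
          have h1 := congrArg Sigma.fst h
          have h2 := congrArg Sigma.snd h
          dsimp only at *
          subst h2
          obtain ⟨k, rfl⟩ := hx.2.2.2
          obtain ⟨k', rfl⟩ := hx'.2.2.2
          rw [Nat.mul_div_cancel_left _ hx.2.2.1.pos, Nat.mul_div_cancel_left _ hx.2.2.1.pos] at h1
          rw [h1]

lemma FW_inv (w : ℕ → ℝ) (hw : ∀ p, 0 ≤ w p) (W : ℝ) (hW : ∀ p, w p ≤ W) (N : ℕ) (s : ℝ) (hs : 1 < s)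
    (hsN : (s - 1) * Real.log N ≤ 1) : ∑ m ∈ Icc 1 N, FW w m / m ≤ Real.exp 1 * Real.exp (PS w s) := by
  refine le_trans ?_ (mul_le_mul_of_nonneg_left (FW_euler w hw s hs W hW N) (Real.exp_pos 1).le)
  rw [mul_sum]; apply sum_le_sum; intro m hm
  rw [mem_Icc] at hm
  have hm0 : (0:ℝ) < m := by exact_mod_cast hm.1
  rw [mul_left_comm, div_eq_mul_inv]
  apply mul_le_mul_of_nonneg_left _ (FW_nonneg hw m)
  rw [Real.rpow_def_of_pos hm0, ← Real.exp_add]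
  rw [← Real.exp_log (inv_pos.2 hm0), Real.log_inv]
  apply Real.exp_le_exp.2
  have : Real.log m ≤ Real.log N := Real.log_le_log hm0 (by exact_mod_cast hm.2)
  nlinarith

theorem Uprime (w : ℕ → ℝ) (hw : ∀ p, 0 ≤ w p) (W : ℝ) (hW : ∀ p, w p ≤ W) (N : ℕ) (hN : 2 ≤ N) (s : ℝ) (hs : 1 < s)
    (hsN : (s - 1) * Real.log N ≤ 1) :
    ∑ n ∈ Icc 1 N, FW w n ≤ (N / Real.log N) * (W * Real.log 4 + 1) * (Real.exp 1 * Real.exp (PS w s)) := by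
  have hN1 : (1:ℝ) < N := by exact_mod_cast (by omega : 1 < N)
  have hL : 0 < Real.log N := Real.log_pos hN1
  have hW0 : 0 ≤ W := (hw 0).trans (hW 0)
  have hA := FW_inv w hw W hW N s hs hsN
  have hB := FW_log w hw W hW N
  have hC : ∑ m ∈ Icc 1 N, FW w m * Chebyshev.theta ((N:ℝ)/m) ≤ Real.log 4 * N * ∑ m ∈ Icc 1 N, FW w m / m := by
    rw [mul_sum]; apply sum_le_sum; intro m hm
    have := Chebyshev.theta_le_log4_mul_x (x := (N:ℝ)/m) (by positivity)
    calc _ ≤ FW w m * (Real.log 4 * (N/m)) := mul_le_mul_of_nonneg_left this (FW_nonneg hw m)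
      _ = _ := by ring
  have hD : Real.log N * ∑ n ∈ Icc 1 N, FW w n ≤ ∑ n ∈ Icc 1 N, FW w n * Real.log n + N * ∑ m ∈ Icc 1 N, FW w m / m := by
    rw [mul_sum, mul_sum, ← sum_add_distrib]; apply sum_le_sum; intro m hm
    rw [mem_Icc] at hm
    have hm0 : (0:ℝ) < m := by exact_mod_cast hm.1
    have h1 : Real.log N - Real.log m ≤ N / m := by
      rw [← Real.log_div (by positivity) (by positivity)]
      exact (Real.log_le_sub_one_of_pos (by positivity)).trans (by linarith)
    have := mul_le_mul_of_nonneg_left h1 (FW_nonneg hw m)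
    have e : FW w m * (N/m) = N * (FW w m / m) := by ring
    linarith
  rw [div_mul_eq_mul_div, div_mul_eq_mul_div, le_div_iff₀ hL]
  have hE : 0 ≤ W * Real.log 4 + 1 := by
    have : 0 ≤ Real.log 4 := Real.log_nonneg (by norm_num)
    positivity
  calc _ = Real.log N * ∑ n ∈ Icc 1 N, FW w n := mul_comm _ _
    _ ≤ N * (W * Real.log 4 + 1) * ∑ m ∈ Icc 1 N, FW w m / m := by
      have := mul_le_mul_of_nonneg_left hC hW0
      nlinarith
    _ ≤ _ := by gcongr

end FR

namespace FR
open Finset ArithmeticFunction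

noncomputable def x8 (n : ℕ) : ℝ := ((ZMod.χ₈ (n : ZMod 8) : ℤ) : ℝ)

lemma x8_mul (a b : ℕ) : x8 (a*b) = x8 a * x8 b := by
  unfold x8; rw [Nat.cast_mul, map_mul]; push_cast; rfl

lemma x8_mod (n : ℕ) : x8 n = x8 (n % 8) := by
  unfold x8; rw [ZMod.natCast_mod]

lemma x8_val (n : ℕ) : (n % 8 = 1 ∨ n % 8 = 7 → x8 n = 1) ∧ (n % 8 = 3 ∨ n % 8 = 5 → x8 n = -1) ∧ (n % 2 = 0 → x8 n = 0) := by
  rw [x8_mod]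
  have h : n % 8 < 8 := Nat.mod_lt _ (by norm_num)
  have h2 : n % 2 = (n % 8) % 2 := by omega
  rw [h2]
  generalize n % 8 = k at *
  have t : ∀ k : ℕ, k < 8 → (k = 1 ∨ k = 7 → ZMod.χ₈ (k : ZMod 8) = 1) ∧ (k = 3 ∨ k = 5 → ZMod.χ₈ (k : ZMod 8) = -1) ∧ (k % 2 = 0 → ZMod.χ₈ (k : ZMod 8) = 0) := by decide
  obtain ⟨a, b, c⟩ := t k h
  unfold x8
  refine ⟨fun h => ?_, fun h => ?_, fun h => ?_⟩
  · rw [a h]; simp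
  · rw [b h]; simp
  · rw [c h]; simp

lemma x8_abs (n : ℕ) : |x8 n| ≤ 1 := by
  obtain ⟨a, b, c⟩ := x8_val n
  have : n % 2 = 0 ∨ (n % 8 = 1 ∨ n % 8 = 7) ∨ (n % 8 = 3 ∨ n % 8 = 5) := by omega
  rcases this with h | h | h
  · rw [c h]; simp
  · rw [a h]; simp
  · rw [b h]; simp

lemma x8_psum (N : ℕ) : ∑ n ∈ range N, x8 n = if N % 8 = 2 ∨ N % 8 = 3 then 1 else if N % 8 = 6 ∨ N % 8 = 7 then -1 else 0 := by
  induction N with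
  | zero => simp
  | succ N ih =>
    rw [sum_range_succ, ih]
    obtain ⟨a, b, c⟩ := x8_val N
    have h : N % 8 < 8 := Nat.mod_lt _ (by norm_num)
    have e : (N+1) % 8 = (N % 8 + 1) % 8 := by omega
    have e2 : N % 2 = (N % 8) % 2 := by omega
    rw [e]; rw [e2] at c
    generalize N % 8 = k at *
    interval_cases k <;> simp_all

lemma x8_win (M N : ℕ) (h : M ≤ N) : |∑ n ∈ Ico M N, x8 n| ≤ 2 := by
  rw [sum_Ico_eq_sub _ h, x8_psum, x8_psum]
  split_ifs <;> norm_num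

noncomputable def LL (N : ℕ) : ℝ := ∑ n ∈ Ioc 0 N, x8 n / n

lemma LL_diff (M N : ℕ) (h : M ≤ N) : |LL N - LL M| ≤ 2 / (M+1) := by
  have h1 := abel_bound x8 (fun n => 1/(n:ℝ)) 2 (M+1) (fun N hN => x8_win _ _ hN)
    (fun n hn => by
      have : (0:ℝ) < n := by exact_mod_cast (by omega : 0 < n)
      apply one_div_le_one_div_of_le this; push_cast; linarith) (fun n hn => by positivity) (N+1) (by omega)
  have e : LL N - LL M = ∑ n ∈ Ico (M+1) (N+1), x8 n * (1/(n:ℝ)) := by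
    unfold LL
    rw [← sum_Ioc_consecutive _ (Nat.zero_le M) h, add_sub_cancel_left]
    apply sum_congr
    · ext x; simp only [mem_Ioc, mem_Ico]; omega
    · intros; ring
  rw [e]; refine h1.trans (le_of_eq ?_); push_cast; ring

lemma LL_seven : LL 7 = 1 - 1/3 - 1/5 + 1/7 := by
  have : LL 7 = ∑ n ∈ Ioc 0 7, x8 n / n := rfl
  rw [this]
  have z : ∀ n : ℕ, Ioc 0 (n+1) = insert (n+1) (Ioc 0 n) := fun n => by ext; simp; omega
  simp [z, (x8_val 1).1, (x8_val 2).2.2, (x8_val 3).2.1, (x8_val 4).2.2, (x8_val 5).2.1, (x8_val 6).2.2, (x8_val 7).1]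
  norm_num

lemma LL_ge (N : ℕ) (h : 1 ≤ N) : 1/3 ≤ LL N := by
  rcases Nat.lt_or_ge N 7 with h7 | h7
  · have : LL N = ∑ n ∈ Ioc 0 N, x8 n / n := rfl
    rw [this]
    have z : ∀ n : ℕ, Ioc 0 (n+1) = insert (n+1) (Ioc 0 n) := fun n => by ext; simp; omega
    interval_cases N <;> simp [z, (x8_val 1).1, (x8_val 2).2.2, (x8_val 3).2.1, (x8_val 4).2.2, (x8_val 5).2.1, (x8_val 6).2.2] <;> norm_num
  · have := (abs_le.1 (LL_diff 7 N h7)).1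
    rw [LL_seven] at this
    norm_num at this ⊢
    linarith

lemma log_sum_bd (N : ℕ) : |∑ n ∈ Ioc 0 N, x8 n * (Real.log n / n)| ≤ 2 := by
  rcases Nat.lt_or_ge N 2 with h | h
  · interval_cases N <;> simp
  have h1 := abel_bound x8 (fun n => Real.log n/(n:ℝ)) 2 3 (fun N hN => x8_win _ _ hN)
    (fun n hn => by
      have h3 : (3:ℝ) ≤ n := by exact_mod_cast hn
      have he := Real.exp_one_lt_d9
      apply Real.log_div_self_antitoneOn
      · show Real.exp 1 ≤ n; linarith
      · show Real.exp 1 ≤ ((n+1:ℕ):ℝ); push_cast; linarith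
      · push_cast; linarith) (fun n hn => by positivity) (N+1) (by omega)
  have e : ∑ n ∈ Ioc 0 N, x8 n * (Real.log n / n) = ∑ n ∈ Ico 3 (N+1), x8 n * (Real.log n/(n:ℝ)) := by
    rw [← sum_Ioc_consecutive _ (Nat.zero_le 2) h]
    rw [show Ioc 0 2 = {1,2} by decide]
    have : x8 2 = 0 := (x8_val 2).2.2 (by norm_num)
    simp [this]
    apply sum_congr
    · ext x; simp only [mem_Ioc, mem_Ico]; omega
    · intros; ring
  rw [e]; refine h1.trans ?_
  have : Real.log 3 ≤ 3 - 1 := Real.log_le_sub_one_of_pos (by norm_num)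
  push_cast
  linarith

noncomputable def fA : ArithmeticFunction ℝ := ⟨fun n => x8 n * vonMangoldt n / n, by simp⟩
noncomputable def gA : ArithmeticFunction ℝ := ⟨fun n => x8 n / n, by simp⟩

lemma fgA (n : ℕ) : (fA * gA) n = x8 n * (Real.log n / n) := by
  rw [mul_apply]
  have h : ∀ x ∈ n.divisorsAntidiagonal, fA x.1 * gA x.2 = (x8 n / n) * vonMangoldt x.1 := by
    intro x hx
    rw [Nat.mem_divisorsAntidiagonal] at hx
    show x8 x.1 * vonMangoldt x.1 / x.1 * (x8 x.2 / x.2) = _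
    rw [← hx.1, x8_mul]; push_cast; ring
  rw [sum_congr rfl h, ← mul_sum, Nat.sum_divisorsAntidiagonal (f := fun i _ => vonMangoldt i), vonMangoldt_sum]; ring

noncomputable def ML0 (N : ℕ) : ℝ := ∑ d ∈ Ioc 0 N, vonMangoldt d / d
noncomputable def ML8 (N : ℕ) : ℝ := ∑ d ∈ Ioc 0 N, x8 d * vonMangoldt d / d

lemma psi_bd (N : ℕ) : ∑ d ∈ Ioc 0 N, vonMangoldt d ≤ 6 * N := by
  have h := Chebyshev.psi_le_const_mul_self (x := (N:ℝ)) (by positivity)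
  rw [Chebyshev.psi, Nat.floor_natCast] at h
  have h4 : Real.log 4 ≤ 2 := by
    rw [show (4:ℝ) = 2^2 by norm_num, Real.log_pow]
    have := Real.log_two_lt_d9; push_cast; linarith
  have : (0:ℝ) ≤ N := by positivity
  nlinarith

lemma ML8_bd (N : ℕ) : |ML8 N| ≤ 42 := by
  rcases Nat.eq_zero_or_pos N with rfl | hN
  · simp [ML8]
  have h1 := sum_Ioc_mul_eq_sum_sum fA gA N
  rw [sum_congr rfl (fun n _ => fgA n)] at h1
  have h2 : ∑ n ∈ Ioc 0 N, fA n * ∑ m ∈ Ioc 0 (N / n), gA m = LL N * ML8 N - ∑ n ∈ Ioc 0 N, fA n * (LL N - LL (N/n)) := by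
    unfold ML8; rw [mul_sum, ← sum_sub_distrib]; apply sum_congr rfl; intro n _
    show fA n * LL (N/n) = LL N * fA n - _
    ring
  have h3 : |∑ n ∈ Ioc 0 N, fA n * (LL N - LL (N/n))| ≤ 12 := by
    refine (abs_sum_le_sum_abs _ _).trans ?_
    have hN0 : (0:ℝ) < N := by exact_mod_cast hN
    calc _ ≤ ∑ n ∈ Ioc 0 N, vonMangoldt n * (2/N) := by
          apply sum_le_sum; intro n hn
          rw [mem_Ioc] at hn
          have hn0 : (0:ℝ) < n := by exact_mod_cast hn.1
          rw [abs_mul]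
          have a1 : |fA n| ≤ vonMangoldt n / n := by
            show |x8 n * vonMangoldt n / n| ≤ _
            rw [abs_div, abs_mul, abs_of_pos hn0, abs_of_nonneg vonMangoldt_nonneg]
            have := x8_abs n
            have : |x8 n| * vonMangoldt n ≤ 1 * vonMangoldt n := mul_le_mul_of_nonneg_right this vonMangoldt_nonneg
            rw [one_mul] at this
            gcongr
          have a2 : |LL N - LL (N/n)| ≤ 2 * n / N := by
            refine (LL_diff _ _ (Nat.div_le_self _ _)).trans ?_
            rw [div_le_div_iff₀ (by positivity) hN0]
            have : N < (N/n + 1) * n := by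
              have := Nat.lt_div_mul_add (a := N) hn.1
              rw [Nat.add_mul]; omega
            have : (N:ℝ) < ((N/n:ℕ) + 1) * n := by exact_mod_cast this
            linarith
          calc _ ≤ vonMangoldt n / n * (2 * n / N) := mul_le_mul a1 a2 (abs_nonneg _) (div_nonneg vonMangoldt_nonneg hn0.le)
            _ = _ := by field_simp
      _ = (∑ n ∈ Ioc 0 N, vonMangoldt n) * (2/N) := by rw [sum_mul]
      _ ≤ (6*N) * (2/N) := mul_le_mul_of_nonneg_right (psi_bd N) (by positivity)
      _ = 12 := by field_simp; norm_num
  have h4 := log_sum_bd N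
  rw [h1, h2] at h4
  have h5 : |LL N * ML8 N| ≤ 14 := by
    have := abs_add_le (LL N * ML8 N - ∑ n ∈ Ioc 0 N, fA n * (LL N - LL (N/n))) (∑ n ∈ Ioc 0 N, fA n * (LL N - LL (N/n)))
    rw [sub_add_cancel] at this; linarith
  rw [abs_mul] at h5
  have := LL_ge N hN
  have h6 : |LL N| = LL N := abs_of_nonneg (by linarith)
  rw [h6] at h5
  have := abs_nonneg (ML8 N)
  nlinarith

lemma ML0_bd (N : ℕ) (hN : 1 ≤ N) : Real.log N - 1 ≤ ML0 N ∧ ML0 N ≤ Real.log N + 6 := by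
  have hN0 : (0:ℝ) < N := by exact_mod_cast hN
  have h1 := sum_Ioc_mul_zeta_eq_sum vonMangoldt N
  rw [vonMangoldt_mul_zeta] at h1
  have h2 : ∑ n ∈ Ioc 0 N, log n = Real.log (N.factorial) := by
    clear h1 hN0 hN
    induction N with
    | zero => simp
    | succ n ih =>
      rw [sum_Ioc_succ_top (Nat.zero_le n), ih, Nat.factorial_succ, Nat.cast_mul, Real.log_mul (by positivity) (by positivity), log_apply]; ring
  rw [h2] at h1
  have h3 : N * Real.log N - N ≤ Real.log (N.factorial) := by
    have := Real.pow_div_factorial_le_exp (x := (N:ℝ)) hN0.le N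
    have h5 := Real.log_le_log (by positivity) this
    rw [Real.log_exp, Real.log_div (by positivity) (by positivity), Real.log_pow] at h5
    linarith
  have h4 : Real.log (N.factorial) ≤ N * Real.log N := by
    rw [← Real.log_pow]
    apply Real.log_le_log (by positivity)
    exact_mod_cast Nat.factorial_le_pow N
  have h5 : ∑ n ∈ Ioc 0 N, vonMangoldt n * ((N/n:ℕ):ℝ) ≤ N * ML0 N := by
    unfold ML0; rw [mul_sum]; apply sum_le_sum; intro n hn
    calc _ ≤ vonMangoldt n * ((N:ℝ)/n) := mul_le_mul_of_nonneg_left Nat.cast_div_le vonMangoldt_nonneg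
      _ = _ := by ring
  have h6 : N * ML0 N ≤ ∑ n ∈ Ioc 0 N, vonMangoldt n * ((N/n:ℕ):ℝ) + ∑ d ∈ Ioc 0 N, vonMangoldt d := by
    unfold ML0; rw [mul_sum, ← sum_add_distrib]; apply sum_le_sum; intro n hn
    rw [mem_Ioc] at hn
    have hn0 : (0:ℝ) < n := by exact_mod_cast hn.1
    have : (N:ℝ)/n ≤ ((N/n:ℕ):ℝ) + 1 := by
      rw [div_le_iff₀ hn0]
      have : N < (N/n + 1) * n := by
        have := Nat.lt_div_mul_add (a := N) hn.1
        rw [Nat.add_mul]; omega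
      exact_mod_cast this.le
    calc _ = vonMangoldt n * ((N:ℝ)/n) := by ring
      _ ≤ vonMangoldt n * (((N/n:ℕ):ℝ) + 1) := mul_le_mul_of_nonneg_left this vonMangoldt_nonneg
      _ = _ := by ring
  have h7 := psi_bd N
  constructor
  · have : N * (Real.log N - 1) ≤ N * ML0 N := by nlinarith
    exact le_of_mul_le_mul_left this hN0
  · have : N * ML0 N ≤ N * (Real.log N + 6) := by nlinarith
    exact le_of_mul_le_mul_left this hN0

lemma psi8_ge : ∃ K : ℕ, 1 ≤ K ∧ ∀ N : ℕ, K ≤ N → (N:ℝ)/K ≤ ∑ d ∈ Ioc 0 N, (1 + x8 d) * vonMangoldt d := by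
  obtain ⟨K, hK⟩ := exists_nat_ge (Real.exp 92)
  have hK1 : 1 ≤ K := by
    have : (0:ℝ) < K := (Real.exp_pos _).trans_le hK
    exact_mod_cast this
  have hK0 : (0:ℝ) < K := by exact_mod_cast hK1
  refine ⟨K, hK1, fun N hN => ?_⟩
  have hlK : 92 ≤ Real.log K := by rw [Real.le_log_iff_exp_le hK0]; exact hK
  have hN0 : (0:ℝ) < N := by exact_mod_cast (by omega : 0 < N)
  set M := N / K with hM
  have hM1 : 1 ≤ M := (Nat.one_le_div_iff (by omega)).2 hN
  have hMN : M ≤ N := Nat.div_le_self _ _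
  have hlM : Real.log M ≤ Real.log N - Real.log K := by
    rw [← Real.log_div hN0.ne' hK0.ne']
    exact Real.log_le_log (by exact_mod_cast hM1) Nat.cast_div_le
  have a1 := (ML0_bd N (by omega)).1
  have a2 := (ML0_bd M hM1).2
  have a3 := abs_le.1 (ML8_bd N)
  have a4 := abs_le.1 (ML8_bd M)
  have h1 : ∑ d ∈ Ioc M N, (1 + x8 d) * vonMangoldt d / d = (ML0 N + ML8 N) - (ML0 M + ML8 M) := by
    unfold ML0 ML8
    rw [← sum_add_distrib, ← sum_add_distrib, ← sum_Ioc_consecutive _ (Nat.zero_le M) hMN, add_sub_cancel_left]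
    apply sum_congr rfl; intros; ring
  have hpos : ∀ d : ℕ, 0 ≤ (1 + x8 d) * vonMangoldt d := fun d =>
    mul_nonneg (by linarith [(abs_le.1 (x8_abs d)).1]) vonMangoldt_nonneg
  have h2 : ∑ d ∈ Ioc M N, (1 + x8 d) * vonMangoldt d / d ≤ (K/N) * ∑ d ∈ Ioc M N, (1 + x8 d) * vonMangoldt d := by
    rw [mul_sum]; apply sum_le_sum; intro d hd
    rw [mem_Ioc] at hd
    rw [div_eq_mul_inv, mul_comm]
    apply mul_le_mul_of_nonneg_right _ (hpos d)
    rw [inv_eq_one_div, div_le_div_iff₀ (by exact_mod_cast (by omega : 0 < d)) hN0, one_mul]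
    have : N < (M + 1) * K := by
      have := Nat.lt_div_mul_add (a := N) (b := K) (by omega)
      rw [← hM] at this
      rw [Nat.add_mul]; omega
    have h9 : N ≤ K * d := by nlinarith [hd.1]
    exact_mod_cast h9
  have h3 : ∑ d ∈ Ioc M N, (1 + x8 d) * vonMangoldt d ≤ ∑ d ∈ Ioc 0 N, (1 + x8 d) * vonMangoldt d :=
    sum_le_sum_of_subset_of_nonneg (Ioc_subset_Ioc_left (Nat.zero_le _)) fun d _ _ => hpos d
  have h4 : 1 ≤ (K/N) * ∑ d ∈ Ioc 0 N, (1 + x8 d) * vonMangoldt d := by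
    have : (1:ℝ) ≤ ∑ d ∈ Ioc M N, (1 + x8 d) * vonMangoldt d / d := by rw [h1]; linarith
    refine this.trans (h2.trans ?_)
    gcongr
  rw [div_le_iff₀ hK0]
  rw [div_mul_eq_mul_div, one_le_div hN0] at h4
  linarith

noncomputable def th8 (N : ℕ) : ℝ := ∑ p ∈ (Ioc 0 N).filter (fun p => p.Prime ∧ x8 p = 1), Real.log p

theorem th8_ge : ∃ c : ℝ, 0 < c ∧ ∃ N0 : ℕ, ∀ N : ℕ, N0 ≤ N → c * N ≤ th8 N := by
  obtain ⟨K, hK1, hK⟩ := psi8_ge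
  have hK0 : (0:ℝ) < K := by exact_mod_cast hK1
  have hlim : ∀ᶠ x : ℝ in Filter.atTop, 4 * √x * Real.log x + 1 ≤ x / (2*K) := by
    have h1 : (fun x : ℝ => 4 * √x * Real.log x + 1) =o[Filter.atTop] (fun x : ℝ => x) := by
      apply Asymptotics.IsLittleO.add
      · have h2 : (fun x : ℝ => Real.log x) =o[Filter.atTop] (fun x : ℝ => x ^ (1/2:ℝ)) := isLittleO_log_rpow_atTop (by norm_num)
        have h3 := (Asymptotics.isBigO_refl (fun x : ℝ => 4 * √x) Filter.atTop).mul_isLittleO h2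
        refine h3.trans_isBigO ?_
        apply Asymptotics.IsBigO.of_bound 4
        filter_upwards [Filter.eventually_ge_atTop 0] with x hx
        rw [← Real.sqrt_eq_rpow, mul_assoc, Real.mul_self_sqrt hx, norm_mul]; simp
      · exact Asymptotics.isLittleO_const_id_atTop 1
    have h2 := h1.bound (show (0:ℝ) < 1/(2*K) by positivity)
    filter_upwards [h2, Filter.eventually_ge_atTop 0] with x hx hx0
    rw [Real.norm_eq_abs, Real.norm_eq_abs, abs_of_nonneg hx0] at hx
    have := (le_abs_self _).trans hx
    rw [div_eq_mul_one_div, mul_comm x]; exact this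
  obtain ⟨x0, hx0⟩ := Filter.eventually_atTop.1 hlim
  refine ⟨1/(4*K), by positivity, max (max 1 K) ⌈x0⌉₊, fun N hN => ?_⟩
  have hNK : K ≤ N := (le_max_right _ _).trans ((le_max_left _ _).trans hN)
  have hN1 : 1 ≤ N := (le_max_left _ _).trans ((le_max_left _ _).trans hN)
  have h1 := hK N hNK
  have h2 := hx0 N ((Nat.le_ceil _).trans (by exact_mod_cast (le_max_right _ _).trans hN))
  have h3 := Chebyshev.psi_sub_theta_le (x := (N:ℝ)) (by exact_mod_cast hN1)
  rw [Chebyshev.psi_sub_theta_eq_sum_not_prime, Nat.floor_natCast] at h3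
  have h4 : ∑ d ∈ Ioc 0 N, (1 + x8 d) * vonMangoldt d ≤ 2 * ∑ n ∈ Ioc 0 N with ¬n.Prime, vonMangoldt n + 2 * th8 N + 1 := by
    rw [← sum_filter_add_sum_filter_not (Ioc 0 N) (fun n => n.Prime)]
    have b1 : ∑ d ∈ Ioc 0 N with ¬ d.Prime, (1 + x8 d) * vonMangoldt d ≤ 2 * ∑ n ∈ Ioc 0 N with ¬n.Prime, vonMangoldt n := by
      rw [mul_sum]; apply sum_le_sum; intro n _
      apply mul_le_mul_of_nonneg_right _ vonMangoldt_nonneg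
      linarith [(abs_le.1 (x8_abs n)).2]
    have b2 : ∑ d ∈ Ioc 0 N with d.Prime, (1 + x8 d) * vonMangoldt d ≤ 2 * th8 N + 1 := by
      have : ∀ d ∈ (Ioc 0 N).filter (fun n => n.Prime), (1 + x8 d) * vonMangoldt d ≤ (if x8 d = 1 then 2 * Real.log d else 0) + (if d = 2 then 1 else 0) := by
        intro d hd
        rw [mem_filter] at hd
        rw [vonMangoldt_apply_prime hd.2]
        obtain ⟨a, b, c⟩ := x8_val d
        by_cases hd2 : d = 2
        · subst hd2
          rw [c (by norm_num)]
          have := Real.log_two_lt_d9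
          norm_num; linarith
        · have hodd := hd.2.eq_two_or_odd.resolve_left hd2
          have : (d % 8 = 1 ∨ d % 8 = 7) ∨ (d % 8 = 3 ∨ d % 8 = 5) := by omega
          rcases this with h | h
          · rw [a h]; simp [hd2]; norm_num
          · rw [b h]; norm_num; split_ifs <;> norm_num
      refine (sum_le_sum this).trans ?_
      rw [sum_add_distrib]
      apply add_le_add
      · rw [th8, mul_sum, ← sum_filter, filter_filter]
      · rw [sum_ite_eq']; split_ifs <;> norm_num
    linarith
  have e1 : (N:ℝ)/K = 2 * ((N:ℝ)/(2*K)) := by field_simp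
  have e2 : 1/(4*(K:ℝ)) * N = (N:ℝ)/(2*K)/2 := by field_simp; norm_num
  rw [e2]; linarith

end FR

namespace FR
open Finset

lemma PS_mono (u v : ℕ → ℝ) (W : ℝ) (hu : ∀ p : Nat.Primes, |u p| ≤ W) (hv : ∀ p : Nat.Primes, |v p| ≤ W) (s : ℝ) (hs : 1 < s)
    (h : ∀ p : ℕ, p.Prime → u p ≤ v p) : PS u s ≤ PS v s := by
  apply Summable.tsum_le_tsum _ (summable_P u W hu s hs) (summable_P v W hv s hs)
  intro p
  exact mul_le_mul_of_nonneg_right (h p p.2) (by positivity)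

lemma PS_add (u v : ℕ → ℝ) (U V : ℝ) (hu : ∀ p : Nat.Primes, |u p| ≤ U) (hv : ∀ p : Nat.Primes, |v p| ≤ V) (s : ℝ) (hs : 1 < s) :
    PS (fun n => u n + v n) s = PS u s + PS v s := by
  unfold PS
  rw [← Summable.tsum_add (summable_P u U hu s hs) (summable_P v V hv s hs)]
  congr 1; ext p; ring

lemma PS_smul (c : ℝ) (u : ℕ → ℝ) (s : ℝ) : PS (fun n => c * u n) s = c * PS u s := by
  unfold PS
  rw [← tsum_mul_left]
  congr 1; ext p; ring

lemma PS_small (T : ℕ) (hT : 2 ≤ T) (s : ℝ) (hs : 1 < s) :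
    PS (fun p => if p ≤ T then 1 else 0) s ≤ Real.exp 1 * PS (fun _ => 1) (1 + 1/Real.log T) := by
  have hlT : 0 < Real.log T := Real.log_pos (by exact_mod_cast hT)
  have hs' : 1 < 1 + 1/Real.log T := by have : 0 < 1/Real.log T := by positivity
                                        linarith
  rw [← PS_smul]
  unfold PS
  apply Summable.tsum_le_tsum _ (summable_P (fun p => if p ≤ T then 1 else 0) 1 (fun p => by split_ifs <;> simp) s hs) (summable_P (fun _ => Real.exp 1 * 1) (Real.exp 1) (fun p => by rw [mul_one, abs_of_pos (Real.exp_pos 1)]) _ hs')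
  intro p
  have hp0 : (0:ℝ) < (p:ℕ) := by exact_mod_cast p.2.pos
  have hp1 : (1:ℝ) ≤ (p:ℕ) := by exact_mod_cast p.2.one_le
  split_ifs with h
  · rw [one_mul, mul_one]
    calc ((p:ℕ):ℝ)^(-s) ≤ ((p:ℕ):ℝ)^(-1:ℝ) := Real.rpow_le_rpow_of_exponent_le hp1 (by linarith)
      _ = ((p:ℕ):ℝ)^(1/Real.log T) * ((p:ℕ):ℝ)^(-(1+1/Real.log T)) := by rw [← Real.rpow_add hp0]; congr 1; ring
      _ ≤ _ := by
        apply mul_le_mul_of_nonneg_right _ (by positivity)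
        rw [Real.rpow_def_of_pos hp0]
        apply Real.exp_le_exp.2
        rw [mul_one_div, div_le_one hlT]
        exact Real.log_le_log hp0 (by exact_mod_cast h)
  · rw [zero_mul]; positivity

noncomputable def one0 : ℕ →*₀ ℝ where
  toFun n := if n = 0 then 0 else 1
  map_zero' := by simp
  map_one' := by simp
  map_mul' a b := by by_cases ha : a = 0 <;> by_cases hb : b = 0 <;> simp [ha, hb]

lemma PS_one : ∃ δ : ℝ, 0 < δ ∧ ∀ s, 1 < s → s ≤ 1 + δ → PS (fun _ => 1) s ≤ Real.log (2/(s-1)) := by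
  obtain ⟨δ, hδ, h⟩ := LS_one
  refine ⟨δ, hδ, fun s hs hs2 => ?_⟩
  have h1 := euler_le one0 (fun n => by show |if n = 0 then (0:ℝ) else 1| ≤ 1; split_ifs <;> simp) s hs
  have e1 : PS one0 s = PS (fun _ => 1) s := by
    unfold PS; congr 1; ext p
    show (if (p:ℕ) = 0 then (0:ℝ) else 1) * _ = _
    rw [if_neg p.2.ne_zero]
  have e2 : LS one0 s = LS (fun _ => 1) s := by
    unfold LS; congr 1; ext n
    show (if n = 0 then (0:ℝ) else 1) * _ = _
    split_ifs with h
    · subst h; rw [Nat.cast_zero, Real.zero_rpow (by linarith)]; simp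
    · rfl
  rw [e1, e2] at h1
  rw [Real.le_log_iff_exp_le (by apply div_pos <;> linarith)]
  exact h1.trans (h s hs hs2)

noncomputable def x8h : ℕ →*₀ ℝ where
  toFun n := x8 n
  map_zero' := (x8_val 0).2.2 (by norm_num)
  map_one' := (x8_val 1).1 (by norm_num)
  map_mul' a b := x8_mul a b

lemma LS8_ge (s : ℝ) (hs : 1 < s) : 1/3 ≤ LS x8 s := by
  have hsum := (summable_L x8 x8_abs s hs).of_norm.hasSum.tendsto_sum_nat
  refine ge_of_tendsto hsum ?_
  filter_upwards [Filter.eventually_ge_atTop 8] with N hN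
  rw [range_eq_Ico, ← sum_Ico_consecutive _ (Nat.zero_le 8) hN]
  have h1 : |∑ n ∈ Ico 8 N, x8 n * (n:ℝ)^(-s)| ≤ 2 * ((8:ℕ):ℝ)^(-s) := by
    apply abel_bound x8 (fun n => (n:ℝ)^(-s))
    · intro N hN; exact x8_win _ _ hN
    · intro n hn
      apply Real.rpow_le_rpow_of_nonpos
      · have : 0 < n := by omega
        exact_mod_cast this
      · push_cast; linarith
      · linarith
    · intros; positivity
    · exact hN
  have h2 : ∑ n ∈ Ico 0 8, x8 n * (n:ℝ)^(-s) = 1 - (3:ℝ)^(-s) - (5:ℝ)^(-s) + (7:ℝ)^(-s) := by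
    rw [← range_eq_Ico]
    simp [sum_range_succ, (x8_val 0).2.2, (x8_val 1).1, (x8_val 2).2.2, (x8_val 3).2.1, (x8_val 4).2.2, (x8_val 5).2.1, (x8_val 6).2.2, (x8_val 7).1]
    ring
  have hle : ∀ a : ℝ, 1 ≤ a → a^(-s) ≤ a⁻¹ := fun a ha => by
    rw [← Real.rpow_neg_one]; exact Real.rpow_le_rpow_of_exponent_le ha (by linarith)
  have h3 := hle 3 (by norm_num)
  have h5 := hle 5 (by norm_num)
  have h8 := hle 8 (by norm_num)
  have h87 : (8:ℝ)^(-s) ≤ (7:ℝ)^(-s) := Real.rpow_le_rpow_of_nonpos (by norm_num) (by norm_num) (by linarith)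
  have := (abs_le.1 h1).1
  push_cast at this
  rw [h2]
  norm_num at h3 h5 h8 ⊢
  linarith

lemma PS8_ge : ∃ C : ℝ, ∀ s, 1 < s → -C ≤ PS x8 s := by
  refine ⟨(∑' p : Nat.Primes, ((p:ℕ):ℝ)^(-2:ℝ)) - Real.log (1/3), fun s hs => ?_⟩
  have h := euler_ge x8h x8_abs s hs
  have h1 := (LS8_ge s hs).trans h
  rw [← Real.log_le_iff_le_exp (by norm_num)] at h1
  have e : PS x8h s = PS x8 s := rfl
  linarith

noncomputable def w8 (p : ℕ) : ℝ := if x8 p = 1 then 1 else 0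
noncomputable def w8' (p : ℕ) : ℝ := if x8 p = 1 then 0 else 1

lemma w8_nonneg (p : ℕ) : 0 ≤ w8 p := by unfold w8; split_ifs <;> norm_num
lemma w8'_nonneg (p : ℕ) : 0 ≤ w8' p := by unfold w8'; split_ifs <;> norm_num
lemma w8'_le (p : ℕ) : w8' p ≤ 1 := by unfold w8'; split_ifs <;> norm_num
lemma x8_prime (p : ℕ) (hp : p.Prime) (h2 : p ≠ 2) : x8 p = 1 ∨ x8 p = -1 := by
  obtain ⟨a, b, c⟩ := x8_val p
  have hodd := hp.eq_two_or_odd.resolve_left h2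
  have : (p % 8 = 1 ∨ p % 8 = 7) ∨ (p % 8 = 3 ∨ p % 8 = 5) := by omega
  rcases this with h | h
  · exact Or.inl (a h)
  · exact Or.inr (b h)

lemma x8_two : x8 2 = 0 := (x8_val 2).2.2 (by norm_num)

lemma PS_w8' (s : ℝ) (hs : 1 < s) : PS w8' s ≤ 1/2 * PS (fun _ => 1) s + (-1/2) * PS x8 s + 1 := by
  have h1 : PS (fun n => (1/2 * 1 + (-1/2) * x8 n) + (if n = 2 then 1 else 0)) s = 1/2 * PS (fun _ => 1) s + (-1/2) * PS x8 s + PS (fun n => if n = 2 then 1 else 0) s := by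
    rw [PS_add (fun n => 1/2 * 1 + (-1/2) * x8 n) (fun n => if n = 2 then 1 else 0) 1 1 _ _ s hs, PS_add (fun n => 1/2 * 1) (fun n => (-1/2) * x8 n) 1 1 _ _ s hs, PS_smul, PS_smul]
    · intro p; norm_num
    · intro p; rw [abs_mul]; have := x8_abs p; norm_num; linarith
    · intro p; have := abs_le.1 (x8_abs p); rw [abs_le]; constructor <;> linarith
    · intro p; split_ifs <;> norm_num
  have h2 : PS (fun n => if n = 2 then 1 else 0) s ≤ 1 := by
    have e : PS (fun n => if n = 2 then 1 else 0) s = (if (2:ℕ) = 2 then 1 else 0) * ((2:ℕ):ℝ)^(-s) := by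
      have hh : HasSum (fun p : Nat.Primes => (if (p:ℕ) = 2 then 1 else 0) * ((p:ℕ):ℝ)^(-s)) _ := hasSum_single (⟨2, Nat.prime_two⟩ : Nat.Primes) (fun b hb => by
        rw [if_neg, zero_mul]
        intro h; exact hb (Subtype.ext h))
      exact hh.tsum_eq
    rw [e]
    have := prime_rpow_le ⟨2, Nat.prime_two⟩ s hs
    norm_num at this ⊢; linarith
  have h3 : PS w8' s ≤ PS (fun n => (1/2 * 1 + (-1/2) * x8 n) + (if n = 2 then 1 else 0)) s := by
    apply PS_mono _ _ 2 _ _ s hs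
    · intro p hp
      by_cases h : p = 2
      · subst h; rw [x8_two]; simp; have := w8'_le 2; linarith
      · unfold w8'
        rcases x8_prime p hp h with e | e <;> rw [e] <;> norm_num [h]
    · intro p; rw [abs_of_nonneg (w8'_nonneg _)]; linarith [w8'_le p]
    · intro p; have := abs_le.1 (x8_abs p); rw [abs_le]; split_ifs <;> constructor <;> linarith
  linarith

lemma FW_w8 (n : ℕ) : FW w8 n = if Squarefree n ∧ ∀ p ∈ n.primeFactors, x8 p = 1 then 1 else 0 := by
  unfold FW w8
  by_cases h : Squarefree n
  · rw [if_pos h]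
    by_cases h2 : ∀ p ∈ n.primeFactors, x8 p = 1
    · rw [if_pos ⟨h, h2⟩]; exact prod_eq_one fun p hp => if_pos (h2 p hp)
    · rw [if_neg (fun h' => h2 h'.2)]
      push Not at h2
      obtain ⟨p, hp, h3⟩ := h2
      exact prod_eq_zero hp (if_neg h3)
  · rw [if_neg h, if_neg (fun h' => h h'.1)]

lemma split_n (n : ℕ) (hn : 1 ≤ n) : ∃ t : ℕ × ℕ × ℕ, n = t.1 * t.2.1 * t.2.2^2 ∧ FW w8 t.1 = 1 ∧ FW w8' t.2.1 = 1 := by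
  obtain ⟨k, l, h, hk⟩ := Nat.sq_mul_squarefree n
  have hprime : ∀ p ∈ k.primeFactors, p.Prime := fun p hp => Nat.prime_of_mem_primeFactors hp
  refine ⟨(∏ p ∈ k.primeFactors.filter (fun p => x8 p = 1), p, ∏ p ∈ k.primeFactors.filter (fun p => ¬ x8 p = 1), p, l), ?_, ?_, ?_⟩
  · dsimp only
    rw [prod_filter_mul_prod_filter_not, Nat.prod_primeFactors_of_squarefree hk, ← h]; ring
  · dsimp only
    have hdv : ∏ p ∈ k.primeFactors.filter (fun p => x8 p = 1), p ∣ k := by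
      conv_rhs => rw [← Nat.prod_primeFactors_of_squarefree hk]
      exact prod_dvd_prod_of_subset _ _ _ (filter_subset _ _)
    unfold FW
    rw [if_pos (hk.squarefree_of_dvd hdv), pf_prod_set _ (fun p hp => hprime p (mem_filter.1 hp).1)]
    exact prod_eq_one fun p hp => if_pos (mem_filter.1 hp).2
  · dsimp only
    have hdv : ∏ p ∈ k.primeFactors.filter (fun p => ¬ x8 p = 1), p ∣ k := by
      conv_rhs => rw [← Nat.prod_primeFactors_of_squarefree hk]
      exact prod_dvd_prod_of_subset _ _ _ (filter_subset _ _)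
    unfold FW
    rw [if_pos (hk.squarefree_of_dvd hdv), pf_prod_set _ (fun p hp => hprime p (mem_filter.1 hp).1)]
    exact prod_eq_one fun p hp => if_neg (mem_filter.1 hp).2

lemma sum_sq_inv (N : ℕ) : ∑ l ∈ Icc 1 N, 1/(l:ℝ)^2 ≤ 2 := by
  have : ∀ N : ℕ, ∑ l ∈ Icc 1 (N+1), 1/(l:ℝ)^2 ≤ 2 - 1/((N:ℝ)+1) := by
    intro N
    induction N with
    | zero => norm_num
    | succ N ih =>
      rw [sum_Icc_succ_top (by omega)]
      have : 1/((N+1+1:ℕ):ℝ)^2 ≤ 1/((N:ℝ)+1) - 1/((N:ℝ)+1+1) := by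
        rw [div_sub_div _ _ (by positivity) (by positivity), div_le_div_iff₀ (by positivity) (by positivity)]
        push_cast; nlinarith [(by positivity : (0:ℝ) ≤ N)]
      push_cast at *; linarith
  rcases N with _ | N
  · norm_num
  · refine (this N).trans ?_
    have : (0:ℝ) ≤ 1/((N:ℝ)+1) := by positivity
    linarith

lemma harm_prod (M : ℕ) : ∑ n ∈ Icc 1 M, 1/(n:ℝ) ≤ (∑ a ∈ Icc 1 M, FW w8 a / a) * ((∑ b ∈ Icc 1 M, FW w8' b / b) * 2) := by
  have h0 : ∀ a : ℕ, 0 ≤ FW w8 a / a := fun a => div_nonneg (FW_nonneg w8_nonneg a) (by positivity)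
  have h0' : ∀ a : ℕ, 0 ≤ FW w8' a / a := fun a => div_nonneg (FW_nonneg w8'_nonneg a) (by positivity)
  refine le_trans ?_ (mul_le_mul_of_nonneg_left (mul_le_mul_of_nonneg_left (sum_sq_inv M) (sum_nonneg fun b _ => h0' b)) (sum_nonneg fun b _ => h0 b))
  have hS : ∀ n : ℕ, ∃ t : ℕ × ℕ × ℕ, 1 ≤ n → n = t.1 * t.2.1 * t.2.2^2 ∧ FW w8 t.1 = 1 ∧ FW w8' t.2.1 = 1 := fun n => by
    by_cases h : 1 ≤ n
    · obtain ⟨t, ht⟩ := split_n n h; exact ⟨t, fun _ => ht⟩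
    · exact ⟨(0,0,0), fun h' => absurd h' h⟩
  choose t ht using hS
  calc _ = ∑ n ∈ Icc 1 M, FW w8 (t n).1 / (t n).1 * (FW w8' (t n).2.1 / (t n).2.1 * (1/((t n).2.2:ℝ)^2)) := by
        apply sum_congr rfl; intro n hn
        obtain ⟨e, e1, e2⟩ := ht n (mem_Icc.1 hn).1
        rw [e1, e2]; conv_lhs => rw [e]
        push_cast; rw [one_div, mul_inv, mul_inv]; ring
    _ = ∑ x ∈ (Icc 1 M).image t, FW w8 x.1 / x.1 * (FW w8' x.2.1 / x.2.1 * (1/(x.2.2:ℝ)^2)) := by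
        rw [sum_image]
        intro a ha b hb hab
        rw [mem_coe, mem_Icc] at ha hb
        rw [(ht a ha.1).1, (ht b hb.1).1, hab]
    _ ≤ ∑ x ∈ (Icc 1 M) ×ˢ ((Icc 1 M) ×ˢ (Icc 1 M)), FW w8 x.1 / x.1 * (FW w8' x.2.1 / x.2.1 * (1/(x.2.2:ℝ)^2)) := by
        apply sum_le_sum_of_subset_of_nonneg
        · intro x hx
          rw [mem_image] at hx
          obtain ⟨n, hn, rfl⟩ := hx
          rw [mem_Icc] at hn
          obtain ⟨e, -, -⟩ := ht n hn.1
          have hpos : 0 < (t n).1 * (t n).2.1 * (t n).2.2^2 := by omega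
          have p1 : 0 < (t n).1 := Nat.pos_of_ne_zero fun h => by simp [h] at hpos
          have p2 : 0 < (t n).2.1 := Nat.pos_of_ne_zero fun h => by simp [h] at hpos
          have p3 : 0 < (t n).2.2 := Nat.pos_of_ne_zero fun h => by simp [h] at hpos
          rw [mem_product, mem_product, mem_Icc, mem_Icc, mem_Icc]
          have d1 : (t n).1 ∣ n := ⟨(t n).2.1 * (t n).2.2^2, by rw [← mul_assoc]; exact e⟩
          have d2 : (t n).2.1 ∣ n := ⟨(t n).1 * (t n).2.2^2, e.trans (by ring)⟩
          have d3 : (t n).2.2 ∣ n := ⟨(t n).1 * (t n).2.1 * (t n).2.2, e.trans (by ring)⟩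
          exact ⟨⟨p1, (Nat.le_of_dvd hn.1 d1).trans hn.2⟩, ⟨p2, (Nat.le_of_dvd hn.1 d2).trans hn.2⟩, ⟨p3, (Nat.le_of_dvd hn.1 d3).trans hn.2⟩⟩
        · intro x _ _
          exact mul_nonneg (h0 _) (mul_nonneg (h0' _) (by positivity))
    _ = _ := by
        rw [sum_mul_sum (Icc 1 M) (Icc 1 M) (fun b : ℕ => FW w8' b / b), ← sum_product', sum_mul_sum, ← sum_product']

lemma sumw8_ge : ∃ c : ℝ, 0 < c ∧ ∃ M0 : ℕ, ∀ M : ℕ, M0 ≤ M → c * √(Real.log M) ≤ ∑ a ∈ Icc 1 M, FW w8 a / a := by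
  obtain ⟨δ, hδ, h1⟩ := PS_one
  obtain ⟨C, hC⟩ := PS8_ge
  obtain ⟨M0, hM0⟩ := exists_nat_ge (Real.exp (max 1 (1/δ)))
  set D := Real.exp 1 * (Real.exp (1/2 * C + 1) * √2) * 2 with hD
  refine ⟨1/D, by positivity, M0, fun M hM => ?_⟩
  have hMe : Real.exp (max 1 (1/δ)) ≤ M := hM0.trans (by exact_mod_cast hM)
  have hMpos : (0:ℝ) < M := (Real.exp_pos _).trans_le hMe
  have hl := (Real.le_log_iff_exp_le hMpos).2 hMe
  have hl1 : 1 ≤ Real.log M := (le_max_left _ _).trans hl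
  have hl2 : 1/δ ≤ Real.log M := (le_max_right _ _).trans hl
  set l := Real.log M with hldef
  have hl0 : 0 < l := by linarith
  set s := 1 + 1/l with hs
  have hs1 : 1 < s := by rw [hs]; have : 0 < 1/l := by positivity
                         linarith
  have hs2 : s ≤ 1 + δ := by
    rw [hs]; have : 1/l ≤ δ := by rw [div_le_iff₀ hl0]; rw [div_le_iff₀ hδ] at hl2; linarith
    linarith
  have a1 := h1 s hs1 hs2
  have a2 := hC s hs1
  have a3 := PS_w8' s hs1
  have a4 := FW_inv w8' w8'_nonneg 1 w8'_le M s hs1 (by rw [hs, add_sub_cancel_left, ← hldef]; rw [one_div, inv_mul_cancel₀ hl0.ne'])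
  have a5 := harm_prod M
  have a6 : l ≤ ∑ n ∈ Icc 1 M, 1/(n:ℝ) := by
    have h7 := log_add_one_le_harmonic M
    rw [harmonic_eq_sum_Icc] at h7; push_cast at h7
    have : Real.log M ≤ Real.log (M+1) := Real.log_le_log hMpos (by linarith)
    simp only [one_div]; linarith
  have e : 2/(s-1) = 2 * l := by rw [hs, add_sub_cancel_left]; field_simp
  rw [e] at a1
  have a7 : Real.exp (PS w8' s) ≤ Real.exp (1/2 * C + 1) * √2 * √l := by
    have : PS w8' s ≤ (1/2 * C + 1) + 1/2 * Real.log (2*l) := by linarith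
    refine (Real.exp_le_exp.2 this).trans (le_of_eq ?_)
    rw [Real.exp_add, mul_assoc, ← Real.sqrt_mul (by norm_num)]
    congr 1
    rw [Real.sqrt_eq_rpow, Real.rpow_def_of_pos (by positivity), mul_comm]
  have h0 : 0 ≤ ∑ a ∈ Icc 1 M, FW w8 a / a := sum_nonneg fun a _ => div_nonneg (FW_nonneg w8_nonneg a) (by positivity)
  have a8 : l ≤ (∑ a ∈ Icc 1 M, FW w8 a / a) * (D * √l) := by
    refine a6.trans (a5.trans (mul_le_mul_of_nonneg_left ?_ h0))
    have := mul_le_mul_of_nonneg_left a7 (Real.exp_pos 1).le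
    rw [hD]; nlinarith
  have hsq : l = √l * √l := (Real.mul_self_sqrt hl0.le).symm
  have hsl : 0 < √l := Real.sqrt_pos.2 hl0
  have hD0 : 0 < D := by positivity
  have a9 : √l * √l ≤ ((∑ a ∈ Icc 1 M, FW w8 a / a) * D) * √l := by rw [← hsq]; linarith
  have := le_of_mul_le_mul_right a9 hsl
  rw [one_div, inv_mul_le_iff₀ hD0]; linarith

noncomputable def Q8 (Y : ℕ) : ℝ := ∑ n ∈ Icc 1 Y, FW w8 n

lemma Q8_log (Y M : ℕ) (hM : M ≤ Y) : ∑ m ∈ Icc 1 M, FW w8 m * (th8 (Y/m) - Real.log m) ≤ Real.log Y * Q8 Y := by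
  have hlog : ∀ p : ℕ, p.Prime → 0 ≤ Real.log p := fun p hp => Real.log_nonneg (by exact_mod_cast hp.one_le)
  -- pairs
  set R := (Icc 1 M).sigma (fun m => (Ioc 0 (Y/m)).filter (fun p => (p.Prime ∧ x8 p = 1) ∧ ¬ p ∣ m)) with hR
  have h1 : ∑ m ∈ Icc 1 M, FW w8 m * (th8 (Y/m) - Real.log m) ≤ ∑ x ∈ R, FW w8 x.1 * Real.log x.2 := by
    rw [hR, sum_sigma]
    apply sum_le_sum; intro m hm
    rw [mem_Icc] at hm
    dsimp only
    rw [← mul_sum]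
    by_cases hs : Squarefree m
    swap
    · simp [FW, hs]
    apply mul_le_mul_of_nonneg_left _ (FW_nonneg w8_nonneg m)
    have h2 : th8 (Y/m) = ∑ p ∈ (Ioc 0 (Y/m)).filter (fun p => (p.Prime ∧ x8 p = 1) ∧ ¬ p ∣ m), Real.log p + ∑ p ∈ (Ioc 0 (Y/m)).filter (fun p => (p.Prime ∧ x8 p = 1) ∧ p ∣ m), Real.log p := by
      unfold th8
      rw [← sum_filter_add_sum_filter_not _ (fun p => ¬ p ∣ m), filter_filter, filter_filter]
      simp only [not_not]
    have h3 : ∑ p ∈ (Ioc 0 (Y/m)).filter (fun p => (p.Prime ∧ x8 p = 1) ∧ p ∣ m), Real.log p ≤ Real.log m := by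
      have : Real.log m = ∑ p ∈ m.primeFactors, Real.log p := by
        conv_lhs => rw [← Nat.prod_primeFactors_of_squarefree hs]
        rw [Nat.cast_prod, Real.log_prod]
        intro p hp; have := (Nat.prime_of_mem_primeFactors hp).pos; positivity
      rw [this]
      apply sum_le_sum_of_subset_of_nonneg
      · intro p hp; rw [mem_filter] at hp
        exact Nat.mem_primeFactors.2 ⟨hp.2.1.1, hp.2.2, by omega⟩
      · intro p hp _; exact hlog p (Nat.prime_of_mem_primeFactors hp)
    linarith
  refine h1.trans ?_
  have h4 : ∀ n ∈ Icc 1 Y, ∑ p ∈ n.primeFactors, FW w8 n * Real.log p ≤ Real.log Y * FW w8 n := by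
    intro n hn
    rw [mem_Icc] at hn
    rw [← mul_sum, mul_comm]
    by_cases hs : Squarefree n
    · apply mul_le_mul_of_nonneg_right _ (FW_nonneg w8_nonneg n)
      rw [← Real.log_prod (fun p hp => by have := (Nat.prime_of_mem_primeFactors hp).pos; positivity), ← Nat.cast_prod, Nat.prod_primeFactors_of_squarefree hs]
      exact Real.log_le_log (by exact_mod_cast hn.1) (by exact_mod_cast hn.2)
    · simp [FW, hs]
  unfold Q8
  rw [mul_sum]
  refine le_trans ?_ (sum_le_sum h4)
  rw [sum_sigma']
  calc _ = ∑ x ∈ R, FW w8 (x.2 * x.1) * Real.log x.2 := by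
        apply sum_congr rfl
        rintro ⟨m, p⟩ hx
        rw [hR, mem_sigma, mem_filter, mem_Icc] at hx
        obtain ⟨hm, hp, ⟨hpp, hp8⟩, hpm⟩ := hx
        dsimp only at *
        congr 1
        have hc : Nat.Coprime p m := (Nat.Prime.coprime_iff_not_dvd hpp).2 hpm
        rw [FW_w8, FW_w8]
        congr 1
        rw [Nat.squarefree_mul_iff, Nat.primeFactors_mul hpp.ne_zero (by omega), hpp.primeFactors]
        simp [hc, hpp.squarefree, hp8, Prime.squarefree, hpp.prime]
        try exact fun _ _ => hc
    _ = ∑ y ∈ R.image (fun x => (⟨x.2 * x.1, x.2⟩ : (_ : ℕ) × ℕ)), FW w8 y.1 * Real.log y.2 := by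
        rw [sum_image]
        rintro ⟨m, p⟩ hx ⟨m', p'⟩ hx' h
        rw [mem_coe, hR, mem_sigma, mem_filter] at hx hx'
        have h1 := congrArg Sigma.fst h
        have h2 := congrArg Sigma.snd h
        dsimp only at *
        subst h2
        rw [Nat.eq_of_mul_eq_mul_left hx.2.2.1.1.pos h1]
    _ ≤ _ := by
        apply sum_le_sum_of_subset_of_nonneg
        · rintro y hy
          rw [mem_image] at hy
          obtain ⟨⟨m, p⟩, hx, rfl⟩ := hy
          rw [hR, mem_sigma, mem_filter, mem_Icc, mem_Ioc] at hx
          obtain ⟨hm, hp, ⟨hpp, hp8⟩, hpm⟩ := hx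
          dsimp only at *
          rw [mem_sigma, mem_Icc]
          have := (Nat.le_div_iff_mul_le (by omega)).1 hp.2
          refine ⟨⟨Nat.mul_pos hpp.pos (by omega), this⟩, ?_⟩
          dsimp only
          exact Nat.mem_primeFactors.2 ⟨hpp, dvd_mul_right _ _, by have := Nat.mul_pos hpp.pos (by omega : 0 < m); omega⟩
        · rintro ⟨n, p⟩ hx _
          rw [mem_sigma] at hx
          exact mul_nonneg (FW_nonneg w8_nonneg _) (hlog p (Nat.prime_of_mem_primeFactors hx.2))

end FR

namespace FR
open Finset

lemma Q8_ge : ∃ c : ℝ, 0 < c ∧ ∃ N0 : ℕ, ∀ Y ≥ N0, c * Y / √(Real.log Y) ≤ Q8 Y := by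
  obtain ⟨c, hc, N1, h1⟩ := th8_ge
  obtain ⟨c2, hc2, M0, h2⟩ := sumw8_ge
  have hev : ∀ᶠ x : ℝ in Filter.atTop, c + Real.log x ≤ c/2 * x := by
    have := (Real.isLittleO_log_id_atTop).bound (show (0:ℝ) < c/4 by positivity)
    filter_upwards [this, Filter.eventually_ge_atTop (4:ℝ)] with x hx hx4
    rw [Real.norm_of_nonneg (Real.log_nonneg (by linarith)), id, Real.norm_of_nonneg (by linarith)] at hx
    nlinarith
  obtain ⟨x0, hx0⟩ := Filter.eventually_atTop.1 hev
  obtain ⟨K, hK⟩ := exists_nat_ge x0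
  refine ⟨c*c2/4, by positivity, (N1+M0+K+2)^2, fun Y hY => ?_⟩
  set M := Nat.sqrt Y with hMdef
  have hM : N1+M0+K+2 ≤ M := Nat.le_sqrt'.2 hY
  have hMM : M*M ≤ Y := Nat.sqrt_le Y
  have hM1 : Y < (M+1)*(M+1) := Nat.lt_succ_sqrt Y
  have hMY : M ≤ Y := by nlinarith
  have hY1 : 1 < Y := by nlinarith
  have hlY : 0 < Real.log Y := Real.log_pos (by exact_mod_cast hY1)
  have h3 := Q8_log Y M hMY
  have h4 : ∑ m ∈ Icc 1 M, (c/2*Y) * (FW w8 m / m) ≤ ∑ m ∈ Icc 1 M, FW w8 m * (th8 (Y/m) - Real.log m) := by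
    apply sum_le_sum; intro m hm
    rw [mem_Icc] at hm
    have hm0 : (0:ℝ) < m := by exact_mod_cast hm.1
    rw [show c/2*Y*(FW w8 m/m) = FW w8 m * (c/2*(Y/m)) by ring]
    apply mul_le_mul_of_nonneg_left _ (FW_nonneg w8_nonneg m)
    have hd : M ≤ Y/m := by
      rw [Nat.le_div_iff_mul_le hm.1]; exact (Nat.mul_le_mul_left M hm.2).trans hMM
    have h5 := h1 (Y/m) (by omega)
    have h6 : (Y:ℝ)/m - 1 ≤ ((Y/m:ℕ):ℝ) := by
      rw [sub_le_iff_le_add, div_le_iff₀ hm0]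
      have := Nat.lt_div_mul_add (a := Y) hm.1
      have h7 : (Y:ℝ) ≤ ((Y/m*m+m:ℕ):ℝ) := by exact_mod_cast this.le
      push_cast at h7; linarith
    have h8 := hx0 ((Y:ℝ)/m) (by
      have : (M:ℝ) ≤ ((Y/m:ℕ):ℝ) := by exact_mod_cast hd
      have h9 : ((Y/m:ℕ):ℝ) ≤ (Y:ℝ)/m := Nat.cast_div_le
      have h10 : (K:ℝ) ≤ M := by exact_mod_cast (by omega : K ≤ M)
      linarith)
    have h9 : Real.log m ≤ Real.log ((Y:ℝ)/m) := by
      apply Real.log_le_log hm0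
      rw [le_div_iff₀ hm0]
      have : m*m ≤ Y := (Nat.mul_le_mul hm.2 hm.2).trans hMM
      exact_mod_cast this
    nlinarith
  rw [← mul_sum] at h4
  have h5 := h2 M (by omega)
  have h6 : Real.log Y ≤ 4 * Real.log M := by
    have : Y ≤ M^4 := by
      have a : M + 1 ≤ M*M := by nlinarith
      calc Y ≤ (M+1)*(M+1) := hM1.le
        _ ≤ (M*M)*(M*M) := Nat.mul_le_mul a a
        _ = M^4 := by ring
    have h7 : Real.log Y ≤ Real.log ((M:ℝ)^4) := Real.log_le_log (by positivity) (by exact_mod_cast this)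
    rw [Real.log_pow] at h7; exact_mod_cast h7
  have h7 : √(Real.log Y) ≤ 2 * √(Real.log M) := by
    rw [show (2:ℝ) = √4 by rw [show (4:ℝ) = 2^2 by norm_num]; simp, ← Real.sqrt_mul (by norm_num)]
    exact Real.sqrt_le_sqrt h6
  have hs : 0 < √(Real.log Y) := Real.sqrt_pos.2 hlY
  have hss : √(Real.log Y) * √(Real.log Y) = Real.log Y := Real.mul_self_sqrt hlY.le
  have h8 : c*c2/4*Y*√(Real.log Y) ≤ Real.log Y * Q8 Y := by
    refine le_trans ?_ (h4.trans h3)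
    have h9 : c2/2*√(Real.log Y) ≤ ∑ i ∈ Icc 1 M, FW w8 i / i := by
      refine le_trans ?_ h5; nlinarith
    have := mul_le_mul_of_nonneg_left h9 (show 0 ≤ c/2*(Y:ℝ) by positivity)
    linarith
  rw [div_le_iff₀ hs]
  have h10 : √(Real.log Y) * (c*c2/4*Y) ≤ √(Real.log Y) * (Q8 Y * √(Real.log Y)) := by
    rw [show √(Real.log Y) * (Q8 Y * √(Real.log Y)) = Real.log Y * Q8 Y by linear_combination (Q8 Y) * hss]; linarith
  exact le_of_mul_le_mul_left h10 hs

/-- the count of admissible `d ≤ Y`. -/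
noncomputable def A0 (Y : ℕ) : ℕ := ((range (Y+1)).filter Adm).card

lemma x8_jac (p : ℕ) (hp : p.Prime) (h : x8 p = 1) : jacobiSym 2 p = 1 := by
  have ho : Odd p := by
    rcases hp.eq_two_or_odd' with h2 | h2
    · subst h2; rw [x8_two] at h; norm_num at h
    · exact h2
  rw [jacobiSym.at_two ho]
  unfold x8 at h
  exact_mod_cast h

lemma jac_x8 (p : ℕ) (hp : p.Prime) (h : jacobiSym 2 p = 1) : x8 p = 1 := by
  have ho : Odd p := hp.eq_two_or_odd'.resolve_left (ne_two h)
  rw [jacobiSym.at_two ho] at h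
  unfold x8
  exact_mod_cast h

lemma x8_one_of (n : ℕ) (hs : Squarefree n) (h : ∀ p ∈ n.primeFactors, x8 p = 1) : x8 n = 1 := by
  have : ∀ s : Finset ℕ, (∀ p ∈ s, x8 p = 1) → x8 (∏ p ∈ s, p) = 1 := by
    intro s
    induction s using Finset.induction_on with
    | empty => intro _; rw [prod_empty]; exact (x8_val 1).1 (by norm_num)
    | insert a s ha ih =>
      intro h
      rw [prod_insert ha, x8_mul, h a (mem_insert_self _ _), ih (fun p hp => h p (mem_insert_of_mem hp)), one_mul]
  have h2 := this _ h
  rwa [Nat.prod_primeFactors_of_squarefree hs] at h2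

lemma Q8_le (Y : ℕ) : Q8 Y ≤ 3 * A0 (7*Y) := by
  set S := (Icc 1 Y).filter (fun n => Squarefree n ∧ ∀ p ∈ n.primeFactors, x8 p = 1) with hS
  have hQ : Q8 Y = S.card := by
    unfold Q8
    rw [hS, card_filter]
    push_cast
    apply sum_congr rfl; intro n _; rw [FW_w8]
  have hmod : ∀ n ∈ S, n % 8 = 1 ∨ n % 8 = 7 := by
    intro n hn
    rw [hS, mem_filter] at hn
    have h := x8_one_of n hn.2.1 hn.2.2
    have hv := x8_val n
    by_contra hh
    have : (n%8=3 ∨ n%8=5) ∨ n%2=0 := by omega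
    rcases this with e | e
    · rw [hv.2.1 e] at h; norm_num at h
    · rw [hv.2.2 e] at h; norm_num at h
  set A := (range (7*Y+1)).filter Adm with hA
  have key : ∀ n, n ≤ 7*Y → n % 4 = 3 → Squarefree n → (∀ p, p.Prime → p ∣ n → x8 p = 1) → n ∈ A := by
    intro n a b c e
    rw [hA, mem_filter, mem_range]
    exact ⟨by omega, c, b, fun p hp hd => x8_jac p hp (e p hp hd)⟩
  have hSp : ∀ n ∈ S, 1 ≤ n ∧ n ≤ Y ∧ Squarefree n ∧ ∀ p, p.Prime → p ∣ n → x8 p = 1 := by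
    intro n hn
    rw [hS, mem_filter, mem_Icc] at hn
    exact ⟨hn.1.1, hn.1.2, hn.2.1, fun p hp hd => hn.2.2 p (Nat.mem_primeFactors.2 ⟨hp, hd, by omega⟩)⟩
  have hsub : S ⊆ S.filter (fun n => n % 8 = 7) ∪ (S.filter (fun n => n % 8 = 1 ∧ ¬ 7 ∣ n) ∪ S.filter (fun n => n % 8 = 1 ∧ 7 ∣ n)) := by
    intro n hn
    simp only [mem_union, mem_filter]
    have := hmod n hn
    tauto
  have c1 : (S.filter (fun n => n % 8 = 7)).card ≤ A.card := by
    apply card_le_card; intro n hn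
    rw [mem_filter] at hn
    obtain ⟨a, b, c, e⟩ := hSp n hn.1
    exact key n (by omega) (by omega) c e
  have h77 : x8 7 = 1 := (x8_val 7).1 (by norm_num)
  have p7 : Nat.Prime 7 := by norm_num
  have c2 : (S.filter (fun n => n % 8 = 1 ∧ ¬ 7 ∣ n)).card ≤ A.card := by
    apply card_le_card_of_injOn (fun n => 7*n)
    · intro n hn
      rw [mem_coe, mem_filter] at hn
      obtain ⟨a, b, c, e⟩ := hSp n hn.1
      apply key (7*n) (by omega) (by omega)
      · rw [Nat.squarefree_mul_iff]
        exact ⟨(Nat.Prime.coprime_iff_not_dvd p7).2 hn.2.2, p7.prime.squarefree, c⟩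
      · intro p hp hd
        rcases (Nat.Prime.dvd_mul hp).1 hd with h | h
        · rw [(Nat.prime_dvd_prime_iff_eq hp p7).1 h]; exact h77
        · exact e p hp h
    · intro a _ b _ h; dsimp only at h; omega
  have c3 : (S.filter (fun n => n % 8 = 1 ∧ 7 ∣ n)).card ≤ A.card := by
    apply card_le_card_of_injOn (fun n => n/7)
    · intro n hn
      rw [mem_coe, mem_filter] at hn
      obtain ⟨a, b, c, e⟩ := hSp n hn.1
      obtain ⟨k, rfl⟩ := hn.2.2
      have : 7*k/7 = k := by omega
      show 7*k/7 ∈ _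
      rw [this]
      apply key k (by omega) (by omega)
      · exact c.squarefree_of_dvd (Dvd.intro_left 7 rfl)
      · intro p hp hd
        exact e p hp (hd.mul_left 7)
    · intro a ha b hb h
      rw [mem_coe, mem_filter] at ha hb
      dsimp only at h; omega
  have h := (card_le_card hsub).trans ((card_union_le _ _).trans (Nat.add_le_add_left (card_union_le _ _) _))
  rw [hQ]
  have : S.card ≤ 3 * A.card := by omega
  exact_mod_cast this

lemma A0_mono {a b : ℕ} (h : a ≤ b) : A0 a ≤ A0 b := by
  apply card_le_card
  apply filter_subset_filter
  intro x hx; rw [mem_range] at *; omega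

lemma A0_ge : ∃ c : ℝ, 0 < c ∧ ∃ N0 : ℕ, ∀ Y ≥ N0, c * Y / √(Real.log Y) ≤ A0 Y := by
  obtain ⟨c, hc, N0, h⟩ := Q8_ge
  refine ⟨c/42, by positivity, 7*N0+14, fun Y hY => ?_⟩
  have h1 := h (Y/7) (by omega)
  have h2 := Q8_le (Y/7)
  have h3 : (A0 (7*(Y/7)) : ℝ) ≤ A0 Y := by exact_mod_cast A0_mono (by omega)
  have h4 : (Y:ℝ) ≤ 14 * ((Y/7:ℕ):ℝ) := by exact_mod_cast (by omega : Y ≤ 14*(Y/7))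
  have h5 : 0 < √(Real.log ((Y/7:ℕ):ℝ)) := Real.sqrt_pos.2 (Real.log_pos (by exact_mod_cast (by omega : 1 < Y/7)))
  have h6 : √(Real.log ((Y/7:ℕ):ℝ)) ≤ √(Real.log Y) := Real.sqrt_le_sqrt (Real.log_le_log (by exact_mod_cast (by omega : 0 < Y/7)) (by exact_mod_cast Nat.div_le_self _ _))
  calc c/42*Y/√(Real.log Y) ≤ c/42*Y/√(Real.log ((Y/7:ℕ):ℝ)) := by gcongr
    _ ≤ c/42*(14 * ((Y/7:ℕ):ℝ))/√(Real.log ((Y/7:ℕ):ℝ)) := by gcongr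
    _ = (c * ((Y/7:ℕ):ℝ)/√(Real.log ((Y/7:ℕ):ℝ)))/3 := by ring
    _ ≤ A0 Y := by linarith

end FR

namespace FR
open Finset

noncomputable def x4 (n : ℕ) : ℝ := ((ZMod.χ₄ (n : ZMod 4) : ℤ) : ℝ)

lemma x4_mul (a b : ℕ) : x4 (a*b) = x4 a * x4 b := by
  unfold x4; rw [Nat.cast_mul, map_mul]; push_cast; rfl

lemma x4_val (n : ℕ) : (n % 4 = 1 → x4 n = 1) ∧ (n % 4 = 3 → x4 n = -1) ∧ (n % 2 = 0 → x4 n = 0) := by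
  unfold x4
  refine ⟨fun h => ?_, fun h => ?_, fun h => ?_⟩
  · rw [ZMod.χ₄_nat_one_mod_four h]; norm_num
  · rw [ZMod.χ₄_nat_three_mod_four h]; norm_num
  · rw [ZMod.χ₄_nat_eq_if_mod_four, if_pos h]; norm_num

lemma x4_abs (n : ℕ) : |x4 n| ≤ 1 := by
  obtain ⟨a, b, c⟩ := x4_val n
  have : n % 2 = 0 ∨ n % 4 = 1 ∨ n % 4 = 3 := by omega
  rcases this with h | h | h
  · rw [c h]; norm_num
  · rw [a h]; norm_num
  · rw [b h]; norm_num

lemma x4_mod (n : ℕ) : x4 n = x4 (n % 4) := by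
  unfold x4; rw [ZMod.natCast_mod]

/-- a family of real characters modulo `8e`. -/
noncomputable def psi (i j : Bool) (e n : ℕ) : ℝ :=
  (if i then x4 n else 1) * (if j then x8 n else 1) * (jacobiSym n e : ℝ)

lemma psi_mul (i j : Bool) (e a b : ℕ) : psi i j e (a*b) = psi i j e a * psi i j e b := by
  unfold psi
  rw [Nat.cast_mul, jacobiSym.mul_left, x4_mul, x8_mul]
  push_cast
  split_ifs <;> ring

lemma psi_abs (i j : Bool) (e n : ℕ) : |psi i j e n| ≤ 1 := by
  unfold psi
  rw [abs_mul, abs_mul]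
  have h1 : |if i then x4 n else 1| ≤ 1 := by split_ifs; exact x4_abs n; simp
  have h2 : |if j then x8 n else 1| ≤ 1 := by split_ifs; exact x8_abs n; simp
  exact mul_le_one₀ (mul_le_one₀ h1 (abs_nonneg _) h2) (abs_nonneg _) (jac_abs _ _)

lemma psi_per (i j : Bool) (e n : ℕ) : psi i j e (n + 8*e) = psi i j e n := by
  unfold psi
  have h1 : x4 (n+8*e) = x4 n := by
    rw [x4_mod, x4_mod n]; congr 1; omega
  have h2 : x8 (n+8*e) = x8 n := by
    rw [x8_mod, x8_mod n]; congr 1; omega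
  have h3 : jacobiSym ((n+8*e : ℕ):ℤ) e = jacobiSym n e := by
    apply jacobiSym.mod_left'
    push_cast
    rw [Int.add_mul_emod_self_right]
  rw [h1, h2, h3]

lemma psi_nontriv (i j : Bool) (e : ℕ) (he : Squarefree e) (ho : e % 2 = 1) (h : e ≠ 1 ∨ i = true ∨ j = true) :
    ∃ u : ℕ, u.Coprime (8*e) ∧ psi i j e u ≠ 1 := by
  by_cases h1 : e = 1
  · subst h1
    rcases h with h | h
    · exact absurd rfl h
    · unfold psi
      have a3 : x4 3 = -1 := (x4_val 3).2.1 (by norm_num)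
      have b3 : x8 3 = -1 := (x8_val 3).2.1 (by norm_num)
      have a5 : x4 5 = 1 := (x4_val 5).1 (by norm_num)
      have b5 : x8 5 = -1 := (x8_val 5).2.1 (by norm_num)
      by_cases hi : i = true
      · by_cases hj : j = true
        · exact ⟨5, by norm_num, by rw [if_pos hi, if_pos hj, a5, b5]; norm_num⟩
        · exact ⟨3, by norm_num, by rw [if_pos hi, if_neg hj, a3]; norm_num⟩
      · have hj : j = true := h.resolve_left hi
        exact ⟨3, by norm_num, by rw [if_neg hi, if_pos hj, b3]; norm_num⟩
  · obtain ⟨p, hp, k, rfl⟩ := Nat.exists_prime_and_dvd h1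
    have hp2 : p ≠ 2 := by rintro rfl; omega
    have hsq := Nat.squarefree_mul_iff.1 he
    have hpc : p.Coprime (8*k) := by
      apply Nat.Coprime.mul_right _ hsq.1
      rw [show 8 = 2^3 by norm_num]
      exact Nat.Coprime.pow_right 3 ((Nat.coprime_primes hp Nat.prime_two).2 hp2)
    obtain ⟨u, hu, hur⟩ := exists_nonres p hp hp2 (8*k) hpc
    have hu8 : u % 8 = 1 := by
      have : u ≡ 1 [MOD 8] := hur.of_mul_right k
      exact this
    have huk : u ≡ 1 [MOD k] := hur.of_mul_left 8
    have hup : u.Coprime p := by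
      have h0 : jacobiSym u p ≠ 0 := by rw [hu]; norm_num
      haveI : NeZero p := ⟨hp.ne_zero⟩
      have h2 := jacobiSym.eq_zero_iff_not_coprime.not_left.1 h0
      rwa [Int.gcd_natCast_natCast] at h2
    refine ⟨u, ?_, ?_⟩
    · have h8k : u.Coprime (8*k) := by
        have := hur.gcd_eq
        rw [Nat.gcd_one_left] at this
        exact this
      rw [show 8*(p*k) = p*(8*k) by ring]
      exact Nat.Coprime.mul_right hup h8k
    · unfold psi
      rw [(x4_val u).1 (by omega), (x8_val u).1 (Or.inl hu8)]
      haveI : NeZero p := ⟨hp.ne_zero⟩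
      haveI : NeZero k := ⟨by rintro rfl; simp at ho⟩
      rw [jacobiSym.mul_right, hu]
      have : jacobiSym u k = 1 := by
        rw [jacobiSym.mod_left' (a₂ := 1)]
        · simp
        · exact_mod_cast huk
      rw [this]
      norm_num

lemma psi_zero (i j : Bool) (e : ℕ) (ho : e % 2 = 1) (h : e ≠ 1 ∨ i = true ∨ j = true) : psi i j e 0 = 0 := by
  unfold psi
  rcases h with h | h | h
  · rw [Nat.cast_zero, jacobiSym.zero_left (by omega)]; simp
  · rw [if_pos h, (x4_val 0).2.2 (by norm_num)]; simp
  · rw [if_pos h, (x8_val 0).2.2 (by norm_num)]; simp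

lemma PS_psi (i j : Bool) (e : ℕ) (he : Squarefree e) (ho : e % 2 = 1) (h : e ≠ 1 ∨ i = true ∨ j = true) (s : ℝ) (hs : 1 < s) :
    PS (psi i j e) s ≤ Real.log (Real.log (8*e) + 3) := by
  obtain ⟨u, hu, hgu⟩ := psi_nontriv i j e he ho h
  have h1 := LS_per (psi i j e) (8*e) (by omega) (psi_per i j e) (psi_mul i j e) (psi_abs i j e) u hu hgu s hs
  let g : ℕ →*₀ ℝ := ⟨⟨psi i j e, psi_zero i j e ho h⟩, by simp [psi, x4_val, x8_val], psi_mul i j e⟩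
  have h2 : Real.exp (PS (psi i j e) s) ≤ LS (psi i j e) s := euler_le g (psi_abs i j e) s hs
  have h3 := h2.trans h1
  push_cast at h3
  have h4 := Real.log_le_log (Real.exp_pos _) h3
  rwa [Real.log_exp] at h4

/-- comparison with characters. -/
lemma PS_cmp : ∃ δ : ℝ, 0 < δ ∧ ∀ (w : ℕ → ℝ) (i : Bool) (e T : ℕ) (a b V s : ℝ), 0 ≤ a → 0 ≤ b → 0 ≤ V →
    Squarefree e → e % 2 = 1 → (e ≠ 1 ∨ i = true) → 1 < s → s ≤ 1 + δ → 2 ≤ T → 1/Real.log T ≤ δ →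
    (∀ p, 0 ≤ w p) → (∀ p : ℕ, p.Prime → w p ≤ (1 + x8 p) * (a + b * psi i false e p) + V * (if p ≤ T then 1 else 0)) →
    PS w s ≤ a * Real.log (2/(s-1)) + (a + 2*b) * Real.log (Real.log (8*e)+3) + V * (Real.exp 1 * Real.log (2 * Real.log T)) := by
  obtain ⟨δ, hδ, h1⟩ := PS_one
  refine ⟨δ, hδ, fun w i e T a b V s ha hb hV he ho hnt hs hsδ hT hTδ hw hle => ?_⟩
  have hlT : 0 < Real.log T := Real.log_pos (by exact_mod_cast hT)
  have e1 : PS (psi false true e) s ≤ Real.log (Real.log (8*e)+3) := PS_psi false true e he ho (by simp) s hs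
  have hx8 : PS x8 s ≤ Real.log (Real.log (8*e)+3) := by
    have h2 := PS_psi false true 1 squarefree_one (by norm_num) (by simp) s hs
    have h3 : psi false true 1 = x8 := by ext n; simp [psi]
    rw [h3] at h2
    refine h2.trans ?_
    apply Real.log_le_log
    · have : 0 ≤ Real.log (8 * ((1:ℕ):ℝ)) := Real.log_nonneg (by norm_num)
      linarith
    · have : Real.log (8 * ((1:ℕ):ℝ)) ≤ Real.log (8*e) := by
        apply Real.log_le_log (by norm_num)
        have : (1:ℝ) ≤ e := by exact_mod_cast (by omega : 1 ≤ e)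
        push_cast; linarith
      linarith
  have e2 : PS (psi i false e) s ≤ Real.log (Real.log (8*e)+3) := PS_psi i false e he ho (by tauto) s hs
  have e3 : PS (psi i true e) s ≤ Real.log (Real.log (8*e)+3) := PS_psi i true e he ho (by tauto) s hs
  have e4 := h1 s hs hsδ
  have e5 := PS_small T hT s hs
  have e6 := h1 (1+1/Real.log T) (by have : 0 < 1/Real.log T := by positivity
                                     linarith) (by linarith)
  rw [show 2/(1+1/Real.log T - 1) = 2 * Real.log T by rw [add_sub_cancel_left]; field_simp] at e6
  have q : ∀ c x : ℝ, 0 ≤ c → |x| ≤ 1 → -c ≤ c*x ∧ c*x ≤ c := fun c x hc hx => by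
    rw [abs_le] at hx; constructor <;> nlinarith
  have q1 : ∀ p : ℕ, -a ≤ a * x8 p ∧ a * x8 p ≤ a := fun p => q a _ ha (x8_abs p)
  have q2 : ∀ p : ℕ, -b ≤ b * psi i false e p ∧ b * psi i false e p ≤ b := fun p => q b _ hb (psi_abs _ _ _ p)
  have q3 : ∀ p : ℕ, -b ≤ b * psi i true e p ∧ b * psi i true e p ≤ b := fun p => q b _ hb (psi_abs _ _ _ p)
  have q4 : ∀ p : ℕ, 0 ≤ V * (if p ≤ T then 1 else 0) ∧ V * (if p ≤ T then 1 else 0) ≤ V := fun p => by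
    split_ifs <;> constructor <;> linarith
  have hpp : ∀ p : ℕ, (1 + x8 p) * (a + b * psi i false e p) = (a * 1 + a * x8 p) + (b * psi i false e p + b * psi i true e p) := fun p => by
    have : psi i true e p = x8 p * psi i false e p := by cases i <;> simp [psi] <;> ring
    rw [this]; ring
  have hm : PS w s ≤ PS (fun p => (a * 1 + a * x8 p) + ((b * psi i false e p + b * psi i true e p) + V * (if p ≤ T then 1 else 0))) s := by
    apply PS_mono _ _ (2*a+2*b+V) _ _ s hs
    · intro p hp
      have h1 := hle p hp
      rw [hpp] at h1
      linarith
    · intro p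
      have h1 := hle p p.2
      rw [hpp] at h1
      have := q1 p; have := q2 p; have := q3 p; have := q4 p
      rw [abs_of_nonneg (hw p)]
      linarith
    · intro p
      have := q1 p; have := q2 p; have := q3 p; have := q4 p
      rw [abs_le]
      constructor <;> linarith
  rw [PS_add (fun p => a * 1 + a * x8 p) (fun p => (b * psi i false e p + b * psi i true e p) + V * (if p ≤ T then 1 else 0)) (2*a) (2*b+V) _ _ s hs,
    PS_add (fun p => a * 1) (fun p => a * x8 p) a a _ _ s hs,
    PS_add (fun p => b * psi i false e p + b * psi i true e p) (fun p => V * (if p ≤ T then 1 else 0)) (2*b) V _ _ s hs,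
    PS_add (fun p => b * psi i false e p) (fun p => b * psi i true e p) b b _ _ s hs, PS_smul, PS_smul, PS_smul, PS_smul, PS_smul] at hm
  · have e7 : PS (fun p => if p ≤ T then 1 else 0) s ≤ Real.exp 1 * Real.log (2 * Real.log T) :=
      e5.trans (mul_le_mul_of_nonneg_left e6 (Real.exp_pos 1).le)
    have := mul_le_mul_of_nonneg_left e4 ha
    have := mul_le_mul_of_nonneg_left hx8 ha
    have := mul_le_mul_of_nonneg_left e2 hb
    have := mul_le_mul_of_nonneg_left e3 hb
    have := mul_le_mul_of_nonneg_left e7 hV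
    linarith
  all_goals intro p
  all_goals have := q1 p; have := q2 p; have := q3 p; have := q4 p
  all_goals rw [abs_le]
  all_goals constructor <;> linarith

end FR

namespace FR
open Finset

lemma FW_ind (P : ℕ → Prop) [DecidablePred P] (n : ℕ) : FW (fun p => if P p then 1 else 0) n = if Squarefree n ∧ ∀ p ∈ n.primeFactors, P p then 1 else 0 := by
  unfold FW
  by_cases h : Squarefree n
  · rw [if_pos h]
    by_cases h2 : ∀ p ∈ n.primeFactors, P p
    · rw [if_pos ⟨h, h2⟩]; exact prod_eq_one fun p hp => if_pos (h2 p hp)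
    · rw [if_neg (fun h' => h2 h'.2)]
      push Not at h2
      obtain ⟨p, hp, h3⟩ := h2
      exact prod_eq_zero hp (if_neg h3)
  · rw [if_neg h, if_neg (fun h' => h h'.1)]

lemma Adm_pos {d : ℕ} (h : Adm d) : 1 ≤ d := by
  have := h.2.1; omega

/-- (a) many prime factors -/
lemma bad_omega : ∃ C : ℝ, ∃ N0 : ℕ, ∀ Y ≥ N0, ∀ Z : ℕ,
    (((range (Y+1)).filter (fun d => Adm d ∧ Z < d.primeFactors.card)).card : ℝ) * 3^Z ≤ C * (Y * (Real.log Y)^2) := by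
  obtain ⟨δ, hδ, h1⟩ := PS_one
  obtain ⟨N1, hN1⟩ := exists_nat_ge (Real.exp (1/δ))
  refine ⟨(3 * Real.log 4 + 1) * Real.exp 1 * 8, N1 + 2, fun Y hY Z => ?_⟩
  have hL : 0 < Real.log Y := Real.log_pos (by exact_mod_cast (by omega : 1 < Y))
  have hLδ : 1/Real.log Y ≤ δ := by
    rw [div_le_iff₀ hL]
    have : 1/δ ≤ Real.log Y := by
      rw [Real.le_log_iff_exp_le (by exact_mod_cast (by omega : 0 < Y))]
      exact hN1.trans (by exact_mod_cast (by omega : N1 ≤ Y))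
    rw [div_le_iff₀ hδ] at this; linarith
  have hs : 1 < 1 + 1/Real.log Y := by have : 0 < 1/Real.log Y := by positivity
                                       linarith
  have hU := Uprime (fun _ => 3) (fun _ => by norm_num) 3 (fun _ => le_rfl) Y (by omega) (1+1/Real.log Y) hs
    (by rw [add_sub_cancel_left]; field_simp; exact le_rfl)
  have h2 := h1 _ hs (by linarith)
  rw [show 2/(1+1/Real.log Y - 1) = 2 * Real.log Y by rw [add_sub_cancel_left]; field_simp] at h2
  have h3 : PS (fun _ => 3) (1+1/Real.log Y) = 3 * PS (fun _ => 1) (1+1/Real.log Y) := by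
    rw [← PS_smul]; simp
  have h4 : Real.exp (PS (fun _ => 3) (1+1/Real.log Y)) ≤ (2*Real.log Y)^3 := by
    rw [h3]
    calc _ ≤ Real.exp (3 * Real.log (2*Real.log Y)) := Real.exp_le_exp.2 (by linarith)
      _ = _ := by
        rw [show (3:ℝ) * Real.log (2*Real.log Y) = ((3:ℕ):ℝ) * Real.log (2*Real.log Y) by norm_num, Real.exp_nat_mul, Real.exp_log (by positivity)]
  have h5 : (((range (Y+1)).filter (fun d => Adm d ∧ Z < d.primeFactors.card)).card : ℝ) * 3^Z ≤ ∑ n ∈ Icc 1 Y, FW (fun _ => 3) n := by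
    rw [← nsmul_eq_mul, ← sum_const]
    calc _ ≤ ∑ d ∈ (range (Y+1)).filter (fun d => Adm d ∧ Z < d.primeFactors.card), FW (fun _ => 3) d := by
          apply sum_le_sum; intro d hd
          rw [mem_filter] at hd
          unfold FW
          rw [if_pos hd.2.1.1, prod_const]
          exact pow_le_pow_right₀ (by norm_num) hd.2.2.le
      _ ≤ _ := by
          apply sum_le_sum_of_subset_of_nonneg
          · intro d hd
            rw [mem_filter, mem_range] at hd
            exact mem_Icc.2 ⟨Adm_pos hd.2.1, by omega⟩
          · intro d _ _; exact FW_nonneg (fun _ => by norm_num) d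
  refine h5.trans (hU.trans ?_)
  have h6 : 0 ≤ Real.log 4 := Real.log_nonneg (by norm_num)
  calc _ ≤ (Y / Real.log Y) * (3 * Real.log 4 + 1) * (Real.exp 1 * (2*Real.log Y)^3) := by gcongr
    _ = _ := by field_simp; ring

noncomputable def w7 (T p : ℕ) : ℝ := if p ≤ T then 4 else if p % 8 = 7 then 1/2 else if p % 8 = 1 then 1 else 0

lemma pm_one {d p : ℕ} (h : Adm d) (hp : p ∈ d.primeFactors) : p % 8 = 1 ∨ p % 8 = 7 := by
  have hpp := Nat.prime_of_mem_primeFactors hp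
  have h1 := jac_x8 p hpp (h.2.2 p hpp (Nat.dvd_of_mem_primeFactors hp))
  have hv := x8_val p
  by_contra hh
  have : (p%8=3 ∨ p%8=5) ∨ p%2=0 := by omega
  rcases this with e | e
  · rw [hv.2.1 e] at h1; norm_num at h1
  · rw [hv.2.2 e] at h1; norm_num at h1

lemma FW_w7 (C T d : ℕ) (h : Adm d) (hb : ¬ 2 * (d.primeFactors.filter (fun p => p ≤ T)).card + C ≤ (d.primeFactors.filter (fun p => T < p ∧ vv p = 1)).card) :
    1 ≤ 2^C * FW (w7 T) d := by
  unfold FW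
  rw [if_pos h.1]
  have h1 : ∏ p ∈ d.primeFactors, w7 T p = ∏ p ∈ d.primeFactors, ((4:ℝ)^(if p ≤ T then 1 else 0) * (1/2:ℝ)^(if T < p ∧ vv p = 1 then 1 else 0)) := by
    apply prod_congr rfl
    intro p hp
    have := pm_one h hp
    unfold w7 vv
    by_cases hT : p ≤ T
    · simp [hT, Nat.not_lt.2 hT]
    · rcases this with e | e
      · have : p % 4 = 1 := by omega
        simp [hT, e, this]
      · have : p % 4 = 3 := by omega
        simp [hT, e, this]
  rw [h1, prod_mul_distrib, prod_pow_eq_pow_sum, prod_pow_eq_pow_sum, ← card_filter, ← card_filter]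
  rw [show (4:ℝ) = 2^2 by norm_num, ← pow_mul, ← mul_assoc, ← pow_add, one_div, inv_pow]
  rw [← div_eq_mul_inv, le_div_iff₀ (by positivity), one_mul]
  exact pow_le_pow_right₀ (by norm_num) (by omega)

lemma log_delta (δ : ℝ) (hδ : 0 < δ) : ∃ N1 : ℕ, ∀ Y ≥ N1, 2 ≤ Y ∧ 0 < Real.log Y ∧ 1/Real.log Y ≤ δ := by
  obtain ⟨N1, hN1⟩ := exists_nat_ge (Real.exp (1/δ))
  refine ⟨N1+2, fun Y hY => ?_⟩
  have hL : 0 < Real.log Y := Real.log_pos (by exact_mod_cast (by omega : 1 < Y))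
  refine ⟨by omega, hL, ?_⟩
  rw [div_le_iff₀ hL]
  have : 1/δ ≤ Real.log Y := by
    rw [Real.le_log_iff_exp_le (by exact_mod_cast (by omega : 0 < Y))]
    exact hN1.trans (by exact_mod_cast (by omega : N1 ≤ Y))
  rw [div_le_iff₀ hδ] at this; linarith

/-- (b) size-bad -/
lemma bad_size : ∃ K : ℝ, 0 ≤ K ∧ ∃ N0 : ℕ, ∀ Y ≥ N0, ∀ T ≥ N0, ∀ C : ℕ,
    (((range (Y+1)).filter (fun d => Adm d ∧ ¬ 2 * (d.primeFactors.filter (fun p => p ≤ T)).card + C ≤ (d.primeFactors.filter (fun p => T < p ∧ vv p = 1)).card)).card : ℝ)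
      ≤ K * 2^C * (Y / Real.log Y) * Real.exp (3/8 * Real.log (2 * Real.log Y) + 4 * (Real.exp 1 * Real.log (2 * Real.log T))) := by
  obtain ⟨δ, hδ, h1⟩ := PS_cmp
  obtain ⟨N1, hN1⟩ := log_delta δ hδ
  have h6 : 0 ≤ Real.log 4 := Real.log_nonneg (by norm_num)
  refine ⟨(4 * Real.log 4 + 1) * Real.exp 1 * Real.exp ((3/8 + 2*(1/8)) * Real.log (Real.log (8*((1:ℕ):ℝ))+3)), by positivity, N1, fun Y hY T hT C => ?_⟩
  obtain ⟨hY2, hL, hLδ⟩ := hN1 Y hY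
  obtain ⟨hT2, hLT, hTδ⟩ := hN1 T hT
  have hs : 1 < 1 + 1/Real.log Y := by have : 0 < 1/Real.log Y := by positivity
                                       linarith
  have hw0 : ∀ p, 0 ≤ w7 T p := fun p => by unfold w7; split_ifs <;> norm_num
  have hU := Uprime (w7 T) hw0 4 (fun p => by unfold w7; split_ifs <;> norm_num) Y (by omega) (1+1/Real.log Y) hs
    (by rw [add_sub_cancel_left]; field_simp; exact le_rfl)
  have h2 := h1 (w7 T) true 1 T (3/8) (1/8) 4 (1+1/Real.log Y) (by norm_num) (by norm_num) (by norm_num) squarefree_one (by norm_num) (by simp) hs (by linarith) hT2 hTδ hw0 (by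
    intro p hp
    have a8 := x8_val p
    have a4 := x4_val p
    have hpsi : psi true false 1 p = x4 p := by simp [psi]
    rw [hpsi]
    have c8 := abs_le.1 (x8_abs p)
    have c4 := abs_le.1 (x4_abs p)
    have hpos : 0 ≤ (1 + x8 p) * (3/8 + 1/8 * x4 p) := mul_nonneg (by linarith) (by linarith)
    unfold w7
    by_cases h : p ≤ T
    · rw [if_pos h, if_pos h]; linarith
    · rw [if_neg h, if_neg h]
      by_cases e : p % 8 = 7
      · rw [if_pos e, a8.1 (Or.inr e), a4.2.1 (by omega)]; norm_num
      · rw [if_neg e]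
        by_cases e' : p % 8 = 1
        · rw [if_pos e', a8.1 (Or.inl e'), a4.1 (by omega)]; norm_num
        · rw [if_neg e']; linarith)
  rw [show 2/(1+1/Real.log Y - 1) = 2 * Real.log Y by rw [add_sub_cancel_left]; field_simp] at h2
  have h5 : (((range (Y+1)).filter (fun d => Adm d ∧ ¬ 2 * (d.primeFactors.filter (fun p => p ≤ T)).card + C ≤ (d.primeFactors.filter (fun p => T < p ∧ vv p = 1)).card)).card : ℝ) ≤ 2^C * ∑ n ∈ Icc 1 Y, FW (w7 T) n := by
    rw [card_eq_sum_ones]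
    push_cast
    rw [mul_sum]
    refine (sum_le_sum (g := fun d => 2^C * FW (w7 T) d) ?_).trans ?_
    · intro d hd
      rw [mem_filter] at hd
      exact FW_w7 C T d hd.2.1 hd.2.2
    · apply sum_le_sum_of_subset_of_nonneg
      · intro d hd
        rw [mem_filter, mem_range] at hd
        exact mem_Icc.2 ⟨Adm_pos hd.2.1, by omega⟩
      · intro d _ _; exact mul_nonneg (by positivity) (FW_nonneg hw0 d)
  refine h5.trans ((mul_le_mul_of_nonneg_left hU (by positivity)).trans ?_)
  have h7 := Real.exp_le_exp.2 h2
  calc _ ≤ 2^C * ((Y / Real.log Y) * (4 * Real.log 4 + 1) * (Real.exp 1 * Real.exp (3/8 * Real.log (2 * Real.log Y) + (3/8+2*(1/8)) * Real.log (Real.log (8*((1:ℕ):ℝ))+3) + 4 * (Real.exp 1 * Real.log (2 * Real.log T))))) := by gcongr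
    _ = _ := by
      rw [show 3/8 * Real.log (2 * Real.log Y) + (3/8+2*(1/8)) * Real.log (Real.log (8*((1:ℕ):ℝ))+3) + 4 * (Real.exp 1 * Real.log (2 * Real.log T)) = (3/8+2*(1/8)) * Real.log (Real.log (8*((1:ℕ):ℝ))+3) + (3/8 * Real.log (2 * Real.log Y) + 4 * (Real.exp 1 * Real.log (2 * Real.log T))) by ring, Real.exp_add]
      ring

end FR

namespace FR
open Finset

noncomputable def wn (T : ℕ) (i : Bool) (e p : ℕ) : ℝ := if (p ≤ T ∨ (x8 p = 1 ∧ psi i false e p = 1)) then 1 else 0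

noncomputable def Es (T M : ℕ) : Finset ℕ := (Icc 2 M).filter (fun e => Squarefree e ∧ e % 2 = 1 ∧ ∀ p ∈ e.primeFactors, p ≤ T)

lemma wn_nonneg (T i e p) : 0 ≤ wn T i e p := by unfold wn; split_ifs <;> norm_num
lemma wn_le (T i e p) : wn T i e p ≤ 1 := by unfold wn; split_ifs <;> norm_num

def ntbad (T d : ℕ) : Prop := ∃ E ⊆ d.primeFactors.filter (fun p => p ≤ T), E.Nonempty ∧ ∃ c : ZMod 2, ∀ p ∈ d.primeFactors, T < p →
    ∑ q ∈ E, ls p q + c * vv p = 0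

lemma nt_exists (T Z d : ℕ) (hT : 1 ≤ T) (h : Adm d) (hZ : d.primeFactors.card ≤ Z) (hb : ntbad T d) :
    ∃ i : Bool, ∃ e ∈ Es T (T^Z), ∃ n, d = e * n ∧ FW (wn T i e) n = 1 := by
  obtain ⟨E, hE, hne, c, hc⟩ := hb
  have hEp : ∀ q ∈ E, q ∈ d.primeFactors ∧ q ≤ T := fun q hq => by
    have := hE hq; rwa [mem_filter] at this
  have hEpr : ∀ q ∈ E, q.Prime := fun q hq => Nat.prime_of_mem_primeFactors (hEp q hq).1
  set e := ∏ q ∈ E, q with he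
  have hpf : e.primeFactors = E := pf_prod_set E hEpr
  have hed : e ∣ d := by
    rw [← Nat.prod_primeFactors_of_squarefree h.1]
    exact prod_dvd_prod_of_subset _ _ _ (fun q hq => (hEp q hq).1)
  obtain ⟨n, hn⟩ := hed
  have hesq : Squarefree e := h.1.squarefree_of_dvd ⟨n, hn⟩
  have hodd : ∀ q ∈ d.primeFactors, q % 2 = 1 := fun q hq => by have := pm_one h hq; omega
  have heo : e % 2 = 1 := (vv_prod E (fun q => q) (fun q hq => hodd q (hEp q hq).1)).1
  have he2 : 2 ≤ e := by
    by_contra hlt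
    have : e = 1 := by omega
    rw [this, Nat.primeFactors_one] at hpf
    rw [← hpf] at hne; simp at hne
  have heT : e ≤ T^Z := by
    calc e ≤ ∏ q ∈ E, T := prod_le_prod' fun q hq => (hEp q hq).2
      _ = T^E.card := prod_const _
      _ ≤ T^Z := Nat.pow_le_pow_right hT ((card_le_card (fun q hq => (hEp q hq).1)).trans hZ)
  have hd0 : d ≠ 0 := by have := Adm_pos h; omega
  have hn0 : n ≠ 0 := by rintro rfl; simp at hn; exact hd0 hn
  refine ⟨xor (decide (c = 1)) (decide (e % 4 = 3)), e, ?_, n, hn, ?_⟩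
  · unfold Es
    rw [mem_filter, mem_Icc]
    exact ⟨⟨he2, heT⟩, hesq, heo, fun p hp => by rw [hpf] at hp; exact (hEp p hp).2⟩
  · unfold wn
    rw [FW_ind, if_pos]
    refine ⟨h.1.squarefree_of_dvd ⟨e, by rw [hn]; ring⟩, fun p hp => ?_⟩
    by_cases hpT : p ≤ T
    · exact Or.inl hpT
    right
    push Not at hpT
    have hpp := Nat.prime_of_mem_primeFactors hp
    have hpd : p ∈ d.primeFactors := Nat.mem_primeFactors.2 ⟨hpp, (Nat.dvd_of_mem_primeFactors hp).trans ⟨e, by rw [hn]; ring⟩, hd0⟩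
    refine ⟨jac_x8 p hpp (h.2.2 p hpp (Nat.dvd_of_mem_primeFactors hpd)), ?_⟩
    have h1 := hc p hpd hpT
    have h2 : chi (∑ q ∈ E, ls p q) = jacobiSym ((∏ j ∈ E, j : ℕ) : ℤ) p := chi_sum_ls E (fun q => q) p hpp (fun q hq => ⟨hEpr q hq, by have := (hEp q hq).2; omega⟩)
    have h3 := congrArg chi h1
    rw [chi_add, h2, ← he, chi_zero] at h3
    have hpo := hodd p hpd
    have h4 := jacobiSym.quadratic_reciprocity_if heo hpo
    have hp4 : p % 4 = 1 ∨ p % 4 = 3 := by omega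
    unfold psi
    simp only [Bool.false_eq_true, if_false, mul_one]
    rcases hp4 with hp4 | hp4
    · have hv : vv p = 0 := by simp [vv, hp4]
      rw [hv, mul_zero, chi_zero, mul_one] at h3
      rw [if_neg (by omega)] at h4
      rw [(x4_val p).1 hp4, h4, h3]; simp
    · have hv : vv p = 1 := by simp [vv, hp4]
      rw [hv, mul_one] at h3
      rw [(x4_val p).2.1 hp4]
      have h5 : ((if e % 4 = 3 then -jacobiSym p e else jacobiSym p e : ℤ) : ℝ) = jacobiSym e p := by
        rw [← h4]; congr 1; simp [hp4]
      rcases zcases c with hcc | hcc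
      · rw [hcc, chi_zero, mul_one] at h3
        rw [h3] at h5
        by_cases he4 : e % 4 = 3
        · rw [if_pos he4] at h5; push_cast at h5
          simp [hcc, he4]; linarith
        · rw [if_neg he4] at h5
          simp [hcc, he4]; exact_mod_cast h5
      · rw [hcc, chi_one] at h3
        have h6 : (jacobiSym e p : ℝ) = -1 := by linarith
        rw [h6] at h5
        by_cases he4 : e % 4 = 3
        · rw [if_pos he4] at h5; push_cast at h5
          simp [hcc, he4]; exact_mod_cast (by linarith : (jacobiSym p e : ℝ) = 1)
        · rw [if_neg he4] at h5
          simp [hcc, he4]; linarith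

lemma nt_count (T Z Y : ℕ) (hT : 1 ≤ T) :
    (((DD Y Z).filter (ntbad T)).card : ℝ) ≤ ∑ i : Bool, ∑ e ∈ Es T (T^Z), ∑ n ∈ Icc 1 (Y/e), FW (wn T i e) n := by
  have h1 : (DD Y Z).filter (ntbad T) ⊆ (univ : Finset Bool).biUnion (fun i => (Es T (T^Z)).biUnion (fun e => ((Icc 1 (Y/e)).filter (fun n => FW (wn T i e) n = 1)).image (fun n => e*n))) := by
    intro d hd
    rw [mem_filter] at hd
    unfold DD at hd
    rw [mem_filter, mem_range] at hd
    obtain ⟨i, e, he, n, hn, hF⟩ := nt_exists T Z d hT hd.1.2.1 hd.1.2.2 hd.2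
    have hd1 := Adm_pos hd.1.2.1
    simp only [mem_biUnion, mem_image, mem_filter, mem_univ, true_and]
    refine ⟨i, e, he, n, ⟨mem_Icc.2 ⟨?_, ?_⟩, hF⟩, hn.symm⟩
    · rcases Nat.eq_zero_or_pos n with h | h
      · rw [h, mul_zero] at hn; omega
      · exact h
    · unfold Es at he
      rw [mem_filter, mem_Icc] at he
      rw [Nat.le_div_iff_mul_le (by omega), mul_comm, ← hn]; omega
  have h2 := (card_le_card h1).trans (card_biUnion_le.trans (sum_le_sum fun i _ => card_biUnion_le.trans (sum_le_sum fun e _ => card_image_le)))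
  have h3 : (((DD Y Z).filter (ntbad T)).card : ℝ) ≤ ((∑ i : Bool, ∑ e ∈ Es T (T^Z), ((Icc 1 (Y/e)).filter (fun n => FW (wn T i e) n = 1)).card : ℕ) : ℝ) := by exact_mod_cast h2
  refine h3.trans ?_
  push_cast
  apply sum_le_sum; intro i _
  apply sum_le_sum; intro e _
  rw [card_filter]
  push_cast
  apply sum_le_sum; intro n _
  split_ifs with h
  · rw [h]
  · exact FW_nonneg (wn_nonneg T i e) n

lemma bad_nt : ∃ K : ℝ, 0 ≤ K ∧ ∃ N0 : ℕ, ∀ Y ≥ N0, ∀ T ≥ N0, ∀ Z : ℕ, 4 * (Z * Real.log T) ≤ Real.log Y →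
    (((DD Y Z).filter (ntbad T)).card : ℝ) ≤ K * (Y / Real.log Y) * Real.exp (1/4 * Real.log (2 * Real.log Y)
      + 3/4 * Real.log (Z * Real.log T + 6) + 2 * (Real.exp 1 * Real.log (2 * Real.log T))) := by
  obtain ⟨δ, hδ, h1⟩ := PS_cmp
  obtain ⟨N1, hN1⟩ := log_delta δ hδ
  have h6 : 0 ≤ Real.log 4 := Real.log_nonneg (by norm_num)
  refine ⟨4 * (1 * Real.log 4 + 1) * Real.exp 1 * Real.exp 1, by positivity, N1 + 256, fun Y hY T hT Z hZ => ?_⟩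
  obtain ⟨hY2, hL, hLδ⟩ := hN1 Y (by omega)
  obtain ⟨hT2, hLT, hTδ⟩ := hN1 T (by omega)
  have hs : 1 < 1 + 1/Real.log Y := by have : 0 < 1/Real.log Y := by positivity
                                       linarith
  have hY0 : (0:ℝ) < Y := by positivity
  refine (nt_count T Z Y (by omega)).trans ?_
  set G := Real.exp (1/4 * Real.log (2 * Real.log Y) + 3/4 * Real.log (Z * Real.log T + 6) + Real.exp 1 * Real.log (2 * Real.log T)) with hG
  have hTZ : Real.log ((T^Z:ℕ):ℝ) ≤ Real.log Y / 4 := by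
    push_cast; rw [Real.log_pow]; linarith
  have hin : ∀ i : Bool, ∀ e ∈ Es T (T^Z), ∑ n ∈ Icc 1 (Y/e), FW (wn T i e) n ≤ (1/e) * (2 * (Y/Real.log Y) * (1 * Real.log 4 + 1) * (Real.exp 1 * G)) := by
    intro i e he
    unfold Es at he
    rw [mem_filter, mem_Icc] at he
    obtain ⟨⟨he2, heT⟩, hesq, heo, hep⟩ := he
    have he0 : (0:ℝ) < e := by exact_mod_cast (by omega : 0 < e)
    have hle : Real.log e ≤ Real.log Y / 4 := (Real.log_le_log he0 (by exact_mod_cast heT)).trans hTZ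
    have heZ : Real.log e ≤ Z * Real.log T := by
      have := Real.log_le_log he0 (by exact_mod_cast heT : (e:ℝ) ≤ ((T^Z:ℕ):ℝ))
      push_cast at this; rwa [Real.log_pow] at this
    have he4 : (e:ℝ)^4 ≤ Y := by
      rw [← Real.log_le_log_iff (by positivity) hY0, Real.log_pow]; push_cast; linarith
    have he4' : e^4 ≤ Y := by exact_mod_cast he4
    -- N
    set N := Y/e with hN
    have hNe : Y < N * e + e := Nat.lt_div_mul_add (by omega)
    have hNN : Y ≤ N * N := by
      by_contra hlt
      push Not at hlt
      have a1 : N + 1 ≥ e^3 := by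
        by_contra hh
        push Not at hh
        have : N * e + e < e^3 * e := by nlinarith
        have e5 : e^3 * e = e^4 := by ring
        omega
      have a2 : Y < (N+1)*e := by linarith
      have a3 : e * 4 ≤ e^3 := by
        have : 4 ≤ e^2 := by nlinarith
        calc e*4 ≤ e*e^2 := Nat.mul_le_mul_left _ this
          _ = e^3 := by ring
      have a4 : e ≤ N/2 := by omega
      have a5 : N ≥ 7 := by omega
      have a6 : e * 2 ≤ N := by omega
      nlinarith
    have hN2 : 2 ≤ N := by
      by_contra hlt
      have : N ≤ 1 := by omega
      nlinarith
    have hN0 : (0:ℝ) < N := by exact_mod_cast (by omega : 0 < N)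
    have hlN : Real.log Y ≤ 2 * Real.log N := by
      have : Real.log Y ≤ Real.log ((N:ℝ)*N) := Real.log_le_log hY0 (by exact_mod_cast hNN)
      rw [Real.log_mul hN0.ne' hN0.ne'] at this; linarith
    have hlN' : Real.log N ≤ Real.log Y := Real.log_le_log hN0 (by exact_mod_cast Nat.div_le_self Y e)
    have hU := Uprime (wn T i e) (wn_nonneg T i e) 1 (wn_le T i e) N hN2 (1+1/Real.log Y) hs
      (by rw [add_sub_cancel_left, one_div, inv_mul_le_iff₀ hL]; linarith)
    have h2 := h1 (wn T i e) i e T (1/4) (1/4) 1 (1+1/Real.log Y) (by norm_num) (by norm_num) (by norm_num) hesq heo (Or.inl (by omega)) hs (by linarith) hT2 hTδ (wn_nonneg T i e) (by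
      intro p hp
      have c8 := abs_le.1 (x8_abs p)
      have c4 := abs_le.1 (psi_abs i false e p)
      have hpos : 0 ≤ (1 + x8 p) * (1/4 + 1/4 * psi i false e p) := mul_nonneg (by linarith) (by linarith)
      unfold wn
      by_cases h : p ≤ T
      · rw [if_pos (Or.inl h), if_pos h]; linarith
      · rw [if_neg h]
        by_cases e : x8 p = 1 ∧ psi i false e p = 1
        · rw [if_pos (Or.inr e), e.1, e.2]; norm_num
        · rw [if_neg (by tauto)]; linarith)
    rw [show 2/(1+1/Real.log Y - 1) = 2 * Real.log Y by rw [add_sub_cancel_left]; field_simp] at h2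
    have h8 : Real.log (8*e) + 3 ≤ Z * Real.log T + 6 := by
      rw [Real.log_mul (by norm_num) he0.ne']
      have : Real.log 8 ≤ 3 := by
        rw [show (8:ℝ) = 2^3 by norm_num, Real.log_pow]
        have := Real.log_two_lt_d9; push_cast; linarith
      linarith
    have h9 : Real.log (Real.log (8*e) + 3) ≤ Real.log (Z * Real.log T + 6) := by
      apply Real.log_le_log _ h8
      have : 0 ≤ Real.log (8*e) := Real.log_nonneg (by
        have : (1:ℝ) ≤ e := by exact_mod_cast (by omega : 1 ≤ e)
        linarith)
      linarith
    have h7 : Real.exp (PS (wn T i e) (1+1/Real.log Y)) ≤ G := by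
      apply Real.exp_le_exp.2; linarith
    have h10 : (N:ℝ) / Real.log N ≤ (1/e) * (2 * (Y/Real.log Y)) := by
      have hlNp : 0 < Real.log N := by linarith
      rw [div_le_iff₀ hlNp]
      have b1 : (N:ℝ) ≤ Y/e := Nat.cast_div_le
      calc (N:ℝ) ≤ Y/e := b1
        _ = (1/e) * (2*(Y/Real.log Y)) * (Real.log Y/2) := by field_simp
        _ ≤ _ := by gcongr; linarith
    refine hU.trans ?_
    calc _ ≤ (1/e) * (2 * (Y/Real.log Y)) * (1 * Real.log 4 + 1) * (Real.exp 1 * G) := by gcongr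
      _ = _ := by ring
  have hsum : ∑ e ∈ Es T (T^Z), (1:ℝ)/e ≤ Real.exp 1 * Real.exp (Real.exp 1 * Real.log (2 * Real.log T)) := by
    have hF := FW_inv (fun p => if p ≤ T then 1 else 0) (fun p => by split_ifs <;> norm_num) 1 (fun p => by split_ifs <;> norm_num) (T^Z) (1+1/Real.log Y) hs
      (by rw [add_sub_cancel_left, one_div, inv_mul_le_iff₀ hL]; linarith)
    have h2 := h1 (fun p => if p ≤ T then 1 else 0) true 1 T 0 0 1 (1+1/Real.log Y) le_rfl le_rfl (by norm_num) squarefree_one (by norm_num) (by simp) hs (by linarith) hT2 hTδ (fun p => by split_ifs <;> norm_num) (fun p _ => by simp)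
    refine le_trans ?_ (hF.trans (mul_le_mul_of_nonneg_left (Real.exp_le_exp.2 (h2.trans (by linarith))) (Real.exp_pos 1).le))
    refine (sum_le_sum (g := fun e : ℕ => FW (fun p => if p ≤ T then 1 else 0) e / e) ?_).trans (sum_le_sum_of_subset_of_nonneg ?_ ?_)
    · intro e he
      unfold Es at he
      rw [mem_filter] at he
      rw [FW_ind, if_pos ⟨he.2.1, he.2.2.2⟩]
    · intro e he
      unfold Es at he
      rw [mem_filter, mem_Icc] at he
      exact mem_Icc.2 ⟨by omega, he.1.2⟩
    · intro e _ _
      exact div_nonneg (FW_nonneg (fun p => by split_ifs <;> norm_num) e) (by positivity)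
  calc _ ≤ ∑ i : Bool, ∑ e ∈ Es T (T^Z), (1/(e:ℝ)) * (2 * (Y/Real.log Y) * (1 * Real.log 4 + 1) * (Real.exp 1 * G)) :=
        sum_le_sum fun i _ => sum_le_sum fun e he => hin i e he
    _ = 2 * ((∑ e ∈ Es T (T^Z), (1:ℝ)/e) * (2 * (Y/Real.log Y) * (1 * Real.log 4 + 1) * (Real.exp 1 * G))) := by
        rw [sum_const, ← sum_mul]; simp
    _ ≤ 2 * ((Real.exp 1 * Real.exp (Real.exp 1 * Real.log (2 * Real.log T))) * (2 * (Y/Real.log Y) * (1 * Real.log 4 + 1) * (Real.exp 1 * G))) := by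
        gcongr
    _ = _ := by
        rw [hG, show 1/4 * Real.log (2 * Real.log Y) + 3/4 * Real.log (Z * Real.log T + 6) + 2 * (Real.exp 1 * Real.log (2 * Real.log T)) = Real.exp 1 * Real.log (2 * Real.log T) + (1/4 * Real.log (2 * Real.log Y) + 3/4 * Real.log (Z * Real.log T + 6) + Real.exp 1 * Real.log (2 * Real.log T)) by ring, Real.exp_add (Real.exp 1 * Real.log (2 * Real.log T))]
        ring

end FR

namespace FR
open Finset Filter

lemma ev_helper (F : ℝ → ℝ) (K η : ℝ) (hη : 0 < η) (hF : ∀ᶠ l in atTop, F l ≤ -l/2 - l/100) :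
    ∀ᶠ l in atTop, K * Real.exp (F l) ≤ η * Real.exp (-l/2) := by
  have h1 : Tendsto (fun l : ℝ => |K| * Real.exp (-(l/100))) atTop (nhds (|K| * 0)) := by
    apply Tendsto.const_mul
    apply Real.tendsto_exp_neg_atTop_nhds_zero.comp
    exact tendsto_id.atTop_div_const (by norm_num)
  rw [mul_zero] at h1
  filter_upwards [hF, h1.eventually_lt_const hη] with l h2 h3
  calc K * Real.exp (F l) ≤ |K| * Real.exp (-l/2 - l/100) := by
        gcongr; exact le_abs_self K
    _ = (|K| * Real.exp (-(l/100))) * Real.exp (-l/2) := by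
        rw [mul_assoc, ← Real.exp_add]; congr 2; ring
    _ ≤ _ := by gcongr

lemma ev_log : ∀ᶠ l : ℝ in atTop, 0 ≤ Real.log l ∧ Real.log l ≤ l/10000 := by
  have := (Real.isLittleO_log_id_atTop).bound (show (0:ℝ) < 1/10000 by positivity)
  filter_upwards [this, Filter.eventually_ge_atTop (4:ℝ)] with x hx hx4
  rw [Real.norm_of_nonneg (Real.log_nonneg (by linarith)), id, Real.norm_of_nonneg (by linarith)] at hx
  exact ⟨Real.log_nonneg (by linarith), by linarith⟩

lemma log4l {l : ℝ} (hl : 1 ≤ l) : Real.log (4*l^3) ≤ 2 + 3 * Real.log l := by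
  rw [Real.log_mul (by norm_num) (by positivity), Real.log_pow]
  have : Real.log 4 ≤ 2 := by
    rw [show (4:ℝ) = 2^2 by norm_num, Real.log_pow]
    have := Real.log_two_lt_d9; push_cast; linarith
  push_cast; linarith

lemma ev_all (K η : ℝ) (hη : 0 < η) : ∀ᶠ l : ℝ in atTop,
    K * Real.exp (-(2*l)) ≤ η * Real.exp (-l/2) ∧
    K * Real.exp (-l + 3/8 * (Real.log 2 + l) + 4 * (Real.exp 1 * Real.log (4*l^3))) ≤ η * Real.exp (-l/2) ∧
    K * Real.exp (-l + 1/4 * (Real.log 2 + l) + 3/4 * Real.log (10*l^4+6) + 2 * (Real.exp 1 * Real.log (4*l^3))) ≤ η * Real.exp (-l/2) ∧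
    K * Real.exp (35*l^2 + 24*l - l^3/12) ≤ η * Real.exp (-l/2) := by
  have he : Real.exp 1 < 3 := lt_trans Real.exp_one_lt_d9 (by norm_num)
  have hl2 := Real.log_two_lt_d9
  have e1 := ev_helper (fun l => -(2*l)) K η hη (by
    filter_upwards [eventually_ge_atTop (0:ℝ)] with l hl; linarith)
  have key : ∀ l : ℝ, 1 ≤ l → 0 ≤ Real.log l → Real.exp 1 * Real.log (4*l^3) ≤ 3 * (2 + 3 * Real.log l) := by
    intro l h1 h2
    have := log4l h1
    have h0 : 0 ≤ Real.log (4*l^3) := Real.log_nonneg (by nlinarith [one_le_pow₀ h1 (n := 3)])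
    nlinarith [Real.exp_pos 1]
  have e2 := ev_helper (fun l => -l + 3/8 * (Real.log 2 + l) + 4 * (Real.exp 1 * Real.log (4*l^3))) K η hη (by
    filter_upwards [eventually_ge_atTop (1000:ℝ), ev_log] with l hl hlog
    have := key l (by linarith) hlog.1
    linarith)
  have e3 := ev_helper (fun l => -l + 1/4 * (Real.log 2 + l) + 3/4 * Real.log (10*l^4+6) + 2 * (Real.exp 1 * Real.log (4*l^3))) K η hη (by
    filter_upwards [eventually_ge_atTop (1000:ℝ), ev_log] with l hl hlog
    have h1 := key l (by linarith) hlog.1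
    have h2 : Real.log (10*l^4+6) ≤ 4 + 4 * Real.log l := by
      have hp : (1:ℝ) ≤ l^4 := one_le_pow₀ (by linarith)
      have : Real.log (10*l^4+6) ≤ Real.log (2^4*l^4) := Real.log_le_log (by positivity) (by linarith)
      rw [Real.log_mul (by norm_num) (by positivity), Real.log_pow, Real.log_pow] at this
      push_cast at this; linarith
    linarith)
  have e4 := ev_helper (fun l => 35*l^2 + 24*l - l^3/12) K η hη (by
    filter_upwards [eventually_ge_atTop (1000:ℝ)] with l hl
    have h1 : 1000 * l^2 ≤ l^3 := by
      have : l^3 = l * l^2 := by ring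
      rw [this]; exact mul_le_mul_of_nonneg_right hl (by positivity)
    have h2 : 1000 * l ≤ l^2 := by nlinarith
    linarith)
  filter_upwards [e1, e2, e3, e4] with l a b c d
  exact ⟨a, b, c, d⟩

lemma ev_misc (N0 : ℕ) : ∀ᶠ l : ℝ in atTop, 10 ≤ l ∧ 40 * l^4 ≤ Real.exp l ∧ (N0:ℝ) ≤ Real.exp (l^3) ∧ 2 ≤ Real.exp (l^3/12) := by
  have h1 : ∀ᶠ l : ℝ in atTop, 40 * l^4 ≤ Real.exp l := by
    have := (Real.isLittleO_pow_exp_atTop (n := 4)).bound (show (0:ℝ) < 1/40 by positivity)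
    filter_upwards [this, eventually_ge_atTop (0:ℝ)] with l hl h0
    rw [Real.norm_of_nonneg (by positivity), Real.norm_of_nonneg (Real.exp_pos l).le] at hl
    linarith
  filter_upwards [h1, eventually_ge_atTop (12:ℝ), eventually_ge_atTop (N0:ℝ)] with l a b c
  have h3 : l ≤ l^3 := by nlinarith [sq_nonneg l]
  refine ⟨by linarith, a, ?_, ?_⟩
  · have := Real.add_one_le_exp (l^3); linarith
  · have := Real.add_one_le_exp (l^3/12); linarith

lemma ll_tendsto : Tendsto (fun Y : ℕ => Real.log (Real.log Y)) atTop atTop :=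
  Real.tendsto_log_atTop.comp (Real.tendsto_log_atTop.comp tendsto_natCast_atTop_atTop)

end FR

namespace FR
open Finset Filter

lemma not_good {C T d : ℕ} (h : ¬ good C T d) :
    (¬ 2 * (d.primeFactors.filter (fun p => p ≤ T)).card + C ≤ (d.primeFactors.filter (fun p => T < p ∧ vv p = 1)).card) ∨ ntbad T d := by
  by_contra hh
  push Not at hh
  apply h
  refine ⟨hh.1, fun E hE hne c => ?_⟩
  by_contra h3
  push Not at h3
  exact hh.2 ⟨E, hE, hne, c, h3⟩

lemma err_bound (Y Z : ℕ) (l κ : ℝ) (hY : (1:ℝ) ≤ Y) (hl : 10 ≤ l) (hL : Real.log Y = Real.exp l) (hZ : (Z:ℝ) ≤ 5*l) (hκ : κ = Real.exp (l^3/12)) :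
    (Z + 1) * (2 ^ (Z ^ 2) * ((2 * 4 ^ Z) ^ 2 * (13 * (Y * (Real.log Y + 1) ^ 2 / κ)) * (1 + Real.log Y) ^ Z)) ≤ Y * (52 * Real.exp (35*l^2 + 24*l - l^3/12)) := by
  have hZ0 : (0:ℝ) ≤ Z := by positivity
  have a1 : (Z:ℝ)+1 ≤ Real.exp (5*l) := (Real.add_one_le_exp _).trans (Real.exp_le_exp.2 hZ)
  have he1 : (2:ℝ) ≤ Real.exp 1 := by have := Real.add_one_le_exp (1:ℝ); linarith
  have a2 : (2:ℝ)^(Z^2) ≤ Real.exp (25*l^2) := by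
    calc (2:ℝ)^(Z^2) ≤ (Real.exp 1)^(Z^2) := pow_le_pow_left₀ (by norm_num) he1 _
      _ = Real.exp ((Z:ℝ)^2) := by rw [← Real.exp_nat_mul]; push_cast; rw [mul_one]
      _ ≤ _ := Real.exp_le_exp.2 (by nlinarith)
  have a3 : (2 * (4:ℝ) ^ Z) ^ 2 ≤ 4 * Real.exp (15*l) := by
    have : (16:ℝ) ≤ Real.exp 3 := by
      have h : Real.exp 3 = (Real.exp 1)^3 := by rw [← Real.exp_nat_mul]; norm_num
      have h2 := Real.exp_one_gt_d9
      rw [h]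
      calc (16:ℝ) ≤ (2.7)^3 := by norm_num
        _ ≤ _ := pow_le_pow_left₀ (by norm_num) (by linarith) 3
    calc (2 * (4:ℝ) ^ Z) ^ 2 = 4 * (16:ℝ)^Z := by
          rw [mul_pow, ← pow_mul, mul_comm Z 2, pow_mul]; norm_num
      _ ≤ 4 * (Real.exp 3)^Z := by gcongr
      _ = 4 * Real.exp (Z*3) := by rw [← Real.exp_nat_mul]
      _ ≤ _ := mul_le_mul_of_nonneg_left (Real.exp_le_exp.2 (by linarith)) (by norm_num)
  have a4 : 1 + Real.log Y ≤ Real.exp (2*l) := by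
    rw [hL, two_mul, Real.exp_add]
    have := Real.add_one_le_exp l
    nlinarith
  have a4' : 0 ≤ 1 + Real.log Y := by rw [hL]; positivity
  have a5 : (Real.log Y + 1)^2 ≤ Real.exp (4*l) := by
    calc (Real.log Y + 1)^2 ≤ (Real.exp (2*l))^2 := by
          rw [add_comm]; exact pow_le_pow_left₀ a4' a4 2
      _ = _ := by rw [← Real.exp_nat_mul]; congr 1; push_cast; ring
  have a6 : (1 + Real.log Y)^Z ≤ Real.exp (10*l^2) := by
    calc (1 + Real.log Y)^Z ≤ (Real.exp (2*l))^Z := pow_le_pow_left₀ a4' a4 Z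
      _ = Real.exp (Z*(2*l)) := by rw [← Real.exp_nat_mul]
      _ ≤ _ := Real.exp_le_exp.2 (by nlinarith)
  calc _ ≤ Real.exp (5*l) * (Real.exp (25*l^2) * ((4 * Real.exp (15*l)) * (13 * (Y * Real.exp (4*l) / κ)) * Real.exp (10*l^2))) := by
        rw [hκ]; gcongr
    _ = Y * (52 * (Real.exp (5*l) * Real.exp (25*l^2) * Real.exp (15*l) * Real.exp (4*l) * Real.exp (10*l^2) * Real.exp (-(l^3/12)))) := by
        rw [hκ, Real.exp_neg, div_eq_mul_inv]; ring
    _ = _ := by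
        simp only [← Real.exp_add]; congr 3; ring

set_option maxHeartbeats 1000000 in
theorem anatomy (r : ℕ) (ε : ℝ) (hε : 0 < ε) : ∃ N0 : ℕ, ∀ Y ≥ N0,
    |∑ d ∈ (range (Y+1)).filter Adm, ((if RR d = 2 ^ r then 1 else 0) - piR r)| ≤ ε * A0 Y := by
  obtain ⟨C, hC⟩ := main_sum r (ε/2) (by positivity)
  obtain ⟨c, hc, NA, hA⟩ := A0_ge
  obtain ⟨K1, N1, h1⟩ := bad_omega
  obtain ⟨K2, hK2, N2, h2⟩ := bad_size
  obtain ⟨K3, hK3, N3, h3⟩ := bad_nt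
  set P := 1 + |piR r| with hP
  have hP0 : 0 < P := by positivity
  set η := ε*c/(8*P) with hη
  have hη0 : 0 < η := by positivity
  have hηle : P * η = ε*c/8 := by rw [hη]; field_simp
  have hev := ((ev_all K1 η hη0).and ((ev_all (K2*2^C) η hη0).and ((ev_all K3 η hη0).and ((ev_all 52 (ε*c/8) (by positivity)).and (ev_misc (N2+N3))))))
  have hev2 := ll_tendsto.eventually hev
  obtain ⟨NE, hNE⟩ := eventually_atTop.1 hev2
  refine ⟨NE+NA+N1+N2+N3+3, fun Y hY => ?_⟩
  obtain ⟨⟨b1,_⟩, ⟨_,b2,_⟩, ⟨_,_,b3,_⟩, ⟨_,_,_,b4⟩, m1, m2, m3, m4⟩ := hNE Y (by omega)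
  set l := Real.log (Real.log Y) with hl
  have hY3 : (3:ℝ) ≤ Y := by exact_mod_cast (by omega : 3 ≤ Y)
  have hL0 : 0 < Real.log Y := Real.log_pos (by linarith)
  have hL : Real.log Y = Real.exp l := by rw [hl, Real.exp_log hL0]
  set Z := ⌈4*l⌉₊ with hZ
  have hZ1 : 4*l ≤ Z := Nat.le_ceil _
  have hZ2 : (Z:ℝ) ≤ 5*l := by
    have := Nat.ceil_lt_add_one (show 0 ≤ 4*l by linarith); linarith
  set T := ⌈Real.exp (l^3)⌉₊ with hT
  have hT1 : Real.exp (l^3) ≤ T := Nat.le_ceil _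
  have hTN : N2 + N3 ≤ T := by exact_mod_cast m3.trans hT1
  have hl3 : (1:ℝ) ≤ l^3 := one_le_pow₀ (by linarith)
  have hT2 : Real.log T ≤ 2*l^3 := by
    have h := Nat.ceil_lt_add_one (show 0 ≤ Real.exp (l^3) by positivity)
    have h5 : (T:ℝ) ≤ Real.exp (2*l^3) := by
      rw [two_mul, Real.exp_add]
      have := Real.add_one_le_exp (l^3)
      nlinarith
    have hTpos : (0:ℝ) < T := lt_of_lt_of_le (Real.exp_pos _) hT1
    have := Real.log_le_log hTpos h5
    rwa [Real.log_exp] at this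
  have hT3 : l^3 ≤ Real.log T := by
    have := Real.log_le_log (Real.exp_pos _) hT1
    rwa [Real.log_exp] at this
  have hM := hC T Y Z (Real.exp (l^3/12)) m4 (by
    rw [← Real.exp_nat_mul]
    refine le_trans (le_of_eq ?_) hT1
    congr 1; push_cast; ring)
  have herr := err_bound Y Z l _ (by linarith) m1 hL hZ2 rfl
  have hsq : √(Real.log Y) = Real.exp (l/2) := by
    rw [hL, Real.sqrt_eq_iff_mul_self_eq (Real.exp_pos _).le (Real.exp_pos _).le, ← Real.exp_add]; congr 1; ring
  have hAY := hA Y (by omega)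
  have hAY2 : c * (Y * Real.exp (-l/2)) ≤ A0 Y := by
    refine le_trans (le_of_eq ?_) hAY
    rw [hsq, show -l/2 = -(l/2) by ring, Real.exp_neg]; ring
  set W := (Y:ℝ) * Real.exp (-l/2) with hW
  have hY0 : (0:ℝ) ≤ Y := by linarith
  -- the four bounds
  have c4 := herr.trans (mul_le_mul_of_nonneg_left b4 hY0)
  have c1 : (((range (Y+1)).filter (fun d => Adm d ∧ Z < d.primeFactors.card)).card : ℝ) ≤ η * W := by
    have h := h1 Y (by omega) Z
    have h3Z : Real.exp (4*l) ≤ (3:ℝ)^Z := by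
      have he : Real.exp 1 ≤ 3 := (lt_trans Real.exp_one_lt_d9 (by norm_num)).le
      calc Real.exp (4*l) ≤ Real.exp Z := Real.exp_le_exp.2 hZ1
        _ = (Real.exp 1)^Z := by rw [← Real.exp_nat_mul, mul_one]
        _ ≤ _ := pow_le_pow_left₀ (Real.exp_pos _).le he _
    have h6 := (mul_le_mul_of_nonneg_left h3Z (Nat.cast_nonneg _)).trans h
    have h7 : K1 * (Y * (Real.log Y)^2) = (Y * (K1 * Real.exp (-(2*l)))) * Real.exp (4*l) := by
      rw [hL, ← Real.exp_nat_mul, show Y * (K1 * Real.exp (-(2*l))) * Real.exp (4*l) = K1 * (Y * (Real.exp (-(2*l)) * Real.exp (4*l))) by ring, ← Real.exp_add]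
      congr 3; push_cast; ring
    rw [h7] at h6
    have h8 := le_of_mul_le_mul_right h6 (Real.exp_pos _)
    refine h8.trans ((mul_le_mul_of_nonneg_left b1 hY0).trans (le_of_eq ?_))
    rw [hW]; ring
  have hlog2L : Real.log (2 * Real.log Y) = Real.log 2 + l := by
    rw [Real.log_mul (by norm_num) hL0.ne']
  have hlogT : Real.log (2 * Real.log T) ≤ Real.log (4*l^3) := Real.log_le_log (by linarith) (by linarith)
  have hlogT' : Real.exp 1 * Real.log (2 * Real.log T) ≤ Real.exp 1 * Real.log (4*l^3) := mul_le_mul_of_nonneg_left hlogT (Real.exp_pos 1).le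
  have hYL : (Y:ℝ)/Real.log Y = Y * Real.exp (-l) := by rw [hL, Real.exp_neg]; rfl
  have c2 : (((range (Y+1)).filter (fun d => Adm d ∧ ¬ 2 * (d.primeFactors.filter (fun p => p ≤ T)).card + C ≤ (d.primeFactors.filter (fun p => T < p ∧ vv p = 1)).card)).card : ℝ) ≤ η * W := by
    refine (h2 Y (by omega) T (by omega) C).trans ?_
    rw [hlog2L, hYL]
    calc _ = K2 * 2^C * Y * Real.exp (-l + (3/8 * (Real.log 2 + l) + 4 * (Real.exp 1 * Real.log (2 * Real.log T)))) := by
          rw [Real.exp_add (-l)]; ring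
      _ ≤ K2 * 2^C * Y * Real.exp (-l + 3/8 * (Real.log 2 + l) + 4 * (Real.exp 1 * Real.log (4*l^3))) := by
          gcongr ?_ * Real.exp ?_; linarith
      _ = Y * (K2 * 2^C * Real.exp (-l + 3/8 * (Real.log 2 + l) + 4 * (Real.exp 1 * Real.log (4*l^3)))) := by ring
      _ ≤ Y * (η * Real.exp (-l/2)) := mul_le_mul_of_nonneg_left b2 hY0
      _ = _ := by rw [hW]; ring
  have hZT : (Z:ℝ) * Real.log T ≤ 10*l^4 := by
    calc (Z:ℝ) * Real.log T ≤ (5*l)*(2*l^3) := mul_le_mul hZ2 hT2 (by linarith) (by linarith)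
      _ = _ := by ring
  have hZT0 : 0 ≤ (Z:ℝ) * Real.log T := mul_nonneg (by positivity) (by linarith)
  have c3 : (((DD Y Z).filter (ntbad T)).card : ℝ) ≤ η * W := by
    refine (h3 Y (by omega) T (by omega) Z (by rw [hL]; linarith)).trans ?_
    rw [hlog2L, hYL]
    have h9 : Real.log (Z * Real.log T + 6) ≤ Real.log (10*l^4+6) := Real.log_le_log (by linarith) (by linarith)
    calc _ = K3 * Y * Real.exp (-l + (1/4 * (Real.log 2 + l) + 3/4 * Real.log (Z * Real.log T + 6) + 2 * (Real.exp 1 * Real.log (2 * Real.log T)))) := by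
          rw [Real.exp_add (-l)]; ring
      _ ≤ K3 * Y * Real.exp (-l + 1/4 * (Real.log 2 + l) + 3/4 * Real.log (10*l^4+6) + 2 * (Real.exp 1 * Real.log (4*l^3))) := by
          gcongr ?_ * Real.exp ?_; linarith
      _ = Y * (K3 * Real.exp (-l + 1/4 * (Real.log 2 + l) + 3/4 * Real.log (10*l^4+6) + 2 * (Real.exp 1 * Real.log (4*l^3)))) := by ring
      _ ≤ Y * (η * Real.exp (-l/2)) := mul_le_mul_of_nonneg_left b3 hY0
      _ = _ := by rw [hW]; ring
  -- split
  have hsplit : ∑ d ∈ (range (Y+1)).filter Adm, ((if RR d = 2 ^ r then 1 else 0) - piR r) = ∑ d ∈ DD Y Z, ((if RR d = 2 ^ r then 1 else 0) - piR r) + ∑ d ∈ (range (Y+1)).filter (fun d => Adm d ∧ Z < d.primeFactors.card), ((if RR d = 2 ^ r then 1 else 0) - piR r) := by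
    rw [← sum_filter_add_sum_filter_not ((range (Y+1)).filter Adm) (fun d => d.primeFactors.card ≤ Z), filter_filter, filter_filter]
    simp only [not_le]; rfl
  have hterm : ∀ d : ℕ, |(if RR d = 2 ^ r then (1:ℝ) else 0) - piR r| ≤ P := by
    intro d
    refine (abs_sub _ _).trans ?_
    rw [hP]; gcongr
    split_ifs <;> norm_num
  have hs2 : |∑ d ∈ (range (Y+1)).filter (fun d => Adm d ∧ Z < d.primeFactors.card), ((if RR d = 2 ^ r then (1:ℝ) else 0) - piR r)| ≤ P * (η * W) := by
    refine (abs_sum_le_sum_abs _ _).trans ((sum_le_sum fun d _ => hterm d).trans ?_)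
    rw [sum_const, nsmul_eq_mul, mul_comm]
    exact mul_le_mul_of_nonneg_left c1 hP0.le
  have hs3 : ∑ d ∈ DD Y Z, (ε/2 + if good C T d then 0 else P) ≤ ε/2 * A0 Y + P * (η * W + η * W) := by
    rw [sum_add_distrib]
    apply add_le_add
    · rw [sum_const, nsmul_eq_mul, mul_comm]
      apply mul_le_mul_of_nonneg_left _ (by positivity)
      unfold A0 DD
      have : ((range (Y+1)).filter (fun d => Adm d ∧ d.primeFactors.card ≤ Z)).card ≤ ((range (Y+1)).filter Adm).card := by
        apply card_le_card; intro d hd; rw [mem_filter] at hd ⊢; exact ⟨hd.1, hd.2.1⟩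
      exact_mod_cast this
    · rw [show (∑ d ∈ DD Y Z, if good C T d then (0:ℝ) else P) = ∑ d ∈ (DD Y Z).filter (fun d => ¬ good C T d), P by
        rw [sum_filter]; exact sum_congr rfl fun d _ => (ite_not _ _ _).symm, sum_const, nsmul_eq_mul, mul_comm]
      apply mul_le_mul_of_nonneg_left _ hP0.le
      refine le_trans ?_ (add_le_add c2 c3)
      have : ((DD Y Z).filter (fun d => ¬ good C T d)).card ≤ ((range (Y+1)).filter (fun d => Adm d ∧ ¬ 2 * (d.primeFactors.filter (fun p => p ≤ T)).card + C ≤ (d.primeFactors.filter (fun p => T < p ∧ vv p = 1)).card)).card + ((DD Y Z).filter (ntbad T)).card := by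
        refine (card_le_card ?_).trans (card_union_le _ _)
        intro d hd
        rw [mem_filter] at hd
        rw [mem_union]
        rcases not_good hd.2 with h | h
        · left
          have := hd.1
          unfold DD at this
          rw [mem_filter] at this
          exact mem_filter.2 ⟨this.1, this.2.1, h⟩
        · right; exact mem_filter.2 ⟨hd.1, h⟩
      exact_mod_cast this
  rw [hsplit]
  refine (abs_add_le _ _).trans ?_
  have hfin : P * (η * W) = ε/8 * (c*W) := by rw [← mul_assoc, hηle]; ring
  have h10 : (Y:ℝ) * (ε*c/8 * Real.exp (-l/2)) = ε/8*(c*W) := by rw [hW]; ring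
  rw [h10] at c4
  have h11 := mul_le_mul_of_nonneg_left hAY2 (show 0 ≤ ε/8 by positivity)
  have h12 : P * (η * W + η * W) = 2 * (ε/8*(c*W)) := by rw [← hfin]; ring
  linarith

end FR

namespace FR
open Finset

lemma nsq_mul {n : ℕ} (h : ¬ IsSquare n) {X Y : ℤ} (e : X^2 = n * Y^2) : Y = 0 := by
  by_contra hY
  apply h
  have : IsSquare ((n:ℚ)) := ⟨X/Y, by
    have : (X:ℚ)^2 = n * Y^2 := by exact_mod_cast e
    have hY' : (Y:ℚ) ≠ 0 := by exact_mod_cast hY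
    field_simp; linarith⟩
  rwa [Rat.isSquare_natCast_iff] at this

lemma leg (a b : ℕ) (ha : 0 < a) (hb : 0 < b) (t u : ℤ) (ht : (b:ℤ) ∣ t^2 - a) (hu : (a:ℤ) ∣ u^2 + b)
    (hco : Nat.Coprime a b) (h1 : ¬ IsSquare (a*b)) (h2 : ¬ IsSquare b) :
    ∃ x y z : ℤ, z ≠ 0 ∧ (a:ℤ) * x^2 = b * y^2 + z^2 := by
  haveI : NeZero a := ⟨ha.ne'⟩
  haveI : NeZero b := ⟨hb.ne'⟩
  let f : Fin (b.sqrt+1) × Fin (a.sqrt+1) × Fin ((a*b).sqrt+1) → ZMod b × ZMod a :=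
    fun w => (((w.2.2:ℕ):ℤ) - t * ((w.1:ℕ):ℤ) , ((w.2.2:ℕ):ℤ) - u * ((w.2.1:ℕ):ℤ))
  have hcard : Fintype.card (ZMod b × ZMod a) < Fintype.card (Fin (b.sqrt+1) × Fin (a.sqrt+1) × Fin ((a*b).sqrt+1)) := by
    simp only [Fintype.card_prod, ZMod.card, Fintype.card_fin]
    have e1 := Nat.lt_succ_sqrt b
    have e2 := Nat.lt_succ_sqrt a
    have e3 := Nat.lt_succ_sqrt (a*b)
    simp only [Nat.succ_eq_add_one] at e1 e2 e3
    by_contra hc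
    push Not at hc
    have := Nat.mul_lt_mul'' (Nat.mul_lt_mul'' e1 e2) e3
    have h := Nat.mul_le_mul hc hc
    nlinarith
  obtain ⟨⟨x1, y1, z1⟩, ⟨x2, y2, z2⟩, hne, heq⟩ := Fintype.exists_ne_map_eq_of_card_lt f hcard
  simp only [f, Prod.mk.injEq] at heq
  obtain ⟨q1, q2⟩ := heq
  have bd : ∀ {n : ℕ} (p q : Fin (n.sqrt+1)), (((p:ℕ):ℤ) - ((q:ℕ):ℤ))^2 ≤ n := by
    intro n p q
    have hp : (p:ℕ) ≤ n.sqrt := Nat.lt_succ_iff.1 p.2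
    have hq : (q:ℕ) ≤ n.sqrt := Nat.lt_succ_iff.1 q.2
    have hs : ((n.sqrt:ℕ):ℤ)^2 ≤ n := by exact_mod_cast Nat.sqrt_le' n
    have : |((p:ℕ):ℤ) - ((q:ℕ):ℤ)| ≤ n.sqrt := by rw [abs_le]; constructor <;> omega
    refine le_trans ?_ hs
    exact sq_le_sq.2 (by rwa [abs_of_nonneg (show (0:ℤ) ≤ (n.sqrt:ℕ) by positivity)])
  have bX := bd x1 x2
  have bY := bd y1 y2
  have bZ := bd z1 z2
  set X : ℤ := ((x1:ℕ):ℤ) - ((x2:ℕ):ℤ) with hX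
  set Y : ℤ := ((y1:ℕ):ℤ) - ((y2:ℕ):ℤ) with hY
  set Z : ℤ := ((z1:ℕ):ℤ) - ((z2:ℕ):ℤ) with hZ
  have hnz : ¬ (X = 0 ∧ Y = 0 ∧ Z = 0) := by
    rintro ⟨r1, r2, r3⟩
    apply hne
    simp only [Prod.mk.injEq]
    refine ⟨Fin.ext ?_, Fin.ext ?_, Fin.ext ?_⟩ <;> omega
  have d1 : (b:ℤ) ∣ Z - t * X := by
    rw [← ZMod.intCast_zmod_eq_zero_iff_dvd, hX, hZ]
    push_cast at q1 ⊢
    linear_combination q1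
  have d2 : (a:ℤ) ∣ Z - u * Y := by
    rw [← ZMod.intCast_zmod_eq_zero_iff_dvd, hY, hZ]
    push_cast at q2 ⊢
    linear_combination q2
  have hQ : ((a:ℤ) * b) ∣ a * X^2 - b * Y^2 - Z^2 := by
    apply IsCoprime.mul_dvd (Nat.isCoprime_iff_coprime.2 hco)
    · obtain ⟨k, hk⟩ := hu
      obtain ⟨l, hl⟩ := d2
      exact ⟨X^2 - k * Y^2 - l * (Z + u*Y), by linear_combination (-Y^2) * hk - (Z+u*Y) * hl⟩
    · obtain ⟨k, hk⟩ := ht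
      obtain ⟨l, hl⟩ := d1
      exact ⟨- Y^2 - k * X^2 - l * (Z + t*X), by linear_combination (-X^2) * hk - (Z+t*X) * hl⟩
  obtain ⟨k, hk⟩ := hQ
  have ha' : (0:ℤ) < a := by exact_mod_cast ha
  have hb' : (0:ℤ) < b := by exact_mod_cast hb
  have hab : (0:ℤ) < a * b := by positivity
  push_cast at bZ
  have hZab : Z^2 ≠ a * b := fun h => h1 (by
    have : IsSquare (((a*b:ℕ)):ℤ) := ⟨Z, by push_cast; linarith [h, sq Z]⟩
    exact_mod_cast this)
  have hXb : X^2 ≠ b := fun h => h2 (by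
    have : IsSquare ((b:ℕ):ℤ) := ⟨X, by linarith [h, sq X]⟩
    exact_mod_cast this)
  have hXb' : X^2 < b := lt_of_le_of_ne bX hXb
  have hZ' : Z^2 < a * b := lt_of_le_of_ne bZ hZab
  have u1 : k < 1 := by
    by_contra h
    push Not at h
    nlinarith [sq_nonneg Y, sq_nonneg Z, mul_lt_mul_of_pos_left hXb' ha']
  have u2 : -2 < k := by
    by_contra h
    push Not at h
    nlinarith [sq_nonneg X, mul_le_mul_of_nonneg_left bY hb'.le]
  rcases (show k = 0 ∨ k = -1 by omega) with rfl | rfl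
  · refine ⟨X, Y, Z, fun h0 => ?_, by linear_combination hk⟩
    rw [h0] at hk
    have : ((a:ℤ)*X)^2 = ((a*b:ℕ):ℤ) * Y^2 := by push_cast; linear_combination (a:ℤ) * hk
    have hY0 := nsq_mul h1 this
    rw [hY0] at hk
    have : X = 0 := by
      have : (a:ℤ) * X^2 = 0 := by linear_combination hk
      rcases mul_eq_zero.1 this with h | h
      · omega
      · exact pow_eq_zero_iff two_ne_zero |>.1 h
    exact hnz ⟨this, hY0, h0⟩
  · exact ⟨X*Z - b*Y, Y*Z - a*X, Z^2 - a*b, sub_ne_zero.2 hZab, by linear_combination (Z^2 - a * b)*hk⟩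

lemma crt_sq (m : ℕ) (a : ℤ) (hm : Squarefree m) (h : ∀ p : ℕ, p.Prime → p ∣ m → ∃ t : ℤ, (p:ℤ) ∣ t^2 - a) :
    ∃ t : ℤ, (m:ℤ) ∣ t^2 - a := by
  induction m using Nat.recOnMul with
  | zero => exact absurd hm not_squarefree_zero
  | one => exact ⟨0, by simp⟩
  | prime p hp => exact h p hp dvd_rfl
  | mul m n hm1 hn1 =>
    obtain ⟨t, ht⟩ := hm1 (hm.of_mul_left) (fun p hp hd => h p hp (hd.mul_right _))
    obtain ⟨u, hu⟩ := hn1 (hm.of_mul_right) (fun p hp hd => h p hp (hd.mul_left _))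
    have hc : IsCoprime (m:ℤ) n := Nat.isCoprime_iff_coprime.2 (Nat.coprime_of_squarefree_mul hm)
    obtain ⟨r, s, hrs⟩ := hc
    refine ⟨t * (s*n) + u * (r*m), ?_⟩
    push_cast
    apply IsCoprime.mul_dvd ⟨r, s, hrs⟩
    · obtain ⟨k, hk⟩ := ht
      have : s * n = 1 - r*m := by linear_combination hrs
      rw [this]
      exact ⟨k - 2*t*t*r + t^2*r^2*m + 2*t*u*r*(1-r*m) + u^2*r^2*m, by linear_combination hk⟩
    · obtain ⟨k, hk⟩ := hu
      have : r * m = 1 - s*n := by linear_combination hrs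
      rw [this]
      exact ⟨k - 2*u*u*s + u^2*s^2*n + 2*t*u*s*(1-s*n) + t^2*s^2*n, by linear_combination hk⟩

/-- being a norm from `ℚ(√D)` -/
def isN (D : ℕ) (n : ℚ) : Prop := ∃ x y : ℚ, n = x^2 - D * y^2

lemma isN.mul {D : ℕ} {m n : ℚ} (h1 : isN D m) (h2 : isN D n) : isN D (m*n) := by
  obtain ⟨x, y, rfl⟩ := h1
  obtain ⟨z, w, rfl⟩ := h2
  exact ⟨x*z + D*y*w, x*w+y*z, by ring⟩

lemma isN.sq {D : ℕ} {n c : ℚ} (h1 : isN D n) : isN D (n*c^2) :=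
  h1.mul ⟨c, 0, by ring⟩

lemma isN_of_leg {a b : ℕ} {x y z : ℤ} (hz : z ≠ 0) (h : (a:ℤ) * x^2 = b * y^2 + z^2) : isN (a*b) a := by
  have hz' : (z:ℚ) ≠ 0 := by exact_mod_cast hz
  have h' : (a:ℚ) * x^2 = b * y^2 + z^2 := by exact_mod_cast h
  refine ⟨a*x/z, y/z, ?_⟩
  push_cast
  field_simp
  linear_combination (-(a:ℚ)) * h'

lemma jac_sq {p : ℕ} (hp : p.Prime) {a : ℤ} (h : jacobiSym a p = 1) : ∃ t : ℤ, (p:ℤ) ∣ t^2 - a := by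
  haveI := Fact.mk hp
  rw [← jacobiSym.legendreSym.to_jacobiSym] at h
  have ha : ((a:ℤ) : ZMod p) ≠ 0 := fun h0 => by
    rw [(legendreSym.eq_zero_iff p a).2 h0] at h; norm_num at h
  obtain ⟨r, hr⟩ := (legendreSym.eq_one_iff p ha).1 h
  refine ⟨(r.val : ℤ), ?_⟩
  rw [← ZMod.intCast_zmod_eq_zero_iff_dvd]
  push_cast
  rw [ZMod.natCast_zmod_val, hr]; ring

lemma sq_jac {p : ℕ} (hp : p.Prime) {a x z : ℤ} (hz : ¬ (p:ℤ) ∣ z) (h : (p:ℤ) ∣ a * x^2 - z^2) : jacobiSym a p = 1 := by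
  haveI := Fact.mk hp
  rw [← jacobiSym.legendreSym.to_jacobiSym]
  have hz' : (z : ZMod p) ≠ 0 := by rwa [Ne, ZMod.intCast_zmod_eq_zero_iff_dvd]
  have h' : (a : ZMod p) * x^2 = z^2 := by
    rw [← ZMod.intCast_zmod_eq_zero_iff_dvd] at h; push_cast at h; linear_combination h
  have hx : (x : ZMod p) ≠ 0 := fun h0 => hz' (by
    rw [h0] at h'; exact pow_eq_zero_iff two_ne_zero |>.1 (by rw [← h']; ring))
  have ha : (a : ZMod p) ≠ 0 := fun h0 => hz' (by
    rw [h0] at h'; exact pow_eq_zero_iff two_ne_zero |>.1 (by rw [← h']; ring))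
  rw [legendreSym.eq_one_iff p ha]
  exact ⟨z/x, by field_simp; linear_combination h'⟩

/-- primitive solutions -/
lemma prim {B C D : ℕ} (hD : B * C = D) (hs : Squarefree D) (h : isN D B) (hn : ¬ IsSquare D) :
    ∃ x y z : ℤ, (B:ℤ) * x^2 = C * y^2 + z^2 ∧ IsCoprime z y ∧ IsCoprime z D ∧ IsCoprime (B:ℤ) y := by
  have hB0 : B ≠ 0 := fun h0 => hs.ne_zero (by rw [← hD, h0, zero_mul])
  have hBs : Squarefree B := by rw [← hD] at hs; exact hs.of_mul_left
  have hCs : Squarefree C := by rw [← hD] at hs; exact hs.of_mul_right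
  have hBC : Nat.Coprime B C := by rw [← hD] at hs; exact Nat.coprime_of_squarefree_mul hs
  have key : ∃ x y z : ℤ, (B:ℤ) * x^2 = C * y^2 + z^2 ∧ Int.gcd y z = 1 := by
    obtain ⟨u, v, huv⟩ := h
    set w : ℤ := u.den * v.den with hw
    set a : ℤ := u.num * v.den with ha
    set b : ℤ := v.num * u.den with hb
    have hw0 : w ≠ 0 := by rw [hw]; positivity
    have e1 : (B:ℤ) * w^2 = a^2 - D * b^2 := by
      have : (B:ℚ) * (w:ℚ)^2 = a^2 - D * b^2 := by
        rw [huv, hw, ha, hb]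
        push_cast
        have p1 : (u.num : ℚ) = u * u.den := (Rat.mul_den_eq_num u).symm
        have p2 : (v.num : ℚ) = v * v.den := (Rat.mul_den_eq_num v).symm
        rw [p1, p2]; ring
      exact_mod_cast this
    have hBa : (B:ℤ) ∣ a := by
      have hsq : Squarefree (B:ℤ) := Int.squarefree_natCast.2 hBs
      rw [← hsq.dvd_pow_iff_dvd two_ne_zero]
      exact ⟨w^2 + C * b^2, by rw [← hD] at e1; push_cast at e1; linear_combination -e1⟩
    obtain ⟨x, hx⟩ := hBa
    have hB0' : (B:ℤ) ≠ 0 := by exact_mod_cast hB0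
    have e2 : (B:ℤ) * x^2 = C * b^2 + w^2 := by
      apply mul_left_cancel₀ hB0'
      rw [hx, ← hD] at e1; push_cast at e1; linear_combination -e1
    have hg : 0 < Int.gcd b w := Int.gcd_pos_of_ne_zero_right _ hw0
    obtain ⟨b', hb'⟩ := Int.gcd_dvd_left b w
    obtain ⟨w', hw'⟩ := Int.gcd_dvd_right b w
    set g := Int.gcd b w with hgd
    have hg0 : (g:ℤ) ≠ 0 := by exact_mod_cast hg.ne'
    have hgcd : Int.gcd b' w' = 1 := by
      have : Int.gcd b w = g * Int.gcd b' w' := by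
        conv_lhs => rw [hb', hw', Int.gcd_mul_left]
        simp
      rw [← hgd] at this
      exact Nat.eq_of_mul_eq_mul_left hg (by omega)
    have hgx : (g:ℤ) ∣ x := by
      have h1 : (g:ℤ)^2 ∣ B * x^2 := ⟨C * b'^2 + w'^2, by rw [e2, hb', hw']; ring⟩
      have h2 : (g:ℤ)^2 ∣ (B * x)^2 := by
        have := h1.mul_left (B:ℤ)
        rwa [show (B:ℤ) * (B * x^2) = (B*x)^2 by ring] at this
      have h3 : (g:ℤ) ∣ B * x := (Int.pow_dvd_pow_iff two_ne_zero).1 h2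
      obtain ⟨l, hl⟩ := h3
      have h4 : (B:ℤ) ∣ l^2 := by
        obtain ⟨k, hk⟩ := h1
        refine ⟨k, ?_⟩
        apply mul_left_cancel₀ (pow_ne_zero 2 hg0)
        have : (g*l)^2 = (g:ℤ)^2*l^2 := by ring
        rw [← this, ← hl]; linear_combination (B:ℤ) * hk
      have hsq : Squarefree (B:ℤ) := Int.squarefree_natCast.2 hBs
      rw [hsq.dvd_pow_iff_dvd two_ne_zero] at h4
      obtain ⟨m, hm⟩ := h4
      exact ⟨m, by apply mul_left_cancel₀ hB0'; rw [hl, hm]; ring⟩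
    obtain ⟨x', hx'⟩ := hgx
    refine ⟨x', b', w', ?_, hgcd⟩
    apply mul_left_cancel₀ (pow_ne_zero 2 hg0)
    have e3 := e2
    rw [hx', hb', hw'] at e3
    linear_combination e3
  obtain ⟨x, y, z, e, hg⟩ := key
  have hyz : ∀ p : ℕ, p.Prime → (p:ℤ) ∣ y → (p:ℤ) ∣ z → False := by
    intro p hp h1 h2
    have h3 := Int.dvd_coe_gcd h1 h2
    rw [hg] at h3
    have := Int.natCast_dvd_natCast.1 (by simpa using h3 : (p:ℤ) ∣ ((1:ℕ):ℤ))
    exact hp.one_lt.ne' (Nat.dvd_one.1 this)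
  have cop : ∀ u v : ℤ, (∀ p : ℕ, p.Prime → (p:ℤ) ∣ u → (p:ℤ) ∣ v → False) → IsCoprime u v := by
    intro u v h
    rw [Int.isCoprime_iff_gcd_eq_one]
    by_contra hne
    obtain ⟨p, hp, hpd⟩ := Nat.exists_prime_and_dvd hne
    exact h p hp ((Int.natCast_dvd_natCast.2 hpd).trans (Int.gcd_dvd_left _ _)) ((Int.natCast_dvd_natCast.2 hpd).trans (Int.gcd_dvd_right _ _))
  have hzB : ∀ p : ℕ, p.Prime → (p:ℤ) ∣ z → (p:ℤ) ∣ B → False := by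
    intro p hp h1 h2
    have hP : Prime (p:ℤ) := Nat.prime_iff_prime_int.1 hp
    have h3 : (p:ℤ) ∣ C * y^2 := by
      have : (C:ℤ) * y^2 = B * x^2 - z * z := by linear_combination -e
      rw [this]; exact dvd_sub (h2.mul_right _) (h1.mul_right _)
    rcases hP.dvd_or_dvd h3 with h4 | h4
    · have := Nat.dvd_gcd (Int.natCast_dvd_natCast.1 h2) (Int.natCast_dvd_natCast.1 h4)
      rw [hBC] at this
      exact hp.one_lt.ne' (Nat.dvd_one.1 this)
    · exact hyz p hp (hP.dvd_of_dvd_pow h4) h1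
  refine ⟨x, y, z, e, cop _ _ fun p hp h1 h2 => hyz p hp h2 h1, cop _ _ ?_, cop _ _ ?_⟩
  · intro p hp h1 h2
    have hP : Prime (p:ℤ) := Nat.prime_iff_prime_int.1 hp
    have h2' : (p:ℤ) ∣ B * C := by rw [← hD] at h2; exact_mod_cast h2
    rcases hP.dvd_or_dvd h2' with h3 | h3
    · exact hzB p hp h1 h3
    · have h4 : (p:ℤ) ∣ B * x^2 := by rw [e, sq z]; exact dvd_add (h3.mul_right _) (h1.mul_right _)
      rcases hP.dvd_or_dvd h4 with h5 | h5
      · exact hzB p hp h1 h5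
      have h6 := hP.dvd_of_dvd_pow h5
      obtain ⟨i, hi⟩ := h6
      obtain ⟨j, hj⟩ := h1
      obtain ⟨k, hk⟩ := h3
      have hp0 : (p:ℤ) ≠ 0 := hP.ne_zero
      have h7 : (p:ℤ) ∣ k * y^2 := ⟨B*i^2 - j^2, by
        apply mul_left_cancel₀ hp0
        rw [hi, hj, hk] at e; linear_combination -e⟩
      rcases hP.dvd_or_dvd h7 with h8 | h8
      · have h9 : (p:ℤ) * p ∣ C := by rw [hk]; exact mul_dvd_mul_left _ h8
        exact hp.one_lt.ne' (Nat.isUnit_iff.1 (hCs p (by exact_mod_cast h9)))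
      · exact hyz p hp (hP.dvd_of_dvd_pow h8) ⟨j, hj⟩
  · intro p hp h1 h2
    have hP : Prime (p:ℤ) := Nat.prime_iff_prime_int.1 hp
    apply hyz p hp h2
    apply hP.dvd_of_dvd_pow (n := 2)
    have : z^2 = B * x^2 - y * (C * y) := by linear_combination -e
    rw [this]; exact dvd_sub (h1.mul_right _) (h2.mul_right _)

lemma Adm_nsq {d : ℕ} (h : Adm d) : Squarefree (2*d) ∧ ¬ IsSquare (2*d) := by
  have hodd : d % 4 = 3 := h.2.1
  have hs : Squarefree (2*d) := (Nat.squarefree_mul (by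
    rw [Nat.coprime_two_left]; exact Nat.odd_iff.2 (by omega))).2 ⟨Nat.prime_two.squarefree, h.1⟩
  refine ⟨hs, ?_⟩
  rintro ⟨k, hk⟩
  have : IsUnit k := hs k ⟨1, by omega⟩
  rw [Nat.isUnit_iff] at this
  subst this
  omega

lemma isN_two {d : ℕ} (h : Adm d) : isN (2*d) 2 := by
  have hodd : d % 4 = 3 := h.2.1
  obtain ⟨t, ht⟩ := crt_sq d 2 h.1 (fun p hp hd => jac_sq hp (h.2.2 p hp hd))
  obtain ⟨x, y, z, hz, e⟩ := leg 2 d (by norm_num) (by omega) t 1 (by exact_mod_cast ht)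
    (by push_cast; omega) (by rw [Nat.coprime_two_left]; exact Nat.odd_iff.2 (by omega)) (Adm_nsq h).2 (by
      rintro ⟨k, hk⟩
      have : k % 4 = 0 ∨ k % 4 = 1 ∨ k % 4 = 2 ∨ k % 4 = 3 := by omega
      have h2 := Nat.mul_mod k k 4
      rcases this with h | h | h | h <;> simp only [h] at h2 <;> omega)
  exact_mod_cast isN_of_leg hz e

lemma isN_iff {d B : ℕ} (h : Adm d) (hB : B ∣ d) : isN (2*d) B ↔ Bcond d B := by
  obtain ⟨hs, hns⟩ := Adm_nsq h
  have hodd : d % 4 = 3 := h.2.1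
  obtain ⟨C, rfl⟩ := hB
  have hB0 : 0 < B := Nat.pos_of_ne_zero fun h0 => by subst h0; omega
  have hC0 : 0 < C := Nat.pos_of_ne_zero fun h0 => by subst h0; omega
  have hdiv : B * C / B = C := Nat.mul_div_cancel_left _ hB0
  have hD : B * (2 * C) = 2 * (B * C) := by ring
  have hpodd : ∀ p : ℕ, p.Prime → p ∣ B*C → jacobiSym 2 p = 1 := h.2.2
  have hBC : Nat.Coprime B C := Nat.coprime_of_squarefree_mul h.1
  unfold Bcond
  rw [hdiv]
  constructor
  · intro hN p hp hpd
    obtain ⟨x, y, z, e, g1, g2, g3⟩ := prim hD hs hN hns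
    have hpz : ¬ (p:ℤ) ∣ z := fun hz => by
      have h2 : (p:ℤ) ∣ ((2*(B*C):ℕ):ℤ) := Int.natCast_dvd_natCast.2 (hpd.mul_left _)
      have := g2.isUnit_of_dvd' hz h2
      exact (Nat.prime_iff_prime_int.1 hp).not_unit this
    constructor
    · intro hpC
      apply sq_jac hp hpz (x := x)
      have : (B:ℤ) * x^2 - z^2 = C * (2*y^2) := by push_cast at e; linear_combination e
      rw [this]; exact (Int.natCast_dvd_natCast.2 hpC).mul_right _
    · intro hpB
      have h1 : jacobiSym (2 * (-(C:ℤ))) p = 1 := by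
        apply sq_jac hp hpz (x := y)
        have : (2 * (-(C:ℤ))) * y^2 - z^2 = B * (-x^2) := by push_cast at e; linear_combination e
        rw [this]; exact (Int.natCast_dvd_natCast.2 hpB).mul_right _
      rw [jacobiSym.mul_left, hpodd p hp hpd, one_mul] at h1
      exact h1
  · intro hc
    have hCodd : C % 2 = 1 := by
      rcases Nat.mod_two_eq_zero_or_one C with h0 | h0
      · have := Nat.mul_mod B C 2; rw [h0] at this; simp at this; omega
      · exact h0
    have hBodd : B % 2 = 1 := by
      rcases Nat.mod_two_eq_zero_or_one B with h0 | h0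
      · have := Nat.mul_mod B C 2; rw [h0] at this; simp at this; omega
      · exact h0
    have hsC : Squarefree (2*C) := by rw [← hD] at hs; exact hs.of_mul_right
    obtain ⟨t, ht⟩ := crt_sq (2*C) B hsC (fun p hp hd => by
      rcases (Nat.Prime.dvd_mul hp).1 hd with h2 | h2
      · rw [(Nat.prime_dvd_prime_iff_eq hp Nat.prime_two).1 h2]
        exact ⟨1, by push_cast; omega⟩
      · exact jac_sq hp ((hc p hp (h2.mul_left _)).1 h2))
    obtain ⟨u, hu⟩ := crt_sq B (-((2*C:ℕ):ℤ)) (h.1.of_mul_left) (fun p hp hd => by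
      apply jac_sq hp
      rw [show (-((2*C:ℕ):ℤ)) = 2 * (-(C:ℤ)) by push_cast; ring, jacobiSym.mul_left,
        hpodd p hp (hd.mul_right _), (hc p hp (hd.mul_right _)).2 hd, one_mul])
    have hco : Nat.Coprime B (2*C) := by
      apply Nat.Coprime.mul_right _ hBC
      rw [Nat.coprime_two_right]; exact Nat.odd_iff.2 hBodd
    obtain ⟨x, y, z, hz, e⟩ := leg B (2*C) hB0 (by omega) t u ht (by simpa using hu) hco (by rw [hD]; exact hns) (by
      rintro ⟨k, hk⟩
      have : IsUnit k := hsC k ⟨1, by omega⟩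
      rw [Nat.isUnit_iff] at this
      subst this; omega)
    have := isN_of_leg hz e
    rwa [hD] at this

/-- number of divisors of `2d` that are norms -/
lemma count_isN {d : ℕ} (h : Adm d) : (((2*d).divisors).filter (fun B : ℕ => isN (2*d) B)).card = 2 * RR d := by
  have hodd : d % 4 = 3 := h.2.1
  have hd0 : d ≠ 0 := by omega
  have h2 := isN_two h
  have e : ((2*d).divisors).filter (fun B : ℕ => isN (2*d) B) =
      (d.divisors.filter (Bcond d)) ∪ (d.divisors.filter (Bcond d)).image (fun B => 2*B) := by
    have hdiv : ∀ B, B ∣ 2*d ↔ B ∣ d ∨ ∃ B', B' ∣ d ∧ 2*B' = B := by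
      intro B
      constructor
      · intro hB
        rcases Nat.even_or_odd B with ⟨k, hk⟩ | ho
        · right
          exact ⟨k, by rw [hk, ← two_mul] at hB; exact Nat.dvd_of_mul_dvd_mul_left (by norm_num) hB, by omega⟩
        · left
          exact (Nat.Coprime.dvd_mul_left (Nat.coprime_two_right.2 ho)).1 hB
      · rintro (hB | ⟨B', hB, rfl⟩)
        · exact hB.mul_left _
        · exact Nat.mul_dvd_mul_left _ hB
    ext B
    simp only [mem_filter, Nat.mem_divisors, mem_union, mem_image, hdiv]
    constructor
    · rintro ⟨⟨hB | ⟨B', hB, rfl⟩, _⟩, hN⟩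
      · exact Or.inl ⟨⟨hB, hd0⟩, (isN_iff h hB).1 hN⟩
      · refine Or.inr ⟨B', ⟨⟨hB, hd0⟩, (isN_iff h hB).1 ?_⟩, rfl⟩
        have := (h2.mul hN).sq (c := 1/2)
        push_cast at this
        convert this using 1; ring
    · rintro (⟨⟨hB, _⟩, hN⟩ | ⟨B', ⟨⟨hB, _⟩, hN⟩, rfl⟩)
      · exact ⟨⟨Or.inl hB, by omega⟩, (isN_iff h hB).2 hN⟩
      · refine ⟨⟨Or.inr ⟨B', hB, rfl⟩, by omega⟩, ?_⟩
        have := h2.mul ((isN_iff h hB).2 hN)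
        exact_mod_cast this
  rw [e, card_union_of_disjoint, card_image_of_injective _ (fun a b h => by simpa using h), two_mul]
  · rfl
  · rw [disjoint_left]
    rintro B hB hB2
    obtain ⟨B', _, rfl⟩ := mem_image.1 hB2
    have : 2 * B' ∣ d := (Nat.mem_divisors.1 (mem_filter.1 hB).1).1
    have : 2 ∣ d := (dvd_mul_right 2 B').trans this
    omega
end FR

namespace FR
open Finset QuadraticAlgebra

lemma four_rank_card (G : Type*) [CommGroup G] [Finite (powMonoidHom 2 : G →* G).range] :
    fourRankPow G = Nat.card {g : G // g^2 = 1 ∧ ∃ h, h^2 = g} := by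
  set H := (powMonoidHom 2 : G →* G).range with hH
  let f : H →* H := powMonoidHom 2
  have h1 : (powMonoidHom 4 : G →* G).range.subgroupOf H = f.range := by
    ext ⟨x, hx⟩
    rw [Subgroup.mem_subgroupOf]
    simp only [MonoidHom.mem_range, powMonoidHom_apply, f, Subtype.exists, Subtype.ext_iff]
    constructor
    · rintro ⟨y, rfl⟩
      exact ⟨y^2, ⟨y, rfl⟩, (pow_mul y 2 2).symm⟩
    · rintro ⟨_, ⟨y, rfl⟩, rfl⟩
      exact ⟨y, pow_mul y 2 2⟩
  have h2 : fourRankPow G = f.range.index := by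
    unfold fourRankPow Subgroup.index
    rw [h1]
  have h3 : f.range.index * Nat.card f.range = Nat.card f.ker * Nat.card f.range := by
    rw [mul_comm, Subgroup.card_mul_index, ← Subgroup.card_mul_index f.ker, Subgroup.index_ker]
  have h4 : Nat.card f.range ≠ 0 := Nat.card_pos.ne'
  rw [h2, Nat.eq_of_mul_eq_mul_right (Nat.pos_of_ne_zero h4) h3]
  apply Nat.card_congr
  exact
    { toFun := fun x => ⟨x.1.1, by
        have h := x.2
        rw [MonoidHom.mem_ker, Subtype.ext_iff] at h
        simpa [f] using h, x.1.2⟩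
      invFun := fun x => ⟨⟨x.1, x.2.2⟩, by
        rw [MonoidHom.mem_ker, Subtype.ext_iff]; simpa [f] using x.2.1⟩
      left_inv := fun x => rfl
      right_inv := fun x => rfl }

section
variable {F : Type} [Field F] [NumberField F] {D : ℕ} (e : QuadraticAlgebra ℚ (D:ℚ) 0 ≃+* F)

/-- coordinates -/
def rr (x : F) : ℚ := (e.symm x).re
def ii (x : F) : ℚ := (e.symm x).im
def sD : F := e ⟨0, 1⟩
def Nm (x : F) : ℚ := rr e x ^ 2 - D * ii e x ^ 2

lemma e_rat (q : ℚ) : e.symm (q:F) = ⟨q, 0⟩ := by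
  have := ((e.symm : F →+* QuadraticAlgebra ℚ (D:ℚ) 0).toRatAlgHom).commutes q
  rw [eq_ratCast] at this
  exact this
lemma rr_rat (q : ℚ) : rr e (q:F) = q := by unfold rr; rw [e_rat]
lemma ii_rat (q : ℚ) : ii e (q:F) = 0 := by unfold ii; rw [e_rat]
lemma rr_add (x y : F) : rr e (x+y) = rr e x + rr e y := by unfold rr; rw [map_add]; rfl
lemma ii_add (x y : F) : ii e (x+y) = ii e x + ii e y := by unfold ii; rw [map_add]; rfl
lemma rr_mul (x y : F) : rr e (x*y) = rr e x * rr e y + D * ii e x * ii e y := by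
  unfold rr ii; rw [map_mul, re_mul]
lemma ii_mul (x y : F) : ii e (x*y) = rr e x * ii e y + ii e x * rr e y := by
  unfold rr ii; rw [map_mul, im_mul]; ring
lemma rr_sD : rr e (sD e) = 0 := by unfold rr sD; simp
lemma ii_sD : ii e (sD e) = 1 := by unfold ii sD; simp
lemma ext_ri {x y : F} (h1 : rr e x = rr e y) (h2 : ii e x = ii e y) : x = y :=
  e.symm.injective (QuadraticAlgebra.ext h1 h2)
lemma decomp_ri (x : F) : x = (rr e x : F) + (ii e x : F) * sD e := by
  apply ext_ri e <;> simp [rr_add, ii_add, rr_mul, ii_mul, rr_rat, ii_rat, rr_sD, ii_sD]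
lemma rr_mk (a b : ℚ) : rr e ((a:F) + (b:F) * sD e) = a := by
  simp [rr_add, ii_add, rr_mul, ii_mul, rr_rat, ii_rat, rr_sD, ii_sD]
lemma ii_mk (a b : ℚ) : ii e ((a:F) + (b:F) * sD e) = b := by
  simp [rr_add, ii_add, rr_mul, ii_mul, rr_rat, ii_rat, rr_sD, ii_sD]
lemma sD_sq : sD e * sD e = (D:F) := by
  rw [show (D:F) = ((D:ℚ):F) by simp]
  apply ext_ri e <;> simp only [rr_mul, ii_mul, rr_rat, ii_rat, rr_sD, ii_sD] <;> ring
lemma Nm_mul (x y : F) : Nm e (x*y) = Nm e x * Nm e y := by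
  unfold Nm; rw [rr_mul, ii_mul]; ring
lemma Nm_rat (q : ℚ) : Nm e (q:F) = q^2 := by unfold Nm; rw [rr_rat, ii_rat]; ring
lemma quad_eq (x : F) : x^2 = ((2 * rr e x : ℚ):F) * x - (Nm e x : ℚ) := by
  have : x^2 + (Nm e x : ℚ) = ((2 * rr e x : ℚ):F) * x := by
    rw [sq]
    apply ext_ri e <;> simp only [rr_add, ii_add, rr_mul, ii_mul, rr_rat, ii_rat, Nm] <;> ring
  rw [← this]; ring
lemma Nm_inv (x : F) : Nm e x⁻¹ = (Nm e x)⁻¹ := by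
  by_cases hx : x = 0
  · subst hx
    have : Nm e (0:F) = 0 := by have := Nm_rat e 0; simpa using this
    simp [this]
  have h := Nm_mul e x x⁻¹
  have h1 := Nm_rat e 1
  rw [mul_inv_cancel₀ hx] at h
  rw [Rat.cast_one, h] at h1
  rw [one_pow] at h1
  exact eq_inv_of_mul_eq_one_right h1

lemma Nm_alg (x : F) : Algebra.norm ℚ x = Nm e x := by
  let E : QuadraticAlgebra ℚ (D:ℚ) 0 ≃ₐ[ℚ] F := AlgEquiv.ofBijective (e : QuadraticAlgebra ℚ (D:ℚ) 0 →+* F).toRatAlgHom e.bijective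
  have h : x = E (e.symm x) := (e.apply_symm_apply x).symm
  have h2 : Algebra.norm ℚ (e.symm x) = (e.symm x).norm := by
    rw [← det_toLinearMap_eq_norm]; rfl
  conv_lhs => rw [h]
  rw [Algebra.norm_eq_of_algEquiv, h2, norm_def]
  unfold Nm rr ii; ring

/-- total positivity -/
def TP (x : F) : Prop := ∀ φ : F →+* ℝ, 0 < φ x

lemma TP_iff (x : F) : TP x ↔ 0 < rr e x ∧ 0 < Nm e x := by
  have hD : Real.sqrt D * Real.sqrt D = D := Real.mul_self_sqrt (Nat.cast_nonneg _)
  constructor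
  · intro h
    let φ : ∀ w : ℝ, w * w = D → F →+* ℝ := fun w hw =>
      ((QuadraticAlgebra.lift ⟨w, by rw [hw]; simp⟩ : QuadraticAlgebra ℚ (D:ℚ) 0 →ₐ[ℚ] ℝ) : QuadraticAlgebra ℚ (D:ℚ) 0 →+* ℝ).comp (e.symm : F →+* QuadraticAlgebra ℚ (D:ℚ) 0)
    have hφ : ∀ w hw, φ w hw x = rr e x + ii e x * w := by
      intro w hw
      simp [φ, QuadraticAlgebra.lift, rr, ii, Rat.smul_def]
    have hD' : -Real.sqrt D * -Real.sqrt D = D := by rw [neg_mul_neg, hD]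
    have h1 := h (φ (Real.sqrt D) hD)
    have h2 := h (φ (-Real.sqrt D) hD')
    rw [hφ _ hD] at h1
    rw [hφ _ hD'] at h2
    have h3 : (0:ℝ) < rr e x := by linarith
    have h4 := mul_pos h1 h2
    have h5 : (0:ℝ) < (Nm e x : ℚ) := by
      unfold Nm; push_cast
      have : ((rr e x : ℝ) + ii e x * √D) * (rr e x + ii e x * -√D) = rr e x ^2 - D * ii e x^2 := by
        linear_combination (- (ii e x : ℝ)^2) * hD
      linarith
    exact ⟨by exact_mod_cast h3, by exact_mod_cast h5⟩
  · rintro ⟨h1, h2⟩ φ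
    have e1 : φ x = rr e x + ii e x * φ (sD e) := by
      conv_lhs => rw [decomp_ri e x]
      simp
    have e2 : φ (sD e) * φ (sD e) = D := by rw [← map_mul, sD_sq]; simp
    rw [e1]
    have h1' : (0:ℝ) < rr e x := by exact_mod_cast h1
    have h2' : (0:ℝ) < (rr e x:ℝ)^2 - D * (ii e x:ℝ)^2 := by unfold Nm at h2; exact_mod_cast h2
    by_contra hc
    push Not at hc
    have h3 : 0 < (rr e x:ℝ) - ii e x * φ (sD e) := by linarith
    have := mul_nonneg_of_nonpos_of_nonpos hc (by linarith : -((rr e x:ℝ) - ii e x * φ (sD e)) ≤ 0)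
    have e3 : (ii e x : ℝ)^2 * (φ (sD e) * φ (sD e)) = (ii e x : ℝ)^2 * D := by rw [e2]
    nlinarith

lemma TP.mul {x y : F} (hx : TP x) (hy : TP y) : TP (x*y) := fun φ => by rw [map_mul]; exact mul_pos (hx φ) (hy φ)
lemma TP.inv {x : F} (hx : TP x) : TP x⁻¹ := fun φ => by rw [map_inv₀]; exact inv_pos.2 (hx φ)
lemma TP_rat {q : ℚ} (hq : 0 < q) : TP (q:F) := fun φ => by rw [map_ratCast]; exact_mod_cast hq

/-- square root of a rational with positive norm is rational -/
lemma rat_of_sq (hD : 0 < D) {x : F} {q : ℚ} (h : x^2 = (q:F)) (hN : 0 < Nm e x) : x = (rr e x : F) := by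
  have h1 : ii e (x*x) = 0 := by rw [← sq, h, ii_rat]
  rw [ii_mul] at h1
  have h0 : ii e x = 0 := by
    by_contra h0
    have h2 : rr e x = 0 := by
      have : (2 * ii e x) * rr e x = 0 := by linear_combination h1
      rcases mul_eq_zero.1 this with h | h
      · exact absurd (by linarith : ii e x = 0) h0
      · exact h
    unfold Nm at hN
    rw [h2] at hN
    have : (0:ℚ) ≤ D * ii e x^2 := by positivity
    linarith
  conv_lhs => rw [decomp_ri e x, h0]
  simp

lemma int_of_sqf {D : ℕ} (hs : Squarefree D) {q : ℚ} {k : ℤ} (h : (D:ℚ) * q^2 = k) : ∃ b : ℤ, q = b := by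
  have hq : (q.den : ℤ)^2 * k = D * q.num^2 := by
    have : (q.den : ℚ)^2 * k = D * q.num^2 := by
      rw [← h, ← Rat.mul_den_eq_num q]; ring
    exact_mod_cast this
  have hco : IsCoprime ((q.den:ℤ)^2) (q.num^2) := by
    apply IsCoprime.pow
    rw [isCoprime_comm, Int.isCoprime_iff_gcd_eq_one]
    exact q.reduced
  have h1 : (q.den:ℤ)^2 ∣ D := hco.dvd_of_dvd_mul_right ⟨k, hq.symm⟩
  have h2 : q.den * q.den ∣ D := by rw [← sq]; exact_mod_cast h1
  have h3 := Nat.isUnit_iff.1 (hs _ h2)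
  exact ⟨q.num, ((Rat.den_eq_one_iff q).1 h3).symm⟩

lemma rat_int {q : ℚ} (h : IsIntegral ℤ (q:F)) : ∃ k : ℤ, q = k := by
  have : IsIntegral ℤ q := by
    have h' : IsIntegral ℤ (algebraMap ℚ F q) := by simpa using h
    exact (isIntegral_algebraMap_iff (algebraMap ℚ F).injective).1 h'
  obtain ⟨k, hk⟩ := IsIntegrallyClosed.isIntegral_iff.1 this
  exact ⟨k, by rw [← hk]; simp⟩

lemma sD_int : IsIntegral ℤ (sD e) :=
  IsIntegral.of_pow two_pos (by rw [sq, sD_sq]; exact isIntegral_natCast D)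

lemma int_iff (hs : Squarefree D) (h4 : D % 4 = 2) (x : F) :
    IsIntegral ℤ x ↔ (∃ a : ℤ, rr e x = a) ∧ ∃ b : ℤ, ii e x = b := by
  constructor
  · intro h
    let σ : F →+* F := (e : QuadraticAlgebra ℚ (D:ℚ) 0 →+* F).comp ((starRingEnd (QuadraticAlgebra ℚ (D:ℚ) 0)).comp (e.symm : F →+* QuadraticAlgebra ℚ (D:ℚ) 0))
    have hσ : IsIntegral ℤ (σ x) := map_isIntegral_int σ h
    have hr : rr e (σ x) = rr e x := by simp [σ, rr, starRingEnd_apply, re_star]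
    have hi : ii e (σ x) = - ii e x := by simp [σ, ii, starRingEnd_apply, im_star]
    have t1 : x + σ x = ((2 * rr e x : ℚ):F) := by
      apply ext_ri e <;> simp only [rr_add, ii_add, rr_rat, ii_rat, hr, hi] <;> ring
    have t2 : x * σ x = ((Nm e x : ℚ):F) := by
      apply ext_ri e <;> simp only [rr_mul, ii_mul, rr_rat, ii_rat, hr, hi, Nm] <;> ring
    obtain ⟨A, hA⟩ := rat_int (F := F) (q := 2 * rr e x) (by rw [← t1]; exact h.add hσ)
    obtain ⟨M, hM⟩ := rat_int (F := F) (q := Nm e x) (by rw [← t2]; exact h.mul hσ)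
    unfold Nm at hM
    have h5 : (D:ℚ) * (2 * ii e x)^2 = ((A^2 - 4*M : ℤ):ℚ) := by
      push_cast; rw [← hA, ← hM]; ring
    obtain ⟨Bq, hB⟩ := int_of_sqf hs h5
    rw [hB] at h5
    have h6 : (D:ℤ) * Bq^2 = A^2 - 4*M := by exact_mod_cast h5
    obtain ⟨k, hk⟩ : ∃ k : ℤ, (D:ℤ) = 4*k+2 := ⟨D/4, by omega⟩
    have hA2 : Even A := by
      rcases Int.even_or_odd A with h | ⟨c, hc⟩
      · exact h
      · exfalso
        rw [hk, hc] at h6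
        ring_nf at h6
        have := congrArg (· % 2) h6
        omega
    obtain ⟨c, hc⟩ := hA2
    have hB2 : Even Bq := by
      rcases Int.even_or_odd Bq with h | ⟨m, hm⟩
      · exact h
      · exfalso
        rw [hk, hc, hm] at h6
        ring_nf at h6
        have := congrArg (· % 4) h6
        omega
    obtain ⟨m, hm⟩ := hB2
    refine ⟨⟨c, ?_⟩, m, ?_⟩
    · rw [hc] at hA; push_cast at hA; linarith
    · rw [hm] at hB; push_cast at hB; linarith
  · rintro ⟨⟨a, ha⟩, b, hb⟩
    rw [decomp_ri e x, ha, hb, Rat.cast_intCast, Rat.cast_intCast]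
    exact (isIntegral_intCast a).add ((isIntegral_intCast b).mul (sD_int e))

end
end FR

namespace FR
open Finset QuadraticAlgebra FractionalIdeal

section
variable {F : Type} [Field F] [NumberField F]

/-- group of fractional ideals, principal ideals -/
abbrev Idl (F : Type) [Field F] := (FractionalIdeal (𝓞 F)⁰ F)ˣ
noncomputable abbrev pr : Fˣ →* Idl F := toPrincipalIdeal (𝓞 F) F
noncomputable abbrev sp (x : F) : FractionalIdeal (𝓞 F)⁰ F := spanSingleton (𝓞 F)⁰ x

lemma pr_val (u : Fˣ) : ((pr u : Idl F) : FractionalIdeal (𝓞 F)⁰ F) = sp (u:F) := coe_toPrincipalIdeal u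

lemma int_mul_mem {I : FractionalIdeal (𝓞 F)⁰ F} {t x : F} (ht : IsIntegral ℤ t) (hx : x ∈ I) : t * x ∈ I := by
  have := I.coeToSubmodule.smul_mem (⟨t, ht⟩ : 𝓞 F) hx
  exact this

lemma mem_sp {x y : F} : y ∈ sp x ↔ ∃ t : F, IsIntegral ℤ t ∧ y = t * x := by
  rw [mem_spanSingleton]
  constructor
  · rintro ⟨z, rfl⟩; exact ⟨z, z.2, by rw [Algebra.smul_def]⟩
  · rintro ⟨t, ht, rfl⟩; exact ⟨⟨t, ht⟩, rfl⟩

lemma mem_one' {y : F} : y ∈ (1 : FractionalIdeal (𝓞 F)⁰ F) ↔ IsIntegral ℤ y := by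
  rw [← spanSingleton_one, mem_sp]
  exact ⟨fun ⟨t, ht, h⟩ => by rwa [h, mul_one], fun h => ⟨y, h, by rw [mul_one]⟩⟩

lemma sq_le_one {K : Idl F} (h : ((K^2 : Idl F) : FractionalIdeal (𝓞 F)⁰ F) ≤ 1) : (K : FractionalIdeal (𝓞 F)⁰ F) ≤ 1 := by
  intro x hx
  rw [mem_one']
  have : x * x ∈ ((K^2 : Idl F) : FractionalIdeal (𝓞 F)⁰ F) := by
    rw [sq, Units.val_mul]; exact mul_mem_mul hx hx
  exact IsIntegral.of_pow two_pos (by rw [sq]; exact mem_one'.1 (h this))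

lemma sq_inj' {J K : Idl F} (h : J^2 = K^2) : J = K := by
  have h1 : (J * K⁻¹)^2 = 1 := by rw [mul_pow, h, inv_pow, mul_inv_cancel]
  set R := J * K⁻¹ with hR
  have h2 : (R : FractionalIdeal (𝓞 F)⁰ F) ≤ 1 := sq_le_one (by rw [h1, Units.val_one])
  have h3 : (1 : FractionalIdeal (𝓞 F)⁰ F) ≤ R := by
    have := mul_le_mul_right h2 (R : FractionalIdeal (𝓞 F)⁰ F)
    rwa [mul_one, ← Units.val_mul, ← sq, h1, Units.val_one] at this
  have h4 : R = 1 := Units.ext (le_antisymm h2 h3)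
  rw [hR] at h4
  exact mul_inv_eq_one.1 h4

/-- positive rational -/
def IsR (u : Fˣ) : Prop := ∃ q : ℚ, 0 < q ∧ (u:F) = q
lemma IsR.mul {u v : Fˣ} (hu : IsR u) (hv : IsR v) : IsR (u*v) := by
  obtain ⟨q, hq, e1⟩ := hu
  obtain ⟨r, hr, e2⟩ := hv
  exact ⟨q*r, mul_pos hq hr, by rw [Units.val_mul, e1, e2]; push_cast; ring⟩
lemma IsR.inv {u : Fˣ} (hu : IsR u) : IsR u⁻¹ := by
  obtain ⟨q, hq, e1⟩ := hu
  exact ⟨q⁻¹, inv_pos.2 hq, by rw [Units.val_inv_eq_inv_val, e1]; push_cast; ring⟩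
lemma IsR.tp {u : Fˣ} (hu : IsR u) : TP (u:F) := by
  obtain ⟨q, hq, e1⟩ := hu; rw [e1]; exact TP_rat hq
lemma exR {q : ℚ} (hq : 0 < q) : ∃ u : Fˣ, (u:F) = q ∧ IsR u :=
  ⟨Units.mk0 (q:F) (by exact_mod_cast hq.ne'), rfl, q, hq, rfl⟩

lemma pr_eq_iff {u v : Fˣ} : (pr u : Idl F) = pr v ↔ ∃ t : F, IsIntegral ℤ t ∧ IsIntegral ℤ t⁻¹ ∧ (u:F) = t * v := by
  constructor
  · intro h
    have h' : sp (u:F) = sp (v:F) := by rw [← pr_val, ← pr_val, h]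
    obtain ⟨t, ht, e1⟩ := mem_sp.1 (h' ▸ mem_spanSingleton_self _ (u:F) : (u:F) ∈ sp (v:F))
    obtain ⟨w, hw, e2⟩ := mem_sp.1 (h' ▸ mem_spanSingleton_self _ (v:F) : (v:F) ∈ sp (u:F))
    refine ⟨t, ht, ?_, e1⟩
    have h3 : t * w = 1 := by
      apply mul_right_cancel₀ u.ne_zero
      rw [one_mul, mul_assoc, ← e2, ← e1]
    rwa [inv_eq_of_mul_eq_one_right h3]
  · rintro ⟨t, h1, h2, e1⟩
    apply Units.ext
    rw [pr_val, pr_val]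
    have ht : t ≠ 0 := fun h0 => u.ne_zero (by rw [e1, h0, zero_mul])
    apply le_antisymm
    · rw [spanSingleton_le_iff_mem, e1]; exact mem_sp.2 ⟨t, h1, rfl⟩
    · rw [spanSingleton_le_iff_mem]; exact mem_sp.2 ⟨t⁻¹, h2, by rw [e1, ← mul_assoc, inv_mul_cancel₀ ht, one_mul]⟩

variable {D : ℕ}

lemma narrow_iff (e : QuadraticAlgebra ℚ (D:ℚ) 0 ≃+* F) {I : Idl F} : I ∈ narrowPrincipals F ↔ ∃ u : Fˣ, TP (u:F) ∧ I = pr u := by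
  constructor
  · intro h
    refine Subgroup.closure_induction (p := fun I _ => ∃ u : Fˣ, TP (u:F) ∧ I = pr u) ?_ ?_ ?_ ?_ h
    · rintro I ⟨x, hx, hI⟩
      have hx0 : x ≠ 0 := by
        rintro rfl
        have := ((TP_iff e 0).1 hx).1
        rw [show rr e (0:F) = 0 by simpa using rr_rat e 0] at this
        exact lt_irrefl _ this
      refine ⟨Units.mk0 x hx0, hx, Units.ext ?_⟩
      rw [pr_val]
      apply coeToSubmodule_injective
      exact hI.trans (coe_spanSingleton _ _).symm
    · exact ⟨1, fun φ => by simp, by rw [map_one]⟩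
    · rintro I J _ _ ⟨u, hu, rfl⟩ ⟨v, hv, rfl⟩
      exact ⟨u*v, by rw [Units.val_mul]; exact hu.mul hv, by rw [map_mul]⟩
    · rintro I _ ⟨u, hu, rfl⟩
      exact ⟨u⁻¹, by rw [Units.val_inv_eq_inv_val]; exact hu.inv, by rw [map_inv]⟩
  · rintro ⟨u, hu, rfl⟩
    apply Subgroup.subset_closure
    refine ⟨u, hu, ?_⟩
    rw [pr_val, coe_spanSingleton]

lemma cop_mem {M : FractionalIdeal (𝓞 F)⁰ F} {m n : ℤ} (h : IsCoprime m n) {x : F} (h1 : (m:F) * x ∈ M) (h2 : (n:F)*x ∈ M) : x ∈ M := by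
  obtain ⟨a, b, hab⟩ := h
  have : x = (a:F) * (m * x) + b * (n * x) := by
    have h' : (a:F) * m + b * n = 1 := by exact_mod_cast hab
    linear_combination (-x) * h'
  rw [this]
  exact M.coeToSubmodule.add_mem (int_mul_mem (isIntegral_intCast a) h1) (int_mul_mem (isIntegral_intCast b) h2)

lemma left_mem {I J : FractionalIdeal (𝓞 F)⁰ F} {x : F} (h : x ∈ I) : x ∈ I + J := by
  rw [← sup_eq_add]; exact (le_sup_left : I ≤ I ⊔ J) h
lemma right_mem {I J : FractionalIdeal (𝓞 F)⁰ F} {x : F} (h : x ∈ J) : x ∈ I + J := by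
  rw [← sup_eq_add]; exact (le_sup_right : J ≤ I ⊔ J) h
lemma sp_self (x : F) : x ∈ sp x := mem_spanSingleton_self _ x

/-- the explicit identities -/
lemma IB_ex (e : QuadraticAlgebra ℚ (D:ℚ) 0 ≃+* F) {B C : ℕ} (hBC : B * C = D) (hs : Squarefree D) :
    ∃ A : Idl F, (A : FractionalIdeal (𝓞 F)⁰ F) = sp (B:F) + sp (sD e) ∧ ∀ u : Fˣ, (u:F) = B → A^2 = pr u := by
  have hB0 : (B:F) ≠ 0 := by
    have : B ≠ 0 := fun h0 => hs.ne_zero (by rw [← hBC, h0, zero_mul])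
    exact_mod_cast this
  have hco : IsCoprime (B:ℤ) C := Nat.isCoprime_iff_coprime.2 (by rw [← hBC] at hs; exact Nat.coprime_of_squarefree_mul hs)
  have hD : sD e * sD e = (B:F) * C := by rw [sD_sq, ← hBC]; push_cast; ring
  have hne : sp (B:F) + sp (sD e) ≠ 0 := by
    intro h0
    have h1 : (B:F) ∈ sp (B:F) + sp (sD e) := left_mem (sp_self _)
    rw [h0, mem_zero_iff] at h1
    exact hB0 h1
  refine ⟨Units.mk0 _ hne, rfl, fun u hu => Units.ext ?_⟩
  rw [Units.val_pow_eq_pow_val, Units.val_mk0, pr_val, hu, sq]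
  apply le_antisymm
  · simp only [add_mul, mul_add, spanSingleton_mul_spanSingleton]
    simp only [← sup_eq_add, sup_le_iff, spanSingleton_le_iff_mem, mem_sp]
    refine ⟨⟨⟨B, isIntegral_natCast B, rfl⟩, ⟨sD e, sD_int e, rfl⟩⟩, ⟨sD e, sD_int e, by ring⟩, ⟨C, isIntegral_natCast C, by rw [hD]; ring⟩⟩
  · rw [spanSingleton_le_iff_mem]
    have hB : (B:F) ∈ sp (B:F) + sp (sD e) := left_mem (sp_self _)
    have hS : sD e ∈ sp (B:F) + sp (sD e) := right_mem (sp_self _)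
    apply cop_mem hco
    · exact_mod_cast mul_mem_mul hB hB
    · have := mul_mem_mul hS hS
      rw [hD, mul_comm (B:F) C] at this
      exact_mod_cast this

lemma IB_sq_class (e : QuadraticAlgebra ℚ (D:ℚ) 0 ≃+* F) {B C : ℕ} (hBC : B * C = D) (hs : Squarefree D) (h2 : D % 4 = 2) (A : Idl F)
    (hA : (A : FractionalIdeal (𝓞 F)⁰ F) = sp (B:F) + sp (sD e)) {x y z : ℤ} (hxyz : (B:ℤ) * x^2 = C * y^2 + z^2)
    (g1 : IsCoprime z y) (g2 : IsCoprime z D) (g3 : IsCoprime (B:ℤ) y) :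
    ∃ J : Idl F, ∃ u : Fˣ, TP (u:F) ∧ A * J^2 = pr u := by
  have hD : sD e * sD e = (B:F) * C := by rw [sD_sq, ← hBC]; push_cast; ring
  have hco : IsCoprime (B:ℤ) C := Nat.isCoprime_iff_coprime.2 (by rw [← hBC] at hs; exact Nat.coprime_of_squarefree_mul hs)
  have hB0 : 0 < B := Nat.pos_of_ne_zero fun h0 => by subst h0; omega
  have hxyz' : (B:F) * (x:F)^2 = C * (y:F)^2 + (z:F)^2 := by exact_mod_cast hxyz
  have hz0 : z ≠ 0 := by
    rintro rfl
    rw [isCoprime_zero_left] at g2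
    rcases Int.isUnit_iff.1 g2 with h | h <;> omega
  set α : F := (B:F) * x + y * sD e with hα
  have hαint : IsIntegral ℤ α :=
    ((isIntegral_natCast B).mul (isIntegral_intCast x)).add ((isIntegral_intCast y).mul (sD_int e))
  have hα' : α = ((B * x : ℚ):F) + ((y:ℚ):F) * sD e := by rw [hα]; push_cast; ring
  have hN : Nm e α = B * z^2 := by
    have h' : (B:ℚ) * x^2 = C * y^2 + z^2 := by exact_mod_cast hxyz
    unfold Nm
    rw [hα', rr_mk, ii_mk, ← hBC]; push_cast; linear_combination (B:ℚ) * h'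
  have hNpos : 0 < Nm e α := by rw [hN]; positivity
  have hα0 : α ≠ 0 := fun h0 => by
    rw [h0, show Nm e (0:F) = 0 by simpa using Nm_rat e 0] at hNpos; exact lt_irrefl _ hNpos
  have hz0' : (z:F) ≠ 0 := by exact_mod_cast hz0
  have hne : sp (z:F) + sp α ≠ 0 := by
    intro h0
    have h1 : (z:F) ∈ sp (z:F) + sp α := left_mem (sp_self _)
    rw [h0, mem_zero_iff] at h1
    exact hz0' h1
  have main : A * (Units.mk0 _ hne)^2 = pr (Units.mk0 α hα0) := by
    apply Units.ext
    rw [Units.val_mul, Units.val_pow_eq_pow_val, Units.val_mk0, pr_val, Units.val_mk0, hA, sq]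
    set S := sD e with hS
    have iS : IsIntegral ℤ S := sD_int e
    have iz : IsIntegral ℤ (z:F) := isIntegral_intCast z
    have iB : IsIntegral ℤ (B:F) := isIntegral_natCast B
    have eB : (B:F) * (z * z) = (B * x - y * S) * α := by
      rw [hα]; linear_combination (-(B:F)) * hxyz' + (y:F)^2 * hD
    have eS : S * (z * z) = (x * S - C * y) * α := by
      rw [hα]; linear_combination (-S) * hxyz' - (x:F) * y * hD
    have iy : IsIntegral ℤ ((B * x - y * S) : F) :=
      (iB.mul (isIntegral_intCast x)).sub ((isIntegral_intCast y).mul iS)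
    have ix : IsIntegral ℤ ((x * S - C * y) : F) :=
      ((isIntegral_intCast x).mul iS).sub ((isIntegral_natCast C).mul (isIntegral_intCast y))
    apply le_antisymm
    · simp only [add_mul, mul_add, spanSingleton_mul_spanSingleton]
      simp only [← sup_eq_add, sup_le_iff, spanSingleton_le_iff_mem, mem_sp]
      refine ⟨⟨⟨⟨_, iy, eB⟩, ⟨_, ix, eS⟩⟩, ⟨_, iB.mul iz, by ring⟩, ⟨_, iS.mul iz, by ring⟩⟩,
        ⟨⟨_, iB.mul iz, by ring⟩, ⟨_, iS.mul iz, by ring⟩⟩, ⟨_, iB.mul hαint, by ring⟩, ⟨_, iS.mul hαint, by ring⟩⟩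
    · rw [spanSingleton_le_iff_mem]
      set J := sp (z:F) + sp α with hJ
      have mz : (z:F) ∈ J := left_mem (sp_self _)
      have mα : α ∈ J := right_mem (sp_self _)
      have m1 := mul_mem_mul mz mα
      have m2 := mul_mem_mul mα mα
      have m3 := mul_mem_mul mz mz
      have m4 : ((2 * y * D : ℤ):F) * α ∈ J * J := by
        have h5 := (J*J).coeToSubmodule.sub_mem m2 (int_mul_mem iB m3)
        have h6 := int_mul_mem iS h5
        have h7 : S * (α * α - B * (z*z)) = ((2 * y * D : ℤ):F) * α := by
          rw [eB]; push_cast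
          have hDS : (D:F) = S * S := (sD_sq e).symm
          rw [hDS, hα]; ring
        rwa [h7] at h6
      have hz2 : IsCoprime z 2 := by
        obtain ⟨k, hk⟩ : ∃ k : ℤ, (D:ℤ) = 2 * k := ⟨D/2, by omega⟩
        rw [hk] at g2; exact g2.of_mul_right_left
      have m5 : α ∈ J * J := cop_mem ((hz2.mul_right g1).mul_right g2) m1 m4
      have mB : (B:F) ∈ sp (B:F) + sp S := left_mem (sp_self _)
      have mS : S ∈ sp (B:F) + sp S := right_mem (sp_self _)
      refine cop_mem (hco.mul_right g3) (by exact_mod_cast mul_mem_mul mB m5) ?_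
      have h8 := ((sp (B:F) + sp S) * (J * J)).coeToSubmodule.sub_mem
        (int_mul_mem (isIntegral_intCast x) (mul_mem_mul mS m5)) (mul_mem_mul mS m3)
      rw [eS] at h8
      have h9 : (x:F) * (S * α) - (x * S - C * y) * α = (((C:ℤ) * y : ℤ):F) * α := by push_cast; ring
      rwa [h9] at h8
  rcases lt_trichotomy (rr e α) 0 with h | h | h
  · have hneg : (-1:F) = ((-1:ℚ):F) := by push_cast; ring
    refine ⟨_, Units.mk0 (-1 * α) (by simpa using hα0), (TP_iff e _).2 ⟨?_, ?_⟩, main.trans ?_⟩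
    · rw [Units.val_mk0, hneg, rr_mul, rr_rat, ii_rat]; linarith
    · rw [Units.val_mk0, hneg, Nm_mul, Nm_rat]; linarith
    · have i1 : IsIntegral ℤ (-1:F) := isIntegral_one.neg
      exact pr_eq_iff.2 ⟨-1, i1, by rwa [inv_neg, inv_one], by simp⟩
  · exfalso
    unfold Nm at hNpos
    rw [h] at hNpos
    have : (0:ℚ) ≤ D * ii e α ^2 := by positivity
    linarith
  · exact ⟨_, Units.mk0 α hα0, (TP_iff e α).2 ⟨h, hNpos⟩, main⟩

end
end FR

namespace FR
open Finset QuadraticAlgebra FractionalIdeal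

section
variable {F : Type} [Field F] [NumberField F] {D : ℕ}

/-- the ramified ideal of norm `B` -/
noncomputable def IB (e : QuadraticAlgebra ℚ (D:ℚ) 0 ≃+* F) (B : ℕ) : Idl F :=
  if h : sp (B:F) + sp (sD e) ≠ 0 then Units.mk0 _ h else 1

lemma IB_spec (e : QuadraticAlgebra ℚ (D:ℚ) 0 ≃+* F) (hs : Squarefree D) {B : ℕ} (hB : B ∣ D) :
    ((IB e B : Idl F) : FractionalIdeal (𝓞 F)⁰ F) = sp (B:F) + sp (sD e) ∧ ∀ u : Fˣ, (u:F) = B → (IB e B)^2 = pr u := by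
  obtain ⟨C, hC⟩ := hB
  obtain ⟨A, h1, h2⟩ := IB_ex e hC.symm hs
  have hne : sp (B:F) + sp (sD e) ≠ 0 := by rw [← h1]; exact A.ne_zero
  have : IB e B = A := by
    apply Units.ext
    unfold IB
    rw [dif_pos hne, Units.val_mk0, h1]
  rw [this]
  exact ⟨h1, h2⟩

noncomputable def aN : Idl F →* ℚ :=
  ((FractionalIdeal.absNorm : FractionalIdeal (𝓞 F)⁰ F →*₀ ℚ) : FractionalIdeal (𝓞 F)⁰ F →* ℚ).comp (Units.coeHom _)
lemma aN_pos (I : Idl F) : 0 < aN I := by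
  apply lt_of_le_of_ne (absNorm_nonneg _)
  intro h
  exact I.ne_zero (absNorm_eq_zero_iff.1 h.symm)
lemma aN_pr (e : QuadraticAlgebra ℚ (D:ℚ) 0 ≃+* F) (u : Fˣ) : aN (pr u : Idl F) = |Nm e u| := by
  have : aN (pr u : Idl F) = absNorm (sp (u:F)) := by rw [← pr_val]; rfl
  rw [this, absNorm_span_singleton, Nm_alg e]

lemma dvd_cop {e : QuadraticAlgebra ℚ (D:ℚ) 0 ≃+* F} (hs : Squarefree D) (h4 : D % 4 = 2) {m p : ℕ} (hp : p.Prime)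
    (hpm : p ∣ m) (hpD : ¬ p ∣ D) {x t : F} (hx : IsIntegral ℤ x) (ht : IsIntegral ℤ t) (h : x * x = t * (m:F)) :
    IsIntegral ℤ ((p:F)⁻¹ * x) := by
  obtain ⟨⟨a, ha⟩, b, hb⟩ := (int_iff e hs h4 x).1 hx
  obtain ⟨⟨a', ha'⟩, b', hb'⟩ := (int_iff e hs h4 t).1 ht
  have hm : (m:F) = ((m:ℚ):F) := by simp
  have h1 := congrArg (rr e) h
  have h2 := congrArg (ii e) h
  rw [hm, rr_mul, rr_mul, rr_rat, ii_rat, ha, hb, ha', hb'] at h1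
  rw [hm, ii_mul, ii_mul, rr_rat, ii_rat, ha, hb, ha', hb'] at h2
  have h1' : a * a + D * b * b = a' * m := by
    have : (a * a + D * b * b : ℚ) = a' * m := by linarith
    exact_mod_cast this
  have h2' : 2 * a * b = b' * m := by
    have : (2 * a * b : ℚ) = b' * m := by linarith
    exact_mod_cast this
  have hpi : Prime (p:ℤ) := Nat.prime_iff_prime_int.1 hp
  have hpm' : (p:ℤ) ∣ m := by exact_mod_cast hpm
  have hpD' : ¬ (p:ℤ) ∣ D := by exact_mod_cast hpD
  have hp2 : ¬ (p:ℤ) ∣ 2 := fun h => hpD' (h.trans ⟨D/2, by omega⟩)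
  have d1 : (p:ℤ) ∣ a * a + D * b * b := h1' ▸ hpm'.mul_left _
  have d2 : (p:ℤ) ∣ 2 * a * b := h2' ▸ hpm'.mul_left _
  have key : (p:ℤ) ∣ a ∧ (p:ℤ) ∣ b := by
    rcases hpi.dvd_or_dvd d2 with h | h
    · rcases hpi.dvd_or_dvd h with h | h
      · exact absurd h hp2
      · refine ⟨h, ?_⟩
        have h3 := (Int.dvd_add_right (h.mul_right a)).1 d1
        rcases hpi.dvd_or_dvd h3 with h | h
        · rcases hpi.dvd_or_dvd h with h | h
          · exact absurd h hpD'
          · exact h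
        · exact h
    · refine ⟨?_, h⟩
      have h3 := (Int.dvd_add_left (h.mul_left (D * b))).1 d1
      exact (hpi.dvd_or_dvd h3).elim id id
  obtain ⟨⟨a1, rfl⟩, ⟨b1, rfl⟩⟩ := key
  have hp0 : (p:ℚ) ≠ 0 := by exact_mod_cast hp.ne_zero
  have hpc : (p:F)⁻¹ = (((p:ℚ)⁻¹:ℚ):F) := by push_cast; rfl
  refine (int_iff e hs h4 _).2 ⟨⟨a1, ?_⟩, b1, ?_⟩
  · rw [hpc, rr_mul, rr_rat, ii_rat, ha]; push_cast; field_simp; ring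
  · rw [hpc, ii_mul, rr_rat, ii_rat, hb]; push_cast; field_simp; ring

/-- ideals whose square is rational -/
lemma rat_sq (e : QuadraticAlgebra ℚ (D:ℚ) 0 ≃+* F) (hs : Squarefree D) (h4 : D % 4 = 2) {I : Idl F} {u : Fˣ} (hu : IsR u) (hI : I^2 = pr u) :
    ∃ B, B ∣ D ∧ ∃ c : Fˣ, IsR c ∧ I = pr c * IB e B := by
  obtain ⟨q, hq, huq⟩ := hu
  obtain ⟨m, k, hmk, hm⟩ := Nat.sq_mul_squarefree (q.num.natAbs * q.den)
  have hk0 : k ≠ 0 := by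
    rintro rfl
    have h1 : q.num.natAbs ≠ 0 := Int.natAbs_ne_zero.2 (Rat.num_pos.2 hq).ne'
    have h2 := q.den_nz
    have := Nat.mul_ne_zero h1 h2
    omega
  have hqm : q = m * ((k:ℚ)/q.den)^2 := by
    have h1 : ((k:ℚ)^2 * m) = q.num * q.den := by
      have : ((k^2 * m : ℕ):ℤ) = q.num * q.den := by
        rw [hmk]; push_cast; rw [abs_of_pos (Rat.num_pos.2 hq)]
      exact_mod_cast this
    have hd : (q.den:ℚ) ≠ 0 := by exact_mod_cast q.den_nz
    rw [div_pow, mul_div_assoc', mul_comm, h1]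
    conv_lhs => rw [← Rat.num_div_den q]
    field_simp
  have hcp : (0:ℚ) < (k:ℚ)/q.den := div_pos (by positivity) (by exact_mod_cast q.den_pos)
  obtain ⟨c, hc, hcR⟩ := exR (F := F) hcp
  have hm0 : m ≠ 0 := hm.ne_zero
  obtain ⟨v, hv, hvR⟩ := exR (F := F) (q := (m:ℚ)) (by positivity)
  have hv' : (v:F) = m := by rw [hv]; simp
  have huv : u = v * c^2 := by
    apply Units.ext; rw [huq, Units.val_mul, Units.val_pow_eq_pow_val, hv, hc]
    conv_lhs => rw [hqm]
    push_cast; rfl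
  set K : Idl F := I * (pr c)⁻¹ with hK
  have hK2 : K^2 = pr v := by
    rw [hK, mul_pow, hI, huv, map_mul, map_pow, inv_pow, mul_inv_cancel_right]
  have hmem : ∀ x ∈ (K : FractionalIdeal (𝓞 F)⁰ F), ∃ t : F, IsIntegral ℤ t ∧ x * x = t * m := by
    intro x hx
    have h1 := mul_mem_mul hx hx
    rw [← Units.val_mul, ← sq, hK2, pr_val, hv'] at h1
    exact mem_sp.1 h1
  have hmD : m ∣ D := by
    rw [← Nat.prod_primeFactors_of_squarefree hm]
    refine Finset.prod_primes_dvd D (fun p hp => (Nat.prime_of_mem_primeFactors hp).prime) fun p hp => ?_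
    have hpp := Nat.prime_of_mem_primeFactors hp
    have hpm := Nat.dvd_of_mem_primeFactors hp
    by_contra hpD
    obtain ⟨w, hw, hwR⟩ := exR (F := F) (q := (p:ℚ)) (by exact_mod_cast hpp.pos)
    have hle : ((K * (pr w)⁻¹ : Idl F) : FractionalIdeal (𝓞 F)⁰ F) ≤ 1 := by
      rw [← map_inv, Units.val_mul, pr_val]
      rw [mul_comm, spanSingleton_mul_le_iff]
      intro x hx
      obtain ⟨t, ht, hxt⟩ := hmem x hx
      have hxi : IsIntegral ℤ x := IsIntegral.of_pow two_pos (by rw [sq, hxt]; exact ht.mul (isIntegral_natCast m))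
      rw [mem_one', Units.val_inv_eq_inv_val, hw]
      have := dvd_cop (e := e) hs h4 hpp hpm hpD hxi ht hxt
      simpa using this
    have hle2 : (((K * (pr w)⁻¹)^2 : Idl F) : FractionalIdeal (𝓞 F)⁰ F) ≤ 1 := by
      rw [sq, Units.val_mul]
      exact (mul_le_mul' hle hle).trans (by rw [mul_one])
    rw [mul_pow, hK2, ← map_inv, ← map_pow, ← map_mul, pr_val, spanSingleton_le_iff_mem, mem_one'] at hle2
    have hval : ((v * w⁻¹^2 : Fˣ):F) = (((m:ℚ)/p^2:ℚ):F) := by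
      rw [Units.val_mul, Units.val_pow_eq_pow_val, Units.val_inv_eq_inv_val, hv, hw]; push_cast
      rw [div_eq_mul_inv, inv_pow]
    rw [hval] at hle2
    obtain ⟨j, hj⟩ := rat_int hle2
    have hp0 : (p:ℚ)^2 ≠ 0 := pow_ne_zero _ (by exact_mod_cast hpp.ne_zero)
    rw [div_eq_iff hp0] at hj
    have hj' : (m:ℤ) = j * p^2 := by exact_mod_cast hj
    have hd : p * p ∣ m := by
      have : ((p*p:ℕ):ℤ) ∣ m := ⟨j, by rw [hj']; push_cast; ring⟩
      exact_mod_cast this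
    exact hpp.not_isUnit (hm p hd)
  refine ⟨m, hmD, c, hcR, ?_⟩
  have : K = IB e m := sq_inj' (by rw [hK2, (IB_spec e hs hmD).2 v hv'])
  rw [← this, hK, mul_comm, inv_mul_cancel_right]

lemma IB_inj (e : QuadraticAlgebra ℚ (D:ℚ) 0 ≃+* F) (hs : Squarefree D) {B B' : ℕ} (hB : B ∣ D) (hB' : B' ∣ D) {c : Fˣ} (hc : IsR c)
    (h : IB e B = pr c * IB e B') : B = B' := by
  have hp : ∀ B, B ∣ D → (0:ℚ) < B := fun B hB => by exact_mod_cast Nat.pos_of_dvd_of_pos hB (Nat.pos_of_ne_zero hs.ne_zero)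
  obtain ⟨u, hu, _⟩ := exR (F := F) (hp B hB)
  obtain ⟨u', hu', _⟩ := exR (F := F) (hp B' hB')
  obtain ⟨q, hq, hcq⟩ := hc
  have h2 := congrArg (fun I => aN (I^2)) h
  simp only [mul_pow] at h2
  rw [(IB_spec e hs hB).2 u (by rw [hu]; simp), (IB_spec e hs hB').2 u' (by rw [hu']; simp), ← map_pow, ← map_mul,
    aN_pr e, aN_pr e, Units.val_mul, Units.val_pow_eq_pow_val, hu, hu', hcq, ← Rat.cast_pow, ← Rat.cast_mul, Nm_rat, Nm_rat,
    abs_of_nonneg (sq_nonneg _), abs_of_nonneg (sq_nonneg _)] at h2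
  have p1 := hp B hB
  have p2 := hp B' hB'
  have h3 : (B:ℚ) = q^2 * B' := by
    rwa [sq_eq_sq₀ p1.le (by positivity)] at h2
  have h4 : B * q.den^2 = q.num.natAbs^2 * B' := by
    have : (B:ℚ) * q.den^2 = q.num^2 * B' := by
      have hqd : q * q.den = q.num := Rat.mul_den_eq_num q
      rw [h3]
      linear_combination (q * q.den + q.num) * B' * hqd
    have : (B:ℤ) * q.den^2 = q.num^2 * B' := by exact_mod_cast this
    zify; rw [sq_abs]; exact this
  have hcop : Nat.Coprime (q.den^2) (q.num.natAbs^2) := (Nat.Coprime.pow 2 2 q.reduced).symm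
  have a1 : q.den^2 ∣ B' := hcop.dvd_of_dvd_mul_left (h4 ▸ dvd_mul_left _ _)
  have a2 : q.num.natAbs^2 ∣ B := hcop.symm.dvd_of_dvd_mul_right (h4 ▸ dvd_mul_right _ _)
  have b1 : q.den = 1 := Nat.isUnit_iff.1 ((hs.squarefree_of_dvd hB') _ (by rw [← sq]; exact a1))
  have b2 : q.num.natAbs = 1 := Nat.isUnit_iff.1 ((hs.squarefree_of_dvd hB) _ (by rw [← sq]; exact a2))
  rw [b1, b2] at h4
  omega

/-- two-torsion narrow classes come from ramified ideals -/
lemma two_tors (e : QuadraticAlgebra ℚ (D:ℚ) 0 ≃+* F) (hs : Squarefree D) (h4 : D % 4 = 2) {I : Idl F} {x : Fˣ} (hx : TP (x:F)) (hI : I^2 = pr x) :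
    ∃ B, B ∣ D ∧ ∃ c : Fˣ, TP (c:F) ∧ I = pr c * IB e B := by
  obtain ⟨hx1, hx2⟩ := (TP_iff e _).1 hx
  have hn := congrArg aN hI
  rw [map_pow, aN_pr e, abs_of_pos hx2] at hn
  set n := aN I with hnd
  have hn0 : 0 < n := aN_pos I
  have hyTP : TP ((((1:ℚ):F)) + ((n⁻¹:ℚ):F) * x) := fun φ => by
    rw [map_add, map_mul, map_ratCast, map_ratCast]
    have := hx φ
    have : (0:ℝ) < (n⁻¹:ℚ) := by exact_mod_cast inv_pos.2 hn0
    push_cast at *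
    positivity
  have hy0 : ((((1:ℚ):F)) + ((n⁻¹:ℚ):F) * x) ≠ 0 := by
    intro h0
    have := ((TP_iff e _).1 hyTP).1
    rw [h0, show rr e (0:F) = 0 by simpa using rr_rat e 0] at this
    exact lt_irrefl _ this
  have hr : 0 < 2 * n⁻¹ * (1 + n⁻¹ * rr e x) := by positivity
  obtain ⟨r, hr1, hr2⟩ := exR (F := F) hr
  have key : (Units.mk0 _ hy0)^2 = x * r := by
    apply Units.ext
    rw [Units.val_pow_eq_pow_val, Units.val_mk0, Units.val_mul, hr1]
    have h5 := quad_eq e (x:F)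
    rw [← hn] at h5
    have hn' : (n:F) ≠ 0 := by exact_mod_cast hn0.ne'
    push_cast at h5 ⊢
    field_simp
    linear_combination h5
  obtain ⟨B, hB, c, hc, hIc⟩ := rat_sq e hs h4 (I := I * (pr (Units.mk0 _ hy0))⁻¹) (u := r⁻¹) hr2.inv (by
    rw [mul_pow, hI, inv_pow, ← map_pow, key, ← map_inv, ← map_mul, mul_inv, mul_inv_cancel_left])
  refine ⟨B, hB, c * Units.mk0 _ hy0, ?_, ?_⟩
  · rw [Units.val_mul]; exact hc.tp.mul hyTP
  · rw [map_mul, mul_right_comm, ← hIc, inv_mul_cancel_right]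

/-- `IB B` is a square in the narrow class group iff `B` is a norm -/
lemma IB_isSq (e : QuadraticAlgebra ℚ (D:ℚ) 0 ≃+* F) (hs : Squarefree D) (h4 : D % 4 = 2) (hns : ¬ IsSquare D) {B : ℕ} (hB : B ∣ D) :
    (∃ J : Idl F, ∃ u : Fˣ, TP (u:F) ∧ IB e B * J^2 = pr u) ↔ isN D B := by
  constructor
  · rintro ⟨J, u, hu, h⟩
    have hp : (0:ℚ) < B := by exact_mod_cast Nat.pos_of_dvd_of_pos hB (Nat.pos_of_ne_zero hs.ne_zero)
    obtain ⟨v, hv, _⟩ := exR (F := F) hp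
    have h1 := congrArg aN ((IB_spec e hs hB).2 v (by rw [hv]; simp))
    rw [map_pow, aN_pr e, hv, Nm_rat, abs_of_nonneg (sq_nonneg _), sq_eq_sq₀ (aN_pos _).le hp.le] at h1
    have h2 := congrArg aN h
    rw [map_mul, map_pow, aN_pr e, abs_of_pos ((TP_iff e _).1 hu).2, h1] at h2
    have h3 : isN D (Nm e u * (aN J)⁻¹^2) := isN.sq ⟨rr e u, ii e u, rfl⟩
    rw [← h2, mul_assoc, ← mul_pow, mul_inv_cancel₀ (aN_pos J).ne', one_pow, mul_one] at h3
    exact h3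
  · intro h
    obtain ⟨C, hC⟩ := hB
    obtain ⟨x, y, z, h1, h2, h3, h5⟩ := prim hC.symm hs h hns
    exact IB_sq_class e hC.symm hs h4 _ (IB_spec e hs ⟨C, hC⟩).1 h1 h2 h3 h5
end
end FR

namespace FR
open Finset QuadraticAlgebra FractionalIdeal

section
variable {F : Type} [Field F] [NumberField F] {D : ℕ}

noncomputable def pellE (e : QuadraticAlgebra ℚ (D:ℚ) 0 ≃+* F) : Pell.Solution₁ (D:ℤ) →* Fˣ :=
  MonoidHom.toHomUnits
    { toFun := fun a => ((a.x:ℚ):F) + ((a.y:ℚ):F) * sD e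
      map_one' := by simp
      map_mul' := fun a b => by
        have h := sD_sq e
        rw [Pell.Solution₁.x_mul, Pell.Solution₁.y_mul]; push_cast
        linear_combination (-(a.y:F) * b.y) * h }

lemma pellE_val (e : QuadraticAlgebra ℚ (D:ℚ) 0 ≃+* F) (a : Pell.Solution₁ (D:ℤ)) :
    ((pellE e a : Fˣ) : F) = ((a.x:ℚ):F) + ((a.y:ℚ):F) * sD e := rfl

lemma pellE_Nm (e : QuadraticAlgebra ℚ (D:ℚ) 0 ≃+* F) (a : Pell.Solution₁ (D:ℤ)) : Nm e (pellE e a : Fˣ) = 1 := by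
  rw [pellE_val]; unfold Nm; rw [rr_mk, ii_mk]
  exact_mod_cast a.prop

lemma pellE_int (e : QuadraticAlgebra ℚ (D:ℚ) 0 ≃+* F) (a : Pell.Solution₁ (D:ℤ)) : IsIntegral ℤ ((pellE e a : Fˣ) : F) := by
  rw [pellE_val, Rat.cast_intCast, Rat.cast_intCast]
  exact (isIntegral_intCast _).add ((isIntegral_intCast _).mul (sD_int e))

lemma pr_pellE (e : QuadraticAlgebra ℚ (D:ℚ) 0 ≃+* F) (a : Pell.Solution₁ (D:ℤ)) : (pr (pellE e a) : Idl F) = 1 := by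
  rw [← map_one pr]
  refine pr_eq_iff.2 ⟨(pellE e a : Fˣ), pellE_int e a, ?_, by simp⟩
  rw [← Units.val_inv_eq_inv_val, ← map_inv]
  exact pellE_int e _

lemma unit_pell (e : QuadraticAlgebra ℚ (D:ℚ) 0 ≃+* F) (hs : Squarefree D) (h4 : D % 4 = 2)
    {a : Pell.Solution₁ (D:ℤ)} (ha : Pell.IsFundamental a) {t : F}
    (ht : TP t) (h1 : IsIntegral ℤ t) (h2 : IsIntegral ℤ t⁻¹) : ∃ k : ℤ, t = (pellE e (a^k) : Fˣ) := by
  obtain ⟨hr, hN⟩ := (TP_iff e t).1 ht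
  obtain ⟨⟨x, hx⟩, y, hy⟩ := (int_iff e hs h4 t).1 h1
  obtain ⟨⟨x', hx'⟩, y', hy'⟩ := (int_iff e hs h4 _).1 h2
  have hinv := Nm_inv e t
  have hmul : Nm e t * Nm e t⁻¹ = 1 := by rw [hinv]; exact mul_inv_cancel₀ hN.ne'
  have hprod : (x^2 - D * y^2) * (x'^2 - D * y'^2) = (1:ℤ) := by
    unfold Nm at hmul; rw [hx, hy, hx', hy'] at hmul; exact_mod_cast hmul
  have hpos : 0 < x^2 - (D:ℤ) * y^2 := by
    unfold Nm at hN; rw [hx, hy] at hN; exact_mod_cast hN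
  have hone : x^2 - (D:ℤ) * y^2 = 1 := by
    rcases Int.isUnit_iff.1 (IsUnit.of_mul_eq_one _ hprod) with h | h
    · exact h
    · omega
  set b : Pell.Solution₁ (D:ℤ) := Pell.Solution₁.mk x y hone with hb
  have hbx : 0 < b.x := by
    rw [hb, Pell.Solution₁.x_mk]; rw [hx] at hr; exact_mod_cast hr
  have htb : t = (pellE e b : Fˣ) := by
    rw [pellE_val, hb, Pell.Solution₁.x_mk, Pell.Solution₁.y_mk, ← hx, ← hy]; exact decomp_ri e t
  obtain ⟨k, hk | hk⟩ := ha.eq_zpow_or_neg_zpow b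
  · exact ⟨k, by rw [htb, hk]⟩
  · exfalso
    rw [hk, Pell.Solution₁.x_neg] at hbx
    have := Pell.Solution₁.x_zpow_pos ha.x_pos k
    omega

lemma isR_of_sq (e : QuadraticAlgebra ℚ (D:ℚ) 0 ≃+* F) (hD : 0 < D) {y q : Fˣ} (hy : TP (y:F)) (hq : IsR q) (h : y^2 = q) : IsR y := by
  obtain ⟨r, hr, hqr⟩ := hq
  obtain ⟨h1, h2⟩ := (TP_iff e _).1 hy
  exact ⟨_, h1, rat_of_sq e hD (by rw [← Units.val_pow_eq_pow_val, h, hqr]) h2⟩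

lemma pell_tp (e : QuadraticAlgebra ℚ (D:ℚ) 0 ≃+* F) {a : Pell.Solution₁ (D:ℤ)} (ha : 0 < a.x) : TP ((pellE e a : Fˣ) : F) := by
  refine (TP_iff e _).2 ⟨?_, by rw [pellE_Nm]; exact one_pos⟩
  rw [pellE_val, rr_mk]; exact_mod_cast ha

lemma unit_ex (e : QuadraticAlgebra ℚ (D:ℚ) 0 ≃+* F) (hs : Squarefree D) (h4 : D % 4 = 2) (hns : ¬ IsSquare D) :
    ∃ w : Fˣ, TP (w:F) ∧ (∃ r : Fˣ, IsR r ∧ (pr w : Idl F)^2 = pr r) ∧ (∀ c : Fˣ, IsR c → (pr w : Idl F) ≠ pr c) ∧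
      ∀ x q : Fˣ, TP (x:F) → IsR q → (pr x : Idl F)^2 = pr q → ∃ c, IsR c ∧ ((pr x : Idl F) = pr c ∨ (pr x : Idl F) = pr c * pr w) := by
  have hD : 0 < D := Nat.pos_of_ne_zero hs.ne_zero
  have hns' : ¬ IsSquare (D:ℤ) := by rwa [Int.isSquare_natCast_iff]
  obtain ⟨a, ha⟩ := Pell.IsFundamental.exists_of_not_isSquare (d := (D:ℤ)) (by exact_mod_cast hD) hns'
  have hax := ha.x_pos
  set ε : Fˣ := pellE e a with hε
  have hεTP : TP (ε:F) := pell_tp e hax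
  have hωTP : TP (1 + (ε:F)) := fun φ => by rw [map_add, map_one]; have := hεTP φ; positivity
  have hω0 : 1 + (ε:F) ≠ 0 := by
    intro h0
    have := ((TP_iff e _).1 hωTP).1
    rw [h0, show rr e (0:F) = 0 by simpa using rr_rat e 0] at this
    exact lt_irrefl _ this
  obtain ⟨w, hw⟩ : ∃ w : Fˣ, (w:F) = 1 + ε := ⟨Units.mk0 _ hω0, rfl⟩
  have hax' : (0:ℚ) < a.x := by exact_mod_cast hax
  obtain ⟨r, hr, hrR⟩ := exR (F := F) (q := 2 + 2 * (a.x:ℚ)) (by positivity)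
  have hw2 : w^2 = r * ε := by
    apply Units.ext
    rw [Units.val_pow_eq_pow_val, Units.val_mul, hw, hr]
    have h5 := quad_eq e (ε:F)
    rw [hε, pellE_Nm, pellE_val, rr_mk, ← pellE_val, ← hε] at h5
    push_cast at h5 ⊢
    linear_combination h5
  have hprε : ∀ k : ℤ, (pr (ε^k) : Idl F) = 1 := fun k => by rw [hε, ← map_zpow]; exact pr_pellE e _
  refine ⟨w, hw ▸ hωTP, ⟨r, hrR, ?_⟩, ?_, ?_⟩
  · rw [← map_pow, hw2, map_mul, hε, pr_pellE, mul_one]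
  · intro c hc h
    obtain ⟨t, t1, t2, t3⟩ := pr_eq_iff.1 h
    have hct := hc.tp
    have htp : TP t := by
      have : t = w * (c:F)⁻¹ := by rw [t3, mul_inv_cancel_right₀ c.ne_zero]
      rw [this, hw]; exact hωTP.mul hct.inv
    obtain ⟨k, hk⟩ := unit_pell e hs h4 ha htp t1 t2
    have hwk : w = ε^k * c := by
      apply Units.ext; rw [t3, hk, Units.val_mul, map_zpow]
    have h6 : ε^(2*k-1) = r * c⁻¹^2 := by
      have h7 : ε^(2*k) * c^2 = r * ε := by
        rw [← hw2, hwk, mul_pow, mul_comm 2 k, zpow_mul]; norm_cast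
      rw [zpow_sub_one, inv_pow, ← div_eq_mul_inv, ← div_eq_mul_inv, div_eq_div_iff_mul_eq_mul, h7]
    obtain ⟨s, hs0, hs1⟩ := (show IsR (ε^(2*k-1)) by rw [h6, sq]; exact hrR.mul (hc.inv.mul hc.inv))
    have h8 := congrArg (ii e) hs1
    rw [hε, ← map_zpow, pellE_val, ii_mk, ii_rat] at h8
    have h9 : (a^(2*k-1)).y = 0 := by exact_mod_cast h8
    rcases Pell.Solution₁.eq_one_or_neg_one_iff_y_eq_zero.2 h9 with h | h
    · have := (ha.zpow_eq_one_iff _).1 h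
      omega
    · exact ha.zpow_ne_neg_zpow (n := 2*k-1) (n' := 0) (by rw [h, zpow_zero])
  · intro x q hx hq h
    rw [← map_pow] at h
    obtain ⟨t, t1, t2, t3⟩ := pr_eq_iff.1 h
    have htp : TP t := by
      have : t = (x:F) * x * (q:F)⁻¹ := by
        rw [← sq, ← Units.val_pow_eq_pow_val, t3, mul_inv_cancel_right₀ q.ne_zero]
      rw [this]; exact (hx.mul hx).mul hq.tp.inv
    obtain ⟨k, hk⟩ := unit_pell e hs h4 ha htp t1 t2
    have hxk : x^2 = ε^k * q := by
      apply Units.ext; rw [t3, hk, Units.val_mul, map_zpow]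
    have hjT : ∀ j : ℤ, TP (((ε^j)⁻¹ : Fˣ) : F) := fun j => by
      rw [Units.val_inv_eq_inv_val, hε, ← map_zpow]
      exact (pell_tp e (Pell.Solution₁.x_zpow_pos hax j)).inv
    rcases Int.even_or_odd' k with ⟨j, hj | hj⟩
    · refine ⟨x * (ε^j)⁻¹, isR_of_sq e hD ?_ hq ?_, Or.inl ?_⟩
      · rw [Units.val_mul]; exact hx.mul (hjT j)
      · rw [mul_pow, hxk, hj, inv_pow, mul_inv_eq_iff_eq_mul, mul_comm, mul_comm 2 j, zpow_mul]; norm_cast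
      · rw [map_mul, map_inv, hprε, inv_one, mul_one]
    · refine ⟨x * (ε^j)⁻¹ * w⁻¹, isR_of_sq e hD ?_ (hq.mul hrR.inv) ?_, Or.inr ?_⟩
      · rw [Units.val_mul, Units.val_mul, Units.val_inv_eq_inv_val w, hw]; exact (hx.mul (hjT j)).mul hωTP.inv
      · rw [mul_pow, mul_pow, hxk, hj, inv_pow, inv_pow, hw2, zpow_add_one, mul_comm 2 j, zpow_mul, mul_inv]
        have : (ε^j)^(2:ℤ) = (ε^j)^2 := by norm_cast
        rw [this, mul_comm r⁻¹]
        generalize (ε^j)^2 = E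
        apply Units.ext
        simp only [Units.val_mul, Units.val_inv_eq_inv_val]
        field_simp
      · rw [map_mul, map_mul, map_inv, map_inv, hprε, inv_one, mul_one, inv_mul_cancel_right]
end
end FR

namespace FR
open Finset QuadraticAlgebra FractionalIdeal

section
variable {F : Type} [Field F] [NumberField F] {D : ℕ}

lemma cls_eq (e : QuadraticAlgebra ℚ (D:ℚ) 0 ≃+* F) {I J : Idl F} :
    (QuotientGroup.mk I : NarrowClassGroup F) = QuotientGroup.mk J ↔ ∃ u : Fˣ, TP (u:F) ∧ I = pr u * J := by
  rw [eq_comm, QuotientGroup.eq, narrow_iff e]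
  constructor
  · rintro ⟨u, hu, h⟩; exact ⟨u, hu, by rw [← h, mul_comm, mul_inv_cancel_left]⟩
  · rintro ⟨u, hu, rfl⟩; exact ⟨u, hu, by rw [mul_comm, mul_inv_cancel_right]⟩

lemma cls_card (e : QuadraticAlgebra ℚ (D:ℚ) 0 ≃+* F) (hs : Squarefree D) (h4 : D % 4 = 2) (hns : ¬ IsSquare D) :
    (D.divisors.filter (fun B : ℕ => isN D B)).card =
      2 * Nat.card {g : NarrowClassGroup F // g^2 = 1 ∧ ∃ h, h^2 = g} := by
  set T := D.divisors.filter (fun B : ℕ => isN D B) with hT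
  set c : ℕ → NarrowClassGroup F := fun B => QuotientGroup.mk (IB e B) with hc
  have hBR : ∀ B, B ∣ D → ∃ u : Fˣ, IsR u ∧ (IB e B)^2 = pr u := fun B hB => by
    obtain ⟨u, hu, hR⟩ := exR (F := F) (q := (B:ℚ)) (by exact_mod_cast Nat.pos_of_dvd_of_pos hB (Nat.pos_of_ne_zero hs.ne_zero))
    exact ⟨u, hR, (IB_spec e hs hB).2 u (by rw [hu]; simp)⟩
  have hsq : ∀ B, B ∣ D → ((∃ h, h^2 = c B) ↔ isN D B) := fun B hB => by
    rw [← IB_isSq e hs h4 hns hB]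
    constructor
    · rintro ⟨h, hh⟩
      obtain ⟨J, rfl⟩ := QuotientGroup.mk_surjective h
      obtain ⟨u, hu, h1⟩ := (cls_eq e).1 (show (QuotientGroup.mk (IB e B) : NarrowClassGroup F) = QuotientGroup.mk (J^2) from hh.symm)
      exact ⟨J⁻¹, u, hu, by rw [h1, inv_pow, mul_inv_cancel_right]⟩
    · rintro ⟨J, u, hu, h1⟩
      refine ⟨QuotientGroup.mk J⁻¹, ?_⟩
      exact ((cls_eq e).2 ⟨u, hu, by rw [← h1, inv_pow, mul_inv_cancel_right]⟩ : (QuotientGroup.mk (IB e B) : NarrowClassGroup F) = QuotientGroup.mk (J⁻¹^2)).symm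
  have hmT : ∀ {B}, B ∈ T ↔ B ∣ D ∧ isN D B := fun {B} => by
    rw [hT, mem_filter, Nat.mem_divisors]; exact ⟨fun h => ⟨h.1.1, h.2⟩, fun h => ⟨⟨h.1, hs.ne_zero⟩, h.2⟩⟩
  have himg : ∀ g : NarrowClassGroup F, (g^2 = 1 ∧ ∃ h, h^2 = g) ↔ g ∈ T.image c := fun g => by
    rw [mem_image]
    constructor
    · rintro ⟨h1, h2⟩
      obtain ⟨I, rfl⟩ := QuotientGroup.mk_surjective g
      obtain ⟨x, hx, h3⟩ := (cls_eq e).1 (show (QuotientGroup.mk (I^2) : NarrowClassGroup F) = QuotientGroup.mk 1 from h1)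
      obtain ⟨B, hB, u, hu, h5⟩ := two_tors e hs h4 hx (by rw [h3, mul_one])
      have h6 : c B = QuotientGroup.mk I := ((cls_eq e).2 ⟨u, hu, h5⟩).symm
      exact ⟨B, hmT.2 ⟨hB, (hsq B hB).1 (by rw [h6]; exact h2)⟩, h6⟩
    · rintro ⟨B, hB, rfl⟩
      obtain ⟨hB, hN⟩ := hmT.1 hB
      refine ⟨?_, (hsq B hB).2 hN⟩
      obtain ⟨u, hu, h1⟩ := hBR B hB
      exact ((cls_eq e).2 ⟨u, hu.tp, by rw [h1, mul_one]⟩ : (QuotientGroup.mk ((IB e B)^2) : NarrowClassGroup F) = QuotientGroup.mk 1)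
  have hcard : Nat.card {g : NarrowClassGroup F // g^2 = 1 ∧ ∃ h, h^2 = g} = (T.image c).card := by
    rw [Nat.card_congr (Equiv.subtypeEquivRight himg), Nat.card_eq_fintype_card, Fintype.card_coe]
  obtain ⟨w, hw, ⟨r, hr, hwr⟩, hw1, hw2⟩ := unit_ex e hs h4 hns
  rw [hcard, Finset.card_eq_sum_card_image c T, Finset.sum_const_nat (m := 2), mul_comm]
  intro g hg
  obtain ⟨B, hB, rfl⟩ := mem_image.1 hg
  obtain ⟨hBD, hN⟩ := hmT.1 hB
  obtain ⟨u, hu, hBu⟩ := hBR B hBD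
  obtain ⟨B', hB'D, v, hv, h5⟩ := rat_sq e hs h4 (I := pr w * IB e B) (hr.mul hu) (by rw [mul_pow, hwr, hBu, map_mul])
  have hcc : c B' = c B := (cls_eq e).2 ⟨v⁻¹ * w, by rw [Units.val_mul, Units.val_inv_eq_inv_val]; exact hv.tp.inv.mul hw,
    by rw [map_mul, mul_assoc, h5, map_inv, inv_mul_cancel_left]⟩
  rw [card_eq_two]
  refine ⟨B, B', ?_, ?_⟩
  · rintro rfl
    exact hw1 v hv (mul_right_cancel h5)
  ext b
  rw [mem_filter, mem_insert, mem_singleton]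
  constructor
  · rintro ⟨hb, hbc⟩
    obtain ⟨hbD, -⟩ := hmT.1 hb
    obtain ⟨x, hx, h6⟩ := (cls_eq e).1 hbc
    obtain ⟨u', hu', hbu⟩ := hBR b hbD
    obtain ⟨t, ht, h7 | h7⟩ := hw2 x (u' * u⁻¹) hx (hu'.mul hu.inv) (by
      rw [map_mul, map_inv, ← hbu, ← hBu, h6, mul_pow, mul_inv_cancel_right])
    · exact Or.inl (IB_inj e hs hbD hBD ht (by rw [h6, h7]))
    · exact Or.inr (IB_inj e hs hbD hB'D (ht.mul hv) (by rw [h6, h7, mul_assoc, h5, map_mul, mul_assoc]))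
  · rintro (rfl | rfl)
    · exact ⟨hB, rfl⟩
    · exact ⟨hmT.2 ⟨hB'D, (hsq _ hB'D).1 (by rw [hcc]; exact (hsq B hBD).2 hN)⟩, hcc⟩

lemma fin_sq (e : QuadraticAlgebra ℚ (D:ℚ) 0 ≃+* F) : Finite (powMonoidHom (α := NarrowClassGroup F) 2).range := by
  haveI : Finite (Idl F ⧸ (toPrincipalIdeal (𝓞 F) F).range) := Finite.of_equiv _ (ClassGroup.equiv (R := 𝓞 F) F).toEquiv
  let f := QuotientGroup.lift (toPrincipalIdeal (𝓞 F) F).range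
    ((powMonoidHom (α := NarrowClassGroup F) 2).comp (QuotientGroup.mk' (narrowPrincipals F))) (by
      rintro _ ⟨u, rfl⟩
      refine ((cls_eq e).2 ⟨u^2, fun φ => ?_, by rw [map_pow, mul_one]⟩ : (QuotientGroup.mk ((pr u : Idl F)^2) : NarrowClassGroup F) = QuotientGroup.mk 1)
      rw [Units.val_pow_eq_pow_val, map_pow]
      have : φ u ≠ 0 := (map_ne_zero φ).2 u.ne_zero
      positivity)
  apply Set.Finite.subset (Set.finite_range f)
  rintro _ ⟨g, rfl⟩
  obtain ⟨I, rfl⟩ := QuotientGroup.mk_surjective g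
  exact ⟨QuotientGroup.mk I, rfl⟩
end

lemma quad_e {D : ℕ} (hns : ¬ IsSquare D) : NumberField (quadField D) ∧ Nonempty (QuadraticAlgebra ℚ (D:ℚ) 0 ≃+* quadField D) := by
  have hsq : ((Real.sqrt D : ℂ)) * (Real.sqrt D : ℂ) = D := by
    exact_mod_cast congrArg (fun r : ℝ => (r:ℂ)) (Real.mul_self_sqrt (Nat.cast_nonneg D))
  have hInt : IsIntegral ℚ (Real.sqrt D : ℂ) := IsIntegral.of_pow two_pos (by rw [sq, hsq]; exact isIntegral_natCast D)
  haveI : FiniteDimensional ℚ (quadField D) := adjoin.finiteDimensional hInt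
  refine ⟨⟨⟩, ?_⟩
  let s : quadField D := ⟨(Real.sqrt D : ℂ), mem_adjoin_simple_self ℚ _⟩
  have hs : s * s = (D:ℚ) • (1 : quadField D) + (0:ℚ) • s := by
    apply Subtype.ext
    simp [s, hsq, Algebra.smul_def]
  let f : QuadraticAlgebra ℚ (D:ℚ) 0 →ₐ[ℚ] quadField D := QuadraticAlgebra.lift ⟨s, hs⟩
  haveI : Fact (∀ r : ℚ, r ^ 2 ≠ (D:ℚ) + 0 * r) := ⟨fun r hr =>
    hns (Rat.isSquare_natCast_iff.1 ⟨r, by rw [← sq, hr]; ring⟩)⟩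
  have hfs : f ⟨0, 1⟩ = s := by
    change (0:ℚ) • (1 : quadField D) + (1:ℚ) • s = s
    rw [zero_smul, one_smul, zero_add]
  have hsurj : quadField D ≤ ((quadField D).val.comp f).fieldRange :=
    adjoin_simple_le_iff.2 ⟨⟨0, 1⟩, congrArg Subtype.val hfs⟩
  refine ⟨RingEquiv.ofBijective f ⟨(f : QuadraticAlgebra ℚ (D:ℚ) 0 →+* quadField D).injective, fun x => ?_⟩⟩
  obtain ⟨z, hz⟩ := hsurj x.2
  exact ⟨z, Subtype.ext hz⟩

theorem alg {d : ℕ} (h : Adm d) : fourRankPow (NarrowClassGroup (quadField (2*d))) = RR d := by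
  obtain ⟨hs, hns⟩ := Adm_nsq h
  obtain ⟨hF, ⟨e⟩⟩ := quad_e hns
  have h4 : (2*d) % 4 = 2 := by have := h.2.1; omega
  haveI := fin_sq e
  rw [four_rank_card]
  have h1 := cls_card e hs h4 hns
  rw [count_isN h] at h1
  omega
end FR

namespace FR
open Finset Filter Topology

lemma piR_pos (r : ℕ) : 0 < piR r := by
  obtain ⟨N, hN⟩ := (FF_lim.eventually (lt_mem_nhds zero_lt_one)).exists
  have h1 : 0 < etaInf := by rw [← eta_FF N]; exact mul_pos (eta_pos N) hN
  have h2 := eta_pos r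
  unfold piR
  positivity

lemma filt (X : ℝ) (hX : 0 ≤ X) : (range (⌊X⌋₊ + 1)).filter (dCond X) = (range (⌊X/2⌋₊ + 1)).filter Adm := by
  ext d
  simp only [mem_filter, mem_range, Nat.lt_succ_iff, Nat.le_floor_iff hX, Nat.le_floor_iff (show 0 ≤ X/2 by positivity)]
  unfold dCond Adm
  have h0 : (0:ℝ) ≤ d := Nat.cast_nonneg d
  constructor
  · rintro ⟨-, h1, h2, -, h3, h4⟩; exact ⟨by linarith, h1, h2, h4⟩
  · rintro ⟨h3, h1, h2, h4⟩; exact ⟨by linarith, h1, h2, by omega, by linarith, h4⟩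

theorem main (r : ℕ) : Asymptotics.IsEquivalent atTop (fun X : ℝ => Ncount r X) (fun X : ℝ => piR r * Acount34 X) := by
  have hA : ∀ X : ℝ, 0 ≤ X → Acount34 X = A0 ⌊X/2⌋₊ := fun X hX => by
    unfold Acount34 A0
    rw [← sum_filter, filt X hX, sum_const, nsmul_eq_mul, mul_one]
  have hN : ∀ X : ℝ, 0 ≤ X → Ncount r X = ∑ d ∈ (range (⌊X/2⌋₊ + 1)).filter Adm, (if RR d = 2^r then (1:ℝ) else 0) := fun X hX => by
    unfold Ncount
    rw [← filt X hX, sum_filter]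
    refine sum_congr rfl fun d hd => ?_
    by_cases h : dCond X d
    · have hadm : Adm d := ⟨h.1, h.2.1, h.2.2.2.2⟩
      rw [if_pos h, alg hadm]; simp only [h, true_and]
    · rw [if_neg h, if_neg fun h' => h h'.1]
  rw [Asymptotics.IsEquivalent, Asymptotics.isLittleO_iff]
  intro ε hε
  obtain ⟨N0, h0⟩ := anatomy r (ε * piR r) (mul_pos hε (piR_pos r))
  filter_upwards [eventually_ge_atTop (2 * (N0:ℝ))] with X hX
  have hX0 : 0 ≤ X := le_trans (by positivity) hX
  have h1 := h0 ⌊X/2⌋₊ (Nat.le_floor (by linarith))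
  rw [sum_sub_distrib, sum_const, nsmul_eq_mul, ← hN X hX0, ← A0, ← hA X hX0, mul_comm (Acount34 X)] at h1
  have hp := (piR_pos r).le
  have hA0 : 0 ≤ Acount34 X := by rw [hA X hX0]; positivity
  rw [Pi.sub_apply, Real.norm_eq_abs, Real.norm_of_nonneg (mul_nonneg hp hA0), ← mul_assoc]
  exact h1
end FR

/-- `N_r(X) ~ 2^{-r²}·η_∞(2)·η_r(2)^{-2}·A(X; 3, 4)` as `X → ∞`, where
`η_r(2) = ∏_{j=1}^r (1 - 2^{-j})` and `η_∞(2) = ∏_{j=1}^∞ (1 - 2^{-j})`. -/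
theorem stmt17 (r : ℕ) :
    Asymptotics.IsEquivalent Filter.atTop (fun X : ℝ => Ncount r X)
      (fun X : ℝ =>
        (2 : ℝ) ^ (-(r ^ 2 : ℤ)) * (∏' j : ℕ, (1 - (2 : ℝ) ^ (-((j : ℤ) + 1)))) *
          (∏ j ∈ Finset.range r, (1 - (2 : ℝ) ^ (-((j : ℤ) + 1))))⁻¹ ^ 2 *
          Acount34 X) := by
  exact FR.main r
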